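/- Almost every even positive integer is expressible as the sum of two primes; that is, the set of even positive integers that cannot be written as a sum of two primes has natural density zero. -/

import Mathlib

namespace Goldbach

open Finset MeasureTheory

/-- The additive character `x ↦ exp (2πix)`. -/
noncomputable def ee (x : ℝ) : ℂ := Complex.exp (((2 * Real.pi * x : ℝ) : ℂ) * Complex.I)

/-- The distance to the nearest integer. -/
noncomputable def nn (x : ℝ) : ℝ := ‖(x : UnitAddCircle)‖

lemma norm_ee (x : ℝ) : ‖ee x‖ = 1 := Complex.norm_exp_ofReal_mul_I _

lemma ee_add (x y : ℝ) : ee (x + y) = ee x * ee y := by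
  unfold ee; rw [← Complex.exp_add]; congr 1; push_cast; ring

lemma ee_zero : ee 0 = 1 := by simp [ee]

lemma ee_int (m : ℤ) : ee m = 1 := by
  unfold ee
  rw [Complex.exp_eq_one_iff]
  exact ⟨m, by push_cast; ring⟩

lemma ee_add_int (x : ℝ) (m : ℤ) : ee (x + m) = ee x := by
  rw [ee_add, ee_int, mul_one]

lemma ee_neg (x : ℝ) : ee (-x) = (starRingEnd ℂ) (ee x) := by
  unfold ee
  rw [← Complex.exp_conj, map_mul, Complex.conj_ofReal, Complex.conj_I]
  congr 1
  push_cast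
  ring

lemma ee_nat_mul (n : ℕ) (x : ℝ) : ee (n * x) = ee x ^ n := by
  unfold ee; rw [← Complex.exp_nat_mul]; congr 1; push_cast; ring

lemma continuous_ee : Continuous ee := by
  unfold ee; fun_prop

lemma ee_re (x : ℝ) : (ee x).re = Real.cos (2 * Real.pi * x) := by
  unfold ee; rw [Complex.exp_ofReal_mul_I_re]

lemma nn_nonneg (x : ℝ) : 0 ≤ nn x := norm_nonneg _

lemma nn_eq (x : ℝ) : nn x = |x - round x| := UnitAddCircle.norm_eq

lemma nn_neg (x : ℝ) : nn (-x) = nn x := by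
  unfold nn; rw [AddCircle.coe_neg, norm_neg]

lemma nn_add_le (x y : ℝ) : nn (x + y) ≤ nn x + nn y := by
  unfold nn; rw [AddCircle.coe_add]; exact norm_add_le _ _

lemma nn_sub_comm (x y : ℝ) : nn (x - y) = nn (y - x) := by
  rw [← nn_neg, neg_sub]

lemma nn_le_abs_sub (x : ℝ) (m : ℤ) : nn x ≤ |x - m| := by
  rw [nn_eq]; exact round_le x m

lemma nn_le_abs (x : ℝ) : nn x ≤ |x| := by simpa using nn_le_abs_sub x 0

lemma nn_le_half (x : ℝ) : nn x ≤ 1 / 2 := by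
  rw [nn_eq]; exact abs_sub_round x

lemma nn_add_int (x : ℝ) (m : ℤ) : nn (x + m) = nn x := by
  simp only [nn_eq, round_add_intCast]
  push_cast
  congr 1
  ring

lemma nn_int (m : ℤ) : nn m = 0 := by
  have := nn_add_int 0 m
  rw [zero_add] at this
  rw [this]; simp [nn]

lemma nn_sub_le (x y : ℝ) : nn (x - y) ≤ nn x + nn y := by
  rw [sub_eq_add_neg]
  exact (nn_add_le _ _).trans (by rw [nn_neg])

lemma exists_int_nn (x : ℝ) : ∃ m : ℤ, nn x = |x - m| := ⟨round x, nn_eq x⟩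

lemma four_mul_nn_le (x : ℝ) : 4 * nn x ≤ ‖ee x - 1‖ := by
  obtain ⟨m, hm⟩ : ∃ m : ℤ, nn x = |x - m| := ⟨round x, nn_eq x⟩
  have h1 : ee x = ee (x - m) := by
    rw [← ee_add_int (x - m) m, sub_add_cancel]
  have hb : |x - m| ≤ 1 / 2 := hm ▸ nn_le_half x
  have h2 : ‖ee (x - m) - 1‖ = 2 * |Real.sin (Real.pi * (x - m))| := by
    unfold ee
    have := Complex.norm_exp_I_mul_ofReal_sub_one (2 * Real.pi * (x - m))
    rw [mul_comm, this, Real.norm_eq_abs, abs_mul, abs_two]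
    congr 3
    ring
  have h3 := Real.mul_abs_le_abs_sin (x := Real.pi * (x - m)) (by
    rw [abs_mul, abs_of_pos Real.pi_pos]; nlinarith [Real.pi_pos])
  rw [abs_mul, abs_of_pos Real.pi_pos] at h3
  rw [h1, h2, hm]
  have h4 : 2 / Real.pi * (Real.pi * |x - m|) = 2 * |x - m| := by
    field_simp
  linarith

lemma norm_geom_sum_ee_le (x : ℝ) (hx : 0 < nn x) (a b : ℕ) :
    ‖∑ n ∈ Ico a b, ee (n * x)‖ ≤ 1 / nn x := by
  rcases le_total b a with h | h
  · rw [Finset.Ico_eq_empty_of_le h]; simp [nn_nonneg]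
  have h4 := four_mul_nn_le x
  have hne : ee x ≠ 1 := by
    intro h; rw [h] at h4; simp at h4; linarith
  simp_rw [ee_nat_mul]
  rw [geom_sum_Ico hne h, norm_div]
  rw [div_le_div_iff₀ (by linarith) hx]
  have : ‖ee x ^ b - ee x ^ a‖ ≤ 2 := by
    refine (norm_sub_le _ _).trans ?_
    rw [norm_pow, norm_pow, norm_ee]; norm_num
  nlinarith

lemma integral_ee_int (m : ℤ) : ∫ t in (0 : ℝ)..1, ee (m * t) = if m = 0 then 1 else 0 := by
  split_ifs with h
  · simp [h, ee_zero]
  · have hc : ((2 * Real.pi * m : ℝ) : ℂ) * Complex.I ≠ 0 := by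
      simp [h, Real.pi_ne_zero]
    have : ∀ t : ℝ, ee (m * t) = Complex.exp ((((2 * Real.pi * m : ℝ) : ℂ) * Complex.I) * t) := by
      intro t; unfold ee; congr 1; push_cast; ring
    simp_rw [this]
    rw [integral_exp_mul_complex hc]
    have h1 : Complex.exp ((((2 * Real.pi * m : ℝ) : ℂ) * Complex.I) * (1 : ℝ)) = 1 := by
      rw [← this, mul_one, ee_int]
    rw [h1]; simp

lemma parseval_integral (N : ℕ) (u : ℕ → ℂ) :
    ∫ t in (0 : ℝ)..1, ‖∑ n ∈ range N, u n * ee (n * t)‖ ^ 2 = ∑ n ∈ range N, ‖u n‖ ^ 2 := by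
  have key : ∀ t : ℝ, ((‖∑ n ∈ range N, u n * ee (n * t)‖ ^ 2 : ℝ) : ℂ)
      = ∑ n ∈ range N, ∑ m ∈ range N, u n * (starRingEnd ℂ) (u m) * ee ((((n : ℤ) - (m : ℤ) : ℤ) : ℝ) * t) := by
    intro t
    rw [Complex.ofReal_pow, ← Complex.mul_conj', map_sum, Finset.sum_mul_sum]
    refine sum_congr rfl fun n _ => sum_congr rfl fun m _ => ?_
    rw [map_mul, ← ee_neg]
    have : (((n : ℤ) - (m : ℤ) : ℤ) : ℝ) * t = n * t + -(m * t) := by push_cast; ring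
    rw [this, ee_add]; ring
  have h2 : ((∫ t in (0 : ℝ)..1, ‖∑ n ∈ range N, u n * ee (n * t)‖ ^ 2 : ℝ) : ℂ)
      = ((∑ n ∈ range N, ‖u n‖ ^ 2 : ℝ) : ℂ) := by
    rw [← intervalIntegral.integral_ofReal]
    simp_rw [key]
    have hc : ∀ k : ℤ, Continuous fun t : ℝ => ee (k * t) := fun k =>
      continuous_ee.comp (continuous_const.mul continuous_id)
    rw [intervalIntegral.integral_finsetSum]
    · rw [Complex.ofReal_sum]
      refine sum_congr rfl fun n hn => ?_
      rw [Complex.ofReal_pow]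
      rw [intervalIntegral.integral_finsetSum]
      · rw [Finset.sum_eq_single n]
        · rw [intervalIntegral.integral_const_mul, integral_ee_int]
          simp [Complex.mul_conj']
        · intro m _ hm
          rw [intervalIntegral.integral_const_mul, integral_ee_int, if_neg, mul_zero]
          intro h; apply hm; omega
        · exact fun h => absurd hn h
      · intro m _
        exact (continuous_const.mul (hc _)).intervalIntegrable _ _
    · intro n _
      have : Continuous fun t : ℝ => ∑ m ∈ range N,
          u n * (starRingEnd ℂ) (u m) * ee ((((n : ℤ) - (m : ℤ) : ℤ) : ℝ) * t) :=
        continuous_finsetSum _ fun m _ => continuous_const.mul (hc _)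
      exact this.intervalIntegrable _ _
  exact_mod_cast h2

lemma le_norm_integral_ee {N n : ℕ} (hN : 0 < N) (hn : n < N) {r : ℝ} (hr : r = 1 / (6 * N)) :
    r ≤ ‖∫ t in (-r)..r, ee (n * t)‖ := by
  have hN' : (0 : ℝ) < N := by exact_mod_cast hN
  have hr0 : 0 < r := by rw [hr]; positivity
  refine le_trans ?_ (Complex.re_le_norm _)
  have hcont : Continuous fun t : ℝ => ee (n * t) := continuous_ee.comp (by fun_prop)
  have h1 : (∫ t in (-r)..r, ee (n * t)).re = ∫ t in (-r)..r, (ee (n * t)).re := by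
    exact (Complex.reCLM.intervalIntegral_comp_comm
      (hcont.intervalIntegrable (μ := volume) (-r) r)).symm
  rw [h1]
  have h2 : ∫ _ in (-r)..r, (1 / 2 : ℝ) = r := by
    rw [intervalIntegral.integral_const, smul_eq_mul]; ring
  refine h2.symm.le.trans ?_
  refine intervalIntegral.integral_mono_on (by linarith) (by simp)
    ((Complex.continuous_re.comp hcont).intervalIntegrable (μ := volume) _ _) ?_
  intro t ht
  rw [ee_re, ← Real.cos_abs, ← Real.cos_pi_div_three]
  have hnN : (n : ℝ) ≤ N := by exact_mod_cast hn.le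
  have ht' : |t| ≤ r := abs_le.mpr ht
  have h3 : |2 * Real.pi * (n * t)| ≤ Real.pi / 3 := by
    rw [abs_mul, abs_of_pos Real.two_pi_pos, abs_mul, Nat.abs_cast]
    calc 2 * Real.pi * (n * |t|) ≤ 2 * Real.pi * (N * r) := by
          have := Real.pi_pos; gcongr
      _ = Real.pi / 3 := by rw [hr]; field_simp; norm_num
  exact Real.cos_le_cos_of_nonneg_of_le_pi (abs_nonneg _) (by linarith [Real.pi_pos]) h3

lemma ee_periodic_sum (N : ℕ) (u : ℕ → ℂ) :
    Function.Periodic (fun t : ℝ => ∑ n ∈ range N, u n * ee (n * t)) 1 := by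
  intro t
  refine sum_congr rfl fun n _ => ?_
  have : (n : ℝ) * (t + 1) = n * t + (n : ℤ) := by push_cast; ring
  rw [this, ee_add_int]

lemma sum_integral_le_of_spaced {ι : Type*} (s : Finset ι) (θ : ι → ℝ) {r : ℝ} (hr : 0 < r)
    (hr2 : r ≤ 1 / 2)
    (hs : ∀ j ∈ s, ∀ k ∈ s, j ≠ k → 2 * r < nn (θ j - θ k)) (F : ℝ → ℝ) (hF : Continuous F)
    (hper : Function.Periodic F 1) (hF0 : ∀ t, 0 ≤ F t) :
    ∑ j ∈ s, ∫ t in (-r)..r, F (θ j + t) ≤ ∫ t in (0 : ℝ)..1, F t := by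
  classical
  set p : ι → ℝ → ℝ := fun j => Set.indicator {t | nn (t - θ j) ≤ r} F with hp
  have hcl : ∀ j, MeasurableSet {t : ℝ | nn (t - θ j) ≤ r} := by
    intro j
    apply IsClosed.measurableSet
    refine isClosed_le ?_ continuous_const
    unfold nn
    exact continuous_norm.comp ((AddCircle.continuous_mk' 1).comp (by fun_prop))
  have hp0 : ∀ j t, 0 ≤ p j t := fun j t => Set.indicator_nonneg (fun t _ => hF0 t) t
  have hpper : ∀ j, Function.Periodic (p j) 1 := by
    intro j t
    have h1 : nn (t + 1 - θ j) = nn (t - θ j) := by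
      have := nn_add_int (t - θ j) 1
      rw [← this]; congr 1; push_cast; ring
    simp only [hp, Set.indicator, Set.mem_ofPred_eq, h1, hper t]
  have hpi : ∀ j a b, IntervalIntegrable (p j) volume a b := by
    intro j a b
    have := hF.intervalIntegrable (μ := volume) a b
    rw [intervalIntegrable_iff] at this ⊢
    exact this.indicator (hcl j)
  have h1 : ∀ j ∈ s, ∫ t in (-r)..r, F (θ j + t) ≤ ∫ t in (0 : ℝ)..1, p j t := by
    intro j _
    have e1 : ∫ t in (-r)..r, F (θ j + t) = ∫ t in (θ j - r)..(θ j + r), p j t := by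
      rw [intervalIntegral.integral_comp_add_left]
      rw [← sub_eq_add_neg]
      refine intervalIntegral.integral_congr ?_
      intro t ht
      rw [Set.uIcc_of_le (by linarith)] at ht
      have : nn (t - θ j) ≤ r := (nn_le_abs _).trans (abs_le.mpr ⟨by linarith [ht.1], by linarith [ht.2]⟩)
      simp [hp, this]
    have e2 : ∫ t in (0 : ℝ)..1, p j t = ∫ t in (θ j - 1 / 2)..(θ j - 1 / 2 + 1), p j t := by
      have := (hpper j).intervalIntegral_add_eq 0 (θ j - 1 / 2)
      rwa [zero_add] at this
    rw [e1, e2]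
    exact intervalIntegral.integral_mono_interval (by linarith) (by linarith) (by linarith)
      (Filter.Eventually.of_forall fun t => hp0 j t) (hpi j _ _)
  refine (sum_le_sum h1).trans ?_
  rw [← intervalIntegral.integral_finsetSum (fun j _ => hpi j _ _)]
  refine intervalIntegral.integral_mono_on zero_le_one ?_ (hF.intervalIntegrable _ _) ?_
  · have := IntervalIntegrable.sum s (f := p) (μ := volume) (a := 0) (b := 1) (fun j _ => hpi j _ _)
    refine this.congr ?_
    intro t _
    simp
  · intro t _
    by_cases h : ∃ j ∈ s, nn (t - θ j) ≤ r
    · obtain ⟨j, hj, hjt⟩ := h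
      rw [Finset.sum_eq_single_of_mem j hj]
      · simp [hp, hjt]
      · intro k hk hkj
        have : ¬ nn (t - θ k) ≤ r := by
          intro hkt
          have h2 := hs j hj k hk (Ne.symm hkj)
          have h3 := nn_sub_le (t - θ k) (t - θ j)
          have h4 : t - θ k - (t - θ j) = θ j - θ k := by ring
          rw [h4] at h3
          linarith
        simp [hp, this]
    · push Not at h
      rw [Finset.sum_eq_zero]
      · exact hF0 t
      · intro j hj
        simp [hp, not_le.mpr (h j hj)]

lemma norm_integral_sq_le {r : ℝ} (hr : 0 < r) (f : ℝ → ℂ) (hf : Continuous f) :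
    ‖∫ t in (-r)..r, f t‖ ^ 2 ≤ 2 * r * ∫ t in (-r)..r, ‖f t‖ ^ 2 := by
  have h1 : ‖∫ t in (-r)..r, f t‖ ≤ ∫ t in (-r)..r, ‖f t‖ :=
    intervalIntegral.norm_integral_le_integral_norm (by linarith)
  set A := ∫ t in (-r)..r, ‖f t‖ with hA
  set B := ∫ t in (-r)..r, ‖f t‖ ^ 2 with hB
  have h2 : 0 ≤ ∫ t in (-r)..r, (2 * r * ‖f t‖ - A) ^ 2 :=
    intervalIntegral.integral_nonneg (by linarith) fun t _ => sq_nonneg _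
  have h3 : ∫ t in (-r)..r, (2 * r * ‖f t‖ - A) ^ 2 = 4 * r ^ 2 * B - 4 * r * A * A + 2 * r * A ^ 2 := by
    have : ∀ t, (2 * r * ‖f t‖ - A) ^ 2 = 4 * r ^ 2 * ‖f t‖ ^ 2 - 4 * r * A * ‖f t‖ + A ^ 2 := by
      intro t; ring
    simp_rw [this]
    have hc1 : Continuous fun t => ‖f t‖ := hf.norm
    rw [intervalIntegral.integral_add, intervalIntegral.integral_sub,
      intervalIntegral.integral_const_mul, intervalIntegral.integral_const_mul,
      intervalIntegral.integral_const, smul_eq_mul]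
    · ring
    all_goals exact Continuous.intervalIntegrable (by fun_prop) _ _
  have h4 : A ^ 2 ≤ 2 * r * B := by
    rw [h3] at h2
    have : 0 ≤ 2 * r * (2 * r * B - A ^ 2) := by nlinarith
    have := nonneg_of_mul_nonneg_right this (by linarith : 0 < 2 * r)
    linarith
  exact (pow_le_pow_left₀ (norm_nonneg _) h1 2).trans h4

/-- The large sieve inequality. -/
theorem large_sieve {ι : Type*} (s : Finset ι) (θ : ι → ℝ) {N : ℕ} (hN : 0 < N)
    (hs : ∀ j ∈ s, ∀ k ∈ s, j ≠ k → 1 / (N : ℝ) ≤ nn (θ j - θ k)) (u : ℕ → ℂ) :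
    ∑ j ∈ s, ‖∑ n ∈ range N, u n * ee (n * θ j)‖ ^ 2 ≤ 12 * N * ∑ n ∈ range N, ‖u n‖ ^ 2 := by
  have hN' : (1 : ℝ) ≤ N := by exact_mod_cast hN
  set r : ℝ := 1 / (6 * N) with hr
  have hr0 : 0 < r := by positivity
  have hr2 : r ≤ 1 / 2 := by
    rw [hr]; apply one_div_le_one_div_of_le <;> linarith
  set g : ℕ → ℂ := fun n => ∫ t in (-r)..r, ee (n * t) with hg
  have hgn : ∀ n ∈ range N, r ≤ ‖g n‖ := fun n hn => le_norm_integral_ee hN (mem_range.mp hn) hr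
  set v : ℕ → ℂ := fun n => u n / g n with hv
  set S : ℝ → ℂ := fun t => ∑ n ∈ range N, v n * ee (n * t) with hS
  have hSc : Continuous S := continuous_finsetSum _ fun n _ =>
    continuous_const.mul (continuous_ee.comp (by fun_prop))
  have hrep : ∀ x : ℝ, ∑ n ∈ range N, u n * ee (n * x) = ∫ t in (-r)..r, S (x + t) := by
    intro x
    simp only [hS]
    rw [intervalIntegral.integral_finsetSum]
    · refine sum_congr rfl fun n hn => ?_
      have hgne : g n ≠ 0 := by
        intro h; have := hgn n hn; rw [h, norm_zero] at this; linarith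
      have : ∀ t : ℝ, v n * ee (n * (x + t)) = v n * ee (n * x) * ee (n * t) := by
        intro t; rw [mul_add, ee_add]; ring
      simp_rw [this]
      rw [intervalIntegral.integral_const_mul]
      change _ = _ * g n
      rw [hv]; field_simp
    · intro n _
      have : Continuous fun t : ℝ => v n * ee (n * (x + t)) :=
        continuous_const.mul (continuous_ee.comp (by fun_prop))
      exact this.intervalIntegrable _ _
  have hspace : ∀ j ∈ s, ∀ k ∈ s, j ≠ k → 2 * r < nn (θ j - θ k) := by
    intro j hj k hk hjk
    refine lt_of_lt_of_le ?_ (hs j hj k hk hjk)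
    rw [hr, mul_one_div, div_lt_div_iff₀ (by positivity) (by positivity)]
    linarith
  calc ∑ j ∈ s, ‖∑ n ∈ range N, u n * ee (n * θ j)‖ ^ 2
      ≤ ∑ j ∈ s, 2 * r * ∫ t in (-r)..r, ‖S (θ j + t)‖ ^ 2 := by
        refine sum_le_sum fun j _ => ?_
        rw [hrep]
        exact norm_integral_sq_le hr0 _ (by fun_prop)
    _ = 2 * r * ∑ j ∈ s, ∫ t in (-r)..r, ‖S (θ j + t)‖ ^ 2 := by rw [mul_sum]
    _ ≤ 2 * r * ∫ t in (0 : ℝ)..1, ‖S t‖ ^ 2 := by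
        gcongr
        refine sum_integral_le_of_spaced s θ hr0 hr2 hspace (fun t => ‖S t‖ ^ 2) (by fun_prop) ?_
          (fun t => by positivity)
        intro t
        have := ee_periodic_sum N v t
        simp only [hS]
        exact congrArg (fun z : ℂ => ‖z‖ ^ 2) this
    _ = 2 * r * ∑ n ∈ range N, ‖v n‖ ^ 2 := by rw [← parseval_integral]
    _ ≤ 2 * r * ∑ n ∈ range N, (1 / r ^ 2) * ‖u n‖ ^ 2 := by
        gcongr with n hn
        rw [hv, norm_div, div_pow, one_div_mul_eq_div]
        have := hgn n hn
        gcongr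
    _ = 12 * N * ∑ n ∈ range N, ‖u n‖ ^ 2 := by
        rw [← mul_sum, ← mul_assoc]
        congr 1
        rw [hr]; field_simp; norm_num

end Goldbach

namespace Goldbach

open Finset

/-- Reduced residues modulo `r`. -/
def units (r : ℕ) : Finset ℕ := (range r).filter fun b => Nat.Coprime r b

lemma mem_units {r b : ℕ} : b ∈ units r ↔ b < r ∧ Nat.Coprime r b := by
  simp [units]

lemma card_units (r : ℕ) : (units r).card = r.totient := rfl

lemma sum_ee_complete {n r : ℕ} (hr : 0 < r) (h : n.Coprime r) :
    ∑ b ∈ range r, ee (n * (b / r)) = if r = 1 then 1 else 0 := by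
  have hr' : (r : ℝ) ≠ 0 := by positivity
  split_ifs with h1
  · subst h1; simp [ee_zero]
  · have h2 : ∀ b : ℕ, ee (n * (b / r)) = ee (n / r) ^ b := by
      intro b; rw [← ee_nat_mul]; congr 1; ring
    simp_rw [h2]
    have hne : ee (n / r) ≠ 1 := by
      intro h3
      unfold ee at h3
      rw [Complex.exp_eq_one_iff] at h3
      obtain ⟨m, hm⟩ := h3
      have h4 : ((2 * Real.pi * (n / r) : ℝ) : ℂ) = ((2 * Real.pi * m : ℝ) : ℂ) := by
        apply mul_right_cancel₀ Complex.I_ne_zero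
        rw [hm]; push_cast; ring
      have h5 : (2 * Real.pi * (n / r) : ℝ) = 2 * Real.pi * m := by exact_mod_cast h4
      have h6 : (n : ℝ) / r = m := mul_left_cancel₀ Real.two_pi_pos.ne' h5
      rw [div_eq_iff hr'] at h6
      have h7 : (n : ℤ) = m * r := by exact_mod_cast h6
      have h8 : (r : ℤ) ∣ n := ⟨m, by rw [h7]; ring⟩
      have h9 : r ∣ n := by exact_mod_cast h8
      exact h1 (Nat.eq_one_of_dvd_coprimes h h9 dvd_rfl)
    rw [geom_sum_eq hne, ← ee_nat_mul]
    have : (r : ℝ) * (n / r) = (n : ℤ) := by push_cast; field_simp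
    rw [this, ee_int]; simp

lemma sum_divisors_sum_units {r : ℕ} (hr : 0 < r) (f : ℝ → ℂ) :
    ∑ d ∈ r.divisors, ∑ b ∈ units d, f (b / d) = ∑ b ∈ range r, f (b / r) := by
  rw [Finset.sum_sigma']
  refine Finset.sum_bij' (fun x _ => x.2 * (r / x.1))
    (fun b _ => ⟨r / Nat.gcd r b, b / Nat.gcd r b⟩) ?_ ?_ ?_ ?_ ?_
  · rintro ⟨d, b⟩ h
    simp only [mem_sigma, Nat.mem_divisors, mem_units] at h
    obtain ⟨⟨⟨e, rfl⟩, _⟩, h2, h3⟩ := h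
    have hd : 0 < d := Nat.pos_of_mul_pos_right hr
    have he : 0 < e := Nat.pos_of_mul_pos_left hr
    simp only [mem_range]
    rw [Nat.mul_div_cancel_left _ hd]
    exact Nat.mul_lt_mul_of_pos_right h2 he
  · intro b hb
    rw [mem_range] at hb
    have hg : 0 < Nat.gcd r b := Nat.gcd_pos_of_pos_left _ hr
    simp only [mem_sigma, Nat.mem_divisors, mem_units]
    refine ⟨⟨Nat.div_dvd_of_dvd (Nat.gcd_dvd_left _ _), hr.ne'⟩, ?_, Nat.coprime_div_gcd_div_gcd hg⟩
    exact Nat.div_lt_div_of_lt_of_dvd (Nat.gcd_dvd_left r b) hb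
  · rintro ⟨d, b⟩ h
    simp only [mem_sigma, Nat.mem_divisors, mem_units] at h
    obtain ⟨⟨⟨e, rfl⟩, _⟩, h2, h3⟩ := h
    have hd : 0 < d := Nat.pos_of_mul_pos_right hr
    have he : 0 < e := Nat.pos_of_mul_pos_left hr
    simp only []
    rw [Nat.mul_div_cancel_left _ hd, Nat.gcd_mul_right, Nat.Coprime.gcd_eq_one h3, one_mul,
      Nat.mul_div_cancel _ he, Nat.mul_div_cancel _ he]
  · intro b hb
    simp only []
    have h1 := Nat.gcd_dvd_left r b
    rw [Nat.div_div_self h1 hr.ne']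
    exact Nat.div_mul_cancel (Nat.gcd_dvd_right r b)
  · rintro ⟨d, b⟩ h
    simp only [mem_sigma, Nat.mem_divisors, mem_units] at h
    obtain ⟨⟨⟨e, rfl⟩, _⟩, h2, h3⟩ := h
    have hd : 0 < d := Nat.pos_of_mul_pos_right hr
    have he : 0 < e := Nat.pos_of_mul_pos_left hr
    simp only []
    rw [Nat.mul_div_cancel_left _ hd]
    congr 1
    push_cast
    field_simp

lemma ramanujan_sum {n r : ℕ} (hr : 0 < r) (h : n.Coprime r) :
    ∑ b ∈ units r, ee (n * (b / r)) = (ArithmeticFunction.moebius r : ℂ) := by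
  have key := (ArithmeticFunction.sum_eq_iff_sum_mul_moebius_eq_on
    (f := fun r : ℕ => ∑ b ∈ units r, ee (n * (b / r)))
    (g := fun r : ℕ => if r = 1 then (1 : ℂ) else 0) {r | n.Coprime r}
    (fun a b hab hb => Nat.Coprime.coprime_dvd_right hab hb)).mp (by
      intro r hr h
      rw [sum_divisors_sum_units hr (fun x => ee (n * x))]
      exact sum_ee_complete hr h) r hr h
  rw [← key]
  rw [Finset.sum_eq_single (r, 1)]
  · simp
  · rintro ⟨a, b⟩ hab hne
    rw [Nat.mem_divisorsAntidiagonal] at hab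
    have : b ≠ 1 := by
      rintro rfl; apply hne; simp at hab ⊢; exact hab.1
    simp [this]
  · intro h
    exact absurd (Nat.mem_divisorsAntidiagonal.mpr ⟨by simp, hr.ne'⟩) h

lemma montgomery {N : ℕ} (u : ℕ → ℂ) (a r : ℕ) (hr : Squarefree r)
    (hu : ∀ n < N, u n ≠ 0 → (a + n).Coprime r) (x : ℝ) :
    ‖∑ n ∈ range N, u n * ee (n * x)‖ ^ 2 ≤
      r.totient * ∑ b ∈ units r, ‖∑ n ∈ range N, u n * ee (n * (x + b / r))‖ ^ 2 := by
  have hr0 : 0 < r := Nat.pos_of_ne_zero hr.ne_zero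
  have h1 : (ArithmeticFunction.moebius r : ℂ) * ∑ n ∈ range N, u n * ee (n * x)
      = ∑ b ∈ units r, ee (a * (b / r)) * ∑ n ∈ range N, u n * ee (n * (x + b / r)) := by
    simp_rw [mul_sum]
    rw [sum_comm]
    refine sum_congr rfl fun n hn => ?_
    by_cases h0 : u n = 0
    · simp [h0]
    rw [← ramanujan_sum hr0 (hu n (mem_range.mp hn) h0), sum_mul]
    refine sum_congr rfl fun b _ => ?_
    have : (((a + n : ℕ) : ℝ)) * (b / r) = a * (b / r) + n * (b / r) := by push_cast; ring
    rw [this, ee_add, mul_add, ee_add]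
    ring
  have hmu : ‖(ArithmeticFunction.moebius r : ℂ)‖ = 1 := by
    rw [Complex.norm_intCast, ArithmeticFunction.moebius_apply_of_squarefree hr]
    simp
  have h2 : ‖∑ n ∈ range N, u n * ee (n * x)‖
      ≤ ∑ b ∈ units r, ‖∑ n ∈ range N, u n * ee (n * (x + b / r))‖ := by
    have := congrArg norm h1
    rw [norm_mul, hmu, one_mul] at this
    rw [this]
    refine (norm_sum_le _ _).trans (sum_le_sum fun b _ => ?_)
    rw [norm_mul, norm_ee, one_mul]
  refine (pow_le_pow_left₀ (norm_nonneg _) h2 2).trans ?_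
  have := sq_sum_le_card_mul_sum_sq (s := units r)
    (f := fun b : ℕ => ‖∑ n ∈ range N, u n * ee (n * (x + b / r))‖)
  rwa [card_units] at this

/-- Montgomery's refinement of the large sieve for sequences supported on integers coprime to
every modulus in `D`. -/
theorem large_sieve_coprime {ι : Type*} (s : Finset ι) (θ : ι → ℝ) {N : ℕ} (hN : 0 < N)
    (D : Finset ℕ) (hD : ∀ r ∈ D, Squarefree r) (u : ℕ → ℂ) (a : ℕ)
    (hu : ∀ r ∈ D, ∀ n < N, u n ≠ 0 → (a + n).Coprime r)
    (hs : ∀ j ∈ s, ∀ k ∈ s, ∀ r ∈ D, ∀ r' ∈ D, ∀ b ∈ units r, ∀ b' ∈ units r',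
      (j = k → r = r' → b ≠ b') → 1 / (N : ℝ) ≤ nn ((θ j + b / r) - (θ k + b' / r'))) :
    (∑ j ∈ s, ‖∑ n ∈ range N, u n * ee (n * θ j)‖ ^ 2) * ∑ r ∈ D, 1 / (r.totient : ℝ)
      ≤ 12 * N * ∑ n ∈ range N, ‖u n‖ ^ 2 := by
  have h1 := large_sieve (s ×ˢ (D.sigma units))
    (fun x : ι × (Σ _ : ℕ, ℕ) => θ x.1 + x.2.2 / x.2.1) hN (by
      rintro ⟨j, r, b⟩ h1 ⟨k, r', b'⟩ h2 hne
      simp only [mem_product, mem_sigma] at h1 h2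
      refine hs j h1.1 k h2.1 r h1.2.1 r' h2.2.1 b h1.2.2 b' h2.2.2 ?_
      rintro rfl rfl rfl
      exact hne rfl) u
  refine le_trans ?_ h1
  rw [Finset.sum_product, sum_mul]
  refine sum_le_sum fun j _ => ?_
  rw [Finset.sum_sigma, mul_sum]
  refine sum_le_sum fun r hr => ?_
  have h3 := montgomery u a r (hD r hr) (hu r hr) (θ j)
  have h4 : (0 : ℝ) < r.totient := by
    exact_mod_cast Nat.totient_pos.mpr (Nat.pos_of_ne_zero (hD r hr).ne_zero)
  rw [mul_one_div, div_le_iff₀ h4, mul_comm (∑ b ∈ units r, _)]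
  exact h3

open Classical in
/-- Squarefree integers up to `R` all of whose prime factors satisfy `P`. -/
noncomputable def sqf (P : ℕ → Prop) (R : ℕ) : Finset ℕ :=
  (Icc 1 R).filter fun r => Squarefree r ∧ ∀ p ∈ r.primeFactors, P p

/-- The singular sum `∑ 1 / φ(r)` over squarefree `r ≤ R` composed of primes satisfying `P`. -/
noncomputable def GG (P : ℕ → Prop) (R : ℕ) : ℝ := ∑ r ∈ sqf P R, 1 / (r.totient : ℝ)

lemma mem_sqf {P : ℕ → Prop} {R r : ℕ} :
    r ∈ sqf P R ↔ (1 ≤ r ∧ r ≤ R) ∧ Squarefree r ∧ ∀ p ∈ r.primeFactors, P p := by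
  simp [sqf]

lemma GG_nonneg (P : ℕ → Prop) (R : ℕ) : 0 ≤ GG P R := sum_nonneg fun _ _ => by positivity

lemma GG_remove (P : ℕ → Prop) (R : ℕ) {p : ℕ} (hp : p.Prime) :
    GG P R ≤ GG (fun l => P l ∧ l ≠ p) R * (1 + 1 / ((p : ℝ) - 1)) := by
  classical
  have hp1 : (1 : ℝ) < p := by exact_mod_cast hp.one_lt
  unfold GG
  rw [← sum_filter_add_sum_filter_not (sqf P R) (fun r => ¬ p ∣ r), mul_add, mul_one]
  refine add_le_add ?_ ?_
  · refine sum_le_sum_of_subset_of_nonneg ?_ fun _ _ _ => by positivity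
    intro r hr
    rw [mem_filter, mem_sqf] at hr
    rw [mem_sqf]
    refine ⟨hr.1.1, hr.1.2.1, fun l hl => ⟨hr.1.2.2 l hl, ?_⟩⟩
    rintro rfl
    exact hr.2 (Nat.dvd_of_mem_primeFactors hl)
  · have h1 : ∀ r ∈ (sqf P R).filter (fun r => ¬¬ p ∣ r),
        1 / (r.totient : ℝ) = (1 / ((r / p).totient : ℝ)) * (1 / ((p : ℝ) - 1)) := by
      intro r hr
      rw [mem_filter, mem_sqf, not_not] at hr
      obtain ⟨e, rfl⟩ := hr.2
      have hc := (Nat.squarefree_mul_iff.mp hr.1.2.1).1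
      rw [Nat.totient_mul hc, Nat.mul_div_cancel_left _ hp.pos, Nat.totient_prime hp]
      push_cast [hp.one_le]
      rw [one_div_mul_one_div, mul_comm]
    rw [sum_congr rfl h1, ← sum_mul]
    refine mul_le_mul_of_nonneg_right ?_ (by
      apply one_div_nonneg.mpr; linarith)
    have hinj : Set.InjOn (fun r => r / p) ((sqf P R).filter (fun r => ¬¬ p ∣ r)) := by
      intro r hr r' hr' h
      rw [mem_coe, mem_filter, not_not] at hr hr'
      rw [← Nat.div_mul_cancel hr.2, ← Nat.div_mul_cancel hr'.2]
      simp only [] at h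
      rw [h]
    rw [← Finset.sum_image (f := fun r => 1 / (r.totient : ℝ)) hinj]
    refine sum_le_sum_of_subset_of_nonneg ?_ fun _ _ _ => by positivity
    intro r hr
    rw [mem_image] at hr
    obtain ⟨m, hm, rfl⟩ := hr
    rw [mem_filter, mem_sqf, not_not] at hm
    obtain ⟨e, rfl⟩ := hm.2
    obtain ⟨hc, -, hs⟩ := Nat.squarefree_mul_iff.mp hm.1.2.1
    rw [Nat.mul_div_cancel_left _ hp.pos, mem_sqf]
    refine ⟨⟨Nat.pos_of_ne_zero hs.ne_zero, ?_⟩, hs, fun l hl => ⟨?_, ?_⟩⟩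
    · exact (Nat.le_mul_of_pos_left e hp.pos).trans hm.1.1.2
    · apply hm.1.2.2
      exact Nat.primeFactors_mono (Dvd.intro_left p rfl) hm.1.2.1.ne_zero hl
    · rintro rfl
      have := Nat.dvd_of_mem_primeFactors hl
      exact hp.one_lt.ne' (Nat.eq_one_of_dvd_coprimes hc dvd_rfl this)

lemma GG_remove_finset (P : ℕ → Prop) (R : ℕ) (B : Finset ℕ) (hB : ∀ p ∈ B, p.Prime) :
    GG P R ≤ GG (fun l => P l ∧ l ∉ B) R * ∏ p ∈ B, (1 + 1 / ((p : ℝ) - 1)) := by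
  classical
  induction B using Finset.induction_on with
  | empty => simp
  | insert p B hpB ih =>
    have h1 := ih fun l hl => hB l (mem_insert_of_mem hl)
    have hp := hB p (mem_insert_self _ _)
    have h2 := GG_remove (fun l => P l ∧ l ∉ B) R hp
    have h3 : (fun l => (P l ∧ l ∉ B) ∧ l ≠ p) = fun l => P l ∧ l ∉ insert p B := by
      funext l; rw [mem_insert]; apply propext; tauto
    rw [h3] at h2
    rw [prod_insert hpB, ← mul_assoc]
    refine h1.trans (mul_le_mul_of_nonneg_right h2 ?_)
    refine prod_nonneg fun l hl => ?_
    have : (1 : ℝ) < l := by exact_mod_cast (hB l (mem_insert_of_mem hl)).one_lt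
    have : 0 ≤ 1 / ((l : ℝ) - 1) := one_div_nonneg.mpr (by linarith)
    linarith

lemma exists_primeCounting_le_div_add (K : ℝ) (hK : 0 < K) :
    ∃ C : ℝ, 0 ≤ C ∧ ∀ n : ℕ, (n.primeCounting : ℝ) ≤ n / K + C := by
  have h1 := Chebyshev.eventually_primeCounting_le (ε := 1) one_pos
  have h2 : ∀ᶠ x : ℝ in Filter.atTop, K * (Real.log 4 + 1) ≤ Real.log x :=
    Real.tendsto_log_atTop.eventually_ge_atTop _
  obtain ⟨X, hX⟩ := Filter.eventually_atTop.mp ((h1.and h2).and (Filter.eventually_gt_atTop 1))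
  refine ⟨|X| , abs_nonneg _, fun n => ?_⟩
  rcases le_total X n with h | h
  · obtain ⟨⟨h3, h4⟩, h5⟩ := hX n h
    rw [Nat.floor_natCast] at h3
    have hl : 0 < Real.log n := Real.log_pos h5
    have h6 : (Real.log 4 + 1) * n / Real.log n ≤ n / K := by
      rw [div_le_div_iff₀ hl hK]
      nlinarith
    linarith [abs_nonneg X]
  · have h3 : (n.primeCounting : ℝ) ≤ n := by
      have : n.primeCounting ≤ n := by
        rw [Nat.primeCounting, Nat.primeCounting', Nat.count_succ]
        rcases Nat.eq_zero_or_pos n with rfl | hn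
        · simp [Nat.not_prime_zero]
        · have h7 : Nat.count Nat.Prime n < n := by
            rw [Nat.count_eq_card_filter_range]
            calc _ ≤ ((range n).erase 0).card := card_le_card (by
                  intro x hx
                  simp only [mem_filter, mem_range, mem_erase] at hx ⊢
                  exact ⟨hx.2.ne_zero, hx.1⟩)
              _ < n := by rw [card_erase_of_mem (by simpa using hn), card_range]; omega
          split_ifs <;> omega
      exact_mod_cast this
    have : (0 : ℝ) ≤ n / K := by positivity
    linarith [le_abs_self X]

lemma exists_sum_primes_inv_le :
    ∃ C : ℝ, 0 ≤ C ∧ ∀ B : Finset ℕ, (∀ p ∈ B, p.Prime) →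
      ∑ p ∈ B, 1 / ((p : ℝ) - 1) ≤ (1 / 6) * Real.log (B.card + 1) + C := by
  obtain ⟨C0, hC0, hpi⟩ := exists_primeCounting_le_div_add 12 (by norm_num)
  set K : ℝ := 2 * C0 + 1 with hK
  suffices h : ∀ B : Finset ℕ, (∀ p ∈ B, p.Prime) →
      ∑ p ∈ B, 1 / ((p : ℝ) - 1) ≤ (1 / 6) * Real.log (B.card + 1) + min (B.card : ℝ) (K + 1) from
    ⟨K + 1, by linarith, fun B hB => (h B hB).trans (by gcongr; exact min_le_right _ _)⟩
  intro B
  induction B using Finset.induction_on_max with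
  | empty => intro _; simp; linarith
  | insert p s hmax ih =>
    intro hB
    have hps : p ∉ s := fun h => lt_irrefl _ (hmax p h)
    have hp := hB p (mem_insert_self _ _)
    have hp2 : (2 : ℝ) ≤ p := by exact_mod_cast hp.two_le
    have ih' := ih fun l hl => hB l (mem_insert_of_mem hl)
    have hcard : ((s.card : ℝ) + 1) ≤ p / 12 + C0 := by
      refine le_trans ?_ (hpi p)
      have : (insert p s).card ≤ p.primeCounting := by
        rw [Nat.primeCounting, Nat.primeCounting', Nat.count_eq_card_filter_range]
        refine card_le_card fun l hl => ?_
        rw [mem_filter, mem_range]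
        refine ⟨?_, hB l hl⟩
        rcases mem_insert.mp hl with rfl | h
        · exact Nat.lt_succ_self _
        · exact (hmax l h).trans (Nat.lt_succ_self _)
      rw [card_insert_of_notMem hps] at this
      exact_mod_cast this
    rw [sum_insert hps, card_insert_of_notMem hps]
    push_cast
    set k : ℝ := (s.card : ℝ) with hk
    have hk0 : 0 ≤ k := by positivity
    have hlogmono : Real.log (k + 1) ≤ Real.log (k + 1 + 1) := Real.log_le_log (by linarith) (by linarith)
    rcases le_total k K with h | h
    · have h1 : 1 / ((p : ℝ) - 1) ≤ 1 := by
        rw [div_le_one (by linarith)]; linarith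
      rw [min_eq_left (by linarith)] at ih' ⊢
      linarith
    · have h2 : 1 / ((p : ℝ) - 1) ≤ (1 / 6) * (Real.log (k + 1 + 1) - Real.log (k + 1)) := by
        rw [← Real.log_div (by linarith) (by linarith)]
        have h3 := Real.one_sub_inv_le_log_of_pos (x := (k + 1 + 1) / (k + 1)) (by positivity)
        rw [inv_div] at h3
        have h4 : 1 - (k + 1) / (k + 1 + 1) = 1 / (k + 1 + 1) := by field_simp; ring
        rw [h4] at h3
        refine le_trans ?_ (mul_le_mul_of_nonneg_left h3 (by norm_num))
        rw [div_mul_div_comm, div_le_div_iff₀ (by linarith) (by positivity)]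
        linarith
      have h5 : min k (K + 1) ≤ min (k + 1) (K + 1) := min_le_min_right _ (by linarith)
      linarith

lemma exists_prod_primes_le :
    ∃ C : ℝ, 0 < C ∧ ∀ B : Finset ℕ, (∀ p ∈ B, p.Prime) →
      ∏ p ∈ B, (1 + 1 / ((p : ℝ) - 1)) ≤ C * ((B.card : ℝ) + 1) ^ (1 / 6 : ℝ) := by
  obtain ⟨C, hC, h⟩ := exists_sum_primes_inv_le
  refine ⟨Real.exp C, Real.exp_pos _, fun B hB => ?_⟩
  have h1 : ∏ p ∈ B, (1 + 1 / ((p : ℝ) - 1)) ≤ Real.exp (∑ p ∈ B, 1 / ((p : ℝ) - 1)) := by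
    rw [Real.exp_sum]
    refine prod_le_prod (fun p hp => ?_) fun p hp => ?_
    · have : (1 : ℝ) < p := by exact_mod_cast (hB p hp).one_lt
      have : 0 ≤ 1 / ((p : ℝ) - 1) := one_div_nonneg.mpr (by linarith)
      linarith
    · rw [add_comm]; exact Real.add_one_le_exp _
  refine h1.trans ((Real.exp_le_exp.mpr (h B hB)).trans (le_of_eq ?_))
  rw [Real.exp_add, Real.rpow_def_of_pos (by positivity), mul_comm, mul_comm (1 / 6 : ℝ)]

lemma half_log_le_GG (R : ℕ) : (1 / 2) * Real.log R ≤ GG (fun _ => True) R := by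
  classical
  have h1 : Real.log R ≤ ∑ n ∈ Icc 1 R, 1 / (n : ℝ) := by
    have := log_add_one_le_harmonic R
    rw [harmonic_eq_sum_Icc] at this
    push_cast at this
    simp only [one_div]
    refine le_trans ?_ this
    rcases Nat.eq_zero_or_pos R with rfl | h
    · simp
    · exact Real.log_le_log (by exact_mod_cast h) (by linarith)
  have h2 : ∑ m ∈ Icc 1 R, 1 / (m : ℝ) ^ 2 ≤ 2 := by
    have := sum_Ioo_inv_sq_le (α := ℝ) 0 (R + 1)
    have h3 : Ioo 0 (R + 1) = Icc 1 R := by ext x; simp only [mem_Ioo, mem_Icc]; omega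
    rw [h3] at this
    simp only [one_div]
    norm_num at this
    exact this
  choose a b hab hsq using Nat.sq_mul_squarefree
  have h3 : ∑ n ∈ Icc 1 R, 1 / (n : ℝ) ≤
      ∑ x ∈ Icc 1 R ×ˢ sqf (fun _ => True) R, (1 / (x.1 : ℝ) ^ 2) * (1 / (x.2 : ℝ)) := by
    have hinj : Set.InjOn (fun n => (b n, a n)) (Icc 1 R : Finset ℕ) := by
      intro n _ m _ h
      simp only [Prod.mk.injEq] at h
      rw [← hab n, ← hab m, h.1, h.2]
    have h4 : ∑ n ∈ Icc 1 R, 1 / (n : ℝ) =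
        ∑ x ∈ (Icc 1 R).image (fun n => (b n, a n)), (1 / (x.1 : ℝ) ^ 2) * (1 / (x.2 : ℝ)) := by
      rw [sum_image hinj]
      refine sum_congr rfl fun n _ => ?_
      rw [one_div_mul_one_div]
      congr 1
      exact_mod_cast (hab n).symm
    rw [h4]
    refine sum_le_sum_of_subset_of_nonneg ?_ fun _ _ _ => by positivity
    intro x hx
    obtain ⟨n, hn, rfl⟩ := mem_image.mp hx
    rw [mem_Icc] at hn
    have hpos : 0 < b n ^ 2 * a n := by rw [hab]; omega
    have hb : 0 < b n := by
      rcases Nat.eq_zero_or_pos (b n) with h | h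
      · simp [h] at hpos
      · exact h
    have ha : 0 < a n := Nat.pos_of_mul_pos_left hpos
    have hle : b n ^ 2 * a n ≤ R := by rw [hab]; exact hn.2
    rw [mem_product, mem_Icc, mem_sqf]
    refine ⟨⟨hb, ?_⟩, ⟨ha, ?_⟩, hsq n, fun _ _ => trivial⟩
    · nlinarith
    · nlinarith [pow_pos hb 2]
  rw [sum_product] at h3
  simp_rw [← mul_sum] at h3
  rw [← sum_mul] at h3
  have h4 : ∑ r ∈ sqf (fun _ => True) R, 1 / (r : ℝ) ≤ GG (fun _ => True) R := by
    unfold GG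
    refine sum_le_sum fun r hr => ?_
    have hr1 := (mem_sqf.mp hr).1.1
    have : (0 : ℝ) < r.totient := by exact_mod_cast Nat.totient_pos.mpr hr1
    exact one_div_le_one_div_of_le this (by exact_mod_cast Nat.totient_le r)
  have h5 : 0 ≤ ∑ r ∈ sqf (fun _ => True) R, 1 / (r : ℝ) := sum_nonneg fun _ _ => by positivity
  nlinarith

lemma le_GG_dvd {P R : ℕ} (hP : Squarefree P) (hR : P ≤ R) :
    (P : ℝ) / P.totient ≤ GG (fun p => p ∣ P) R := by
  have hP0 : P ≠ 0 := hP.ne_zero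
  have hphi : (0 : ℝ) < P.totient := by exact_mod_cast Nat.totient_pos.mpr (Nat.pos_of_ne_zero hP0)
  have h1 : ∑ r ∈ P.divisors, 1 / (r.totient : ℝ) = (P : ℝ) / P.totient := by
    have h2 : ∀ r ∈ P.divisors, 1 / (r.totient : ℝ) = ((P / r).totient : ℝ) / P.totient := by
      intro r hr
      obtain ⟨e, he⟩ := Nat.dvd_of_mem_divisors hr
      have hc : Nat.Coprime r e := by rw [he] at hP; exact (Nat.squarefree_mul_iff.mp hP).1
      have hr0 : 0 < r := Nat.pos_of_mem_divisors hr
      have he' : P / r = e := by rw [he, Nat.mul_div_cancel_left _ hr0]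
      have h3 : P.totient = r.totient * e.totient := by rw [he, Nat.totient_mul hc]
      have h4 : (P.totient : ℝ) = r.totient * e.totient := by exact_mod_cast h3
      rw [he']
      rw [h4] at hphi ⊢
      have h5 : (0 : ℝ) < r.totient := by exact_mod_cast Nat.totient_pos.mpr hr0
      have h6 : (e.totient : ℝ) ≠ 0 := by
        intro h; rw [h, mul_zero] at hphi; exact lt_irrefl _ hphi
      field_simp
    rw [sum_congr rfl h2, ← sum_div]
    congr 1
    rw [Nat.sum_div_divisors P (fun r => (r.totient : ℝ))]
    exact_mod_cast Nat.sum_totient P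
  rw [← h1]
  unfold GG
  refine sum_le_sum_of_subset_of_nonneg ?_ fun _ _ _ => by positivity
  intro r hr
  have hd := Nat.dvd_of_mem_divisors hr
  rw [mem_sqf]
  exact ⟨⟨Nat.pos_of_mem_divisors hr, (Nat.le_of_dvd (Nat.pos_of_ne_zero hP0) hd).trans hR⟩,
    hP.squarefree_of_dvd hd, fun p hp => (Nat.dvd_of_mem_primeFactors hp).trans hd⟩

lemma prod_primeFactors_eq {q : ℕ} (hq : 0 < q) :
    ∏ p ∈ q.primeFactors, (1 + 1 / ((p : ℝ) - 1)) = q / q.totient := by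
  have h1 : (q.totient : ℝ) = q * ∏ p ∈ q.primeFactors, (1 - (p : ℝ)⁻¹) := by
    have := Nat.totient_eq_mul_prod_factors q
    have h := congrArg (fun x : ℚ => (x : ℝ)) this
    push_cast at h
    exact h
  have h2 : (∏ p ∈ q.primeFactors, (1 + 1 / ((p : ℝ) - 1))) *
      ∏ p ∈ q.primeFactors, (1 - (p : ℝ)⁻¹) = 1 := by
    rw [← prod_mul_distrib]
    refine prod_eq_one fun p hp => ?_
    have hp1 : (1 : ℝ) < p := by exact_mod_cast (Nat.prime_of_mem_primeFactors hp).one_lt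
    have : (p : ℝ) - 1 ≠ 0 := by linarith
    field_simp
    ring
  have hq' : (0 : ℝ) < q := by exact_mod_cast hq
  have h3 : (0 : ℝ) < q.totient := by exact_mod_cast Nat.totient_pos.mpr hq
  rw [eq_div_iff h3.ne', h1]
  linear_combination q * h2

lemma le_GG_coprime {q : ℕ} (hq : 0 < q) (R : ℕ) :
    (q.totient : ℝ) / q * ((1 / 2) * Real.log R) ≤ GG (fun p => ¬ p ∣ q) R := by
  have h1 := GG_remove_finset (fun _ => True) R q.primeFactors
    (fun p hp => Nat.prime_of_mem_primeFactors hp)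
  rw [prod_primeFactors_eq hq] at h1
  have h2 : GG (fun l => True ∧ l ∉ q.primeFactors) R ≤ GG (fun p => ¬ p ∣ q) R := by
    unfold GG
    refine sum_le_sum_of_subset_of_nonneg ?_ fun _ _ _ => by positivity
    intro r hr
    rw [mem_sqf] at hr ⊢
    refine ⟨hr.1, hr.2.1, fun p hp h => (hr.2.2 p hp).2 ?_⟩
    exact Nat.mem_primeFactors.mpr ⟨Nat.prime_of_mem_primeFactors hp, h, hq.ne'⟩
  have hq' : (0 : ℝ) < q := by exact_mod_cast hq
  have h3 : (0 : ℝ) < q.totient := by exact_mod_cast Nat.totient_pos.mpr hq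
  have h4 := (half_log_le_GG R).trans h1
  calc (q.totient : ℝ) / q * ((1 / 2) * Real.log R)
      ≤ (q.totient : ℝ) / q * (GG (fun l => True ∧ l ∉ q.primeFactors) R * (q / q.totient)) := by
        gcongr
    _ = GG (fun l => True ∧ l ∉ q.primeFactors) R := by field_simp
    _ ≤ _ := h2

lemma inv_den_le_nn {ρ : ℚ} (h : ρ.den ≠ 1) : 1 / (ρ.den : ℝ) ≤ nn ρ := by
  obtain ⟨m, hm⟩ := exists_int_nn (ρ : ℝ)
  have hd : (0 : ℝ) < ρ.den := by exact_mod_cast ρ.den_pos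
  have h1 : (ρ : ℝ) - m = ((ρ.num - m * ρ.den : ℤ) : ℝ) / ρ.den := by
    rw [eq_div_iff hd.ne']
    have h2 : (ρ : ℝ) * ρ.den = ρ.num := by exact_mod_cast Rat.mul_den_eq_num ρ
    push_cast
    linear_combination h2
  have h2 : ρ.num - m * ρ.den ≠ 0 := by
    intro h0
    apply h
    have h3 : ρ = (m : ℚ) := by
      have : (ρ : ℝ) - m = 0 := by rw [h1, h0]; simp
      have : (ρ : ℝ) = ((m : ℚ) : ℝ) := by push_cast; linarith
      exact_mod_cast this
    rw [h3]; exact Rat.den_intCast m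
  rw [hm, h1, abs_div, abs_of_pos hd]
  have : (1 : ℝ) ≤ |((ρ.num - m * ρ.den : ℤ) : ℝ)| := by
    rw [← Int.cast_abs]; exact_mod_cast Int.one_le_abs h2
  gcongr

lemma den_natCast_div_dvd (b r : ℕ) : ((b : ℚ) / r).den ∣ r := by
  have := Rat.den_dvd (b : ℤ) (r : ℤ)
  rw [Rat.divInt_eq_div, Int.cast_natCast, Int.cast_natCast] at this
  exact Int.natCast_dvd_natCast.mp this

lemma nn_rat_of_den_eq_one {ρ : ℚ} (h : ρ.den = 1) (x : ℝ) : nn (x + ρ) = nn x := by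
  have h1 : (ρ : ℝ) = (ρ.num : ℤ) := by
    have : ρ = (ρ.num : ℚ) := ((Rat.den_eq_one_iff ρ).mp h).symm
    exact_mod_cast congrArg (fun x : ℚ => (x : ℝ)) this
  rw [h1, nn_add_int]

lemma div_sub_div_den_ne_one {r r' b b' : ℕ} (hb : b ∈ units r) (hb' : b' ∈ units r')
    (hne : r = r' → b ≠ b') : ((b : ℚ) / r - b' / r').den ≠ 1 := by
  rw [mem_units] at hb hb'
  have hr : 0 < r := by omega
  have hr' : 0 < r' := by omega
  intro h
  have h1 := (Rat.den_eq_one_iff _).mp h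
  have hrq : (0 : ℚ) < r := by exact_mod_cast hr
  have hrq' : (0 : ℚ) < r' := by exact_mod_cast hr'
  have hbl : (b : ℚ) / r < 1 := by rw [div_lt_one hrq]; exact_mod_cast hb.1
  have hbl' : (b' : ℚ) / r' < 1 := by rw [div_lt_one hrq']; exact_mod_cast hb'.1
  have hb0 : (0 : ℚ) ≤ (b : ℚ) / r := by positivity
  have hb0' : (0 : ℚ) ≤ (b' : ℚ) / r' := by positivity
  set m := ((b : ℚ) / r - b' / r').num
  have h2 : (m : ℚ) < 1 := by linarith
  have h3 : (-1 : ℚ) < m := by linarith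
  have h4 : m = 0 := by
    have : m < 1 := by exact_mod_cast h2
    have : -1 < m := by exact_mod_cast h3
    omega
  rw [h4, Int.cast_zero, eq_comm, sub_eq_zero, div_eq_div_iff hrq.ne' hrq'.ne'] at h1
  have h5 : b * r' = b' * r := by exact_mod_cast h1
  have h6 : r ∣ r' := hb.2.dvd_of_dvd_mul_left ⟨b', by rw [h5]; ring⟩
  have h7 : r' ∣ r := hb'.2.dvd_of_dvd_mul_left ⟨b, by rw [← h5]; ring⟩
  have h8 := Nat.dvd_antisymm h6 h7
  subst h8
  exact hne rfl (Nat.eq_of_mul_eq_mul_right hr h5)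

theorem exists_spectrum_bound : ∃ C : ℝ, 0 < C ∧ ∀ {ι : Type} (s : Finset ι) (θ : ι → ℝ) (N R : ℕ)
    (P : ℕ → Prop) (u : ℕ → ℂ) (a : ℕ), 0 < R → 2 * R ^ 4 ≤ N →
    (∀ n < N, u n ≠ 0 → ∀ p, p.Prime → P p → p ≤ R → ¬ p ∣ a + n) →
    (∀ j ∈ s, ∀ k ∈ s, j ≠ k → 1 / (N : ℝ) ≤ nn (θ j - θ k)) →
    (∑ j ∈ s, ‖∑ n ∈ range N, u n * ee (n * θ j)‖ ^ 2) * GG P R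
      ≤ C * N * (s.card : ℝ) ^ (1 / 3 : ℝ) * ∑ n ∈ range N, ‖u n‖ ^ 2 := by
  classical
  obtain ⟨C, hC, hprod⟩ := exists_prod_primes_le
  refine ⟨12 * C * 2 ^ (1 / 6 : ℝ), by positivity, ?_⟩
  intro ι s θ N R P u a hR hRN hu hs
  have hN : 0 < N := lt_of_lt_of_le (by positivity) hRN
  have hN' : (0 : ℝ) < N := by exact_mod_cast hN
  have hR1 : (1 : ℝ) ≤ R := by exact_mod_cast hR
  have hRN' : 2 * (R : ℝ) ^ 4 ≤ N := by exact_mod_cast hRN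
  rcases s.eq_empty_or_nonempty with rfl | hne
  · simp
  have hcard1 : (1 : ℝ) ≤ s.card := by exact_mod_cast hne.card_pos
  set bad : ι × ι → ℚ → Prop := fun x ρ =>
    ρ.den ≠ 1 ∧ ρ.den ≤ R ^ 2 ∧ nn (θ x.1 - θ x.2 + ρ) < 1 / N with hbad
  set f : ι × ι → ℕ := fun x => if h : ∃ ρ, bad x ρ then h.choose.den.minFac else 2 with hf
  set B : Finset ℕ := (s ×ˢ s).image f with hB
  have hBprime : ∀ p ∈ B, p.Prime := by
    intro p hp
    obtain ⟨x, _, rfl⟩ := mem_image.mp hp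
    simp only [hf]
    split_ifs with h
    · exact Nat.minFac_prime h.choose_spec.1
    · exact Nat.prime_two
  have hBcard : (B.card : ℝ) ≤ (s.card : ℝ) ^ 2 := by
    have : B.card ≤ s.card ^ 2 := by
      refine card_image_le.trans ?_
      rw [card_product, sq]
    exact_mod_cast this
  have hmain := large_sieve_coprime s θ hN (sqf (fun l => P l ∧ l ∉ B) R)
    (fun r hr => (mem_sqf.mp hr).2.1) u a (by
      intro r hr n hn hun
      rw [mem_sqf] at hr
      rw [Nat.coprime_comm]
      refine Nat.Coprime.symm ?_
      refine Nat.coprime_of_dvd' ?_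
      intro p hp hpa hpr
      exfalso
      have hpm : p ∈ r.primeFactors := Nat.mem_primeFactors.mpr ⟨hp, hpr, hr.2.1.ne_zero⟩
      exact hu n hn hun p hp (hr.2.2 p hpm).1 ((Nat.le_of_dvd hr.1.1 hpr).trans hr.1.2) hpa) (by
      intro j hj k hk r hr r' hr' b hb b' hb' hneq
      set ρ : ℚ := (b : ℚ) / r - b' / r' with hρ
      have heq : (θ j + b / r) - (θ k + b' / r') = θ j - θ k + (ρ : ℝ) := by
        rw [hρ]; push_cast; ring
      rw [heq]
      rw [mem_sqf] at hr hr'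
      have hden : ρ.den ∣ r * r' := (Rat.sub_den_dvd _ _).trans
        (mul_dvd_mul (den_natCast_div_dvd _ _) (den_natCast_div_dvd _ _))
      have hdenle : ρ.den ≤ R ^ 2 := by
        refine (Nat.le_of_dvd (Nat.mul_pos hr.1.1 hr'.1.1) hden).trans ?_
        rw [sq]; exact Nat.mul_le_mul hr.1.2 hr'.1.2
      have hR2N : (R : ℝ) ^ 2 ≤ N := by nlinarith [pow_le_pow_right₀ hR1 (show 2 ≤ 4 by norm_num)]
      by_cases hjk : j = k
      · subst hjk
        have h1 : ρ.den ≠ 1 := div_sub_div_den_ne_one hb hb' (hneq rfl)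
        rw [sub_self, zero_add]
        refine le_trans ?_ (inv_den_le_nn h1)
        apply one_div_le_one_div_of_le (by exact_mod_cast ρ.den_pos)
        refine le_trans ?_ hR2N
        exact_mod_cast hdenle
      · by_cases hd1 : ρ.den = 1
        · rw [nn_rat_of_den_eq_one hd1]
          exact hs j hj k hk hjk
        · by_contra hlt
          push Not at hlt
          have hex : ∃ ρ, bad (j, k) ρ := ⟨ρ, hd1, hdenle, hlt⟩
          have hfx : f (j, k) = hex.choose.den.minFac := by simp only [hf]; rw [dif_pos hex]
          obtain ⟨h1, h2, h3⟩ := hex.choose_spec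
          set σ := hex.choose with hσ
          have hpB : f (j, k) ∈ B := mem_image_of_mem _ (mem_product.mpr ⟨hj, hk⟩)
          have hdiff : nn ((σ - ρ : ℚ) : ℝ) < 2 / N := by
            have h4 := nn_sub_le (θ j - θ k + σ) (θ j - θ k + ρ)
            have h5 : θ j - θ k + (σ : ℝ) - (θ j - θ k + ρ) = ((σ - ρ : ℚ) : ℝ) := by push_cast; ring
            rw [h5] at h4
            have h6 : (2 : ℝ) / N = 1 / N + 1 / N := by ring
            simp only [] at h3
            linarith
          have hone : (σ - ρ).den = 1 := by
            by_contra hne1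
            have h4 := inv_den_le_nn hne1
            have h5 : (σ - ρ).den ≤ R ^ 4 := by
              refine (Nat.le_of_dvd (Nat.mul_pos σ.den_pos ρ.den_pos) (Rat.sub_den_dvd σ ρ)).trans ?_
              calc σ.den * ρ.den ≤ R ^ 2 * R ^ 2 := Nat.mul_le_mul h2 hdenle
                _ = R ^ 4 := by ring
            have h6 : 1 / ((R : ℝ) ^ 4) ≤ 1 / ((σ - ρ).den : ℝ) :=
              one_div_le_one_div_of_le (by exact_mod_cast (σ - ρ).den_pos) (by exact_mod_cast h5)
            have h7 : (2 : ℝ) / N ≤ 1 / (R : ℝ) ^ 4 := by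
              rw [div_le_div_iff₀ hN' (by positivity)]; linarith
            linarith
          have hσden : σ.den ∣ ρ.den := by
            have h4 : σ = (σ - ρ) + ρ := by ring
            have h5 := Rat.add_den_dvd (σ - ρ) ρ
            rw [← h4, hone, one_mul] at h5
            exact h5
          have hpp : f (j, k) ∣ r * r' := by
            rw [hfx]; exact (Nat.minFac_dvd _).trans (hσden.trans hden)
          have hprime := hBprime _ hpB
          rcases (hprime.dvd_mul).mp hpp with h | h
          · exact (hr.2.2 _ (Nat.mem_primeFactors.mpr ⟨hprime, h, hr.2.1.ne_zero⟩)).2 hpB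
          · exact (hr'.2.2 _ (Nat.mem_primeFactors.mpr ⟨hprime, h, hr'.2.1.ne_zero⟩)).2 hpB)
  change _ * GG (fun l => P l ∧ l ∉ B) R ≤ _ at hmain
  have h1 := GG_remove_finset P R B hBprime
  have h2 := hprod B hBprime
  have h3 : C * ((B.card : ℝ) + 1) ^ (1 / 6 : ℝ) ≤ C * (2 ^ (1 / 6 : ℝ) * (s.card : ℝ) ^ (1 / 3 : ℝ)) := by
    have h4 : (B.card : ℝ) + 1 ≤ 2 * (s.card : ℝ) ^ 2 := by nlinarith
    have h5 : ((s.card : ℝ) ^ 2) ^ (1 / 6 : ℝ) = (s.card : ℝ) ^ (1 / 3 : ℝ) := by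
      rw [← Real.rpow_natCast, ← Real.rpow_mul (by positivity)]; norm_num
    rw [← h5, ← Real.mul_rpow (by norm_num) (by positivity)]
    gcongr
  set T := ∑ j ∈ s, ‖∑ n ∈ range N, u n * ee (n * θ j)‖ ^ 2 with hT
  have hT0 : 0 ≤ T := sum_nonneg fun _ _ => by positivity
  set G' := GG (fun l => P l ∧ l ∉ B) R
  have hG' : 0 ≤ G' := GG_nonneg _ _
  calc T * GG P R ≤ T * (G' * (C * (2 ^ (1 / 6 : ℝ) * (s.card : ℝ) ^ (1 / 3 : ℝ)))) := by
        gcongr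
        exact h1.trans (mul_le_mul_of_nonneg_left (h2.trans h3) hG')
    _ = (T * G') * (C * (2 ^ (1 / 6 : ℝ) * (s.card : ℝ) ^ (1 / 3 : ℝ))) := by ring
    _ ≤ (12 * N * ∑ n ∈ range N, ‖u n‖ ^ 2) *
        (C * (2 ^ (1 / 6 : ℝ) * (s.card : ℝ) ^ (1 / 3 : ℝ))) := by
        gcongr
    _ = _ := by ring

/-- The Brun–Titchmarsh inequality in arithmetic progressions (upper bound sieve form). -/
theorem card_primes_le (x y q c R : ℕ) (hq : 0 < q) (hR : 1 < R) (hy : q * R ^ 2 ≤ y) :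
    (((Ioc x (x + y)).filter fun p => p.Prime ∧ p ≡ c [MOD q]).card : ℝ)
      ≤ R + 24 * y / (q.totient * Real.log R) := by
  classical
  have hy0 : 0 < y := lt_of_lt_of_le (by positivity) hy
  have hq' : (0 : ℝ) < q := by exact_mod_cast hq
  have hy' : (0 : ℝ) < y := by exact_mod_cast hy0
  have hR' : (1 : ℝ) < R := by exact_mod_cast hR
  set A := (range y).filter fun n => (x + 1 + n).Prime ∧ x + 1 + n ≡ c [MOD q] ∧ R < x + 1 + n with hA
  set u : ℕ → ℂ := fun n => if n ∈ A then 1 else 0 with hu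
  have hcount : ((Ioc x (x + y)).filter fun p => p.Prime ∧ p ≡ c [MOD q]).card ≤ R + A.card := by
    have h1 : ((Ioc x (x + y)).filter fun p => p.Prime ∧ p ≡ c [MOD q]) ⊆
        Icc 1 R ∪ A.image (fun n => x + 1 + n) := by
      intro p hp
      rw [mem_filter, mem_Ioc] at hp
      rw [mem_union, mem_image, mem_Icc]
      rcases le_or_gt p R with h | h
      · exact Or.inl ⟨hp.2.1.one_lt.le, h⟩
      · refine Or.inr ⟨p - (x + 1), ?_, by omega⟩
        rw [hA, mem_filter, mem_range]
        have : x + 1 + (p - (x + 1)) = p := by omega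
        rw [this]
        exact ⟨by omega, hp.2.1, hp.2.2, h⟩
    refine (card_le_card h1).trans ((card_union_le _ _).trans ?_)
    rw [Nat.card_Icc, Nat.add_sub_cancel]
    exact Nat.add_le_add_left card_image_le _
  have hsum : ∀ a ∈ range q, ‖∑ n ∈ range y, u n * ee (n * ((a : ℝ) / q))‖ = A.card := by
    intro a _
    have h1 : ∀ n ∈ A, ee (n * ((a : ℝ) / q)) = ee (((c : ℝ) - (x + 1)) * (a / q)) := by
      intro n hn
      rw [hA, mem_filter] at hn
      have h2 : ((x + 1 + n : ℕ) : ℤ) ≡ (c : ℤ) [ZMOD q] := (Int.natCast_modEq_iff).mpr hn.2.2.1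
      obtain ⟨e, he⟩ := h2.dvd
      have h3 : (c : ℝ) - (x + 1 + n) = q * e := by
        have := congrArg (fun z : ℤ => (z : ℝ)) he
        push_cast at this
        exact this
      have h4 : (n : ℝ) * (a / q) = ((c : ℝ) - (x + 1)) * (a / q) + ((-(e * a) : ℤ) : ℝ) := by
        push_cast
        field_simp
        linear_combination (-(a : ℝ)) * h3
      rw [h4, ee_add_int]
    have h2 : ∑ n ∈ range y, u n * ee (n * ((a : ℝ) / q)) = ∑ n ∈ A, ee (n * ((a : ℝ) / q)) := by
      have h3 : ∑ n ∈ A, u n * ee (n * ((a : ℝ) / q)) = ∑ n ∈ range y, u n * ee (n * ((a : ℝ) / q)) :=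
        sum_subset (filter_subset _ _) fun n _ (hn : n ∉ A) => by
          have h4 : u n = 0 := if_neg hn
          rw [h4, zero_mul]
      rw [← h3]
      refine sum_congr rfl fun n hn => ?_
      simp [hu, hn]
    rw [h2, sum_congr rfl h1, sum_const, nsmul_eq_mul, norm_mul, norm_ee, mul_one]
    simp
  have husq : ∑ n ∈ range y, ‖u n‖ ^ 2 = A.card := by
    have h1 : ∀ n ∈ range y, ‖u n‖ ^ 2 = if n ∈ A then (1 : ℝ) else 0 := by
      intro n _; simp only [hu]; split_ifs <;> simp
    have hf : (range y).filter (fun n => n ∈ A) = A := by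
      rw [filter_mem_eq_inter, inter_eq_right]
      exact filter_subset _ _
    rw [sum_congr rfl h1, ← sum_filter, sum_const, nsmul_eq_mul, mul_one, hf]
  have hmain := large_sieve_coprime (range q) (fun a => (a : ℝ) / q) hy0
    (sqf (fun p => ¬ p ∣ q) R) (fun r hr => (mem_sqf.mp hr).2.1) u (x + 1) (by
      intro r hr n hn hun
      have hnA : n ∈ A := by
        by_contra h; apply hun; simp [hu, h]
      rw [hA, mem_filter] at hnA
      rw [mem_sqf] at hr
      refine Nat.coprime_of_lt_prime ?_ ?_ hnA.2.1
      · omega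
      · omega) (by
      intro j hj k hk r hr r' hr' b hb b' hb' hneq
      rw [mem_sqf] at hr hr'
      rw [mem_range] at hj hk
      have hcop : ∀ r ∈ sqf (fun p => ¬ p ∣ q) R, Nat.Coprime r q := by
        intro r hr
        rw [mem_sqf] at hr
        refine Nat.coprime_of_dvd' fun p hp hpr hpq => ?_
        exact absurd hpq (hr.2.2 p (Nat.mem_primeFactors.mpr ⟨hp, hpr, hr.2.1.ne_zero⟩))
      set ρ : ℚ := ((j : ℚ) / q - k / q) + ((b : ℚ) / r - b' / r') with hρ
      have heq : ((j : ℝ) / q + b / r) - (k / q + b' / r') = (ρ : ℝ) := by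
        rw [hρ]; push_cast; ring
      rw [heq]
      have hd1 : ((j : ℚ) / q - k / q).den ∣ q := by
        have h1 : (j : ℚ) / q - k / q = ((j : ℤ) - k : ℤ) / (q : ℤ) := by push_cast; ring
        rw [h1, ← Rat.divInt_eq_div]
        exact_mod_cast Rat.den_dvd ((j : ℤ) - k) (q : ℤ)
      have hd2 : ((b : ℚ) / r - b' / r').den ∣ r * r' := (Rat.sub_den_dvd _ _).trans
        (mul_dvd_mul (den_natCast_div_dvd _ _) (den_natCast_div_dvd _ _))
      have hρ1 : ρ.den ≠ 1 := by
        intro h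
        have e1 : (b : ℚ) / r - b' / r' = ρ - ((j : ℚ) / q - k / q) := by rw [hρ]; ring
        have h2 : ((b : ℚ) / r - b' / r').den ∣ q := by
          have := Rat.sub_den_dvd ρ ((j : ℚ) / q - k / q)
          rw [← e1, h, one_mul] at this
          exact this.trans hd1
        have h3 : ((b : ℚ) / r - b' / r').den = 1 :=
          Nat.eq_one_of_dvd_coprimes
            (Nat.Coprime.mul_left (hcop r (mem_sqf.mpr hr)) (hcop r' (mem_sqf.mpr hr'))) hd2 h2
        have h4 : r = r' ∧ b = b' := by
          by_contra hne
          exact div_sub_div_den_ne_one hb hb' (fun h1 h2 => hne ⟨h1, h2⟩) h3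
        have hjk : j ≠ k := fun hjk => hneq hjk h4.1 h4.2
        have e2 : (b : ℚ) / r - b' / r' = 0 := by rw [h4.1, h4.2]; ring
        rw [e2, add_zero] at hρ
        have e3 : (ρ : ℚ) = ((j : ℤ) - k : ℤ) / (q : ℤ) := by rw [hρ]; push_cast; ring
        have h5 := (Rat.den_eq_one_iff _).mp h
        rw [← h5] at e3
        rw [eq_div_iff (by exact_mod_cast hq.ne')] at e3
        have e4 : ρ.num * q = (j : ℤ) - k := by exact_mod_cast e3
        have h6 : (q : ℤ) ∣ (j : ℤ) - k := ⟨ρ.num, by rw [← e4]; ring⟩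
        have h7 : (j : ℤ) - k = 0 := by
          apply Int.eq_zero_of_abs_lt_dvd h6
          rw [abs_lt]; omega
        exact hjk (by omega)
      refine le_trans ?_ (inv_den_le_nn hρ1)
      apply one_div_le_one_div_of_le (by exact_mod_cast ρ.den_pos)
      have h8 : ρ.den ≤ y := by
        refine le_trans (Nat.le_of_dvd ?_ ((Rat.add_den_dvd _ _).trans (mul_dvd_mul hd1 hd2))) ?_
        · have := hr.1.1; have := hr'.1.1; positivity
        · refine le_trans ?_ hy
          rw [sq]
          exact Nat.mul_le_mul_left _ (Nat.mul_le_mul hr.1.2 hr'.1.2)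
      exact_mod_cast h8)
  change _ * GG (fun p => ¬ p ∣ q) R ≤ _ at hmain
  have hl : ∑ j ∈ range q, ‖∑ n ∈ range y, u n * ee (n * ((j : ℝ) / q))‖ ^ 2 = q * (A.card : ℝ) ^ 2 := by
    rw [sum_congr rfl fun j hj => by rw [hsum j hj], sum_const, card_range, nsmul_eq_mul]
  rw [hl, husq] at hmain
  have hG := le_GG_coprime hq R
  have hphi : (0 : ℝ) < q.totient := by exact_mod_cast Nat.totient_pos.mpr hq
  have hlog : 0 < Real.log R := Real.log_pos hR'
  have hAb : (A.card : ℝ) ≤ 24 * y / (q.totient * Real.log R) := by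
    rw [le_div_iff₀ (by positivity)]
    rcases Nat.eq_zero_or_pos A.card with h0 | h0
    · rw [h0]; simp
    have h0' : (0 : ℝ) < A.card := by exact_mod_cast h0
    have h1 : (q : ℝ) * A.card ^ 2 * (q.totient / q * ((1 / 2) * Real.log R)) ≤ 12 * y * A.card :=
      (mul_le_mul_of_nonneg_left hG (by positivity)).trans hmain
    have h2 : (q : ℝ) * A.card ^ 2 * (q.totient / q * ((1 / 2) * Real.log R)) =
        A.card * (A.card * (q.totient * Real.log R) / 2) := by
      field_simp
    rw [h2] at h1
    have h3 : (A.card : ℝ) * (A.card * (q.totient * Real.log R) / 2) ≤ A.card * (12 * y) := by linarith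
    have h4 := le_of_mul_le_mul_left h3 h0'
    linarith
  have : (((Ioc x (x + y)).filter fun p => p.Prime ∧ p ≡ c [MOD q]).card : ℝ) ≤ R + A.card := by
    exact_mod_cast hcount
  linarith

open ArithmeticFunction in
/-- The exponential sum `∑_{n ≤ y} Λ(n) e(nα)`. -/
noncomputable def S (y : ℕ) (α : ℝ) : ℂ := ∑ n ∈ range (y + 1), (vonMangoldt n : ℂ) * ee (n * α)

/-- The integer part of the fourth root of `N / 2`. -/
def rt (N : ℕ) : ℕ := Nat.sqrt (Nat.sqrt (N / 2))

lemma two_mul_rt_pow_le (N : ℕ) : 2 * rt N ^ 4 ≤ N := by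
  have h1 := Nat.sqrt_le' (N / 2)
  have h2 := Nat.sqrt_le' (Nat.sqrt (N / 2))
  have h3 : rt N ^ 4 ≤ N / 2 := by
    calc rt N ^ 4 = (rt N ^ 2) ^ 2 := by ring
      _ ≤ (Nat.sqrt (N / 2)) ^ 2 := Nat.pow_le_pow_left h2 2
      _ ≤ _ := h1
  omega

lemma lt_two_mul_rt_pow (N : ℕ) : N < 2 * (rt N + 1) ^ 4 := by
  have h1 := Nat.lt_succ_sqrt' (N / 2)
  have h2 := Nat.lt_succ_sqrt' (Nat.sqrt (N / 2))
  have h3 : N / 2 < (rt N + 1) ^ 4 := by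
    calc N / 2 < (Nat.sqrt (N / 2) + 1) ^ 2 := h1
      _ ≤ ((rt N + 1) ^ 2) ^ 2 := Nat.pow_le_pow_left h2 2
      _ = _ := by ring
  omega

lemma two_le_rt {N : ℕ} (hN : 32 ≤ N) : 2 ≤ rt N := by
  unfold rt
  rw [Nat.le_sqrt', Nat.le_sqrt']
  omega

lemma log_le_log_rt {N : ℕ} (hN : 32 ≤ N) : Real.log N ≤ 9 * Real.log (rt N) := by
  have h2 := two_le_rt hN
  have h2' : (2 : ℝ) ≤ rt N := by exact_mod_cast h2
  have h1 : (N : ℝ) ≤ (rt N : ℝ) ^ 9 := by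
    have h3 := lt_two_mul_rt_pow N
    have h4 : 2 * (rt N + 1) ^ 4 ≤ rt N ^ 9 := by
      calc 2 * (rt N + 1) ^ 4 ≤ 2 * (2 * rt N) ^ 4 :=
            Nat.mul_le_mul_left _ (Nat.pow_le_pow_left (by omega) 4)
        _ = 2 ^ 5 * rt N ^ 4 := by ring
        _ ≤ rt N ^ 5 * rt N ^ 4 := Nat.mul_le_mul_right _ (Nat.pow_le_pow_left h2 5)
        _ = _ := by ring
    exact_mod_cast (h3.trans_le h4).le
  calc Real.log N ≤ Real.log ((rt N : ℝ) ^ 9) := Real.log_le_log (by positivity) h1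
    _ = _ := by rw [Real.log_pow]; norm_num

lemma sum_vonMangoldt_range (y : ℕ) :
    ∑ n ∈ range (y + 1), ArithmeticFunction.vonMangoldt n = Chebyshev.psi y := by
  rw [Chebyshev.psi_eq_sum_Icc, Nat.floor_natCast]
  exact sum_congr (by ext; simp) fun _ _ => rfl

lemma sum_vonMangoldt_le (y : ℕ) :
    ∑ n ∈ range (y + 1), ArithmeticFunction.vonMangoldt n ≤ 6 * y := by
  rw [sum_vonMangoldt_range]
  refine (Chebyshev.psi_le_const_mul_self (by positivity)).trans ?_
  gcongr
  have : Real.log 4 = 2 * Real.log 2 := by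
    rw [show (4 : ℝ) = 2 ^ 2 by norm_num, Real.log_pow]; norm_num
  have := Real.log_two_lt_d9
  linarith

lemma norm_sum_vonMangoldt_le (s : Finset ℕ) (α : ℝ) :
    ‖∑ n ∈ s, (ArithmeticFunction.vonMangoldt n : ℂ) * ee (n * α)‖
      ≤ ∑ n ∈ s, ArithmeticFunction.vonMangoldt n := by
  refine (norm_sum_le _ _).trans (sum_le_sum fun n _ => ?_)
  rw [norm_mul, norm_ee, mul_one, Complex.norm_real, Real.norm_eq_abs,
    abs_of_nonneg ArithmeticFunction.vonMangoldt_nonneg]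

lemma norm_S_le (y : ℕ) (α : ℝ) : ‖S y α‖ ≤ 6 * y :=
  (norm_sum_vonMangoldt_le _ α).trans (sum_vonMangoldt_le y)

lemma sum_primes_log_le (y : ℕ) : ∑ p ∈ (range (y + 1)).filter Nat.Prime, Real.log p ≤ 2 * y := by
  have h := Chebyshev.theta_le_log4_mul_x (x := y) (by positivity)
  rw [Chebyshev.theta_eq_sum_Icc, Nat.floor_natCast] at h
  have h1 : (range (y + 1)).filter Nat.Prime = (Icc 0 y).filter Nat.Prime := by
    ext; simp
  rw [h1]
  refine h.trans ?_
  gcongr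
  have : Real.log 4 = 2 * Real.log 2 := by
    rw [show (4 : ℝ) = 2 ^ 2 by norm_num, Real.log_pow]; norm_num
  have := Real.log_two_lt_d9
  linarith

/-- A sum over well-spaced points of `|∑ u(n) e(nθ)|²` for `u` supported on primes with
logarithmic weights. -/
theorem exists_spectrum_primes : ∃ C : ℝ, 0 < C ∧ ∀ {ι : Type} (s : Finset ι) (θ : ι → ℝ) (N : ℕ)
    (u : ℕ → ℂ), 32 ≤ N → (∀ n < N, u n ≠ 0 → n.Prime ∧ rt N < n) → (∀ n < N, ‖u n‖ ≤ Real.log n) →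
    (∀ j ∈ s, ∀ k ∈ s, j ≠ k → 1 / (N : ℝ) ≤ nn (θ j - θ k)) →
    ∑ j ∈ s, ‖∑ n ∈ range N, u n * ee (n * θ j)‖ ^ 2 ≤ C * N ^ 2 * (s.card : ℝ) ^ (1 / 3 : ℝ) := by
  obtain ⟨C, hC, hmain⟩ := exists_spectrum_bound
  refine ⟨36 * C, by positivity, fun s θ N u hN hu hul hs => ?_⟩
  have h2 := two_le_rt hN
  have h1 := hmain s θ N (rt N) (fun _ => True) u 0 (by omega) (two_mul_rt_pow_le N) (by
    intro n hn hun p hp _ hpR hdvd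
    rw [zero_add] at hdvd
    obtain ⟨hnp, hlt⟩ := hu n hn hun
    rcases (Nat.dvd_prime hnp).mp hdvd with h | h
    · exact hp.one_lt.ne' h
    · omega) hs
  have hlogN : 0 < Real.log N := Real.log_pos (by exact_mod_cast (by omega : 1 < N))
  have hG : Real.log N / 18 ≤ GG (fun _ => True) (rt N) := by
    have := half_log_le_GG (rt N)
    have := log_le_log_rt hN
    linarith
  have hsq : ∑ n ∈ range N, ‖u n‖ ^ 2 ≤ Real.log N * (2 * N) := by
    have h3 : ∀ n ∈ range N, ‖u n‖ ^ 2 ≤ if n.Prime then Real.log N * Real.log n else 0 := by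
      intro n hn
      rw [mem_range] at hn
      by_cases hz : u n = 0
      · rw [hz, norm_zero]
        split_ifs
        · have := Real.log_natCast_nonneg n
          rw [zero_pow two_ne_zero]
          exact mul_nonneg hlogN.le this
        · simp
      · rw [if_pos (hu n hn hz).1, sq]
        have h4 := hul n hn
        have h5 : Real.log n ≤ Real.log N :=
          Real.log_le_log (by exact_mod_cast (hu n hn hz).1.pos) (by exact_mod_cast hn.le)
        exact mul_le_mul (h4.trans h5) h4 (norm_nonneg _) hlogN.le
    refine (sum_le_sum h3).trans ?_
    rw [← sum_filter, ← mul_sum]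
    refine mul_le_mul_of_nonneg_left ?_ hlogN.le
    obtain ⟨M, rfl⟩ : ∃ M, N = M + 1 := ⟨N - 1, by omega⟩
    refine (sum_primes_log_le M).trans ?_
    push_cast
    linarith
  set T := ∑ j ∈ s, ‖∑ n ∈ range N, u n * ee (n * θ j)‖ ^ 2
  have hT : 0 ≤ T := sum_nonneg fun _ _ => by positivity
  have h3 : T * (Real.log N / 18) ≤ C * N * (s.card : ℝ) ^ (1 / 3 : ℝ) * (Real.log N * (2 * N)) :=
    (mul_le_mul_of_nonneg_left hG hT).trans (h1.trans (by gcongr))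
  have h4 : T * Real.log N ≤ (36 * C * N ^ 2 * (s.card : ℝ) ^ (1 / 3 : ℝ)) * Real.log N := by linarith
  exact le_of_mul_le_mul_right h4 hlogN

/-- The function `log p` on primes `p > rt N`. -/
noncomputable def fp (N n : ℕ) : ℂ := if n.Prime ∧ rt N < n then (Real.log n : ℂ) else 0

lemma fp_ne_zero {N n : ℕ} (h : fp N n ≠ 0) : n.Prime ∧ rt N < n := by
  by_contra hn
  exact h (if_neg hn)

lemma norm_fp_le (N n : ℕ) : ‖fp N n‖ ≤ Real.log n := by
  unfold fp
  split_ifs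
  · rw [Complex.norm_real, Real.norm_eq_abs, abs_of_nonneg (Real.log_natCast_nonneg n)]
  · rw [norm_zero]; exact Real.log_natCast_nonneg n

lemma exists_sum_nonprime_le : ∃ C : ℝ, 0 < C ∧ ∀ y : ℕ,
    ∑ n ∈ (range (y + 1)).filter (fun n => ¬ n.Prime), ArithmeticFunction.vonMangoldt n ≤ C * √y := by
  obtain ⟨C, hC⟩ := Chebyshev.psi_sub_theta_le_mul_sqrt
  refine ⟨|C| + 1, by positivity, fun y => ?_⟩
  have h1 := Chebyshev.psi_sub_theta_eq_sum_not_prime (y : ℝ)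
  have h2 := hC y
  rw [h1, Nat.floor_natCast] at h2
  have h3 : ∑ n ∈ (range (y + 1)).filter (fun n => ¬ n.Prime), ArithmeticFunction.vonMangoldt n
      = ∑ n ∈ (Ioc 0 y).filter (fun n => ¬ n.Prime), ArithmeticFunction.vonMangoldt n := by
    symm
    apply sum_subset
    · intro n; simp only [mem_filter, mem_range, mem_Ioc]; exact fun h => ⟨by omega, h.2⟩
    · intro n hn hn'
      simp only [mem_filter, mem_range, mem_Ioc] at hn hn'
      have : n = 0 := by
        by_contra h; exact hn' ⟨⟨Nat.pos_of_ne_zero h, Nat.lt_succ_iff.mp hn.1⟩, hn.2⟩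
      simp [this]
  rw [h3]
  refine h2.trans ?_
  have : 0 ≤ √(y : ℝ) := Real.sqrt_nonneg _
  nlinarith [le_abs_self C]

lemma exists_norm_sub_fp_le : ∃ C : ℝ, 0 < C ∧ ∀ (N y : ℕ) (α : ℝ), y ≤ N →
    ‖S y α - ∑ n ∈ range (y + 1), fp N n * ee (n * α)‖ ≤ C * √N := by
  obtain ⟨C, hC, hmain⟩ := exists_sum_nonprime_le
  refine ⟨C + 2, by positivity, fun N y α hyN => ?_⟩
  rw [S, ← sum_sub_distrib]
  have h1 : ∀ n ∈ range (y + 1), ‖(ArithmeticFunction.vonMangoldt n : ℂ) * ee (n * α) - fp N n * ee (n * α)‖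
      ≤ (if ¬ n.Prime then ArithmeticFunction.vonMangoldt n else 0)
        + (if n.Prime ∧ n ≤ rt N then Real.log n else 0) := by
    intro n _
    rw [← sub_mul, norm_mul, norm_ee, mul_one]
    have h0 := @ArithmeticFunction.vonMangoldt_nonneg n
    by_cases hp : n.Prime
    · rw [if_neg (not_not.mpr hp), fp, ArithmeticFunction.vonMangoldt_apply_prime hp]
      rcases lt_or_ge (rt N) n with h | h
      · simp [hp, h, not_le.mpr h]
      · simp only [hp, true_and, not_lt.mpr h, if_false, sub_zero, h, if_true, zero_add]
        rw [Complex.norm_real, Real.norm_eq_abs, abs_of_nonneg (Real.log_natCast_nonneg n)]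
    · simp only [fp, hp, false_and, if_false, not_false_eq_true, if_true, sub_zero, add_zero]
      rw [Complex.norm_real, Real.norm_eq_abs, abs_of_nonneg h0]
  refine (norm_sum_le _ _).trans ((sum_le_sum h1).trans ?_)
  rw [sum_add_distrib, ← sum_filter, ← sum_filter]
  have hrt : (rt N : ℝ) ≤ √N := by
    apply Real.le_sqrt_of_sq_le
    have h2 := two_mul_rt_pow_le N
    have h3 : rt N ^ 2 ≤ rt N ^ 4 := by
      rcases Nat.eq_zero_or_pos (rt N) with h | h
      · rw [h]; norm_num
      · exact Nat.pow_le_pow_right h (by norm_num)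
    exact_mod_cast (by omega : rt N ^ 2 ≤ N)
  have h4 : ∑ n ∈ (range (y + 1)).filter (fun n => n.Prime ∧ n ≤ rt N), Real.log n ≤ 2 * rt N := by
    refine le_trans (sum_le_sum_of_subset_of_nonneg ?_ ?_) (sum_primes_log_le (rt N))
    · intro n; simp only [mem_filter, mem_range]; intro h; exact ⟨by omega, h.2.1⟩
    · intro n _ _; exact Real.log_natCast_nonneg n
  have h5 : √(y : ℝ) ≤ √N := Real.sqrt_le_sqrt (by exact_mod_cast hyN)
  have h6 := hmain y
  nlinarith

lemma card_mul_cube_le {c t C : ℝ} (hc : 0 ≤ c)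
    (h : c * t ^ 2 ≤ C * c ^ (1 / 3 : ℝ)) : c * t ^ 3 ≤ √(C ^ 3) := by
  rcases hc.eq_or_lt with rfl | hc
  · simp
  have h1 : (c ^ (1 / 3 : ℝ)) ^ 3 = c := by
    rw [← Real.rpow_natCast, ← Real.rpow_mul hc.le]; norm_num
  have h2 : (c * t ^ 2) ^ 3 ≤ (C * c ^ (1 / 3 : ℝ)) ^ 3 := pow_le_pow_left₀ (by positivity) h 3
  rw [mul_pow C, h1] at h2
  apply Real.le_sqrt_of_sq_le
  have h3 : (c * t ^ 3) ^ 2 * c ≤ C ^ 3 * c := by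
    calc (c * t ^ 3) ^ 2 * c = (c * t ^ 2) ^ 3 := by ring
      _ ≤ _ := h2
  exact le_of_mul_le_mul_right h3 hc

/-- The number of well-spaced points where `|S|` is large is bounded polynomially in the level. -/
theorem exists_card_large_spectrum : ∃ C : ℝ, 0 < C ∧ ∀ δ : ℝ, 0 < δ → ∃ y₀ : ℕ, ∀ y ≥ y₀,
    ∀ {ι : Type} (s : Finset ι) (θ : ι → ℝ),
    (∀ j ∈ s, ∀ k ∈ s, j ≠ k → 1 / ((y : ℝ) + 1) ≤ nn (θ j - θ k)) →
    (∀ j ∈ s, δ * y ≤ ‖S y (θ j)‖) → (s.card : ℝ) * δ ^ 3 ≤ C := by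
  obtain ⟨C, hC, hmain⟩ := exists_spectrum_primes
  obtain ⟨D, hD, hS⟩ := exists_norm_sub_fp_le
  refine ⟨√((16 * C) ^ 3), by positivity, fun δ hδ => ?_⟩
  refine ⟨max 32 ⌈8 * (D / δ) ^ 2⌉₊, fun y hy ι s θ hs hlarge => ?_⟩
  have hy1 : 32 ≤ y := (le_max_left _ _).trans hy
  have hy2 : 8 * (D / δ) ^ 2 ≤ y := Nat.ceil_le.mp ((le_max_right _ _).trans hy)
  have hy1' : (32 : ℝ) ≤ y := by exact_mod_cast hy1
  apply card_mul_cube_le (by positivity)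
  have h1 := hmain s θ (y + 1) (fp (y + 1)) (by omega) (fun n _ h => fp_ne_zero h)
    (fun n _ => norm_fp_le _ n) (by push_cast; exact hs)
  have h2 : D * √((y + 1 : ℕ) : ℝ) ≤ δ / 2 * y := by
    have h3 : √((y + 1 : ℕ) : ℝ) ≤ δ / 2 * y / D := by
      apply Real.sqrt_le_iff.mpr
      refine ⟨by positivity, ?_⟩
      have h4 : (1 : ℝ) ≤ (δ / D) ^ 2 * y / 8 := by
        have e : (δ / D) ^ 2 * (8 * (D / δ) ^ 2) = 8 := by field_simp
        have : (δ / D) ^ 2 * (8 * (D / δ) ^ 2) ≤ (δ / D) ^ 2 * y := by gcongr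
        linarith
      calc (((y + 1 : ℕ) : ℝ)) ≤ 2 * y * 1 := by push_cast; linarith
        _ ≤ 2 * y * ((δ / D) ^ 2 * y / 8) := by gcongr
        _ = _ := by field_simp; ring
    calc D * √((y + 1 : ℕ) : ℝ) ≤ D * (δ / 2 * y / D) := by gcongr
      _ = _ := by field_simp
  have h3 : ∀ j ∈ s, (δ / 2 * y) ^ 2 ≤ ‖∑ n ∈ range (y + 1), fp (y + 1) n * ee (n * θ j)‖ ^ 2 := by
    intro j hj
    have h4 := hS (y + 1) y (θ j) (by omega)
    have h5 := hlarge j hj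
    have h6 := norm_sub_norm_le (S y (θ j)) (∑ n ∈ range (y + 1), fp (y + 1) n * ee (n * θ j))
    gcongr
    linarith
  have h4 := sum_le_sum h3
  rw [sum_const, nsmul_eq_mul] at h4
  have h5 : (s.card : ℝ) * (δ / 2 * y) ^ 2 ≤ C * (2 * y) ^ 2 * (s.card : ℝ) ^ (1 / 3 : ℝ) := by
    refine h4.trans (h1.trans ?_)
    push_cast
    gcongr
    linarith
  have h6 : (s.card : ℝ) * δ ^ 2 * ((y : ℝ) ^ 2 / 4) ≤ 16 * C * (s.card : ℝ) ^ (1 / 3 : ℝ) * ((y : ℝ) ^ 2 / 4) := by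
    linarith
  exact le_of_mul_le_mul_right h6 (by positivity)

/-- The Brun–Titchmarsh inequality with an unspecified sieve level. -/
theorem card_primes_le_of_sq_le (x h q c : ℕ) (hq : 0 < q) (hh : 16 ≤ h) (hqh : q ^ 2 ≤ h) :
    (((Ioc x (x + h)).filter fun p => p.Prime ∧ p ≡ c [MOD q]).card : ℝ)
      ≤ 220 * h / (q.totient * Real.log h) := by
  have h2 : 2 ≤ rt (2 * h) := two_le_rt (by omega)
  have h4 : rt (2 * h) ^ 4 ≤ h := by have := two_mul_rt_pow_le (2 * h); omega
  have h1 := card_primes_le x h q c (rt (2 * h)) hq (by omega) (by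
    apply (Nat.pow_le_pow_iff_left two_ne_zero).mp
    calc (q * rt (2 * h) ^ 2) ^ 2 = q ^ 2 * rt (2 * h) ^ 4 := by ring
      _ ≤ h * h := Nat.mul_le_mul hqh h4
      _ = h ^ 2 := by ring)
  have hlog := log_le_log_rt (N := 2 * h) (by omega)
  have hh' : (16 : ℝ) ≤ h := by exact_mod_cast hh
  have hl0 : 0 < Real.log h := Real.log_pos (by linarith)
  have hphi : (0 : ℝ) < q.totient := by exact_mod_cast Nat.totient_pos.mpr hq
  have hl1 : Real.log h ≤ 9 * Real.log (rt (2 * h)) := by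
    refine (Real.log_le_log (by linarith) ?_).trans hlog
    push_cast; linarith
  set r : ℝ := (rt (2 * h) : ℝ) with hr
  have hr2 : (2 : ℝ) ≤ r := by rw [hr]; exact_mod_cast h2
  have hr4 : r ^ 4 ≤ h := by rw [hr]; exact_mod_cast h4
  have hphi2 : (q.totient : ℝ) ^ 2 ≤ h := by
    have : q.totient ^ 2 ≤ h := (Nat.pow_le_pow_left (Nat.totient_le q) 2).trans hqh
    exact_mod_cast this
  have hlogh : Real.log h ≤ 4 * (h : ℝ) ^ (1 / 4 : ℝ) := by
    have := Real.log_le_rpow_div (x := h) (by linarith) (ε := 1 / 4) (by norm_num)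
    linarith
  set w : ℝ := (h : ℝ) ^ (1 / 4 : ℝ) with hw
  have hw4 : w ^ 4 = h := by
    rw [hw, ← Real.rpow_natCast, ← Real.rpow_mul (by linarith)]; norm_num
  have hw0 : 0 ≤ w := by positivity
  have hrw : r ≤ w := le_of_pow_le_pow_left₀ (n := 4) (by norm_num) hw0 (hr4.trans hw4.ge)
  have hpw : (q.totient : ℝ) ≤ w ^ 2 :=
    le_of_pow_le_pow_left₀ (n := 2) (by norm_num) (by positivity) (by rw [← pow_mul, hw4]; exact hphi2)
  have e1 : r ≤ 4 * h / (q.totient * Real.log h) := by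
    rw [le_div_iff₀ (by positivity)]
    calc r * (q.totient * Real.log h) ≤ w * (w ^ 2 * (4 * w)) := by gcongr
      _ = 4 * w ^ 4 := by ring
      _ = 4 * h := by rw [hw4]
  have e2 : 24 * h / (q.totient * Real.log r) ≤ 216 * h / (q.totient * Real.log h) := by
    have : 0 < Real.log r := Real.log_pos (by linarith)
    rw [div_le_div_iff₀ (by positivity) (by positivity)]
    calc 24 * (h : ℝ) * (q.totient * Real.log h) ≤ 24 * h * (q.totient * (9 * Real.log r)) := by gcongr
      _ = _ := by ring
  calc _ ≤ r + 24 * h / (q.totient * Real.log r) := h1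
    _ ≤ 4 * h / (q.totient * Real.log h) + 216 * h / (q.totient * Real.log h) := add_le_add e1 e2
    _ = _ := by ring

/-- Chebyshev-type upper bound in short intervals. -/
theorem exists_sum_vonMangoldt_Ioc_le : ∃ C : ℝ, 0 < C ∧ ∀ η : ℝ, 0 < η → ∃ y₀ : ℕ, ∀ y ≥ y₀, ∀ x : ℕ,
    (y : ℝ) - x ≤ η * y → ∑ n ∈ Ioc x y, ArithmeticFunction.vonMangoldt n ≤ C * η * y := by
  obtain ⟨D, hD, hnp⟩ := exists_sum_nonprime_le
  refine ⟨881, by norm_num, fun η hη => ?_⟩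
  refine ⟨max 2 (max ⌈16 / η⌉₊ (max ⌈(1 / η) ^ 2⌉₊ ⌈(D / η) ^ 2⌉₊)), fun y hy x hxy => ?_⟩
  have hy1 : 2 ≤ y := (le_max_left _ _).trans hy
  have hy' := (le_max_right _ _).trans hy
  have hy2 : 16 / η ≤ y := Nat.ceil_le.mp ((le_max_left _ _).trans hy')
  have hy'' := (le_max_right _ _).trans hy'
  have hy3 : (1 / η) ^ 2 ≤ y := Nat.ceil_le.mp ((le_max_left _ _).trans hy'')
  have hy4 : (D / η) ^ 2 ≤ y := Nat.ceil_le.mp ((le_max_right _ _).trans hy'')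
  have hy0 : (2 : ℝ) ≤ y := by exact_mod_cast hy1
  set h : ℕ := ⌈η * y⌉₊ with hh
  have h1 : η * y ≤ h := Nat.le_ceil _
  have h2 : (h : ℝ) < η * y + 1 := Nat.ceil_lt_add_one (by positivity)
  have h3 : 16 ≤ η * y := by rw [div_le_iff₀ hη] at hy2; linarith
  have h16 : 16 ≤ h := by
    have : (16 : ℝ) ≤ h := h3.trans h1
    exact_mod_cast this
  have hl0 : 0 < Real.log y := Real.log_pos (by linarith)
  have hsq : √(y : ℝ) * √y = y := Real.mul_self_sqrt (by linarith)
  have hs0 : 0 < √(y : ℝ) := Real.sqrt_pos.mpr (by linarith)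
  have h4 : √(y : ℝ) ≤ η * y := by
    have : 1 / η ≤ √y := Real.le_sqrt_of_sq_le hy3
    rw [div_le_iff₀ hη] at this
    nlinarith
  have h5 : D * √(y : ℝ) ≤ η * y := by
    have : D / η ≤ √y := Real.le_sqrt_of_sq_le hy4
    rw [div_le_iff₀ hη] at this
    nlinarith
  have hlog : Real.log y ≤ 2 * Real.log h := by
    have : Real.log (√y) ≤ Real.log h := Real.log_le_log hs0 (h4.trans h1)
    rw [Real.log_sqrt (by linarith)] at this
    linarith
  have hsub : y ≤ x + h := by
    have : (y : ℝ) ≤ x + h := by linarith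
    exact_mod_cast this
  have hbt := card_primes_le_of_sq_le x h 1 0 one_pos h16 (by omega)
  rw [Nat.totient_one, Nat.cast_one, one_mul] at hbt
  have hlh : 0 < Real.log h := by linarith
  rw [le_div_iff₀ hlh] at hbt
  rw [← sum_filter_add_sum_filter_not _ Nat.Prime]
  have hA : ∑ n ∈ (Ioc x y).filter Nat.Prime, ArithmeticFunction.vonMangoldt n ≤ 880 * η * y := by
    have e1 : ∀ n ∈ (Ioc x y).filter Nat.Prime, ArithmeticFunction.vonMangoldt n ≤ 2 * Real.log h := by
      intro n hn
      simp only [mem_filter, mem_Ioc] at hn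
      refine ArithmeticFunction.vonMangoldt_le_log.trans (le_trans ?_ hlog)
      exact Real.log_le_log (by exact_mod_cast hn.2.pos) (by exact_mod_cast hn.1.2)
    refine (sum_le_card_nsmul _ _ _ e1).trans ?_
    rw [nsmul_eq_mul]
    have e2 : (((Ioc x y).filter Nat.Prime).card : ℝ) ≤
        (((Ioc x (x + h)).filter fun p => p.Prime ∧ p ≡ 0 [MOD 1]).card : ℝ) := by
      have : ((Ioc x y).filter Nat.Prime) ⊆ ((Ioc x (x + h)).filter fun p => p.Prime ∧ p ≡ 0 [MOD 1]) := by
        intro p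
        simp only [mem_filter, mem_Ioc]
        exact fun hp => ⟨⟨hp.1.1, by omega⟩, hp.2, Nat.modEq_one⟩
      exact_mod_cast card_le_card this
    nlinarith
  have hB : ∑ n ∈ (Ioc x y).filter (fun n => ¬ n.Prime), ArithmeticFunction.vonMangoldt n ≤ η * y := by
    refine le_trans (sum_le_sum_of_subset_of_nonneg ?_ ?_) ((hnp y).trans h5)
    · intro n; simp only [mem_filter, mem_Ioc, mem_range]; exact fun hn => ⟨by omega, hn.2⟩
    · intro n _ _; exact ArithmeticFunction.vonMangoldt_nonneg
  linarith

lemma sum_log_eq_log_factorial (x : ℕ) : ∑ n ∈ Ioc 0 x, Real.log n = Real.log x.factorial := by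
  induction x with
  | zero => simp
  | succ n ih =>
    rw [sum_Ioc_succ_top (Nat.zero_le n), ih, Nat.factorial_succ, Nat.cast_mul, Real.log_mul]
    · ring
    · positivity
    · exact_mod_cast n.factorial_ne_zero

open ArithmeticFunction in
lemma sum_vonMangoldt_mul_div (x : ℕ) :
    ∑ k ∈ Ioc 0 x, vonMangoldt k * ((x / k : ℕ) : ℝ) = Real.log x.factorial := by
  rw [← sum_log_eq_log_factorial, ← sum_Ioc_mul_zeta_eq_sum, vonMangoldt_mul_zeta]
  rfl

/-- Mertens' first theorem, upper bound. -/
lemma sum_vonMangoldt_div_le {x : ℕ} (hx : 0 < x) :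
    ∑ k ∈ Ioc 0 x, ArithmeticFunction.vonMangoldt k / k ≤ Real.log x + 6 := by
  have hx' : (0 : ℝ) < x := by exact_mod_cast hx
  have h1 := sum_vonMangoldt_mul_div x
  have h2 : Real.log x.factorial ≤ x * Real.log x := by
    rw [← Real.log_pow]
    exact Real.log_le_log (by positivity) (by exact_mod_cast Nat.factorial_le_pow x)
  have h3 : ∀ k ∈ Ioc 0 x, ArithmeticFunction.vonMangoldt k / k * x ≤
      ArithmeticFunction.vonMangoldt k * ((x / k : ℕ) : ℝ) + ArithmeticFunction.vonMangoldt k := by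
    intro k hk
    have h4 : (x : ℝ) / k ≤ ((x / k : ℕ) : ℝ) + 1 := by
      rw [← Nat.floor_div_eq_div (K := ℝ)]; exact (Nat.lt_floor_add_one _).le
    have h0 := @ArithmeticFunction.vonMangoldt_nonneg k
    calc ArithmeticFunction.vonMangoldt k / k * x = ArithmeticFunction.vonMangoldt k * (x / k) := by ring
      _ ≤ ArithmeticFunction.vonMangoldt k * (((x / k : ℕ) : ℝ) + 1) := by gcongr
      _ = _ := by ring
  have h5 := sum_le_sum h3
  rw [← sum_mul, sum_add_distrib, h1] at h5
  have h6 : ∑ k ∈ Ioc 0 x, ArithmeticFunction.vonMangoldt k ≤ 6 * x := by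
    refine le_trans (sum_le_sum_of_subset_of_nonneg ?_ ?_) (sum_vonMangoldt_le x)
    · intro n; simp only [mem_Ioc, mem_range]; omega
    · intro n _ _; exact ArithmeticFunction.vonMangoldt_nonneg
  have h7 : (∑ k ∈ Ioc 0 x, ArithmeticFunction.vonMangoldt k / k) * x ≤ (Real.log x + 6) * x := by linarith
  refine le_of_mul_le_mul_right ?_ hx'
  exact h7

/-- Mertens' first theorem, lower bound. -/
lemma le_sum_vonMangoldt_div {x : ℕ} (hx : 0 < x) :
    Real.log x - 1 ≤ ∑ k ∈ Ioc 0 x, ArithmeticFunction.vonMangoldt k / k := by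
  have hx' : (0 : ℝ) < x := by exact_mod_cast hx
  have h1 := sum_vonMangoldt_mul_div x
  have h2 := Stirling.le_log_factorial_stirling hx.ne'
  have h3 : ∀ k ∈ Ioc 0 x, ArithmeticFunction.vonMangoldt k * ((x / k : ℕ) : ℝ) ≤
      ArithmeticFunction.vonMangoldt k / k * x := by
    intro k hk
    have h0 := @ArithmeticFunction.vonMangoldt_nonneg k
    calc ArithmeticFunction.vonMangoldt k * ((x / k : ℕ) : ℝ)
        ≤ ArithmeticFunction.vonMangoldt k * ((x : ℝ) / k) := by gcongr; exact Nat.cast_div_le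
      _ = _ := by ring
  have h5 := sum_le_sum h3
  rw [← sum_mul, h1] at h5
  have h6 : 0 ≤ Real.log x := Real.log_natCast_nonneg x
  have h7 : 0 ≤ Real.log (2 * Real.pi) := Real.log_nonneg (by nlinarith [Real.two_le_pi])
  have h8 : (Real.log x - 1) * x ≤ (∑ k ∈ Ioc 0 x, ArithmeticFunction.vonMangoldt k / k) * x := by linarith
  exact le_of_mul_le_mul_right h8 hx'

open ArithmeticFunction in
lemma pmul_log_mul (f g : ArithmeticFunction ℝ) :
    pmul log (f * g) = pmul log f * g + f * pmul log g := by
  ext n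
  rcases Nat.eq_zero_or_pos n with rfl | hn
  · simp
  rw [pmul_apply, ArithmeticFunction.add_apply, mul_apply, mul_apply, mul_apply, mul_sum, ← sum_add_distrib]
  refine sum_congr rfl fun x hx => ?_
  have h := Nat.mem_divisorsAntidiagonal.mp hx
  have h1 : x.1 ≠ 0 := fun h0 => h.2 (by rw [← h.1, h0, zero_mul])
  have h2 : x.2 ≠ 0 := fun h0 => h.2 (by rw [← h.1, h0, mul_zero])
  rw [pmul_apply, pmul_apply, log_apply, log_apply, log_apply, ← h.1, Nat.cast_mul,
    Real.log_mul (by exact_mod_cast h1) (by exact_mod_cast h2)]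
  ring

open ArithmeticFunction in
/-- Selberg's identity `Λ log + Λ * Λ = μ * log²`. -/
lemma selberg_identity : pmul log vonMangoldt + vonMangoldt * vonMangoldt =
    (moebius : ArithmeticFunction ℝ) * pmul log log := by
  have h1 : pmul log log = (pmul log vonMangoldt + vonMangoldt * vonMangoldt) * (zeta : ArithmeticFunction ℝ) := by
    conv_lhs => rw [← vonMangoldt_mul_zeta]
    have h2 : pmul (vonMangoldt * (zeta : ArithmeticFunction ℝ)) (vonMangoldt * (zeta : ArithmeticFunction ℝ))
      = pmul log (vonMangoldt * (zeta : ArithmeticFunction ℝ)) := by rw [vonMangoldt_mul_zeta]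
    have h3 : pmul log (zeta : ArithmeticFunction ℝ) = log := by
      rw [pmul_comm]
      exact zeta_pmul log
    rw [h2, pmul_log_mul, h3, add_mul, mul_assoc, vonMangoldt_mul_zeta]
  rw [h1, mul_comm (moebius : ArithmeticFunction ℝ), mul_assoc, coe_zeta_mul_coe_moebius, mul_one]

open ArithmeticFunction in
lemma sum_mul_twist (f g : ArithmeticFunction ℝ) (w : ℕ → ℂ) (N : ℕ) :
    ∑ n ∈ Ioc 0 N, ((f * g) n : ℂ) * w n =
      ∑ d ∈ Ioc 0 N, (f d : ℂ) * ∑ m ∈ Ioc 0 (N / d), (g m : ℂ) * w (d * m) := by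
  have h1 : ∀ n ∈ Ioc 0 N, ((f * g) n : ℂ) * w n =
      ∑ x ∈ Ioc 0 N ×ˢ Ioc 0 N with x.1 * x.2 = n, (f x.1 : ℂ) * (g x.2 * w (x.1 * x.2)) := by
    intro n hn
    rw [mem_Ioc] at hn
    rw [mul_apply, Nat.divisorsAntidiagonal_eq_prod_filter_of_le hn.1.ne' hn.2, Complex.ofReal_sum, sum_mul]
    refine sum_congr rfl fun x hx => ?_
    rw [(mem_filter.mp hx).2]
    push_cast
    ring
  rw [sum_congr rfl h1]
  simp_rw [sum_filter]
  rw [sum_comm, sum_product]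
  refine sum_congr rfl fun d hd => ?_
  rw [mem_Ioc] at hd
  rw [mul_sum]
  have h2 : ∀ m ∈ Ioc 0 N, (∑ n ∈ Ioc 0 N, if d * m = n then (f d : ℂ) * (g m * w (d * m)) else 0) =
      if m ≤ N / d then (f d : ℂ) * (g m * w (d * m)) else 0 := by
    intro m hm
    rw [mem_Ioc] at hm
    rw [sum_ite_eq]
    have : d * m ∈ Ioc 0 N ↔ m ≤ N / d := by
      rw [mem_Ioc, Nat.le_div_iff_mul_le hd.1, mul_comm]
      exact ⟨fun h => h.2, fun h => ⟨Nat.mul_pos hm.1 hd.1, h⟩⟩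
    simp only [this]
  rw [sum_congr rfl h2, ← sum_filter]
  refine sum_congr ?_ fun _ _ => rfl
  ext m
  simp only [mem_filter, mem_Ioc]
  exact ⟨fun h => ⟨h.1.1, h.2⟩, fun h => ⟨⟨h.1, h.2.trans (Nat.div_le_self _ _)⟩, h.2⟩⟩

lemma sum_range_succ_eq_Ioc {M : Type*} [AddCommMonoid M] (f : ℕ → M) (h : f 0 = 0) (y : ℕ) :
    ∑ n ∈ range (y + 1), f n = ∑ n ∈ Ioc 0 y, f n := by
  rw [sum_range_succ', h, add_zero, range_eq_Ico, sum_Ico_add' f 0 y 1]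
  rfl

lemma S_eq_Ioc (y : ℕ) (α : ℝ) :
    S y α = ∑ n ∈ Ioc 0 y, (ArithmeticFunction.vonMangoldt n : ℂ) * ee (n * α) :=
  sum_range_succ_eq_Ioc _ (by simp) y

lemma sum_vonMangoldt_mul_log_le (N : ℕ) :
    ∑ n ∈ Ioc 0 N, ArithmeticFunction.vonMangoldt n * (Real.log N - Real.log n) ≤ 6 * N := by
  have h1 : ∀ n ∈ Ioc 0 N, ArithmeticFunction.vonMangoldt n * (Real.log N - Real.log n) ≤
      ∑ m ∈ Ioc 0 N, if n ≤ m then ArithmeticFunction.vonMangoldt n * (1 / (m : ℝ)) else 0 := by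
    intro n hn
    rw [mem_Ioc] at hn
    rw [← sum_filter, ← mul_sum]
    refine mul_le_mul_of_nonneg_left ?_ ArithmeticFunction.vonMangoldt_nonneg
    rw [← sum_Ico_sub (fun m : ℕ => Real.log m) hn.2]
    calc ∑ m ∈ Ico n N, (Real.log ((m + 1 : ℕ) : ℝ) - Real.log m) ≤ ∑ m ∈ Ico n N, 1 / (m : ℝ) := by
          refine sum_le_sum fun m hm => ?_
          rw [mem_Ico] at hm
          have hm0 : (0 : ℝ) < m := by exact_mod_cast (by omega : 0 < m)
          rw [← Real.log_div (by positivity) hm0.ne']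
          refine (Real.log_le_sub_one_of_pos (by positivity)).trans (le_of_eq ?_)
          push_cast
          field_simp
          ring
      _ ≤ _ := by
          refine sum_le_sum_of_subset_of_nonneg ?_ (fun _ _ _ => by positivity)
          intro m
          simp only [mem_Ico, mem_filter, mem_Ioc]
          omega
  refine (sum_le_sum h1).trans ?_
  rw [sum_comm]
  have h2 : ∀ m ∈ Ioc 0 N, (∑ n ∈ Ioc 0 N, if n ≤ m then ArithmeticFunction.vonMangoldt n * (1 / (m : ℝ)) else 0)
      ≤ 6 := by
    intro m hm
    rw [mem_Ioc] at hm
    have hm0 : (0 : ℝ) < m := by exact_mod_cast hm.1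
    rw [← sum_filter, ← sum_mul, mul_one_div, div_le_iff₀ hm0]
    refine le_trans (sum_le_sum_of_subset_of_nonneg ?_ ?_) (sum_vonMangoldt_le m)
    · intro n; simp only [mem_filter, mem_Ioc, mem_range]; omega
    · intro n _ _; exact ArithmeticFunction.vonMangoldt_nonneg
  refine (sum_le_card_nsmul _ _ _ h2).trans (le_of_eq ?_)
  rw [Nat.card_Ioc, nsmul_eq_mul, Nat.sub_zero, mul_comm]

/-- The type I sum `∑_d μ(d) ∑_m log² m e(dmα)` attached to Selberg's identity. -/
noncomputable def typeI (N : ℕ) (α : ℝ) : ℂ :=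
  ∑ d ∈ Ioc 0 N, (ArithmeticFunction.moebius d : ℂ) *
    ∑ m ∈ Ioc 0 (N / d), ((Real.log m ^ 2 : ℝ) : ℂ) * ee (m * (d * α))

open ArithmeticFunction in
theorem norm_selberg_le (N : ℕ) (α : ℝ) :
    ‖S N α * Real.log N + ∑ k ∈ Ioc 0 N, (vonMangoldt k : ℂ) * S (N / k) (k * α) - typeI N α‖ ≤ 6 * N := by
  have h1 : typeI N α = ∑ n ∈ Ioc 0 N, ((vonMangoldt n * Real.log n : ℝ) : ℂ) * ee (n * α)
      + ∑ k ∈ Ioc 0 N, (vonMangoldt k : ℂ) * S (N / k) (k * α) := by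
    have h2 := sum_mul_twist (moebius : ArithmeticFunction ℝ) (pmul log log) (fun n => ee (n * α)) N
    have h3 := sum_mul_twist vonMangoldt vonMangoldt (fun n => ee (n * α)) N
    have h4 : typeI N α = ∑ n ∈ Ioc 0 N, ((((moebius : ArithmeticFunction ℝ) * pmul log log) n : ℝ) : ℂ) * ee (n * α) := by
      rw [h2, typeI]
      refine sum_congr rfl fun d _ => ?_
      have h6 : ∀ m ∈ Ioc 0 (N / d), ((Real.log m ^ 2 : ℝ) : ℂ) * ee (m * (d * α)) =
          ((pmul log log) m : ℂ) * ee ((d * m : ℕ) * α) := by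
        intro m _
        rw [pmul_apply, log_apply, ← sq]
        congr 2
        push_cast; ring
      rw [sum_congr rfl h6, intCoe_apply, Complex.ofReal_intCast]
    have h5 : ∑ k ∈ Ioc 0 N, (vonMangoldt k : ℂ) * S (N / k) (k * α) =
        ∑ n ∈ Ioc 0 N, (((vonMangoldt * vonMangoldt) n : ℝ) : ℂ) * ee (n * α) := by
      rw [h3]
      refine sum_congr rfl fun d _ => ?_
      rw [S_eq_Ioc]
      congr 1
      refine sum_congr rfl fun m _ => ?_
      congr 2
      push_cast; ring
    rw [h4, h5, ← selberg_identity, ← sum_add_distrib]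
    refine sum_congr rfl fun n _ => ?_
    rw [ArithmeticFunction.add_apply, pmul_apply, log_apply]
    push_cast; ring
  rw [h1, add_sub_add_right_eq_sub, S_eq_Ioc, sum_mul, ← sum_sub_distrib]
  refine (norm_sum_le _ _).trans (le_trans (sum_le_sum fun n hn => ?_) (sum_vonMangoldt_mul_log_le N))
  rw [mem_Ioc] at hn
  have h6 : (vonMangoldt n : ℂ) * ee (n * α) * Real.log N - ((vonMangoldt n * Real.log n : ℝ) : ℂ) * ee (n * α)
      = ((vonMangoldt n * (Real.log N - Real.log n) : ℝ) : ℂ) * ee (n * α) := by push_cast; ring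
  rw [h6, norm_mul, norm_ee, mul_one, Complex.norm_real, Real.norm_eq_abs, abs_of_nonneg]
  refine mul_nonneg vonMangoldt_nonneg (sub_nonneg.mpr ?_)
  exact Real.log_le_log (by exact_mod_cast hn.1) (by exact_mod_cast hn.2)

/-- Abel summation bound. -/
lemma norm_sum_mul_le_abel (g : ℕ → ℝ) (z : ℕ → ℂ) (n : ℕ) {A : ℝ}
    (hA : ∀ k ≤ n, ‖∑ i ∈ range k, z i‖ ≤ A) :
    ‖∑ i ∈ range n, (g i : ℂ) * z i‖ ≤ A * (|g n| + ∑ i ∈ range n, |g (i + 1) - g i|) := by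
  have hA0 : 0 ≤ A := (norm_nonneg _).trans (hA 0 (Nat.zero_le n))
  have h1 : ∀ n, ∑ i ∈ range n, (g i : ℂ) * z i = (g n : ℂ) * ∑ i ∈ range n, z i -
      ∑ i ∈ range n, ((g (i + 1) - g i : ℝ) : ℂ) * ∑ j ∈ range (i + 1), z j := by
    intro n
    induction n with
    | zero => simp
    | succ n ih =>
      rw [sum_range_succ, ih, sum_range_succ (fun i => ((g (i + 1) - g i : ℝ) : ℂ) * ∑ j ∈ range (i + 1), z j),
        sum_range_succ z]
      push_cast
      ring
  rw [h1, mul_add]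
  refine (norm_sub_le _ _).trans (add_le_add ?_ ((norm_sum_le _ _).trans ?_))
  · rw [norm_mul, Complex.norm_real, Real.norm_eq_abs, mul_comm]
    exact mul_le_mul_of_nonneg_right (hA n le_rfl) (abs_nonneg _)
  · rw [mul_sum]
    refine sum_le_sum fun i hi => ?_
    rw [norm_mul, Complex.norm_real, Real.norm_eq_abs, mul_comm]
    rw [mem_range] at hi
    exact mul_le_mul_of_nonneg_right (hA _ (by omega)) (abs_nonneg _)

/-- The deviation of the counting function of integers coprime to `q` from its mean. -/
lemma abs_card_coprime_sub_le {q : ℕ} (hq : 0 < q) (y : ℕ) :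
    |(((Ioc 0 y).filter (q.Coprime ·)).card : ℝ) - q.totient / q * y| ≤ q := by
  have hq' : (0 : ℝ) < q := by exact_mod_cast hq
  induction y using Nat.strong_induction_on with
  | _ y ih =>
    rcases lt_or_ge y q with h | h
    · have h1 : ((Ioc 0 y).filter (q.Coprime ·)).card ≤ y := by
        refine (card_filter_le _ _).trans ?_
        simp
      have h1' : (((Ioc 0 y).filter (q.Coprime ·)).card : ℝ) ≤ y := by exact_mod_cast h1
      have h2 : (q.totient : ℝ) / q ≤ 1 := by
        rw [div_le_one hq']; exact_mod_cast Nat.totient_le q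
      have h3 : (y : ℝ) ≤ q := by exact_mod_cast h.le
      have h4 : (q.totient : ℝ) / q * y ≤ y := by nlinarith [(Nat.cast_nonneg y : (0 : ℝ) ≤ y)]
      have h5 : 0 ≤ (q.totient : ℝ) / q * y := by positivity
      rw [abs_le]
      constructor <;> linarith [(Nat.cast_nonneg ((Ioc 0 y).filter (q.Coprime ·)).card : (0 : ℝ) ≤ _)]
    · have h1 : ((Ioc 0 y).filter (q.Coprime ·)).card =
          ((Ioc 0 (y - q)).filter (q.Coprime ·)).card + q.totient := by
        rw [← Nat.filter_coprime_Ico_eq_totient q (y - q + 1)]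
        rw [← Ioc_union_Ioc_eq_Ioc (Nat.zero_le (y - q)) (Nat.sub_le y q), filter_union,
          card_union_of_disjoint]
        · congr 2
          ext n; simp only [mem_filter, mem_Ioc, mem_Ico]
          have : (y - q < n ∧ n ≤ y) ↔ (y - q + 1 ≤ n ∧ n < y - q + 1 + q) := by omega
          rw [this]
        · apply disjoint_filter_filter
          exact Ioc_disjoint_Ioc_of_le le_rfl
      have h2 := ih (y - q) (by omega)
      rw [h1]
      rw [Nat.cast_sub h] at h2
      push_cast
      have h3 : (q.totient : ℝ) / q * (y - q) = q.totient / q * y - q.totient := by field_simp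
      rw [h3] at h2
      convert h2 using 2
      ring

lemma one_div_le_log_sub {k : ℕ} (hk : 0 < k) : 1 / ((k : ℝ) + 1) ≤ Real.log (k + 1) - Real.log k := by
  have hk' : (0 : ℝ) < k := by exact_mod_cast hk
  have h := Real.log_le_sub_one_of_pos (x := k / (k + 1)) (by positivity)
  rw [Real.log_div (by positivity) (by positivity)] at h
  have : (k : ℝ) / (k + 1) - 1 = -(1 / (k + 1)) := by field_simp; ring
  linarith

lemma log_sub_le_one_div {k : ℕ} (hk : 0 < k) : Real.log (k + 1) - Real.log k ≤ 1 / (k : ℝ) := by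
  have hk' : (0 : ℝ) < k := by exact_mod_cast hk
  have h := Real.log_le_sub_one_of_pos (x := (k + 1) / k) (by positivity)
  rw [Real.log_div (by positivity) (by positivity)] at h
  have : ((k : ℝ) + 1) / k - 1 = 1 / k := by field_simp; ring
  linarith

lemma sum_Ioc_one_div_le {a b : ℕ} (ha : 0 < a) (hab : a ≤ b) :
    ∑ d ∈ Ioc a b, 1 / (d : ℝ) ≤ Real.log b - Real.log a := by
  induction b, hab using Nat.le_induction with
  | base => simp
  | succ b hb ih =>
    rw [sum_Ioc_succ_top hb]
    have := one_div_le_log_sub (k := b) (by omega)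
    push_cast
    linarith

lemma le_sum_Ioc_one_div {a b : ℕ} (ha : 0 < a) (hab : a ≤ b) :
    Real.log b - Real.log a - 1 / a ≤ ∑ d ∈ Ioc a b, 1 / (d : ℝ) := by
  have ha' : (0 : ℝ) < a := by exact_mod_cast ha
  have h : Real.log b - Real.log a - (1 / a - 1 / b) ≤ ∑ d ∈ Ioc a b, 1 / (d : ℝ) := by
    induction b, hab using Nat.le_induction with
    | base => simp
    | succ b hb ih =>
      rw [sum_Ioc_succ_top hb]
      have := log_sub_le_one_div (k := b) (by omega)
      push_cast
      linarith
  have : 0 ≤ 1 / (b : ℝ) := by positivity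
  linarith

/-- The indicator function of coprimality to `q`. -/
noncomputable def chi (q k : ℕ) : ℝ := if q.Coprime k then 1 else 0

lemma chi_nonneg (q k : ℕ) : 0 ≤ chi q k := by unfold chi; split_ifs <;> norm_num

lemma chi_le_one (q k : ℕ) : chi q k ≤ 1 := by unfold chi; split_ifs <;> norm_num

lemma sum_chi (q y : ℕ) : ∑ k ∈ Ioc 0 y, chi q k = ((Ioc 0 y).filter (q.Coprime ·)).card := by
  unfold chi
  rw [← sum_filter, sum_const, nsmul_eq_mul, mul_one]

/-- The harmonic sum over integers coprime to `q`. -/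
noncomputable def chiHarm (q y : ℕ) : ℝ := ∑ k ∈ Ioc 0 y, chi q k / k

lemma abs_sum_Ioc_chi_sub_div_le {q : ℕ} (hq : 0 < q) {y n : ℕ} (hy : 0 < y) (hyn : y ≤ n) :
    |∑ k ∈ Ioc y n, (chi q k - q.totient / q) / k| ≤ 3 * q / y := by
  have hy' : (0 : ℝ) < y := by exact_mod_cast hy
  set ρ : ℝ := q.totient / q
  set D : ℕ → ℝ := fun m => ∑ k ∈ Ioc 0 m, (chi q k - ρ) with hD
  have hDle : ∀ m, |D m| ≤ q := by
    intro m
    have := abs_card_coprime_sub_le hq m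
    rw [hD]
    simp only [sum_sub_distrib, sum_chi, sum_const, Nat.card_Ioc, nsmul_eq_mul, Nat.sub_zero]
    rwa [mul_comm (m : ℝ)]
  have h : |∑ k ∈ Ioc y n, (chi q k - ρ) / k - D n / n| ≤ q / y + q * (1 / y - 1 / n) := by
    induction n, hyn using Nat.le_induction with
    | base =>
      simp only [Ioc_self, sum_empty, zero_sub, abs_neg, sub_self, mul_zero, add_zero]
      rw [abs_div, abs_of_pos hy']
      gcongr
      exact hDle y
    | succ n hn ih =>
      have hn' : (0 : ℝ) < n := by exact_mod_cast (by omega : 0 < n)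
      rw [sum_Ioc_succ_top hn]
      have e1 : D (n + 1) = D n + (chi q (n + 1) - ρ) := by
        rw [hD]; simp only; rw [sum_Ioc_succ_top (Nat.zero_le n)]
      have e2 : ∑ k ∈ Ioc y n, (chi q k - ρ) / k + (chi q (n + 1) - ρ) / ((n + 1 : ℕ) : ℝ) - D (n + 1) / ((n + 1 : ℕ) : ℝ)
          = (∑ k ∈ Ioc y n, (chi q k - ρ) / k - D n / n) + D n * (1 / n - 1 / ((n + 1 : ℕ) : ℝ)) := by
        rw [e1]; ring
      rw [e2]
      refine (abs_add_le _ _).trans ?_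
      have e3 : 0 ≤ 1 / (n : ℝ) - 1 / ((n + 1 : ℕ) : ℝ) := by
        rw [sub_nonneg]
        apply one_div_le_one_div_of_le hn'
        push_cast; linarith
      have e4 : |D n * (1 / n - 1 / ((n + 1 : ℕ) : ℝ))| ≤ q * (1 / n - 1 / ((n + 1 : ℕ) : ℝ)) := by
        rw [abs_mul, abs_of_nonneg e3]
        exact mul_le_mul_of_nonneg_right (hDle n) e3
      linarith
  have hn' : (0 : ℝ) < n := by exact_mod_cast (by omega : 0 < n)
  have h2 : |D n / n| ≤ q / y := by
    rw [abs_div, abs_of_pos hn']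
    have : (y : ℝ) ≤ n := by exact_mod_cast hyn
    exact div_le_div₀ (by positivity) (hDle n) hy' this
  have h3 := abs_add_le (∑ k ∈ Ioc y n, (chi q k - ρ) / k - D n / n) (D n / n)
  rw [sub_add_cancel] at h3
  have h4 : (q : ℝ) * (1 / y - 1 / n) ≤ q / y := by
    have : 0 ≤ (q : ℝ) * (1 / n) := by positivity
    have e : (q : ℝ) / y = q * (1 / y) := by ring
    rw [e]; nlinarith
  have h5 : 3 * (q : ℝ) / y = q / y + q / y + q / y := by ring
  linarith

lemma abs_chiHarm_sub_le {q : ℕ} (hq : 0 < q) {y n : ℕ} (hy : 0 < y) (hyn : y ≤ n) :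
    |chiHarm q y - q.totient / q * Real.log y - (chiHarm q n - q.totient / q * Real.log n)| ≤ 4 * q / y := by
  have hq1 : (1 : ℝ) ≤ q := by exact_mod_cast hq
  have hy' : (0 : ℝ) < y := by exact_mod_cast hy
  have h1 := abs_sum_Ioc_chi_sub_div_le hq hy hyn
  set ρ : ℝ := q.totient / q with hρ
  have hρ0 : 0 ≤ ρ := by positivity
  have hρ1 : ρ ≤ 1 := by
    rw [hρ, div_le_one (by linarith)]; exact_mod_cast Nat.totient_le q
  have h2 : chiHarm q n = chiHarm q y + ∑ k ∈ Ioc y n, chi q k / k := by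
    unfold chiHarm
    rw [sum_Ioc_consecutive _ (Nat.zero_le y) hyn]
  have h3 : ∑ k ∈ Ioc y n, (chi q k - ρ) / k = ∑ k ∈ Ioc y n, chi q k / k - ρ * ∑ k ∈ Ioc y n, 1 / (k : ℝ) := by
    rw [mul_sum, ← sum_sub_distrib]
    exact sum_congr rfl fun k _ => by ring
  rw [h3] at h1
  have h4 := sum_Ioc_one_div_le hy hyn
  have h5 := le_sum_Ioc_one_div hy hyn
  set T := ∑ k ∈ Ioc y n, 1 / (k : ℝ)
  have h6 : |ρ * T - ρ * (Real.log n - Real.log y)| ≤ 1 / y := by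
    rw [← mul_sub, abs_mul, abs_of_nonneg hρ0]
    have : |T - (Real.log n - Real.log y)| ≤ 1 / y := by
      rw [abs_le]; constructor
      · linarith
      · have : 0 ≤ 1 / (y : ℝ) := by positivity
        linarith
    nlinarith [abs_nonneg (T - (Real.log n - Real.log y))]
  have h7 : (1 : ℝ) / y ≤ q / y := by gcongr
  rw [h2]
  have h8 : chiHarm q y - ρ * Real.log y - (chiHarm q y + ∑ k ∈ Ioc y n, chi q k / k - ρ * Real.log n)
      = -((∑ k ∈ Ioc y n, chi q k / k - ρ * T) + (ρ * T - ρ * (Real.log n - Real.log y))) := by ring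
  rw [h8, abs_neg]
  refine (abs_add_le _ _).trans ?_
  have h9 : 4 * (q : ℝ) / y = 3 * q / y + q / y := by ring
  linarith

/-- The Möbius function restricted to integers coprime to `q`. -/
noncomputable def mu (q e : ℕ) : ℝ := chi q e * ArithmeticFunction.moebius e

lemma abs_mu_le (q e : ℕ) : |mu q e| ≤ 1 := by
  unfold mu
  rw [abs_mul, abs_of_nonneg (chi_nonneg q e)]
  have h1 : |((ArithmeticFunction.moebius e : ℤ) : ℝ)| ≤ 1 := by
    exact_mod_cast @ArithmeticFunction.abs_moebius_le_one e
  exact mul_le_one₀ (chi_le_one q e) (abs_nonneg _) h1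

lemma chi_mul (q a b : ℕ) : chi q (a * b) = chi q a * chi q b := by
  unfold chi
  by_cases ha : q.Coprime a
  · by_cases hb : q.Coprime b
    · rw [if_pos ha, if_pos hb, if_pos (Nat.coprime_mul_iff_right.mpr ⟨ha, hb⟩), mul_one]
    · rw [if_neg hb, if_neg (fun h => hb (Nat.coprime_mul_iff_right.mp h).2), mul_zero]
  · rw [if_neg ha, if_neg (fun h => ha (Nat.coprime_mul_iff_right.mp h).1), zero_mul]

lemma sum_mu_mul_chi (q : ℕ) (w : ℕ → ℝ) {n : ℕ} (hn : 0 < n) :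
    ∑ e ∈ Ioc 0 n, mu q e * ∑ k ∈ Ioc 0 (n / e), chi q k * w (e * k) = w 1 := by
  let f : ArithmeticFunction ℝ := ⟨fun e => mu q e, by simp [mu]⟩
  let g : ArithmeticFunction ℝ := ⟨fun k => if k = 0 then 0 else chi q k, by simp⟩
  have h1 := sum_mul_twist f g (fun n => (w n : ℂ)) n
  have h2 : ∀ j ∈ Ioc 0 n, (f * g) j = if j = 1 then 1 else 0 := by
    intro j hj
    rw [mem_Ioc] at hj
    rw [ArithmeticFunction.mul_apply]
    have h3 : ∀ x ∈ j.divisorsAntidiagonal, f x.1 * g x.2 = chi q j * ((ArithmeticFunction.moebius x.1 : ℤ) : ℝ) := by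
      intro x hx
      have h4 := Nat.mem_divisorsAntidiagonal.mp hx
      have h5 : x.2 ≠ 0 := fun h0 => h4.2 (by rw [← h4.1, h0, mul_zero])
      change mu q x.1 * (if x.2 = 0 then 0 else chi q x.2) = _
      rw [if_neg h5, ← h4.1, chi_mul, mu]
      ring
    rw [sum_congr rfl h3, ← mul_sum, Nat.sum_divisorsAntidiagonal (fun d _ => ((ArithmeticFunction.moebius d : ℤ) : ℝ)),
      ← Int.cast_sum]
    have h6 : ∑ i ∈ j.divisors, ArithmeticFunction.moebius i = if j = 1 then 1 else 0 := by
      rw [← ArithmeticFunction.coe_mul_zeta_apply, ArithmeticFunction.moebius_mul_coe_zeta, ArithmeticFunction.one_apply]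
    rw [h6]
    split_ifs with h7
    · rw [h7]; simp [chi]
    · simp
  rw [sum_congr rfl (fun j hj => by rw [h2 j hj])] at h1
  have h3 : ∑ x ∈ Ioc 0 n, ((if x = 1 then (1 : ℝ) else 0 : ℝ) : ℂ) * (w x : ℂ) = (w 1 : ℂ) := by
    rw [sum_eq_single 1]
    · simp
    · intro b _ hb; simp [hb]
    · intro h; exact absurd (mem_Ioc.mpr ⟨one_pos, hn⟩) h
  rw [h3] at h1
  have h4 : ((∑ e ∈ Ioc 0 n, mu q e * ∑ k ∈ Ioc 0 (n / e), chi q k * w (e * k) : ℝ) : ℂ) = (w 1 : ℂ) := by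
    rw [h1]
    push_cast
    refine sum_congr rfl fun e _ => ?_
    congr 1
    refine sum_congr rfl fun k hk => ?_
    rw [mem_Ioc] at hk
    congr 2
    change _ = (if k = 0 then 0 else chi q k)
    rw [if_neg hk.1.ne']
  exact_mod_cast h4

/-- `∑_{e ≤ n} μ(e) log(n/e) / e` over `e` coprime to `q`. -/
noncomputable def m1 (q n : ℕ) : ℝ := ∑ e ∈ Ioc 0 n, mu q e / e * (Real.log n - Real.log e)

lemma exists_abs_sum_mu_div_le {q : ℕ} (hq : 0 < q) : ∃ C : ℝ, ∀ n : ℕ, |∑ e ∈ Ioc 0 n, mu q e / e| ≤ C := by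
  have hq1 : (1 : ℝ) ≤ q := by exact_mod_cast hq
  have hphi : (0 : ℝ) < q.totient := by exact_mod_cast Nat.totient_pos.mpr hq
  refine ⟨q / q.totient * (q + 2), fun n => ?_⟩
  rcases Nat.eq_zero_or_pos n with rfl | hn
  · simp; positivity
  have hn' : (0 : ℝ) < n := by exact_mod_cast hn
  have h1 := sum_mu_mul_chi q (fun _ => 1) hn
  simp only [mul_one, sum_chi] at h1
  set ρ : ℝ := q.totient / q with hρ
  have h2 : |ρ * n * (∑ e ∈ Ioc 0 n, mu q e / e) - 1| ≤ (q + 1) * n := by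
    rw [show ρ * n * (∑ e ∈ Ioc 0 n, mu q e / e) - 1 = ∑ e ∈ Ioc 0 n, (ρ * n * (mu q e / e) -
      mu q e * (((Ioc 0 (n / e)).filter (q.Coprime ·)).card : ℝ)) by rw [sum_sub_distrib, h1, mul_sum]]
    have h3 : ∀ e ∈ Ioc 0 n, |ρ * n * (mu q e / e) - mu q e * (((Ioc 0 (n / e)).filter (q.Coprime ·)).card : ℝ)|
        ≤ q + 1 := by
      intro e he
      rw [mem_Ioc] at he
      have he' : (0 : ℝ) < e := by exact_mod_cast he.1
      have h4 := abs_card_coprime_sub_le hq (n / e)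
      rw [← hρ] at h4
      have h5 : ρ * n * (mu q e / e) - mu q e * (((Ioc 0 (n / e)).filter (q.Coprime ·)).card : ℝ) =
        mu q e * (ρ * (n / e - (n / e : ℕ)) - ((((Ioc 0 (n / e)).filter (q.Coprime ·)).card : ℝ) - ρ * (n / e : ℕ))) := by
        ring
      rw [h5, abs_mul]
      have h6 : |ρ * ((n : ℝ) / e - (n / e : ℕ))| ≤ 1 := by
        have hρ1 : ρ ≤ 1 := by
          rw [hρ, div_le_one (by linarith)]; exact_mod_cast Nat.totient_le q
        have e1 : ((n / e : ℕ) : ℝ) ≤ (n : ℝ) / e := Nat.cast_div_le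
        have e2 : (n : ℝ) / e ≤ ((n / e : ℕ) : ℝ) + 1 := by
          rw [← Nat.floor_div_eq_div (K := ℝ)]; exact (Nat.lt_floor_add_one _).le
        have hρ0 : 0 ≤ ρ := by positivity
        rw [abs_of_nonneg (mul_nonneg hρ0 (by linarith))]
        exact mul_le_one₀ hρ1 (by linarith) (by linarith)
      calc _ ≤ 1 * (1 + (q : ℝ)) := by
            gcongr
            · exact abs_mu_le q e
            · exact (abs_sub _ _).trans (add_le_add h6 h4)
        _ = _ := by ring
    refine (abs_sum_le_sum_abs _ _).trans ((sum_le_card_nsmul _ _ _ h3).trans (le_of_eq ?_))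
    rw [Nat.card_Ioc, nsmul_eq_mul, Nat.sub_zero, mul_comm]
  have h3 : ρ * n * |∑ e ∈ Ioc 0 n, mu q e / e| ≤ (q + 2) * n := by
    have h4 := abs_add_le (ρ * n * (∑ e ∈ Ioc 0 n, mu q e / e) - 1) 1
    rw [sub_add_cancel, abs_mul, abs_of_pos (by positivity : 0 < ρ * n), abs_one] at h4
    have : (1 : ℝ) ≤ n := by exact_mod_cast hn
    linarith
  have h4 : |∑ e ∈ Ioc 0 n, mu q e / e| * (ρ * n) ≤ q / q.totient * (q + 2) * (ρ * n) := by
    have e : (q : ℝ) / q.totient * (q + 2) * (ρ * n) = (q + 2) * n := by rw [hρ]; field_simp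
    rw [e]; linarith
  exact le_of_mul_le_mul_right h4 (by positivity)

lemma exists_abs_m1_le {q : ℕ} (hq : 0 < q) : ∃ C : ℝ, 0 ≤ C ∧ ∀ n : ℕ, |m1 q n| ≤ C := by
  obtain ⟨C, hC⟩ := exists_abs_sum_mu_div_le hq
  have hC0 : 0 ≤ C := (abs_nonneg _).trans (hC 0)
  have hq1 : (1 : ℝ) ≤ q := by exact_mod_cast hq
  have hphi : (0 : ℝ) < q.totient := by exact_mod_cast Nat.totient_pos.mpr hq
  refine ⟨q / q.totient * (1 + (4 * q + 1) * C + 10 * q), by positivity, fun n => ?_⟩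
  rcases Nat.eq_zero_or_pos n with rfl | hn
  · simp [m1]; positivity
  have hn' : (0 : ℝ) < n := by exact_mod_cast hn
  have h1 := sum_mu_mul_chi q (fun j => 1 / (j : ℝ)) hn
  set ρ : ℝ := q.totient / q with hρ
  have hρ0 : 0 ≤ ρ := by positivity
  have hρ1 : ρ ≤ 1 := by
    rw [hρ, div_le_one (by linarith)]; exact_mod_cast Nat.totient_le q
  have h2 : ∑ e ∈ Ioc 0 n, mu q e / e * chiHarm q (n / e) = 1 := by
    rw [Nat.cast_one, one_div_one] at h1
    rw [← h1]
    refine sum_congr rfl fun e _ => ?_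
    rw [div_mul_eq_mul_div, mul_div_assoc]
    congr 1
    rw [chiHarm, sum_div]
    refine sum_congr rfl fun k _ => ?_
    push_cast
    ring
  set c : ℝ := chiHarm q n - ρ * Real.log n with hc
  have hc1 : |c| ≤ 4 * q + 1 := by
    have h3 := abs_chiHarm_sub_le hq one_pos hn
    have h4 : chiHarm q 1 = 1 := by simp [chiHarm, chi]
    rw [← hρ, ← hc, h4, Nat.cast_one, Real.log_one, mul_zero, sub_zero, div_one] at h3
    have h5 := abs_sub_abs_le_abs_sub c 1
    rw [abs_sub_comm c 1, abs_one] at h5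
    linarith
  have h3 : |ρ * m1 q n - (1 - c * ∑ e ∈ Ioc 0 n, mu q e / e)| ≤ 10 * q := by
    rw [← h2, m1, mul_sum, mul_sum, ← sum_sub_distrib, ← sum_sub_distrib]
    have h4 : ∀ e ∈ Ioc 0 n, |ρ * (mu q e / e * (Real.log n - Real.log e)) -
        (mu q e / e * chiHarm q (n / e) - c * (mu q e / e))| ≤ 10 * q / n := by
      intro e he
      rw [mem_Ioc] at he
      have he' : (0 : ℝ) < e := by exact_mod_cast he.1
      have hy : 0 < n / e := Nat.div_pos he.2 he.1
      have hy1 : (1 : ℝ) ≤ (n / e : ℕ) := by exact_mod_cast hy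
      have h5 := abs_chiHarm_sub_le hq hy (Nat.div_le_self n e)
      rw [← hρ, ← hc] at h5
      have e1 : ((n / e : ℕ) : ℝ) ≤ (n : ℝ) / e := Nat.cast_div_le
      have e2 : (n : ℝ) / e ≤ ((n / e : ℕ) : ℝ) + 1 := by
        rw [← Nat.floor_div_eq_div (K := ℝ)]; exact (Nat.lt_floor_add_one _).le
      have h6 : ρ * (mu q e / e * (Real.log n - Real.log e)) -
          (mu q e / e * chiHarm q (n / e) - c * (mu q e / e)) =
          mu q e / e * (ρ * (Real.log n - Real.log e - Real.log (n / e : ℕ)) -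
            (chiHarm q (n / e) - ρ * Real.log (n / e : ℕ) - c)) := by ring
      have h7 : |ρ * (Real.log n - Real.log e - Real.log (n / e : ℕ))| ≤ q / (n / e : ℕ) := by
        have e3 : Real.log n - Real.log e = Real.log ((n : ℝ) / e) := (Real.log_div hn'.ne' he'.ne').symm
        have e4 : Real.log (n / e : ℕ) ≤ Real.log ((n : ℝ) / e) := Real.log_le_log (by linarith) e1
        have e5 : Real.log ((n : ℝ) / e) ≤ Real.log ((n / e : ℕ) + 1) := Real.log_le_log (by positivity) e2
        have e6 := log_sub_le_one_div hy
        rw [e3, abs_of_nonneg (mul_nonneg hρ0 (by linarith))]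
        have e7 : (1 : ℝ) / (n / e : ℕ) ≤ q / (n / e : ℕ) := by gcongr
        nlinarith
      have h8 : (1 : ℝ) / (n / e : ℕ) ≤ 2 * e / n := by
        rw [div_le_div_iff₀ (by linarith) hn']
        rw [div_le_iff₀ he'] at e2
        nlinarith
      rw [h6, abs_mul, abs_div, abs_of_pos he']
      calc |mu q e| / e * _ ≤ 1 / e * (q / (n / e : ℕ) + 4 * q / (n / e : ℕ)) := by
            gcongr
            · exact abs_mu_le q e
            · exact (abs_sub _ _).trans (add_le_add h7 h5)
        _ = 1 / e * (5 * q * (1 / (n / e : ℕ))) := by ring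
        _ ≤ 1 / e * (5 * q * (2 * e / n)) := by gcongr
        _ = 10 * q / n := by field_simp; ring
    refine (abs_sum_le_sum_abs _ _).trans ((sum_le_card_nsmul _ _ _ h4).trans (le_of_eq ?_))
    rw [Nat.card_Ioc, nsmul_eq_mul, Nat.sub_zero]
    field_simp
  have h4 : |1 - c * ∑ e ∈ Ioc 0 n, mu q e / e| ≤ 1 + (4 * q + 1) * C := by
    refine (abs_sub _ _).trans ?_
    rw [abs_one, abs_mul]
    have := mul_le_mul hc1 (hC n) (abs_nonneg _) (by positivity)
    linarith
  have h5 := abs_add_le (ρ * m1 q n - (1 - c * ∑ e ∈ Ioc 0 n, mu q e / e)) (1 - c * ∑ e ∈ Ioc 0 n, mu q e / e)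
  rw [sub_add_cancel, abs_mul, abs_of_nonneg hρ0] at h5
  have h6 : |m1 q n| = q / q.totient * (ρ * |m1 q n|) := by rw [hρ]; field_simp
  rw [h6]
  gcongr
  linarith

lemma one_div_le_nn_div {q b : ℕ} (hq : 0 < q) (h : ¬ q ∣ b) : 1 / (q : ℝ) ≤ nn ((b : ℝ) / q) := by
  obtain ⟨m, hm⟩ := exists_int_nn ((b : ℝ) / q)
  have hq' : (0 : ℝ) < q := by exact_mod_cast hq
  have h1 : (b : ℝ) / q - m = (((b : ℤ) - m * q : ℤ) : ℝ) / q := by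
    rw [eq_div_iff hq'.ne']
    push_cast
    field_simp
  rw [hm, h1, abs_div, abs_of_pos hq', ← Int.cast_abs]
  have h2 : (1 : ℤ) ≤ |(b : ℤ) - m * q| := by
    apply Int.one_le_abs
    intro h0
    apply h
    have : (q : ℤ) ∣ (b : ℤ) := ⟨m, by linarith⟩
    exact_mod_cast this
  have h3 : (1 : ℝ) ≤ ((|(b : ℤ) - m * q| : ℤ) : ℝ) := by exact_mod_cast h2
  gcongr

lemma sum_range_one_div_le (q : ℕ) : ∑ i ∈ range q, 1 / ((i : ℝ) + 1) ≤ 1 + Real.log q := by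
  have := harmonic_le_one_add_log q
  rw [harmonic] at this
  push_cast at this
  simpa [one_div] using this

lemma sum_one_div_nn_le {q : ℕ} (hq : 0 < q) :
    ∑ r ∈ range q, 1 / nn ((r : ℝ) / q) ≤ 2 * q * (1 + Real.log q) := by
  obtain ⟨p, rfl⟩ : ∃ p, q = p + 1 := ⟨q - 1, by omega⟩
  have hq' : (0 : ℝ) < ((p + 1 : ℕ) : ℝ) := by exact_mod_cast hq
  rw [sum_range_succ']
  have h0 : nn (((0 : ℕ) : ℝ) / ((p + 1 : ℕ) : ℝ)) = 0 := by simpa using nn_int 0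
  rw [h0, div_zero, add_zero]
  have h1 : ∀ i ∈ range p, 1 / nn (((i + 1 : ℕ) : ℝ) / ((p + 1 : ℕ) : ℝ)) ≤
      ((p + 1 : ℕ) : ℝ) * (1 / ((i : ℝ) + 1)) + ((p + 1 : ℕ) : ℝ) * (1 / (((p - 1 - i : ℕ) : ℝ) + 1)) := by
    intro i hi
    rw [mem_range] at hi
    have hpi : (((p - 1 - i : ℕ) : ℝ) + 1) = (p : ℝ) - i := by
      have : (p - 1 - i) + 1 + i = p := by omega
      have h : (((p - 1 - i) + 1 + i : ℕ) : ℝ) = p := by rw [this]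
      push_cast at h
      linarith
    rw [hpi]
    have hi' : (i : ℝ) < p := by exact_mod_cast hi
    have hi0 : (0 : ℝ) ≤ i := Nat.cast_nonneg i
    obtain ⟨m, hm⟩ := exists_int_nn (((i + 1 : ℕ) : ℝ) / ((p + 1 : ℕ) : ℝ))
    have hpq : (0 : ℝ) ≤ (p + 1 : ℕ) := hq'.le
    have a1 : 0 ≤ ((p + 1 : ℕ) : ℝ) * (1 / ((i : ℝ) + 1)) := by positivity
    have a2 : 0 ≤ ((p + 1 : ℕ) : ℝ) * (1 / ((p : ℝ) - i)) := by
      have : 0 < (p : ℝ) - i := by linarith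
      positivity
    rcases le_or_gt m 0 with h | h
    · have hm' : (m : ℝ) ≤ 0 := by exact_mod_cast h
      have e1 : ((i : ℝ) + 1) / ((p + 1 : ℕ) : ℝ) ≤ nn (((i + 1 : ℕ) : ℝ) / ((p + 1 : ℕ) : ℝ)) := by
        rw [hm]
        refine le_trans ?_ (le_abs_self _)
        push_cast
        linarith
      calc _ ≤ 1 / (((i : ℝ) + 1) / ((p + 1 : ℕ) : ℝ)) := by gcongr
        _ = ((p + 1 : ℕ) : ℝ) * (1 / ((i : ℝ) + 1)) := by field_simp
        _ ≤ _ := by linarith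
    · have hm' : (1 : ℝ) ≤ m := by exact_mod_cast h
      have hpi0 : 0 < (p : ℝ) - i := by linarith
      have e1 : ((p : ℝ) - i) / ((p + 1 : ℕ) : ℝ) ≤ nn (((i + 1 : ℕ) : ℝ) / ((p + 1 : ℕ) : ℝ)) := by
        rw [hm, abs_sub_comm]
        refine le_trans ?_ (le_abs_self _)
        have : ((p : ℝ) - i) / ((p + 1 : ℕ) : ℝ) = 1 - ((i + 1 : ℕ) : ℝ) / ((p + 1 : ℕ) : ℝ) := by
          rw [eq_sub_iff_add_eq, ← add_div, div_eq_one_iff_eq hq'.ne']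
          push_cast; ring
        rw [this]
        linarith
      calc _ ≤ 1 / (((p : ℝ) - i) / ((p + 1 : ℕ) : ℝ)) := by gcongr
        _ = ((p + 1 : ℕ) : ℝ) * (1 / ((p : ℝ) - i)) := by field_simp
        _ ≤ _ := by linarith
  refine (sum_le_sum h1).trans ?_
  rw [sum_add_distrib, sum_range_reflect (fun i => ((p + 1 : ℕ) : ℝ) * (1 / ((i : ℝ) + 1))) p, ← mul_sum]
  have h2 := sum_range_one_div_le p
  have h3 : Real.log p ≤ Real.log ((p + 1 : ℕ) : ℝ) := by
    rcases Nat.eq_zero_or_pos p with rfl | hp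
    · simp
    · apply Real.log_le_log (by exact_mod_cast hp)
      push_cast; linarith
  nlinarith

lemma sum_one_div_nn_mul_le {q a : ℕ} (hq : 0 < q) (ha : a.Coprime q) (k : ℕ) :
    ∑ d ∈ range (q * k), 1 / nn ((d : ℝ) * (a / q)) ≤ k * (2 * q * (1 + Real.log q)) := by
  have hq' : (0 : ℝ) < q := by exact_mod_cast hq
  have hmod : ∀ d : ℕ, nn ((d : ℝ) * (a / q)) = nn (((d * a % q : ℕ) : ℝ) / q) := by
    intro d
    have h1 : (d : ℝ) * (a / q) = ((d * a % q : ℕ) : ℝ) / q + ((d * a / q : ℕ) : ℤ) := by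
      have h2 : ((d * a % q + q * (d * a / q) : ℕ) : ℝ) = ((d * a : ℕ) : ℝ) := by rw [Nat.mod_add_div]
      rw [Int.cast_natCast]
      rw [Nat.cast_add, Nat.cast_mul, Nat.cast_mul d] at h2
      field_simp
      linarith
    rw [h1, nn_add_int]
  have hbase : ∑ d ∈ range q, 1 / nn ((d : ℝ) * (a / q)) ≤ 2 * q * (1 + Real.log q) := by
    refine le_trans ?_ (sum_one_div_nn_le hq)
    have hinj : Set.InjOn (fun d => d * a % q) (range q : Set ℕ) := by
      intro x hx y hy hxy
      simp only [coe_range, Set.mem_Iio] at hx hy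
      have h1 : x * a ≡ y * a [MOD q] := hxy
      have h2 := Nat.ModEq.cancel_right_of_coprime (by rwa [Nat.coprime_comm] at ha) h1
      exact Nat.ModEq.eq_of_lt_of_lt h2 hx hy
    calc _ = ∑ r ∈ (range q).image (fun d => d * a % q), 1 / nn ((r : ℝ) / q) := by
          rw [sum_image hinj]
          exact sum_congr rfl fun d _ => by rw [hmod]
      _ ≤ _ := by
          apply sum_le_sum_of_subset_of_nonneg
          · intro r hr
            obtain ⟨d, _, rfl⟩ := mem_image.mp hr
            exact mem_range.mpr (Nat.mod_lt _ hq)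
          · intro r _ _
            exact one_div_nonneg.mpr (nn_nonneg _)
  induction k with
  | zero => simp
  | succ k ih =>
    rw [Nat.mul_succ, sum_range_add]
    have h1 : ∀ x ∈ range q, 1 / nn (((q * k + x : ℕ) : ℝ) * (a / q)) = 1 / nn ((x : ℝ) * (a / q)) := by
      intro x _
      rw [hmod, hmod]
      congr 4
      rw [add_mul, mul_assoc, Nat.mul_add_mod]
    rw [sum_congr rfl h1]
    push_cast
    linarith

lemma norm_sum_log_sq_le {θ : ℝ} (hθ : 0 < nn θ) (Y : ℕ) :
    ‖∑ m ∈ Ioc 0 Y, ((Real.log m ^ 2 : ℝ) : ℂ) * ee (m * θ)‖ ≤ 2 * Real.log (Y + 1) ^ 2 / nn θ := by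
  have h1 : ∑ m ∈ Ioc 0 Y, ((Real.log m ^ 2 : ℝ) : ℂ) * ee (m * θ) =
      ∑ m ∈ range (Y + 1), ((Real.log m ^ 2 : ℝ) : ℂ) * ee (m * θ) := by
    rw [sum_range_succ_eq_Ioc]
    simp
  rw [h1]
  have hmono : ∀ m : ℕ, Real.log m ^ 2 ≤ Real.log ((m + 1 : ℕ) : ℝ) ^ 2 := by
    intro m
    have h0 : 0 ≤ Real.log (m : ℝ) := Real.log_natCast_nonneg m
    rcases Nat.eq_zero_or_pos m with rfl | hm
    · simp
    have : Real.log m ≤ Real.log ((m + 1 : ℕ) : ℝ) :=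
      Real.log_le_log (by exact_mod_cast hm) (by push_cast; linarith)
    gcongr
  refine (norm_sum_mul_le_abel (fun m => Real.log m ^ 2) (fun m => ee (m * θ)) (Y + 1)
    (A := 1 / nn θ) (fun k _ => ?_)).trans ?_
  · have := norm_geom_sum_ee_le θ hθ 0 k
    rwa [← range_eq_Ico] at this
  · have h2 : ∑ i ∈ range (Y + 1), |Real.log ((i + 1 : ℕ) : ℝ) ^ 2 - Real.log (i : ℝ) ^ 2| =
        Real.log ((Y + 1 : ℕ) : ℝ) ^ 2 := by
      rw [sum_congr rfl (fun i _ => abs_of_nonneg (sub_nonneg.mpr (hmono i))),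
        sum_range_sub (fun i : ℕ => Real.log (i : ℝ) ^ 2)]
      simp
    rw [h2, abs_of_nonneg (sq_nonneg _)]
    push_cast
    apply le_of_eq
    ring

/-- Trivial bound for the tail of a type I sum. -/
lemma sum_norm_sum_log_sq_le {N D : ℕ} (hD : 0 < D) (hDN : D ≤ N) (w : ℕ → ℕ → ℂ)
    (hw : ∀ d m, ‖w d m‖ ≤ 1) :
    ∑ d ∈ Ioc D N, ‖∑ m ∈ Ioc 0 (N / d), ((Real.log m ^ 2 : ℝ) : ℂ) * w d m‖ ≤
      N * (Real.log N - Real.log D) ^ 3 := by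
  have hD' : (0 : ℝ) < D := by exact_mod_cast hD
  have hN' : (0 : ℝ) < N := by exact_mod_cast hD.trans_le hDN
  have hlog : 0 ≤ Real.log N - Real.log D :=
    sub_nonneg.mpr (Real.log_le_log hD' (by exact_mod_cast hDN))
  have h1 : ∀ d ∈ Ioc D N, ‖∑ m ∈ Ioc 0 (N / d), ((Real.log m ^ 2 : ℝ) : ℂ) * w d m‖ ≤
      N * (Real.log N - Real.log D) ^ 2 * (1 / d) := by
    intro d hd
    rw [mem_Ioc] at hd
    have hd' : (D : ℝ) < d := by exact_mod_cast hd.1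
    have h2 : ∀ m ∈ Ioc 0 (N / d), ‖((Real.log m ^ 2 : ℝ) : ℂ) * w d m‖ ≤
        (Real.log N - Real.log D) ^ 2 := by
      intro m hm
      rw [mem_Ioc] at hm
      have hm' : (0 : ℝ) < m := by exact_mod_cast hm.1
      have h3 : (m : ℝ) ≤ (N : ℝ) / d := le_trans (by exact_mod_cast hm.2) Nat.cast_div_le
      have h4 : Real.log m ≤ Real.log N - Real.log D := by
        rw [← Real.log_div hN'.ne' hD'.ne']
        apply Real.log_le_log hm'
        refine h3.trans ?_
        gcongr
      have h5 : 0 ≤ Real.log (m : ℝ) := Real.log_natCast_nonneg m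
      rw [norm_mul, Complex.norm_real, Real.norm_eq_abs, abs_of_nonneg (sq_nonneg _)]
      calc _ ≤ Real.log m ^ 2 * 1 := by gcongr; exact hw d m
        _ ≤ _ := by rw [mul_one]; gcongr
    refine (norm_sum_le _ _).trans ((sum_le_sum h2).trans ?_)
    rw [sum_const, nsmul_eq_mul, Nat.card_Ioc, Nat.sub_zero]
    have h3 : ((N / d : ℕ) : ℝ) ≤ (N : ℝ) / d := Nat.cast_div_le
    calc _ ≤ (N : ℝ) / d * (Real.log N - Real.log D) ^ 2 := by gcongr
      _ = _ := by ring
  refine (sum_le_sum h1).trans ?_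
  rw [← mul_sum]
  calc _ ≤ N * (Real.log N - Real.log D) ^ 2 * (Real.log N - Real.log D) := by
        gcongr; exact sum_Ioc_one_div_le hD hDN
    _ = _ := by ring

/-- The part of the type I sum supported on multiples of `q`. -/
noncomputable def typeIMul (q N : ℕ) (β : ℝ) : ℂ :=
  ∑ d ∈ (Ioc 0 N).filter (q ∣ ·), (ArithmeticFunction.moebius d : ℂ) *
    ∑ m ∈ Ioc 0 (N / d), ((Real.log m ^ 2 : ℝ) : ℂ) * ee (m * (d * β))

lemma norm_moebius_le (d : ℕ) : ‖((ArithmeticFunction.moebius d : ℤ) : ℂ)‖ ≤ 1 := by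
  rw [Complex.norm_intCast]
  exact_mod_cast @ArithmeticFunction.abs_moebius_le_one d

lemma norm_typeI_sub_le {N q a D : ℕ} {β : ℝ} (hq : 0 < q) (ha : a.Coprime q) (hD : 0 < D) (hDN : D ≤ N)
    (hβ : D * |β| ≤ 1 / (2 * q)) :
    ‖typeI N (a / q + β) - typeIMul q N β‖ ≤ 8 * Real.log (N + 1) ^ 2 * (D + q) * (1 + Real.log q) +
      N * (Real.log N - Real.log D) ^ 3 := by
  have hq' : (0 : ℝ) < q := by exact_mod_cast hq
  set I : ℕ → ℂ := fun d => ∑ m ∈ Ioc 0 (N / d), ((Real.log m ^ 2 : ℝ) : ℂ) * ee (m * (d * (a / q + β))) with hI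
  have h1 : typeI N (a / q + β) - typeIMul q N β =
      ∑ d ∈ (Ioc 0 N).filter (¬ q ∣ ·), (ArithmeticFunction.moebius d : ℂ) * I d := by
    have h2 : typeIMul q N β = ∑ d ∈ (Ioc 0 N).filter (q ∣ ·), (ArithmeticFunction.moebius d : ℂ) * I d := by
      unfold typeIMul
      refine sum_congr rfl fun d hd => ?_
      obtain ⟨e, rfl⟩ := (mem_filter.mp hd).2
      congr 1
      refine sum_congr rfl fun m _ => ?_
      congr 1
      have : (m : ℝ) * ((q * e : ℕ) * (a / q + β)) = m * ((q * e : ℕ) * β) + ((m * e * a : ℕ) : ℤ) := by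
        push_cast
        field_simp
        ring
      rw [this, ee_add_int]
    rw [h2, typeI, ← sum_filter_add_sum_filter_not (Ioc 0 N) (q ∣ ·)]
    ring
  have hle : ∀ s : Finset ℕ, ‖∑ d ∈ s, (ArithmeticFunction.moebius d : ℂ) * I d‖ ≤ ∑ d ∈ s, ‖I d‖ := by
    intro s
    refine (norm_sum_le _ _).trans (sum_le_sum fun d _ => ?_)
    rw [norm_mul]
    exact mul_le_of_le_one_left (norm_nonneg _) (norm_moebius_le d)
  rw [h1]
  refine (hle _).trans ?_
  have h3 : (Ioc 0 N).filter (¬ q ∣ ·) ⊆ (Ioc 0 D).filter (¬ q ∣ ·) ∪ Ioc D N := by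
    intro d hd
    rw [mem_filter, mem_Ioc] at hd
    rw [mem_union, mem_filter, mem_Ioc, mem_Ioc]
    rcases le_or_gt d D with h | h
    · exact Or.inl ⟨⟨hd.1.1, h⟩, hd.2⟩
    · exact Or.inr ⟨h, hd.1.2⟩
  refine (sum_le_sum_of_subset_of_nonneg h3 fun _ _ _ => norm_nonneg _).trans ?_
  refine (sum_union_inter (s₁ := (Ioc 0 D).filter (¬ q ∣ ·)) (s₂ := Ioc D N) (f := fun d => ‖I d‖) ▸
    le_add_of_nonneg_right (sum_nonneg fun _ _ => norm_nonneg _)).trans ?_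
  refine add_le_add ?_ (sum_norm_sum_log_sq_le hD hDN (fun d m => ee (m * (d * (a / q + β))))
    fun d m => (norm_ee _).le)
  have h4 : ∀ d ∈ (Ioc 0 D).filter (¬ q ∣ ·), ‖I d‖ ≤ 4 * Real.log (N + 1) ^ 2 * (1 / nn ((d : ℝ) * (a / q))) := by
    intro d hd
    rw [mem_filter, mem_Ioc] at hd
    have e1 : 1 / (q : ℝ) ≤ nn ((d : ℝ) * (a / q)) := by
      have := one_div_le_nn_div (b := d * a) hq (fun h => hd.2 (Nat.Coprime.dvd_of_dvd_mul_right (Nat.coprime_comm.mp ha) h))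
      have e : ((d * a : ℕ) : ℝ) / q = (d : ℝ) * (a / q) := by push_cast; ring
      rwa [e] at this
    have e2 : nn ((d : ℝ) * (a / q)) / 2 ≤ nn (d * (a / q + β)) := by
      have := nn_add_le (d * (a / q + β)) (-(d * β))
      rw [nn_neg, show (d : ℝ) * (a / q + β) + -(d * β) = d * (a / q) by ring] at this
      have e3 := nn_le_abs (d * β)
      rw [abs_mul, Nat.abs_cast] at e3
      have e4 : (d : ℝ) * |β| ≤ D * |β| := by
        gcongr; exact_mod_cast hd.1.2
      have e5 : 1 / (2 * (q : ℝ)) = 1 / q / 2 := by field_simp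
      linarith
    have e3 : 0 < nn ((d : ℝ) * (a / q)) := lt_of_lt_of_le (by positivity) e1
    refine (norm_sum_log_sq_le (by linarith) (N / d)).trans ?_
    have e4 : Real.log ((N / d : ℕ) + 1) ≤ Real.log (N + 1) := by
      apply Real.log_le_log (by positivity)
      have : ((N / d : ℕ) : ℝ) ≤ N := by exact_mod_cast Nat.div_le_self N d
      linarith
    have e5 : 0 ≤ Real.log ((N / d : ℕ) + 1) := Real.log_nonneg (by linarith [(Nat.cast_nonneg (N / d) : (0:ℝ) ≤ _)])
    calc _ ≤ 2 * Real.log (N + 1) ^ 2 / (nn ((d : ℝ) * (a / q)) / 2) := by gcongr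
      _ = _ := by field_simp; ring
  refine (sum_le_sum h4).trans ?_
  rw [← mul_sum]
  have h5 : ∑ d ∈ (Ioc 0 D).filter (¬ q ∣ ·), 1 / nn ((d : ℝ) * (a / q)) ≤
      ((D / q + 1 : ℕ) : ℝ) * (2 * q * (1 + Real.log q)) := by
    refine le_trans ?_ (sum_one_div_nn_mul_le hq ha (D / q + 1))
    apply sum_le_sum_of_subset_of_nonneg
    · intro d hd
      rw [mem_filter, mem_Ioc] at hd
      exact mem_range.mpr (lt_of_le_of_lt hd.1.2 (Nat.lt_mul_div_succ D hq))
    · intro d _ _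
      exact one_div_nonneg.mpr (nn_nonneg _)
  have h6 : ((D / q + 1 : ℕ) : ℝ) * q ≤ D + q := by
    have := Nat.div_mul_le_self D q
    have h : ((D / q * q : ℕ) : ℝ) ≤ D := by exact_mod_cast this
    push_cast at h ⊢
    linarith
  have h7 : 0 ≤ 1 + Real.log (q : ℝ) := by linarith [Real.log_natCast_nonneg q]
  calc _ ≤ 4 * Real.log (N + 1) ^ 2 * (((D / q + 1 : ℕ) : ℝ) * (2 * q * (1 + Real.log q))) := by gcongr
    _ = 8 * Real.log (N + 1) ^ 2 * (((D / q + 1 : ℕ) : ℝ) * q) * (1 + Real.log q) := by ring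
    _ ≤ _ := by gcongr

lemma eventually_log_mul_pow_cube_le {ε : ℝ} (hε : 0 < ε) {c : ℝ} (hc : 0 < c) (k : ℕ) :
    ∀ᶠ x : ℝ in Filter.atTop, Real.log (c * x ^ k) ^ 3 ≤ ε * x := by
  have hk : (0 : ℝ) < (k : ℝ) + 1 := by positivity
  set δ : ℝ := min ε 1 / (k + 1) with hδ
  have hδ0 : 0 < δ := by positivity
  have h1 := (isLittleO_log_rpow_atTop (r := 1 / 3) (by norm_num)).bound hδ0
  filter_upwards [h1, Filter.eventually_ge_atTop (max c 1)] with x hx hx1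
  have hx0 : 1 ≤ x := (le_max_right _ _).trans hx1
  have hxc : c ≤ x := (le_max_left _ _).trans hx1
  have hxp : 0 < x := by linarith
  have h2 : Real.log (c * x ^ k) ≤ (k + 1) * Real.log x := by
    rw [Real.log_mul hc.ne' (by positivity), Real.log_pow]
    have := Real.log_le_log hc hxc
    linarith
  have hx' : Real.log x ≤ δ * x ^ (1 / 3 : ℝ) := by
    rw [Real.norm_eq_abs, Real.norm_eq_abs, abs_of_nonneg (Real.log_nonneg hx0),
      abs_of_nonneg (by positivity)] at hx
    exact hx
  have h3 : Real.log (c * x ^ k) ≤ min ε 1 * x ^ (1 / 3 : ℝ) := by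
    refine h2.trans ?_
    calc _ ≤ (k + 1) * (δ * x ^ (1 / 3 : ℝ)) := by gcongr
      _ = _ := by rw [hδ]; field_simp
  have hm : 0 < min ε 1 := by positivity
  calc Real.log (c * x ^ k) ^ 3 ≤ (min ε 1 * x ^ (1 / 3 : ℝ)) ^ 3 := by
        exact (Odd.pow_le_pow (by decide)).mpr h3
    _ = min ε 1 ^ 3 * x := by
        rw [mul_pow, ← Real.rpow_natCast (x ^ (1 / 3 : ℝ)), ← Real.rpow_mul hxp.le]
        norm_num
    _ ≤ ε * x := by
        gcongr
        calc min ε 1 ^ 3 ≤ min ε 1 := pow_le_of_le_one hm.le (min_le_right _ _) (by norm_num)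
          _ ≤ ε := min_le_left _ _

lemma tendsto_log_natCast : Filter.Tendsto (fun N : ℕ => Real.log N) Filter.atTop Filter.atTop :=
  Real.tendsto_log_atTop.comp tendsto_natCast_atTop_atTop

lemma eventually_log_pow_le (c : ℝ) (k : ℕ) : ∀ᶠ N : ℕ in Filter.atTop, c * Real.log N ^ k ≤ N := by
  have h1 : (fun x : ℝ => Real.log x ^ k) =o[Filter.atTop] fun x => x := by
    simpa using isLittleO_log_rpow_rpow_atTop (k : ℝ) (one_pos)
  have h2 := (h1.const_mul_left c).bound (one_pos)
  have h3 := tendsto_natCast_atTop_atTop (R := ℝ) |>.eventually h2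
  filter_upwards [h3] with N hN
  rw [one_mul, Real.norm_eq_abs, Real.norm_eq_abs, Nat.abs_cast] at hN
  exact (le_abs_self _).trans hN

/-- Off multiples of the denominator, the type I sum is negligible. -/
lemma exists_norm_typeI_sub_le {ε : ℝ} (hε : 0 < ε) : ∃ N₀ : ℕ, ∀ N ≥ N₀, ∀ q a : ℕ, ∀ β : ℝ, 0 < q →
    a.Coprime q → q * Real.log N ^ 4 ≤ N → |β| * (q * N) ≤ Real.log N ^ 4 →
    ‖typeI N (a / q + β) - typeIMul q N β‖ ≤ ε * N * Real.log N := by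
  have e1 := tendsto_log_natCast.eventually
    (eventually_log_mul_pow_cube_le (half_pos hε) (c := 4) (by norm_num) 4)
  have e2 := tendsto_log_natCast.eventually (Filter.eventually_ge_atTop (max 1 (192 * 2 / ε)))
  have e3 := eventually_log_pow_le 2 4
  obtain ⟨N₀, hN₀⟩ := Filter.eventually_atTop.mp (e1.and (e2.and (e3.and (Filter.eventually_ge_atTop 2))))
  refine ⟨N₀, fun N hN q a β hq ha hqN hβ => ?_⟩
  obtain ⟨h1, h2, h3, h4⟩ := hN₀ N hN
  set L := Real.log N with hL
  have hL1 : 1 ≤ L := (le_max_left _ _).trans h2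
  have hL2 : 192 * 2 / ε ≤ L := (le_max_right _ _).trans h2
  have hN2 : (2 : ℝ) ≤ N := by exact_mod_cast h4
  have hq' : (1 : ℝ) ≤ q := by exact_mod_cast hq
  have hL4 : 1 ≤ L ^ 4 := one_le_pow₀ hL1
  set x : ℝ := N / (2 * L ^ 4) with hx
  have hx1 : 1 ≤ x := by rw [hx, le_div_iff₀ (by positivity)]; linarith
  set D := ⌊x⌋₊ with hD
  have hD0 : 0 < D := Nat.floor_pos.mpr hx1
  have hDx : (D : ℝ) ≤ x := Nat.floor_le (by linarith)
  have hxN : x ≤ N := by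
    rw [hx, div_le_iff₀ (by positivity)]; nlinarith
  have hDN : D ≤ N := by exact_mod_cast hDx.trans hxN
  have hDx2 : x / 2 ≤ D := by
    have := Nat.lt_floor_add_one x
    rw [← hD] at this
    have hD1 : (1 : ℝ) ≤ D := by exact_mod_cast hD0
    linarith
  have hDβ : D * |β| ≤ 1 / (2 * q) := by
    rw [le_div_iff₀ (by positivity)]
    calc D * |β| * (2 * q) ≤ x * |β| * (2 * q) := by gcongr
      _ = |β| * (q * N) / L ^ 4 := by rw [hx]; field_simp
      _ ≤ 1 := by rw [div_le_one (by positivity)]; exact hβ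
  refine (norm_typeI_sub_le hq ha hD0 hDN hDβ).trans ?_
  have hlogN1 : Real.log (N + 1) ≤ 2 * L := by
    rw [hL, ← Real.log_rpow (by positivity)]
    apply Real.log_le_log (by positivity)
    norm_num
    nlinarith
  have hlogN0 : 0 ≤ Real.log ((N : ℝ) + 1) := Real.log_nonneg (by linarith)
  have hqN' : (q : ℝ) ≤ N / L ^ 4 := by rw [le_div_iff₀ (by positivity)]; exact hqN
  have hlogq : Real.log q ≤ L := by
    apply Real.log_le_log (by linarith)
    exact hqN'.trans (div_le_self (by linarith) hL4)
  have hlogq0 : 0 ≤ Real.log (q : ℝ) := Real.log_natCast_nonneg q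
  have hDq : (D : ℝ) + q ≤ 3 / 2 * (N / L ^ 4) := by
    have : x = 1 / 2 * (N / L ^ 4) := by rw [hx]; field_simp
    linarith
  have b1 : 8 * Real.log (N + 1) ^ 2 * (D + q) * (1 + Real.log q) ≤ ε / 2 * N * L := by
    calc _ ≤ 8 * (2 * L) ^ 2 * (3 / 2 * (N / L ^ 4)) * (2 * L) := by gcongr; linarith
      _ = 96 * N / L := by field_simp; ring
      _ ≤ ε / 2 * N * L := by
        rw [div_le_iff₀ (by linarith)]
        have : 192 * 2 ≤ L * ε := by rwa [div_le_iff₀ hε] at hL2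
        have h5 : 96 ≤ ε / 2 * (L * L) := by nlinarith
        nlinarith
  have b2 : N * (L - Real.log D) ^ 3 ≤ ε / 2 * N * L := by
    have h5 : L - Real.log D ≤ Real.log (4 * L ^ 4) := by
      rw [hL, ← Real.log_div (by positivity) (by positivity), ← hL]
      apply Real.log_le_log (by positivity)
      rw [div_le_iff₀ (by positivity)]
      calc (N : ℝ) = 4 * L ^ 4 * (x / 2) := by rw [hx]; field_simp; ring
        _ ≤ _ := by gcongr
    calc N * (L - Real.log D) ^ 3 ≤ N * Real.log (4 * L ^ 4) ^ 3 := by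
          gcongr ?_ * ?_
          exact (Odd.pow_le_pow (by decide)).mpr h5
      _ ≤ N * (ε / 2 * L) := by gcongr
      _ = _ := by ring
  linarith

lemma norm_ee_sub_ee_le (x y : ℝ) : ‖ee x - ee y‖ ≤ 2 * Real.pi * |x - y| := by
  have h1 : ee x - ee y = ee y * (ee (x - y) - 1) := by
    rw [mul_sub, ← ee_add, mul_one]; congr 2; ring
  rw [h1, norm_mul, norm_ee, one_mul]
  unfold ee
  rw [mul_comm _ Complex.I]
  refine (Real.norm_exp_I_mul_ofReal_sub_one_le).trans (le_of_eq ?_)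
  rw [Real.norm_eq_abs, abs_mul, abs_of_pos (by positivity)]

/-- The truncated weight `log (n / e) ^ 2`. -/
noncomputable def lw (e n : ℕ) : ℝ := (max 0 (Real.log n - Real.log e)) ^ 2

lemma lw_nonneg (e n : ℕ) : 0 ≤ lw e n := sq_nonneg _

lemma lw_mono (e : ℕ) {m n : ℕ} (hm : 0 < m) (h : m ≤ n) : lw e m ≤ lw e n := by
  unfold lw
  have : Real.log m ≤ Real.log n := Real.log_le_log (by exact_mod_cast hm) (by exact_mod_cast h)
  gcongr

lemma lw_mul {e : ℕ} (he : 0 < e) (m : ℕ) : lw e (e * m) = Real.log m ^ 2 := by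
  unfold lw
  have he' : (e : ℝ) ≠ 0 := by exact_mod_cast he.ne'
  rcases Nat.eq_zero_or_pos m with rfl | hm
  · have : 0 ≤ Real.log (e : ℝ) := Real.log_natCast_nonneg e
    simp [this]
  · rw [Nat.cast_mul, Real.log_mul he' (by exact_mod_cast hm.ne'), add_sub_cancel_left,
      max_eq_right (Real.log_natCast_nonneg m)]

lemma lw_zero_right (e : ℕ) : lw e 0 = 0 := by
  unfold lw
  have : 0 ≤ Real.log (e : ℝ) := Real.log_natCast_nonneg e
  simp [this]

lemma lw_le {e n X : ℕ} (h : n ≤ X) : lw e n ≤ Real.log X ^ 2 := by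
  rcases Nat.eq_zero_or_pos n with rfl | hn
  · rw [lw_zero_right]; positivity
  refine (lw_mono e hn h).trans ?_
  unfold lw
  have h0 : 0 ≤ Real.log (e : ℝ) := Real.log_natCast_nonneg e
  have h1 : 0 ≤ Real.log (X : ℝ) := Real.log_natCast_nonneg X
  have : max 0 (Real.log X - Real.log e) ≤ Real.log X := max_le h1 (by linarith)
  gcongr

lemma norm_log_sq_sub_block_le {e X : ℕ} (he : 0 < e) (γ : ℝ) {Y : ℕ} (hY : Y ≤ X) :
    ‖(e : ℂ) * ∑ m ∈ Ioc 0 Y, ((Real.log m ^ 2 : ℝ) : ℂ) * ee (m * (e * γ)) -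
      ∑ n ∈ Ioc 0 (e * Y), (lw e n : ℂ) * ee (n * γ)‖ ≤
      e * Real.log Y ^ 2 + Y * (e * (e * (2 * Real.pi * |γ|)) * Real.log X ^ 2) := by
  induction Y with
  | zero => simp
  | succ Y ih =>
    have h1 := ih (by omega)
    have hsplit : ∑ n ∈ Ioc 0 (e * (Y + 1)), (lw e n : ℂ) * ee (n * γ) =
        ∑ n ∈ Ioc 0 (e * Y), (lw e n : ℂ) * ee (n * γ) +
        ∑ n ∈ Ioc (e * Y) (e * (Y + 1)), (lw e n : ℂ) * ee (n * γ) :=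
      (sum_Ioc_consecutive _ (Nat.zero_le _) (Nat.mul_le_mul_left e (Nat.le_succ Y))).symm
    rw [hsplit, sum_Ioc_succ_top (Nat.zero_le _), mul_add]
    set A := (e : ℂ) * ∑ m ∈ Ioc 0 Y, ((Real.log m ^ 2 : ℝ) : ℂ) * ee (m * (e * γ))
    set B := ∑ n ∈ Ioc 0 (e * Y), (lw e n : ℂ) * ee (n * γ)
    set z : ℂ := ((Real.log ((Y + 1 : ℕ) : ℝ) ^ 2 : ℝ) : ℂ) * ee (((Y + 1 : ℕ) : ℝ) * (e * γ)) with hz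
    have h2 : ‖(e : ℂ) * z - ∑ n ∈ Ioc (e * Y) (e * (Y + 1)), (lw e n : ℂ) * ee (n * γ)‖ ≤
        e * (Real.log ((Y + 1 : ℕ) : ℝ) ^ 2 - Real.log Y ^ 2 + e * (2 * Real.pi * |γ|) * Real.log X ^ 2) := by
      have hcard : (Ioc (e * Y) (e * (Y + 1))).card = e := by
        rw [Nat.card_Ioc, Nat.mul_succ]; omega
      have h3 : (e : ℂ) * z = ∑ n ∈ Ioc (e * Y) (e * (Y + 1)), z := by
        rw [sum_const, hcard, nsmul_eq_mul]
      rw [h3, ← sum_sub_distrib]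
      refine (norm_sum_le _ _).trans ?_
      refine (sum_le_card_nsmul _ _ (Real.log ((Y + 1 : ℕ) : ℝ) ^ 2 - Real.log Y ^ 2 +
        e * (2 * Real.pi * |γ|) * Real.log X ^ 2) fun n hn => ?_).trans_eq (by rw [hcard, nsmul_eq_mul])
      rw [mem_Ioc] at hn
      have hn0 : 0 < n := by omega
      have e1 : z - (lw e n : ℂ) * ee (n * γ) =
          ((Real.log ((Y + 1 : ℕ) : ℝ) ^ 2 - lw e n : ℝ) : ℂ) * ee (n * γ) +
          ((Real.log ((Y + 1 : ℕ) : ℝ) ^ 2 : ℝ) : ℂ) * (ee (((Y + 1 : ℕ) : ℝ) * (e * γ)) - ee (n * γ)) := by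
        rw [hz]; push_cast; ring
      rw [e1]
      refine (norm_add_le _ _).trans (add_le_add ?_ ?_)
      · rw [norm_mul, norm_ee, mul_one, Complex.norm_real, Real.norm_eq_abs]
        have u1 : lw e n ≤ Real.log ((Y + 1 : ℕ) : ℝ) ^ 2 := by
          rw [← lw_mul he]; exact lw_mono e hn0 hn.2
        have u2 : Real.log Y ^ 2 ≤ lw e n := by
          rcases Nat.eq_zero_or_pos Y with rfl | hY0
          · simpa using lw_nonneg e n
          rw [← lw_mul he Y]; exact lw_mono e (Nat.mul_pos he hY0) hn.1.le
        rw [abs_of_nonneg (by linarith)]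
        linarith
      · rw [norm_mul, Complex.norm_real, Real.norm_eq_abs, abs_of_nonneg (sq_nonneg _), mul_comm]
        have u1 : Real.log ((Y + 1 : ℕ) : ℝ) ≤ Real.log X :=
          Real.log_le_log (by positivity) (by exact_mod_cast hY)
        have u0 : 0 ≤ Real.log ((Y + 1 : ℕ) : ℝ) := Real.log_natCast_nonneg _
        have u2 : |((Y + 1 : ℕ) : ℝ) * (e * γ) - n * γ| ≤ e * |γ| := by
          rw [show ((Y + 1 : ℕ) : ℝ) * (e * γ) - n * γ = (((e * (Y + 1) : ℕ) : ℝ) - n) * γ by push_cast; ring, abs_mul]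
          gcongr
          have v1 : (n : ℝ) ≤ ((e * (Y + 1) : ℕ) : ℝ) := by exact_mod_cast hn.2
          rw [abs_of_nonneg (by linarith)]
          have v2 : ((e * Y : ℕ) : ℝ) ≤ n := by exact_mod_cast hn.1.le
          push_cast at v1 v2 ⊢
          linarith
        have u3 := norm_ee_sub_ee_le (((Y + 1 : ℕ) : ℝ) * (e * γ)) (n * γ)
        calc _ ≤ (2 * Real.pi * (e * |γ|)) * Real.log X ^ 2 := by
              gcongr
              refine u3.trans ?_
              gcongr
          _ = _ := by ring
    calc _ = ‖(A - B) + ((e : ℂ) * z - ∑ n ∈ Ioc (e * Y) (e * (Y + 1)), (lw e n : ℂ) * ee (n * γ))‖ := by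
          congr 1; ring
      _ ≤ _ := (norm_add_le _ _).trans (add_le_add h1 h2)
      _ = _ := by push_cast; ring

/-- Comparison of the sum over multiples of `e` with a full weighted exponential sum. -/
lemma norm_log_sq_sub_le {e X : ℕ} (he : 0 < e) (γ : ℝ) :
    ‖(e : ℂ) * ∑ m ∈ Ioc 0 (X / e), ((Real.log m ^ 2 : ℝ) : ℂ) * ee (m * (e * γ)) -
      ∑ n ∈ Ioc 0 X, (lw e n : ℂ) * ee (n * γ)‖ ≤
      e * (Real.log X ^ 2 * (2 + 2 * Real.pi * |γ| * X)) := by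
  have h1 := norm_log_sq_sub_block_le (X := X) he γ (Nat.div_le_self X e)
  have hle : e * (X / e) ≤ X := Nat.mul_div_le X e
  rw [← sum_Ioc_consecutive _ (Nat.zero_le _) hle, ← sub_sub]
  have h2 : ‖∑ n ∈ Ioc (e * (X / e)) X, (lw e n : ℂ) * ee (n * γ)‖ ≤ e * Real.log X ^ 2 := by
    refine (norm_sum_le _ _).trans ((sum_le_card_nsmul _ _ (Real.log X ^ 2) fun n hn => ?_).trans ?_)
    · rw [norm_mul, norm_ee, mul_one, Complex.norm_real, Real.norm_eq_abs, abs_of_nonneg (lw_nonneg e n)]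
      exact lw_le (mem_Ioc.mp hn).2
    · rw [nsmul_eq_mul, Nat.card_Ioc]
      have : X - e * (X / e) ≤ e := by
        have := Nat.mod_lt X he
        have := Nat.mod_add_div X e
        omega
      gcongr
  have h3 : Real.log ((X / e : ℕ) : ℝ) ^ 2 ≤ Real.log X ^ 2 := by
    have u0 : 0 ≤ Real.log ((X / e : ℕ) : ℝ) := Real.log_natCast_nonneg _
    rcases Nat.eq_zero_or_pos (X / e) with h | h
    · rw [h]; simp; positivity
    have : Real.log ((X / e : ℕ) : ℝ) ≤ Real.log X :=
      Real.log_le_log (by exact_mod_cast h) (by exact_mod_cast Nat.div_le_self X e)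
    gcongr
  have h4 : ((X / e : ℕ) : ℝ) * e ≤ X := by exact_mod_cast Nat.div_mul_le_self X e
  refine (norm_sub_le _ _).trans ((add_le_add h1 h2).trans ?_)
  calc _ = e * Real.log ((X / e : ℕ) : ℝ) ^ 2 + (((X / e : ℕ) : ℝ) * e) * (e * (2 * Real.pi * |γ|)) * Real.log X ^ 2
        + e * Real.log X ^ 2 := by ring
    _ ≤ e * Real.log X ^ 2 + X * (e * (2 * Real.pi * |γ|)) * Real.log X ^ 2
        + e * Real.log X ^ 2 := by gcongr
    _ = _ := by ring

/-- The density `∑ μ(e) log(n/e)^2 / e` over `e ≤ n` coprime to `q`. -/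
noncomputable def m2 (q n : ℕ) : ℝ := ∑ e ∈ Ioc 0 n, mu q e / e * lw e n

lemma m2_eq (q : ℕ) {n X : ℕ} (h : n ≤ X) : m2 q n = ∑ e ∈ Ioc 0 X, mu q e / e * lw e n := by
  unfold m2
  apply sum_subset (Ioc_subset_Ioc_right h)
  intro e he hen
  rw [mem_Ioc] at he hen
  have h1 : n ≤ e := by omega
  have : lw e n = 0 := by
    rcases Nat.eq_zero_or_pos n with rfl | hn
    · exact lw_zero_right e
    unfold lw
    have : Real.log n ≤ Real.log e := Real.log_le_log (by exact_mod_cast hn) (by exact_mod_cast h1)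
    rw [max_eq_left (by linarith)]
    simp
  rw [this, mul_zero]

lemma m2_succ_sub (q n : ℕ) : m2 q (n + 1) - m2 q n =
    (Real.log ((n + 1 : ℕ) : ℝ) - Real.log n) * (m1 q (n + 1) + m1 q n) := by
  have hm1 : m1 q (n + 1) = ∑ e ∈ Ioc 0 n, mu q e / e * (Real.log ((n + 1 : ℕ) : ℝ) - Real.log e) := by
    unfold m1
    rw [sum_Ioc_succ_top (Nat.zero_le _)]
    simp
  have hm2 : m2 q (n + 1) = ∑ e ∈ Ioc 0 n, mu q e / e * (Real.log ((n + 1 : ℕ) : ℝ) - Real.log e) ^ 2 := by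
    unfold m2
    rw [sum_Ioc_succ_top (Nat.zero_le _)]
    have : lw (n + 1) (n + 1) = 0 := by simp [lw]
    rw [this, mul_zero, add_zero]
    refine sum_congr rfl fun e he => ?_
    rw [mem_Ioc] at he
    rw [lw, max_eq_right]
    exact sub_nonneg.mpr (Real.log_le_log (by exact_mod_cast he.1) (by exact_mod_cast he.2.trans (Nat.le_succ n)))
  have hm2' : m2 q n = ∑ e ∈ Ioc 0 n, mu q e / e * (Real.log (n : ℝ) - Real.log e) ^ 2 := by
    unfold m2
    refine sum_congr rfl fun e he => ?_
    rw [mem_Ioc] at he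
    rw [lw, max_eq_right]
    exact sub_nonneg.mpr (Real.log_le_log (by exact_mod_cast he.1) (by exact_mod_cast he.2))
  rw [hm1, hm2, hm2', m1, ← sum_sub_distrib, ← sum_add_distrib, mul_sum]
  exact sum_congr rfl fun e _ => by ring

lemma abs_le_nn {x : ℝ} (hx : |x| ≤ 1 / 2) : |x| ≤ nn x := by
  obtain ⟨m, hm⟩ := exists_int_nn x
  rw [hm]
  by_cases h : m = 0
  · simp [h]
  · have h1 : (1 : ℝ) ≤ |(m : ℝ)| := by exact_mod_cast Int.one_le_abs h
    have h2 := abs_sub_abs_le_abs_sub (m : ℝ) x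
    rw [abs_sub_comm] at h2
    linarith

lemma norm_sum_m2_le {q X : ℕ} {C γ : ℝ} (hC : ∀ n : ℕ, |m1 q n| ≤ C) (hγ : 0 < |γ|) (hγ2 : |γ| ≤ 1 / 2) :
    ‖∑ n ∈ Ioc 0 X, (m2 q n : ℂ) * ee (n * γ)‖ ≤ 4 * C * Real.log (X + 1) / |γ| := by
  have h1 : ∑ n ∈ Ioc 0 X, (m2 q n : ℂ) * ee (n * γ) = ∑ n ∈ range (X + 1), (m2 q n : ℂ) * ee (n * γ) := by
    rw [sum_range_succ_eq_Ioc]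
    simp [m2]
  have hnn := abs_le_nn hγ2
  have hstep : ∀ i : ℕ, |m2 q (i + 1) - m2 q i| ≤ 2 * C * (Real.log ((i + 1 : ℕ) : ℝ) - Real.log (i : ℝ)) := by
    intro i
    have h0 : 0 ≤ Real.log ((i + 1 : ℕ) : ℝ) - Real.log (i : ℝ) := by
      rcases Nat.eq_zero_or_pos i with rfl | hi
      · simp
      exact sub_nonneg.mpr (Real.log_le_log (by exact_mod_cast hi) (by push_cast; linarith))
    rw [m2_succ_sub, abs_mul, abs_of_nonneg h0, mul_comm]
    gcongr
    refine (abs_add_le _ _).trans ?_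
    linarith [hC i, hC (i + 1)]
  have hsum : ∑ i ∈ range (X + 1), |m2 q (i + 1) - m2 q i| ≤ 2 * C * Real.log (X + 1) := by
    refine (sum_le_sum fun i _ => hstep i).trans (le_of_eq ?_)
    rw [← mul_sum, sum_range_sub (fun i : ℕ => Real.log (i : ℝ))]
    simp
  have hend : |m2 q (X + 1)| ≤ 2 * C * Real.log (X + 1) := by
    refine le_trans ?_ hsum
    have : m2 q (X + 1) = ∑ i ∈ range (X + 1), (m2 q (i + 1) - m2 q i) := by
      rw [sum_range_sub]; simp [m2]
    rw [this]
    exact abs_sum_le_sum_abs _ _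
  rw [h1]
  refine (norm_sum_mul_le_abel (fun n => m2 q n) (fun n => ee (n * γ)) (X + 1) (A := 1 / |γ|) (fun k _ => ?_)).trans ?_
  · have := norm_geom_sum_ee_le γ (hγ.trans_le hnn) 0 k
    rw [← range_eq_Ico] at this
    refine this.trans ?_
    gcongr
  · calc _ ≤ 1 / |γ| * (2 * C * Real.log (X + 1) + 2 * C * Real.log (X + 1)) := by gcongr
      _ = _ := by ring

lemma moebius_mul_eq (q e : ℕ) : ((ArithmeticFunction.moebius (q * e) : ℤ) : ℝ) =
    ((ArithmeticFunction.moebius q : ℤ) : ℝ) * mu q e := by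
  unfold mu chi
  split_ifs with h
  · rw [ArithmeticFunction.isMultiplicative_moebius.map_mul_of_coprime h]
    push_cast; ring
  · rw [ArithmeticFunction.moebius_eq_zero_of_not_squarefree
      (fun hs => h (Nat.coprime_of_squarefree_mul hs))]
    simp

lemma norm_typeIMul_le {q N E : ℕ} {C β : ℝ} (hq : 0 < q) (hC : ∀ n : ℕ, |m1 q n| ≤ C)
    (hβ : 0 < |β|) (hβ2 : q * |β| ≤ 1 / 2) (hE : 0 < E) (hEX : E ≤ N / q) :
    ‖typeIMul q N β‖ ≤ 4 * C * Real.log ((N / q : ℕ) + 1) / (q * |β|) +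
      E * (Real.log (N / q : ℕ) ^ 2 * (2 + 2 * Real.pi * (q * |β|) * (N / q : ℕ))) +
      2 * ((N / q : ℕ) * (Real.log (N / q : ℕ) - Real.log E) ^ 3) := by
  set X := N / q with hX
  set γ : ℝ := q * β with hγ
  have hq' : (0 : ℝ) < q := by exact_mod_cast hq
  have hγabs : |γ| = q * |β| := by rw [hγ, abs_mul, Nat.abs_cast]
  rw [← hγabs]
  rw [← hγabs] at hβ2
  have hγ0 : 0 < |γ| := by rw [hγabs]; positivity
  set I : ℕ → ℂ := fun e => ∑ m ∈ Ioc 0 (X / e), ((Real.log m ^ 2 : ℝ) : ℂ) * ee (m * (e * γ)) with hI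
  set J : ℕ → ℂ := fun e => ∑ n ∈ Ioc 0 X, (lw e n : ℂ) * ee (n * γ) with hJ
  have h1 : typeIMul q N β = (ArithmeticFunction.moebius q : ℂ) * ∑ e ∈ Ioc 0 X, (mu q e : ℂ) * I e := by
    unfold typeIMul
    rw [mul_sum]
    symm
    refine sum_bij (fun e _ => q * e) ?_ ?_ ?_ ?_
    · intro e he
      rw [mem_Ioc] at he
      rw [mem_filter, mem_Ioc]
      refine ⟨⟨Nat.mul_pos hq he.1, ?_⟩, dvd_mul_right q e⟩
      calc q * e ≤ q * X := Nat.mul_le_mul_left q he.2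
        _ ≤ N := Nat.mul_div_le N q
    · intro e _ e' _ h
      exact Nat.eq_of_mul_eq_mul_left hq h
    · intro d hd
      rw [mem_filter, mem_Ioc] at hd
      obtain ⟨e, rfl⟩ := hd.2
      refine ⟨e, ?_, rfl⟩
      rw [mem_Ioc]
      exact ⟨Nat.pos_of_mul_pos_left hd.1.1, (Nat.le_div_iff_mul_le hq).mpr (by rw [mul_comm]; exact hd.1.2)⟩
    · intro e _
      have := moebius_mul_eq q e
      have h2 : ((ArithmeticFunction.moebius (q * e) : ℤ) : ℂ) = ((ArithmeticFunction.moebius q : ℤ) : ℂ) * (mu q e : ℂ) := by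
        exact_mod_cast congrArg (fun x : ℝ => (x : ℂ)) this
      rw [h2, ← Nat.div_div_eq_div_mul, mul_assoc]
      congr 2
      refine sum_congr rfl fun m _ => ?_
      congr 2
      rw [hγ]; push_cast; ring
  have h2 : ∑ e ∈ Ioc 0 X, (mu q e : ℂ) * I e = ∑ n ∈ Ioc 0 X, (m2 q n : ℂ) * ee (n * γ) +
      ∑ e ∈ Ioc 0 X, (mu q e : ℂ) * (I e - J e / e) := by
    have h3 : ∑ n ∈ Ioc 0 X, (m2 q n : ℂ) * ee (n * γ) = ∑ e ∈ Ioc 0 X, (mu q e : ℂ) * (J e / e) := by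
      have h4 : ∀ n ∈ Ioc 0 X, (m2 q n : ℂ) * ee (n * γ) =
          ∑ e ∈ Ioc 0 X, ((mu q e / e * lw e n : ℝ) : ℂ) * ee (n * γ) := by
        intro n hn
        rw [m2_eq q (mem_Ioc.mp hn).2, Complex.ofReal_sum, sum_mul]
      rw [sum_congr rfl h4, sum_comm]
      refine sum_congr rfl fun e _ => ?_
      rw [hJ]
      simp only
      rw [sum_div, mul_sum]
      refine sum_congr rfl fun n _ => ?_
      push_cast
      ring
    rw [h3, ← sum_add_distrib]
    exact sum_congr rfl fun e _ => by ring
  have hmu : ∀ e, ‖(mu q e : ℂ)‖ ≤ 1 := fun e => by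
    rw [Complex.norm_real]; exact abs_mu_le q e
  have h3 : ∑ e ∈ Ioc 0 E, ‖I e - J e / e‖ ≤ E * (Real.log X ^ 2 * (2 + 2 * Real.pi * |γ| * X)) := by
    refine (sum_le_card_nsmul _ _ (Real.log X ^ 2 * (2 + 2 * Real.pi * |γ| * X)) fun e he => ?_).trans (by simp)
    have he0 := (mem_Ioc.mp he).1
    have he' : (0 : ℝ) < e := by exact_mod_cast he0
    have hec : (e : ℂ) ≠ 0 := by exact_mod_cast he0.ne'
    have h4 := norm_log_sq_sub_le (X := X) he0 γ
    have h5 : I e - J e / e = ((e : ℂ) * I e - J e) / e := by field_simp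
    rw [h5, norm_div, Complex.norm_natCast, div_le_iff₀ he', mul_comm _ (e : ℝ)]
    exact h4
  have h4 : ∑ e ∈ Ioc E X, ‖I e - J e / e‖ ≤ 2 * (X * (Real.log X - Real.log E) ^ 3) := by
    have hXE : Real.log E ≤ Real.log X := Real.log_le_log (by exact_mod_cast hE) (by exact_mod_cast hEX)
    have a1 := sum_norm_sum_log_sq_le hE hEX (fun e m => ee (m * (e * γ))) fun _ _ => (norm_ee _).le
    have a2 : ∑ e ∈ Ioc E X, ‖J e / e‖ ≤ X * (Real.log X - Real.log E) ^ 3 := by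
      have : ∀ e ∈ Ioc E X, ‖J e / e‖ ≤ X * (Real.log X - Real.log E) ^ 2 * (1 / e) := by
        intro e he
        rw [mem_Ioc] at he
        have he' : (0 : ℝ) < e := by exact_mod_cast hE.trans he.1
        rw [norm_div, Complex.norm_natCast, div_eq_mul_one_div]
        gcongr
        refine (norm_sum_le _ _).trans ((sum_le_card_nsmul _ _ ((Real.log X - Real.log E) ^ 2) fun n hn => ?_).trans (by simp))
        rw [mem_Ioc] at hn
        rw [norm_mul, norm_ee, mul_one, Complex.norm_real, Real.norm_eq_abs, abs_of_nonneg (lw_nonneg e n)]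
        refine (lw_mono e hn.1 hn.2).trans ?_
        unfold lw
        have : Real.log E ≤ Real.log e := Real.log_le_log (by exact_mod_cast hE) (by exact_mod_cast he.1.le)
        have : max 0 (Real.log X - Real.log e) ≤ Real.log X - Real.log E := max_le (by linarith) (by linarith)
        gcongr
      refine (sum_le_sum this).trans ?_
      rw [← mul_sum]
      calc _ ≤ X * (Real.log X - Real.log E) ^ 2 * (Real.log X - Real.log E) := by
            gcongr; exact sum_Ioc_one_div_le hE hEX
        _ = _ := by ring
    refine (sum_le_sum fun e _ => norm_sub_le (I e) (J e / e)).trans ?_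
    rw [sum_add_distrib]
    linarith
  have h5 : ‖∑ e ∈ Ioc 0 X, (mu q e : ℂ) * (I e - J e / e)‖ ≤
      E * (Real.log X ^ 2 * (2 + 2 * Real.pi * |γ| * X)) + 2 * (X * (Real.log X - Real.log E) ^ 3) := by
    calc _ ≤ ∑ e ∈ Ioc 0 X, ‖I e - J e / e‖ := by
          refine (norm_sum_le _ _).trans (sum_le_sum fun e _ => ?_)
          rw [norm_mul]
          exact mul_le_of_le_one_left (norm_nonneg _) (hmu e)
      _ = ∑ e ∈ Ioc 0 E, ‖I e - J e / e‖ + ∑ e ∈ Ioc E X, ‖I e - J e / e‖ :=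
          (sum_Ioc_consecutive _ (Nat.zero_le _) hEX).symm
      _ ≤ _ := add_le_add h3 h4
  rw [h1, norm_mul]
  refine (mul_le_of_le_one_left (norm_nonneg _) (norm_moebius_le q)).trans ?_
  rw [h2]
  refine (norm_add_le _ _).trans ?_
  have h6 := norm_sum_m2_le (X := X) hC hγ0 hβ2
  linarith

/-- Decay of the type I sum over multiples of a fixed denominator away from the rational point. -/
lemma exists_norm_typeIMul_le {q : ℕ} (hq : 0 < q) : ∃ C : ℝ, 0 < C ∧ ∀ ε > (0 : ℝ), ∃ N₀ : ℕ, ∀ N ≥ N₀,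
    ∀ β : ℝ, 0 < |β| → |β| * (q * N) ≤ Real.log N ^ 4 →
    ‖typeIMul q N β‖ ≤ C * Real.log N / |β| + ε * N * Real.log N := by
  obtain ⟨C, hC0, hC⟩ := exists_abs_m1_le hq
  refine ⟨8 * C + 1, by positivity, fun ε hε => ?_⟩
  have e1 := tendsto_log_natCast.eventually
    (eventually_log_mul_pow_cube_le (show 0 < ε / 4 by positivity) (c := 2) (by norm_num) 7)
  have e2 := tendsto_log_natCast.eventually (Filter.eventually_ge_atTop (max 1 (20 / ε)))
  have e3 := eventually_log_pow_le (2 * q) 7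
  have e4 := eventually_log_pow_le 2 4
  obtain ⟨N₀, hN₀⟩ := Filter.eventually_atTop.mp (e1.and (e2.and (e3.and (e4.and
    (Filter.eventually_ge_atTop (2 * q))))))
  refine ⟨N₀, fun N hN β hβ0 hβ => ?_⟩
  obtain ⟨h1, h2, h3, h4, h5⟩ := hN₀ N hN
  set L := Real.log N with hL
  have hL1 : 1 ≤ L := (le_max_left _ _).trans h2
  have hL2 : 20 / ε ≤ L := (le_max_right _ _).trans h2
  have hq' : (1 : ℝ) ≤ q := by exact_mod_cast hq
  have hqp : (0 : ℝ) < q := by linarith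
  have hN2 : 2 * (q : ℝ) ≤ N := by exact_mod_cast h5
  have hNp : (2 : ℝ) ≤ N := by linarith
  set X := N / q with hX
  have hX1 : (N : ℝ) / (2 * q) ≤ X := by
    have e2 : (N : ℝ) / q ≤ (X : ℝ) + 1 := by
      rw [hX, ← Nat.floor_div_eq_div (K := ℝ)]; exact (Nat.lt_floor_add_one _).le
    have : (1 : ℝ) ≤ N / (2 * q) := by rw [le_div_iff₀ (by positivity)]; linarith
    have : (N : ℝ) / q = 2 * (N / (2 * q)) := by field_simp
    linarith
  have hXL : L ^ 7 ≤ X := by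
    refine le_trans ?_ hX1
    rw [le_div_iff₀ (by positivity)]; linarith
  have hqX : (q : ℝ) * X ≤ N := by exact_mod_cast Nat.mul_div_le N q
  have hXN : (X : ℝ) ≤ N := by exact_mod_cast Nat.div_le_self N q
  have hL7 : 1 ≤ L ^ 7 := one_le_pow₀ hL1
  have hXp : (0 : ℝ) < X := by linarith
  set x : ℝ := X / L ^ 7 with hx
  have hx1 : 1 ≤ x := by rw [hx, le_div_iff₀ (by positivity)]; linarith
  set E := ⌊x⌋₊ with hE
  have hE0 : 0 < E := Nat.floor_pos.mpr hx1
  have hEx : (E : ℝ) ≤ x := Nat.floor_le (by linarith)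
  have hEX : E ≤ X := by
    have : (E : ℝ) ≤ X := hEx.trans (div_le_self hXp.le hL7)
    exact_mod_cast this
  have hEx2 : x / 2 ≤ E := by
    have := Nat.lt_floor_add_one x
    rw [← hE] at this
    have hD1 : (1 : ℝ) ≤ E := by exact_mod_cast hE0
    linarith
  have hβ2 : q * |β| ≤ 1 / 2 := by
    rw [le_div_iff₀ (by norm_num)]
    have : q * |β| * 2 * N ≤ 1 * N := by linarith
    exact le_of_mul_le_mul_right this (by linarith)
  have hE0' : (0 : ℝ) < E := by exact_mod_cast hE0
  refine (norm_typeIMul_le hq hC hβ0 hβ2 hE0 hEX).trans ?_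
  rw [← hX]
  have hlogX : Real.log X ≤ L := Real.log_le_log hXp hXN
  have hlogX0 : 0 ≤ Real.log (X : ℝ) := Real.log_natCast_nonneg X
  have hlogX1 : Real.log ((X : ℝ) + 1) ≤ 2 * L := by
    rw [hL, ← Real.log_rpow (by positivity)]
    apply Real.log_le_log (by positivity)
    norm_num
    nlinarith
  have b1 : 4 * C * Real.log ((X : ℝ) + 1) / (q * |β|) ≤ (8 * C + 1) * L / |β| := by
    have : |β| ≤ q * |β| := le_mul_of_one_le_left hβ0.le hq'
    calc _ ≤ 4 * C * (2 * L) / |β| := by gcongr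
      _ = 8 * C * L / |β| := by ring
      _ ≤ _ := by gcongr; linarith
  have b2 : E * (Real.log X ^ 2 * (2 + 2 * Real.pi * (q * |β|) * X)) ≤ ε / 2 * N * L := by
    have u1 : (q * |β|) * X ≤ L ^ 4 := by
      calc (q * |β|) * X = |β| * (q * X) := by ring
        _ ≤ |β| * N := by gcongr
        _ ≤ |β| * (q * N) := by gcongr; nlinarith
        _ ≤ _ := hβ
    have u2 : 2 + 2 * Real.pi * (q * |β|) * X ≤ 10 * L ^ 4 := by
      have hp := Real.pi_lt_four
      have hL4 : 1 ≤ L ^ 4 := one_le_pow₀ hL1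
      calc 2 + 2 * Real.pi * (q * |β|) * X = 2 + 2 * Real.pi * ((q * |β|) * X) := by ring
        _ ≤ 2 + 2 * 4 * L ^ 4 := by gcongr
        _ ≤ _ := by linarith
    calc _ ≤ (N : ℝ) / L ^ 7 * (L ^ 2 * (10 * L ^ 4)) := by
          gcongr
          refine hEx.trans ?_
          rw [hx]; gcongr
      _ = 10 * N / L := by field_simp
      _ ≤ _ := by
        rw [div_le_iff₀ (by linarith)]
        have : 20 ≤ L * ε := by rwa [div_le_iff₀ hε] at hL2
        have h5 : 10 ≤ ε / 2 * (L * L) := by nlinarith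
        nlinarith
  have b3 : 2 * (X * (Real.log X - Real.log E) ^ 3) ≤ ε / 2 * N * L := by
    have h5 : Real.log X - Real.log E ≤ Real.log (2 * L ^ 7) := by
      rw [← Real.log_div (by positivity) (by positivity)]
      apply Real.log_le_log (by positivity)
      rw [div_le_iff₀ (by positivity)]
      calc (X : ℝ) = 2 * L ^ 7 * (x / 2) := by rw [hx]; field_simp
        _ ≤ _ := by gcongr
    have h6 : (Real.log X - Real.log E) ^ 3 ≤ ε / 4 * L := le_trans ((Odd.pow_le_pow (by decide)).mpr h5) h1
    calc _ ≤ 2 * (X * (ε / 4 * L)) := by gcongr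
      _ ≤ 2 * (N * (ε / 4 * L)) := by gcongr
      _ = _ := by ring
  linarith

lemma exists_separated {ι : Type} [DecidableEq ι] (A : Finset ι) (θ : ι → ℝ) (r : ℝ) (hr : 0 < r) :
    ∃ A' ⊆ A, (∀ j ∈ A', ∀ k ∈ A', j ≠ k → r ≤ nn (θ j - θ k)) ∧ ∀ k ∈ A, ∃ j ∈ A', nn (θ k - θ j) < r := by
  induction A using Finset.induction_on with
  | empty => exact ⟨∅, by simp, by simp, by simp⟩
  | insert a A _ ih =>
    obtain ⟨A', hA, h1, h2⟩ := ih
    by_cases h : ∃ j ∈ A', nn (θ a - θ j) < r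
    · refine ⟨A', hA.trans (subset_insert _ _), h1, fun k hk => ?_⟩
      rcases mem_insert.mp hk with rfl | hk
      · exact h
      · exact h2 k hk
    · push Not at h
      refine ⟨insert a A', insert_subset_insert _ hA, ?_, fun k hk => ?_⟩
      · intro j hj k hk hjk
        rcases mem_insert.mp hj with hj' | hj' <;> rcases mem_insert.mp hk with hk' | hk'
        · exact absurd (hj'.trans hk'.symm) hjk
        · rw [hj']; exact h k hk'
        · rw [hk', nn_sub_comm]; exact h j hj'
        · exact h1 j hj' k hk' hjk
      · rcases mem_insert.mp hk with rfl | hk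
        · refine ⟨k, mem_insert_self _ _, ?_⟩
          rw [sub_self]
          have : nn (0 : ℝ) = 0 := by simpa using nn_int 0
          rwa [this]
        · obtain ⟨j, hj, hjr⟩ := h2 k hk
          exact ⟨j, mem_insert_of_mem hj, hjr⟩

lemma exists_lt_totient (n : ℕ) : ∃ Q : ℕ, ∀ q ≥ Q, n < q.totient := by
  refine ⟨(2 * n).factorial + 1, fun q hq => ?_⟩
  by_contra! h
  have hq0 : 0 < q := by omega
  have hdvd : q ∣ (2 * n).factorial := by
    rw [Nat.dvd_iff_prime_pow_dvd_dvd]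
    intro p k hp hpk
    rcases Nat.eq_zero_or_pos k with rfl | hk
    · simp
    have h1 : (p ^ k).totient ≤ n :=
      (Nat.le_of_dvd (Nat.totient_pos.mpr hq0) (Nat.totient_dvd_of_dvd hpk)).trans h
    rw [Nat.totient_prime_pow hp hk] at h1
    have h2 : p ^ k ≤ 2 * n := by
      obtain ⟨j, rfl⟩ : ∃ j, k = j + 1 := ⟨k - 1, by omega⟩
      rw [Nat.add_sub_cancel] at h1
      have := hp.two_le
      calc p ^ (j + 1) = p ^ j * p := pow_succ _ _
        _ ≤ p ^ j * (2 * (p - 1)) := Nat.mul_le_mul_left _ (by omega)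
        _ = 2 * (p ^ j * (p - 1)) := by ring
        _ ≤ 2 * n := by omega
    exact Nat.dvd_factorial (Nat.pos_of_ne_zero (pow_ne_zero _ hp.ne_zero)) h2
  have := Nat.le_of_dvd (Nat.factorial_pos _) hdvd
  omega

lemma sum_mod_le {q a : ℕ} (hq : 0 < q) (ha : a.Coprime q) (F : ℕ → ℝ) (hF : ∀ n, 0 ≤ F n) (c H : ℕ) :
    ∑ i ∈ range H, F ((i + c) * a % q) ≤ ((H / q + 1 : ℕ) : ℝ) * ∑ r ∈ range q, F r := by
  have hblock : ∀ c, ∑ i ∈ range q, F ((i + c) * a % q) ≤ ∑ r ∈ range q, F r := by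
    intro c
    have hinj : Set.InjOn (fun d => (d + c) * a % q) (range q : Set ℕ) := by
      intro x hx y hy hxy
      simp only [coe_range, Set.mem_Iio] at hx hy
      have h1 : (x + c) * a ≡ (y + c) * a [MOD q] := hxy
      have h2 := Nat.ModEq.cancel_right_of_coprime (by rwa [Nat.coprime_comm] at ha) h1
      exact Nat.ModEq.eq_of_lt_of_lt (Nat.ModEq.add_right_cancel' c h2) hx hy
    calc _ = ∑ r ∈ (range q).image (fun d => (d + c) * a % q), F r := by rw [sum_image hinj]
      _ ≤ _ := by
          apply sum_le_sum_of_subset_of_nonneg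
          · intro r hr
            obtain ⟨d, _, rfl⟩ := mem_image.mp hr
            exact mem_range.mpr (Nat.mod_lt _ hq)
          · intro r _ _
            exact hF r
  have hall : ∀ k, ∑ i ∈ range (q * k), F ((i + c) * a % q) ≤ (k : ℝ) * ∑ r ∈ range q, F r := by
    intro k
    induction k with
    | zero => simp
    | succ k ih =>
      rw [Nat.mul_succ, sum_range_add]
      have := hblock (q * k + c)
      have h2 : ∑ x ∈ range q, F ((q * k + x + c) * a % q) = ∑ x ∈ range q, F ((x + (q * k + c)) * a % q) :=
        sum_congr rfl fun x _ => by rw [show q * k + x + c = x + (q * k + c) by ring]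
      rw [h2]
      push_cast
      linarith
  refine le_trans ?_ (hall (H / q + 1))
  apply sum_le_sum_of_subset_of_nonneg
  · intro d hd
    rw [mem_range] at hd ⊢
    exact hd.trans (Nat.lt_mul_div_succ H hq)
  · intro d _ _
    exact hF _

lemma card_nn_div_le {q : ℕ} (hq : 0 < q) {ρ : ℝ} (hρ : 0 ≤ ρ) :
    (((range q).filter (fun r : ℕ => nn ((r : ℝ) / q) ≤ ρ)).card : ℝ) ≤ 2 * ρ * q + 1 := by
  have hq' : (0 : ℝ) < q := by exact_mod_cast hq
  have h1 : (range q).filter (fun r : ℕ => nn ((r : ℝ) / q) ≤ ρ) ⊆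
      range (⌊ρ * q⌋₊ + 1) ∪ (Ico 1 (⌊ρ * q⌋₊ + 1)).image (fun i => q - i) := by
    intro r hr
    rw [mem_filter, mem_range] at hr
    obtain ⟨m, hm⟩ := exists_int_nn ((r : ℝ) / q)
    have hr2 := hr.2
    rw [hm] at hr2
    have hrq : (r : ℝ) < q := by exact_mod_cast hr.1
    rw [mem_union]
    rcases le_or_gt m 0 with h | h
    · left
      have hm' : (m : ℝ) ≤ 0 := by exact_mod_cast h
      rw [mem_range, Nat.lt_succ_iff]
      apply Nat.le_floor
      have : (r : ℝ) / q ≤ ρ := by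
        have := le_abs_self ((r : ℝ) / q - m)
        linarith
      rwa [div_le_iff₀ hq'] at this
    · right
      have hm' : (1 : ℝ) ≤ m := by exact_mod_cast h
      rw [mem_image]
      refine ⟨q - r, ?_, by omega⟩
      rw [mem_Ico]
      refine ⟨by omega, ?_⟩
      rw [Nat.lt_succ_iff]
      apply Nat.le_floor
      rw [Nat.cast_sub hr.1.le]
      have : 1 - (r : ℝ) / q ≤ ρ := by
        have := neg_abs_le ((r : ℝ) / q - m)
        linarith
      have h2 : (1 - (r : ℝ) / q) * q ≤ ρ * q := by gcongr
      rw [sub_mul, div_mul_cancel₀ _ hq'.ne'] at h2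
      linarith
  have h2 := (card_le_card h1).trans ((card_union_le _ _).trans (Nat.add_le_add_left card_image_le _))
  rw [card_range, Nat.card_Ico] at h2
  have h3 : (((range q).filter (fun r : ℕ => nn ((r : ℝ) / q) ≤ ρ)).card : ℝ) ≤ 2 * (⌊ρ * q⌋₊ : ℝ) + 1 := by
    exact_mod_cast h2.trans (by omega)
  have h4 : (⌊ρ * q⌋₊ : ℝ) ≤ ρ * q := Nat.floor_le (by positivity)
  linarith

/-- The number of `k` in an interval for which `k α` is close to `k₀ α`, with `α` close to `a / q`. -/
lemma card_near_le {q a : ℕ} (hq : 0 < q) (ha : a.Coprime q) {ρ : ℝ} (hρ : 0 ≤ ρ) (K H k₀ : ℕ) :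
    (((Ioc K (K + H)).filter (fun k : ℕ => nn ((k : ℝ) * (a / q) - k₀ * (a / q)) ≤ ρ)).card : ℝ) ≤
      ((H / q + 1 : ℕ) : ℝ) * (2 * ρ * q + 1) := by
  have hq' : (0 : ℝ) < q := by exact_mod_cast hq
  set c := k₀ * (q - 1) with hc
  have hnn : ∀ k : ℕ, nn ((k : ℝ) * (a / q) - k₀ * (a / q)) = nn ((((k + c) * a % q : ℕ) : ℝ) / q) := by
    intro k
    have h2 : (((k + c) * a % q + q * ((k + c) * a / q) : ℕ) : ℝ) = (((k + c) * a : ℕ) : ℝ) := by rw [Nat.mod_add_div]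
    rw [Nat.cast_add, Nat.cast_mul q, Nat.cast_mul (k + c), Nat.cast_add k, hc, Nat.cast_mul k₀, Nat.cast_sub hq] at h2
    rw [← hc] at h2
    have h1 : (k : ℝ) * (a / q) - k₀ * (a / q) = (((k + c) * a % q : ℕ) : ℝ) / q +
        ((((k + c) * a / q : ℕ) : ℤ) - ((k₀ * a : ℕ) : ℤ) : ℤ) := by
      rw [Int.cast_sub, Int.cast_natCast, Int.cast_natCast, Nat.cast_mul k₀]
      push_cast at h2
      field_simp
      linarith
    rw [h1, nn_add_int]
  have h1 : (((Ioc K (K + H)).filter (fun k : ℕ => nn ((k : ℝ) * (a / q) - k₀ * (a / q)) ≤ ρ)).card : ℝ) =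
      ∑ i ∈ range H, (fun r : ℕ => if nn ((r : ℝ) / q) ≤ ρ then (1 : ℝ) else 0) ((i + (K + 1 + c)) * a % q) := by
    rw [card_filter, Nat.cast_sum]
    have : Ioc K (K + H) = Ico (K + 1) (K + 1 + H) := by ext; simp; omega
    rw [this, sum_Ico_eq_sum_range, Nat.add_sub_cancel_left]
    refine sum_congr rfl fun i _ => ?_
    rw [hnn, show i + (K + 1 + c) = K + 1 + i + c by ring]
    push_cast
    rfl
  rw [h1]
  refine (sum_mod_le hq ha (fun r : ℕ => if nn ((r : ℝ) / q) ≤ ρ then (1 : ℝ) else 0)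
    (fun n => by positivity) _ _).trans ?_
  gcongr
  have := card_nn_div_le hq hρ
  rw [card_filter] at this
  push_cast at this
  exact this

lemma one_div_le_nn_int_div {q : ℕ} {b : ℤ} (hq : 0 < q) (h : ¬ (q : ℤ) ∣ b) : 1 / (q : ℝ) ≤ nn ((b : ℝ) / q) := by
  rcases Int.eq_nat_or_neg b with ⟨n, rfl | rfl⟩
  · have := one_div_le_nn_div hq (fun h' => h (by exact_mod_cast h') : ¬ q ∣ n)
    simpa using this
  · have := one_div_le_nn_div hq (fun h' => h (by rw [dvd_neg]; exact_mod_cast h') : ¬ q ∣ n)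
    rw [Int.cast_neg, neg_div, nn_neg]
    simpa using this

lemma eventually_log_pow_le_rpow (c : ℝ) (k : ℕ) {κ : ℝ} (hκ : 0 < κ) :
    ∀ᶠ N : ℕ in Filter.atTop, c * Real.log N ^ k ≤ (N : ℝ) ^ κ := by
  have h1 : (fun x : ℝ => Real.log x ^ k) =o[Filter.atTop] fun x => x ^ κ := by
    simpa using isLittleO_log_rpow_rpow_atTop (k : ℝ) hκ
  have h2 := (h1.const_mul_left c).bound (one_pos)
  have h3 := tendsto_natCast_atTop_atTop (R := ℝ) |>.eventually h2
  filter_upwards [h3] with N hN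
  rw [one_mul, Real.norm_eq_abs, Real.norm_eq_abs, abs_of_nonneg (a := (N : ℝ) ^ κ) (by positivity)] at hN
  exact (le_abs_self _).trans hN

set_option maxHeartbeats 1000000 in
/-- Few primes `k` have `k α` close to a given `k₀ α`, unless `α` is close to a rational
with small denominator. -/
lemma exists_card_primes_near_le {κ ε : ℝ} (hκ : 0 < κ) (hε : 0 < ε) : ∃ Q₀ : ℕ, ∃ B₀ : ℝ, ∃ N₀ : ℕ, ∀ N ≥ N₀,
    ∀ q a : ℕ, ∀ β : ℝ, 0 < q → a.Coprime q → q * Real.log N ^ 4 ≤ N → |β| * (q * N) ≤ Real.log N ^ 4 →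
    (Q₀ ≤ q ∨ B₀ ≤ |β| * N) → ∀ K : ℕ, (N : ℝ) ^ κ ≤ K → (K : ℝ) * (N : ℝ) ^ κ ≤ N → ∀ k₀ ∈ Ioc K (K + K),
    (((Ioc K (K + K)).filter (fun k : ℕ => k.Prime ∧
      nn ((k : ℝ) * (a / q + β) - k₀ * (a / q + β)) < 1 / (((N / K : ℕ) : ℝ) + 1))).card : ℝ) ≤
      ε * K / Real.log K := by
  obtain ⟨Q₀, hQ₀⟩ := exists_lt_totient ⌈220 / ε⌉₊
  set B₀ : ℝ := 1760 / ε + 1 with hB₀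
  have hB₀1 : 1 ≤ B₀ := by rw [hB₀]; have : 0 < 1760 / ε := by positivity
                           linarith
  have e1 := tendsto_log_natCast.eventually (Filter.eventually_ge_atTop (max 1 (8 / ε)))
  have e2 := eventually_log_pow_le_rpow 10 8 hκ
  have e3 := eventually_log_pow_le_rpow (max 256 (B₀ ^ 2)) 0 hκ
  obtain ⟨N₀, hN₀⟩ := Filter.eventually_atTop.mp (e1.and (e2.and e3))
  refine ⟨Q₀, B₀, N₀, fun N hN q a β hq ha hqN hβ hor K hK1 hK2 k₀ hk₀ => ?_⟩
  obtain ⟨h1, h2, h3⟩ := hN₀ N hN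
  set L := Real.log N with hL
  set T : ℝ := (N : ℝ) ^ κ with hT
  rw [pow_zero, mul_one] at h3
  have hL1 : 1 ≤ L := (le_max_left _ _).trans h1
  have hL2 : 8 / ε ≤ L := (le_max_right _ _).trans h1
  have hT256 : 256 ≤ T := (le_max_left _ _).trans h3
  have hTB : B₀ ^ 2 ≤ T := (le_max_right _ _).trans h3
  have hTp : 0 < T := by linarith
  have hKp : (0 : ℝ) < K := by linarith
  have hK0 : 0 < K := by exact_mod_cast hKp
  have hNp : (0 : ℝ) < N := lt_of_lt_of_le (by positivity) hK2
  have hKN : (K : ℝ) / N ≤ 1 / T := by rw [div_le_div_iff₀ hNp hTp]; linarith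
  have hq' : (1 : ℝ) ≤ q := by exact_mod_cast hq
  have hqp : (0 : ℝ) < q := by linarith
  have hLk : ∀ k ≤ 8, 10 * L ^ k ≤ T := fun k hk =>
    le_trans (mul_le_mul_of_nonneg_left (pow_le_pow_right₀ hL1 hk) (by norm_num)) h2
  have hlogK : Real.log K ≤ L := Real.log_le_log hKp (by
    have : (K : ℝ) * 1 ≤ K * T := by gcongr; linarith
    linarith)
  have hlogKp : 0 < Real.log K := Real.log_pos (by linarith)
  have hK1N : 1 / (((N / K : ℕ) : ℝ) + 1) ≤ K / N := by
    rw [div_le_div_iff₀ (by positivity) hNp, one_mul]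
    have : N < K * (N / K + 1) := Nat.lt_mul_div_succ N hK0
    exact_mod_cast this.le
  have hqβ : K * (|β| * q) ≤ L ^ 4 / T := by
    have : K * (|β| * q) = (K : ℝ) / N * (|β| * (q * N)) := by field_simp
    rw [this]
    calc _ ≤ 1 / T * L ^ 4 := by gcongr
      _ = _ := by ring
  have hβT : K * |β| ≤ L ^ 4 / T := by
    refine le_trans ?_ hqβ
    gcongr
    exact le_mul_of_one_le_right (abs_nonneg _) hq'
  have hdist : ∀ k ∈ Ioc K (K + K), |(k : ℝ) - k₀| ≤ K := by
    intro k hk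
    rw [mem_Ioc] at hk hk₀
    have a1 : (K : ℝ) < k := by exact_mod_cast hk.1
    have a2 : (k : ℝ) ≤ K + K := by exact_mod_cast hk.2
    have a3 : (K : ℝ) < k₀ := by exact_mod_cast hk₀.1
    have a4 : (k₀ : ℝ) ≤ K + K := by exact_mod_cast hk₀.2
    rw [abs_le]; constructor <;> linarith
  set ρ : ℝ := (K : ℝ) / N + K * |β| with hρ
  have hrat : ∀ k ∈ Ioc K (K + K), nn ((k : ℝ) * (a / q + β) - k₀ * (a / q + β)) < 1 / (((N / K : ℕ) : ℝ) + 1) →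
      nn ((k : ℝ) * (a / q) - k₀ * (a / q)) < ρ := by
    intro k hk hk2
    have a1 := nn_add_le ((k : ℝ) * (a / q + β) - k₀ * (a / q + β)) (-(((k : ℝ) - k₀) * β))
    rw [nn_neg, show (k : ℝ) * (a / q + β) - k₀ * (a / q + β) + -(((k : ℝ) - k₀) * β) =
      (k : ℝ) * (a / q) - k₀ * (a / q) by ring] at a1
    have a2 := nn_le_abs (((k : ℝ) - k₀) * β)
    rw [abs_mul] at a2
    have a3 : |(k : ℝ) - k₀| * |β| ≤ K * |β| := by gcongr; exact hdist k hk
    rw [hρ]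
    linarith
  have hdiv4 : L ^ 4 / T ≤ 1 / 10 := by
    rw [div_le_div_iff₀ hTp (by norm_num)]; linarith [hLk 4 (by norm_num)]
  rcases le_or_gt (q : ℝ) (L ^ 2) with hqL | hqL
  · have hmod : ∀ k ∈ Ioc K (K + K), nn ((k : ℝ) * (a / q + β) - k₀ * (a / q + β)) < 1 / (((N / K : ℕ) : ℝ) + 1) →
        (q : ℤ) ∣ (k : ℤ) - k₀ := by
      intro k hk hk2
      by_contra hnd
      have a1 := hrat k hk hk2
      have hnd' : ¬ (q : ℤ) ∣ ((k : ℤ) - k₀) * a := by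
        intro h
        apply hnd
        exact IsCoprime.dvd_of_dvd_mul_right (Nat.isCoprime_iff_coprime.mpr (Nat.coprime_comm.mp ha)) h
      have a2 := one_div_le_nn_int_div hq hnd'
      have a3 : ((((k : ℤ) - k₀) * a : ℤ) : ℝ) / q = (k : ℝ) * (a / q) - k₀ * (a / q) := by
        push_cast; ring
      rw [a3] at a2
      have a4 : 1 < ρ * q := by
        have : 1 / (q : ℝ) < ρ := by linarith
        rwa [div_lt_iff₀ hqp] at this
      have a5 : ρ * q ≤ L ^ 2 / T + L ^ 4 / T := by
        calc ρ * q = (K : ℝ) / N * q + K * (|β| * q) := by rw [hρ]; ring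
          _ ≤ 1 / T * L ^ 2 + L ^ 4 / T := by gcongr
          _ = _ := by ring
      have a6 : L ^ 2 / T ≤ 1 / 10 := by
        rw [div_le_div_iff₀ hTp (by norm_num)]; linarith [hLk 2 (by norm_num)]
      linarith
    have hK16 : 16 ≤ K := by
      have : (16 : ℝ) ≤ K := by linarith
      exact_mod_cast this
    rcases hor with hor | hor
    · have hsub : (Ioc K (K + K)).filter (fun k : ℕ => k.Prime ∧
          nn ((k : ℝ) * (a / q + β) - k₀ * (a / q + β)) < 1 / (((N / K : ℕ) : ℝ) + 1)) ⊆
          (Ioc K (K + K)).filter fun p => p.Prime ∧ p ≡ k₀ [MOD q] := by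
        intro k hk
        rw [mem_filter] at hk ⊢
        refine ⟨hk.1, hk.2.1, ?_⟩
        exact (Nat.modEq_iff_dvd.mpr (hmod k hk.1 hk.2.2)).symm
      have hq2K : q ^ 2 ≤ K := by
        have : (q : ℝ) ^ 2 ≤ K := by
          calc (q : ℝ) ^ 2 ≤ (L ^ 2) ^ 2 := by gcongr
            _ = L ^ 4 := by ring
            _ ≤ 10 * L ^ 4 := by linarith [pow_nonneg (by linarith : 0 ≤ L) 4]
            _ ≤ T := hLk 4 (by norm_num)
            _ ≤ K := hK1
        exact_mod_cast this
      have hφ : 220 / ε ≤ q.totient := (Nat.le_ceil _).trans (by exact_mod_cast (hQ₀ q hor).le)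
      have hφp : (0 : ℝ) < q.totient := lt_of_lt_of_le (by positivity) hφ
      have hbt := card_primes_le_of_sq_le K K q k₀ hq hK16 hq2K
      calc _ ≤ _ := by exact_mod_cast card_le_card hsub
        _ ≤ _ := hbt
        _ = 220 / q.totient * K / Real.log K := by field_simp
        _ ≤ _ := by
          gcongr
          rw [div_le_iff₀ hφp]
          rwa [div_le_iff₀ hε, mul_comm] at hφ
    · have hB₀p : 0 < B₀ := by linarith
      set h := ⌈(K : ℝ) / B₀⌉₊ with hh
      have hβp : 0 < |β| := by
        rcases (abs_nonneg β).eq_or_lt with h0 | h0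
        · rw [← h0, zero_mul] at hor; linarith
        · exact h0
      have hhK : h ≤ K := Nat.ceil_le.mpr (div_le_self hKp.le hB₀1)
      have hhr : (K : ℝ) / B₀ ≤ h := Nat.le_ceil _
      have hhr2 : (h : ℝ) ≤ 2 * (K / B₀) := by
        have a1 := Nat.ceil_lt_add_one (show (0 : ℝ) ≤ K / B₀ by positivity)
        rw [← hh] at a1
        have : 1 ≤ (K : ℝ) / B₀ := by
          rw [le_div_iff₀ hB₀p]
          nlinarith
        linarith
      have hk₀h : h ≤ k₀ := hhK.trans (mem_Ioc.mp hk₀).1.le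
      have hsub : (Ioc K (K + K)).filter (fun k : ℕ => k.Prime ∧
          nn ((k : ℝ) * (a / q + β) - k₀ * (a / q + β)) < 1 / (((N / K : ℕ) : ℝ) + 1)) ⊆
          (Ioc (k₀ - h) (k₀ - h + 2 * h)).filter fun p => p.Prime ∧ p ≡ 0 [MOD 1] := by
        intro k hk
        rw [mem_filter] at hk ⊢
        obtain ⟨z, hz⟩ := hmod k hk.1 hk.2.2
        have hz' : (k : ℝ) - k₀ = q * z := by exact_mod_cast congrArg (fun x : ℤ => (x : ℝ)) hz
        have a1 : (k : ℝ) * (a / q + β) - k₀ * (a / q + β) = ((k : ℝ) - k₀) * β + ((z * a : ℤ) : ℝ) := by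
          have : (k : ℝ) * (a / q + β) - k₀ * (a / q + β) = ((k : ℝ) - k₀) * β + ((k : ℝ) - k₀) * (a / q) := by ring
          rw [this]
          congr 1
          rw [hz']
          push_cast
          field_simp
        have a2 := hk.2.2
        rw [a1, nn_add_int] at a2
        have a3 : |((k : ℝ) - k₀) * β| ≤ K * |β| := by
          rw [abs_mul]; gcongr; exact hdist k hk.1
        have a4 := abs_le_nn (a3.trans (by linarith : (K : ℝ) * |β| ≤ 1 / 2))
        rw [abs_mul] at a4
        have a5 : |(k : ℝ) - k₀| < K / B₀ := by
          have b1 : |(k : ℝ) - k₀| * |β| < K / N := by linarith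
          rw [lt_div_iff₀ hB₀p]
          rw [lt_div_iff₀ hNp] at b1
          calc |(k : ℝ) - k₀| * B₀ ≤ |(k : ℝ) - k₀| * (|β| * N) := by gcongr
            _ = |(k : ℝ) - k₀| * |β| * N := by ring
            _ < K := b1
        have a6 : |(k : ℝ) - k₀| < h := a5.trans_le hhr
        rw [abs_lt] at a6
        have a7 : (k₀ : ℝ) < k + h := by linarith [a6.1]
        have a8 : (k : ℝ) < k₀ + h := by linarith [a6.2]
        have a7' : k₀ < k + h := by exact_mod_cast a7
        have a8' : k < k₀ + h := by exact_mod_cast a8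
        refine ⟨?_, hk.2.1, Nat.modEq_one⟩
        rw [mem_Ioc]
        omega
      have hsq : √(K : ℝ) ≤ ((2 * h : ℕ) : ℝ) := by
        have b1 : B₀ ≤ √(K : ℝ) := Real.le_sqrt_of_sq_le (by linarith)
        push_cast
        have b2 : √(K : ℝ) * √(K : ℝ) = K := Real.mul_self_sqrt hKp.le
        have b3 : √(K : ℝ) ≤ K / B₀ := by
          rw [le_div_iff₀ hB₀p]
          calc _ ≤ √(K : ℝ) * √(K : ℝ) := by gcongr
            _ = K := b2
        have : (0 : ℝ) ≤ h := Nat.cast_nonneg h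
        linarith
      have hsq16 : (16 : ℝ) ≤ √(K : ℝ) := Real.le_sqrt_of_sq_le (by linarith)
      have h16 : 16 ≤ 2 * h := by
        exact_mod_cast hsq16.trans hsq
      have hlog : Real.log K / 2 ≤ Real.log ((2 * h : ℕ) : ℝ) := by
        rw [← Real.log_sqrt hKp.le]
        exact Real.log_le_log (by linarith) hsq
      have hbt := card_primes_le_of_sq_le (k₀ - h) (2 * h) 1 0 one_pos h16 (by omega)
      rw [Nat.totient_one, Nat.cast_one, one_mul] at hbt
      calc _ ≤ _ := by exact_mod_cast card_le_card hsub
        _ ≤ _ := hbt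
        _ ≤ 220 * (2 * (2 * (K / B₀))) / (Real.log K / 2) := by
          gcongr
          push_cast
          linarith
        _ = 1760 / B₀ * K / Real.log K := by field_simp; ring
        _ ≤ _ := by
          gcongr
          rw [div_le_iff₀ hB₀p, hB₀, mul_add, mul_div_cancel₀ _ hε.ne']
          linarith
  · have hρ0 : 0 ≤ ρ := by positivity
    have hsub : (Ioc K (K + K)).filter (fun k : ℕ => k.Prime ∧
        nn ((k : ℝ) * (a / q + β) - k₀ * (a / q + β)) < 1 / (((N / K : ℕ) : ℝ) + 1)) ⊆
        (Ioc K (K + K)).filter (fun k : ℕ => nn ((k : ℝ) * (a / q) - k₀ * (a / q)) ≤ ρ) := by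
      intro k hk
      rw [mem_filter] at hk ⊢
      exact ⟨hk.1, (hrat k hk.1 hk.2.2).le⟩
    have hcard := card_near_le hq ha hρ0 K K k₀
    have hLp : 0 < L := by linarith
    have hKq : ((K / q : ℕ) : ℝ) ≤ K / q := Nat.cast_div_le
    have g1 : 1 ≤ (K : ℝ) / L ^ 2 := by
      rw [le_div_iff₀ (by positivity)]
      have := hLk 2 (by norm_num)
      nlinarith [pow_pos hLp 2]
    have g2 : (K : ℝ) / q ≤ K / L ^ 2 := by gcongr
    have g3 : ρ * q ≤ K / L ^ 2 + 1 := by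
      calc ρ * q = (K : ℝ) * q / N + K * (|β| * q) := by rw [hρ]; ring
        _ ≤ K / L ^ 2 + L ^ 4 / T := by
          refine add_le_add ?_ hqβ
          rw [div_le_div_iff₀ hNp (by positivity)]
          have : (q : ℝ) * L ^ 2 ≤ N := by
            refine le_trans ?_ hqN
            gcongr
            norm_num
          nlinarith
        _ ≤ _ := by linarith
    have g4 : ρ ≤ 1 / L ^ 2 := by
      have u1 : 1 / T + L ^ 4 / T ≤ 1 / L ^ 2 := by
        rw [← add_div, div_le_div_iff₀ hTp (by positivity)]
        have := hLk 2 (by norm_num)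
        have v := hLk 6 (by norm_num)
        have e : (1 + L ^ 4) * L ^ 2 = L ^ 2 + L ^ 6 := by ring
        rw [e]
        have : 0 < L ^ 2 := by positivity
        have : 0 < L ^ 6 := by positivity
        linarith
      linarith
    calc _ ≤ _ := by exact_mod_cast card_le_card hsub
      _ ≤ _ := hcard
      _ ≤ ((K : ℝ) / q + 1) * (2 * ρ * q + 1) := by
        push_cast; gcongr
      _ = 2 * K * ρ + K / q + 2 * (ρ * q) + 1 := by field_simp; ring
      _ ≤ 2 * K * (1 / L ^ 2) + K / L ^ 2 + 2 * (K / L ^ 2 + 1) + 1 := by gcongr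
      _ = 5 * (K / L ^ 2) + 3 := by ring
      _ ≤ 8 * (K / L ^ 2) := by linarith
      _ = 8 / L * K / L := by field_simp
      _ ≤ ε * K / Real.log K := by
        gcongr
        rw [div_le_iff₀ hLp]
        rwa [div_le_iff₀ hε, mul_comm] at hL2

lemma norm_S_sub_S_le {x y : ℕ} (h : x ≤ y) (α : ℝ) :
    ‖S y α - S x α‖ ≤ ∑ n ∈ Ioc x y, ArithmeticFunction.vonMangoldt n := by
  rw [S_eq_Ioc, S_eq_Ioc, ← Finset.sum_Ioc_consecutive _ (Nat.zero_le x) h, add_sub_cancel_left]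
  exact norm_sum_vonMangoldt_le _ _

lemma card_le_of_separated_of_near {θ : ℕ → ℝ} {A : Finset ℕ} {r m c : ℝ} (hr : 0 < r) (hm : 0 ≤ m)
    (hsep : ∀ A' ⊆ A, (∀ j ∈ A', ∀ k ∈ A', j ≠ k → r ≤ nn (θ j - θ k)) → (A'.card : ℝ) ≤ c)
    (hnear : ∀ j ∈ A, ((A.filter fun k => nn (θ k - θ j) < r).card : ℝ) ≤ m) : (A.card : ℝ) ≤ c * m := by
  obtain ⟨A', hA', hs, hn⟩ := exists_separated A θ r hr
  have h1 : A ⊆ A'.biUnion fun j => A.filter fun k => nn (θ k - θ j) < r := by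
    intro k hk
    obtain ⟨j, hj, hjk⟩ := hn k hk
    exact mem_biUnion.mpr ⟨j, hj, mem_filter.mpr ⟨hk, hjk⟩⟩
  calc (A.card : ℝ) ≤ ((A'.biUnion fun j => A.filter fun k => nn (θ k - θ j) < r).card : ℝ) := by
        exact_mod_cast card_le_card h1
    _ ≤ ∑ j ∈ A', ((A.filter fun k => nn (θ k - θ j) < r).card : ℝ) := by exact_mod_cast card_biUnion_le
    _ ≤ ∑ j ∈ A', m := sum_le_sum fun j hj => hnear j (hA' hj)
    _ = A'.card * m := by rw [sum_const, nsmul_eq_mul]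
    _ ≤ c * m := by gcongr; exact hsep A' hA' hs

set_option maxHeartbeats 1000000 in
lemma exists_sum_block_le : ∃ C : ℝ, 0 < C ∧ ∀ κ : ℝ, 0 < κ → ∀ t : ℕ, 0 < t →
    ∃ Q₀ : ℕ, ∃ B₀ : ℝ, ∃ N₀ : ℕ, ∀ N ≥ N₀,
    ∀ q a : ℕ, ∀ β : ℝ, 0 < q → a.Coprime q → q * Real.log N ^ 4 ≤ N → |β| * (q * N) ≤ Real.log N ^ 4 →
    (Q₀ ≤ q ∨ B₀ ≤ |β| * N) → ∀ K : ℕ, (N : ℝ) ^ κ ≤ K → (K : ℝ) * (N : ℝ) ^ κ ≤ N →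
    ∑ k ∈ Ioc K (K + K / t), ArithmeticFunction.vonMangoldt k * ‖S (N / k) (k * (a / q + β))‖ ≤
      C / t ^ 2 * N := by
  obtain ⟨C₁, hC₁, h1⟩ := exists_sum_vonMangoldt_Ioc_le
  obtain ⟨C₂, hC₂, h2⟩ := exists_sum_nonprime_le
  obtain ⟨C₃, hC₃, h3⟩ := exists_card_large_spectrum
  refine ⟨4 * C₁ ^ 2 + 2 * C₁ + 1 + 12 * C₃, by positivity, fun κ hκ t ht => ?_⟩
  have htp : (0 : ℝ) < t := by exact_mod_cast ht
  have ht1 : (1 : ℝ) ≤ t := by exact_mod_cast ht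
  set η : ℝ := 1 / t with hη
  have hηp : 0 < η := by positivity
  have hη1 : η ≤ 1 := by rw [hη, div_le_one htp]; exact ht1
  obtain ⟨y₁, hy₁⟩ := h1 η hηp
  obtain ⟨y₂, hy₂⟩ := h1 (2 * η) (by positivity)
  obtain ⟨y₃, hy₃⟩ := h3 η hηp
  obtain ⟨Q₀, B₀, N₁, h4⟩ := exists_card_primes_near_le hκ (show 0 < η ^ 5 by positivity)
  set W : ℝ := y₁ + y₂ + y₃ + (t + 4) + (12 * C₂ / η ^ 2) ^ 2 with hW
  have e1 := eventually_log_pow_le_rpow W 0 hκ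
  obtain ⟨N₂, hN₂⟩ := Filter.eventually_atTop.mp e1
  refine ⟨Q₀, B₀, max N₁ N₂, fun N hN q a β hq ha hqN hβ hor K hK1 hK2 => ?_⟩
  have hTW := hN₂ N ((le_max_right _ _).trans hN)
  have hnear := h4 N ((le_max_left _ _).trans hN) q a β hq ha hqN hβ hor K hK1 hK2
  set T : ℝ := (N : ℝ) ^ κ with hT
  set α : ℝ := a / q + β with hα
  rw [pow_zero, mul_one, hW] at hTW
  have s1 : (0 : ℝ) ≤ y₁ := Nat.cast_nonneg _
  have s2 : (0 : ℝ) ≤ y₂ := Nat.cast_nonneg _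
  have s3 : (0 : ℝ) ≤ y₃ := Nat.cast_nonneg _
  have s4 : 0 ≤ (12 * C₂ / η ^ 2) ^ 2 := sq_nonneg _
  have hTp : 0 < T := by linarith
  have hKp : (0 : ℝ) < K := by linarith
  have hK0 : 0 < K := by exact_mod_cast hKp
  have hNK : T ≤ (N : ℝ) / K := by rw [le_div_iff₀ hKp, mul_comm]; exact hK2
  set y := N / K with hy
  have hyl : (N : ℝ) / K < y + 1 := by
    rw [div_lt_iff₀ hKp]
    have : N < K * (N / K + 1) := Nat.lt_mul_div_succ N hK0
    rw [mul_comm]; exact_mod_cast this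
  have hyu : (y : ℝ) ≤ N / K := Nat.cast_div_le
  have hKy : (K : ℝ) * y ≤ N := by rw [le_div_iff₀ hKp, mul_comm] at hyu; exact hyu
  have hy0 : (0 : ℝ) ≤ y := Nat.cast_nonneg _
  have hytr : (t : ℝ) + 1 ≤ y := by linarith
  have hKt : ((K / t : ℕ) : ℝ) ≤ η * K := by
    refine (Nat.cast_div_le).trans (le_of_eq ?_)
    rw [hη]; ring
  set B := Ioc K (K + K / t) with hB
  have hBk : ∀ k ∈ B, (K : ℝ) < k ∧ (k : ℝ) ≤ K + η * K := by
    intro k hk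
    rw [hB, mem_Ioc] at hk
    have a1 : (K : ℝ) < k := by exact_mod_cast hk.1
    have a2 : (k : ℝ) ≤ ((K + K / t : ℕ) : ℝ) := by exact_mod_cast hk.2
    push_cast at a2
    exact ⟨a1, by linarith⟩
  have hBsub : B ⊆ Ioc K (K + K) := Ioc_subset_Ioc_right (by
    have := Nat.div_le_self K t
    omega)
  have hmass : ∑ k ∈ B, ArithmeticFunction.vonMangoldt k ≤ C₁ * η * (2 * K) := by
    have := hy₁ (K + K / t) (by
      have : (y₁ : ℝ) ≤ K := by linarith
      have : y₁ ≤ K := by exact_mod_cast this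
      exact this.trans (Nat.le_add_right _ _)) K (by push_cast; nlinarith [show (0 : ℝ) ≤ ((K / t : ℕ) : ℝ) from Nat.cast_nonneg _])
    refine this.trans ?_
    push_cast
    gcongr
    nlinarith
  have hdiff : ∀ k ∈ B, ‖S (N / k) (k * α)‖ ≤ ‖S y (k * α)‖ + C₁ * (2 * η) * y := by
    intro k hk
    obtain ⟨b1, b2⟩ := hBk k hk
    have hk0 : (0 : ℝ) < k := by linarith
    have hk0' : 0 < k := by exact_mod_cast hk0
    have hxy : N / k ≤ y := Nat.div_le_div_left (by exact_mod_cast b1.le) hK0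
    have hxl : (N : ℝ) / k < (N / k : ℕ) + 1 := by
      rw [div_lt_iff₀ hk0]
      have : N < k * (N / k + 1) := Nat.lt_mul_div_succ N hk0'
      rw [mul_comm]; exact_mod_cast this
    have c1 : (N : ℝ) / K - N / k ≤ η * (N / K) := by
      have : (N : ℝ) / K - N / k = (N / K) * ((k - K) / k) := by field_simp
      rw [this, mul_comm]
      gcongr
      rw [div_le_iff₀ hk0]
      nlinarith
    have c2 : (y : ℝ) - (N / k : ℕ) ≤ 2 * η * y := by
      have c3 : η * (N / K) ≤ η * (y + 1) := by gcongr
      have c4 : η * (t + 1) ≤ η * y := by gcongr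
      have c5 : η * t = 1 := by rw [hη]; field_simp
      nlinarith
    have hyy : y₂ ≤ y := by
      have : (y₂ : ℝ) ≤ y := by linarith
      exact_mod_cast this
    have c6 := hy₂ y hyy (N / k) c2
    have c7 := norm_S_sub_S_le hxy (k * α)
    have c8 := norm_sub_norm_le (S (N / k) (k * α)) (S y (k * α))
    rw [norm_sub_rev] at c8
    linarith
  set A := B.filter fun k : ℕ => k.Prime ∧ η * y ≤ ‖S y (k * α)‖ with hA
  have hlogK : 0 < Real.log K := Real.log_pos (by linarith)
  have hAcard : (A.card : ℝ) ≤ C₃ / η ^ 3 * (η ^ 5 * K / Real.log K) := by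
    refine card_le_of_separated_of_near (θ := fun k : ℕ => (k : ℝ) * α)
      (r := 1 / ((y : ℝ) + 1)) (by positivity) (by positivity) ?_ ?_
    · intro A' hA' hs
      rw [le_div_iff₀ (by positivity)]
      refine hy₃ y ?_ A' _ hs ?_
      · have : (y₃ : ℝ) ≤ y := by linarith
        exact_mod_cast this
      · intro j hj
        exact (mem_filter.mp (hA' hj)).2.2
    · intro j hj
      refine le_trans ?_ (hnear j (hBsub (mem_filter.mp hj).1))
      norm_cast
      apply card_le_card
      intro k hk
      rw [mem_filter] at hk ⊢
      have := mem_filter.mp hk.1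
      exact ⟨hBsub this.1, this.2.1, hk.2⟩
  have hlog2 : Real.log (2 * K) ≤ 2 * Real.log K := by
    rw [Real.log_mul (by norm_num) hKp.ne']
    have : Real.log 2 ≤ Real.log K := Real.log_le_log (by norm_num) (by linarith)
    linarith
  have hpt : ∀ k ∈ B, ArithmeticFunction.vonMangoldt k * ‖S (N / k) (k * α)‖ ≤
      ArithmeticFunction.vonMangoldt k * (C₁ * (2 * η) * y + η * y) +
      (if k.Prime then 0 else ArithmeticFunction.vonMangoldt k * (6 * y)) +
      (if k ∈ A then 2 * Real.log K * (6 * y) else 0) := by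
    intro k hk
    have hΛ : 0 ≤ ArithmeticFunction.vonMangoldt k := ArithmeticFunction.vonMangoldt_nonneg
    have d1 := mul_le_mul_of_nonneg_left (hdiff k hk) hΛ
    have d2 : ‖S y (k * α)‖ ≤ 6 * y := norm_S_le _ _
    obtain ⟨b1, b2⟩ := hBk k hk
    by_cases hp : k.Prime
    · rw [if_pos hp]
      by_cases hkA : k ∈ A
      · rw [if_pos hkA]
        have d3 : ArithmeticFunction.vonMangoldt k ≤ 2 * Real.log K := by
          refine (ArithmeticFunction.vonMangoldt_le_log).trans ?_
          refine le_trans (Real.log_le_log (by linarith) ?_) hlog2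
          nlinarith
        have d4 : ArithmeticFunction.vonMangoldt k * ‖S y (k * α)‖ ≤ 2 * Real.log K * (6 * y) := by gcongr
        have : 0 ≤ ArithmeticFunction.vonMangoldt k * (η * y) := by positivity
        linarith
      · rw [if_neg hkA]
        have d3 : ‖S y (k * α)‖ < η * y := by
          by_contra h
          push Not at h
          exact hkA (mem_filter.mpr ⟨hk, hp, h⟩)
        have d4 := mul_le_mul_of_nonneg_left d3.le hΛ
        linarith
    · rw [if_neg hp, if_neg (fun h => hp (mem_filter.mp h).2.1)]
      have d4 := mul_le_mul_of_nonneg_left d2 hΛ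
      have : 0 ≤ ArithmeticFunction.vonMangoldt k * (η * y) := by positivity
      linarith
  have hnp : ∑ k ∈ B, (if k.Prime then 0 else ArithmeticFunction.vonMangoldt k * (6 * (y : ℝ))) ≤ η ^ 2 * K * y := by
    have f1 : ∑ k ∈ B, (if k.Prime then 0 else ArithmeticFunction.vonMangoldt k * (6 * (y : ℝ))) =
        (∑ k ∈ B.filter (fun k => ¬ k.Prime), ArithmeticFunction.vonMangoldt k) * (6 * y) := by
      rw [sum_mul, sum_filter]
      refine sum_congr rfl fun k _ => ?_
      by_cases hp : k.Prime <;> simp [hp]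
    have f2 : ∑ k ∈ B.filter (fun k => ¬ k.Prime), ArithmeticFunction.vonMangoldt k ≤ C₂ * √((K + K : ℕ) : ℝ) := by
      refine le_trans (sum_le_sum_of_subset_of_nonneg ?_ fun _ _ _ => ArithmeticFunction.vonMangoldt_nonneg)
        (h2 (K + K))
      intro k hk
      rw [mem_filter] at hk ⊢
      refine ⟨?_, hk.2⟩
      have := mem_Ioc.mp (hBsub hk.1)
      rw [mem_range]; omega
    have f3 : √((K + K : ℕ) : ℝ) ≤ 2 * √(K : ℝ) := by
      rw [Real.sqrt_le_left (by positivity), mul_pow, Real.sq_sqrt hKp.le]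
      push_cast; linarith
    have f4 : 12 * C₂ ≤ η ^ 2 * √(K : ℝ) := by
      have : 12 * C₂ / η ^ 2 ≤ √(K : ℝ) := Real.le_sqrt_of_sq_le (by linarith)
      rw [div_le_iff₀ (by positivity)] at this
      linarith
    have f5 : √(K : ℝ) * √(K : ℝ) = K := Real.mul_self_sqrt hKp.le
    rw [f1]
    calc _ ≤ (C₂ * (2 * √(K : ℝ))) * (6 * y) := by
          refine mul_le_mul_of_nonneg_right (f2.trans ?_) (by positivity)
          gcongr
      _ = (12 * C₂) * √(K : ℝ) * y := by ring
      _ ≤ (η ^ 2 * √(K : ℝ)) * √(K : ℝ) * y := by gcongr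
      _ = η ^ 2 * (√(K : ℝ) * √(K : ℝ)) * y := by ring
      _ = _ := by rw [f5]
  have hbad : ∑ k ∈ B, (if k ∈ A then 2 * Real.log K * (6 * (y : ℝ)) else 0) ≤ 12 * C₃ * η ^ 2 * K * y := by
    rw [sum_ite_mem, sum_const, nsmul_eq_mul]
    have : B ∩ A = A := inter_eq_right.mpr (filter_subset _ _)
    rw [this]
    calc _ ≤ C₃ / η ^ 3 * (η ^ 5 * K / Real.log K) * (2 * Real.log K * (6 * (y : ℝ))) := by gcongr
      _ = _ := by field_simp; ring
  calc _ ≤ _ := sum_le_sum hpt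
    _ = (∑ k ∈ B, ArithmeticFunction.vonMangoldt k) * (C₁ * (2 * η) * y + η * y) + _ + _ := by
        rw [sum_add_distrib, sum_add_distrib, sum_mul]
    _ ≤ C₁ * η * (2 * K) * (C₁ * (2 * η) * y + η * y) + η ^ 2 * K * y + 12 * C₃ * η ^ 2 * K * y := by
        gcongr
    _ = (4 * C₁ ^ 2 + 2 * C₁ + 1 + 12 * C₃) * η ^ 2 * (K * y) := by ring
    _ ≤ (4 * C₁ ^ 2 + 2 * C₁ + 1 + 12 * C₃) * η ^ 2 * N := by gcongr
    _ = _ := by rw [hη]; ring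

lemma sum_Ioc_inv_le (N : ℕ) : ∑ K ∈ Ioc 0 N, 1 / (K : ℝ) ≤ 1 + Real.log N := by
  have h := harmonic_le_one_add_log N
  rw [harmonic_eq_sum_Icc] at h
  push_cast at h
  have e : Ioc 0 N = Icc 1 N := by
    ext x
    rw [mem_Ioc, mem_Icc, Nat.succ_le_iff]
  simpa only [one_div, e] using h

lemma one_le_sum_block {t k : ℕ} (ht : 0 < t) (hk : 4 * t ≤ k) :
    1 ≤ 4 * t * ∑ K ∈ (Ioc 0 k).filter (fun K : ℕ => K < k ∧ k ≤ K + K / t), 1 / (K : ℝ) := by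
  have hk0 : 0 < k := by omega
  have hkp : (0 : ℝ) < k := by exact_mod_cast hk0
  have htp : (1 : ℝ) ≤ t := by exact_mod_cast ht
  have hsub : Ico (k - k / (2 * t)) k ⊆ (Ioc 0 k).filter (fun K : ℕ => K < k ∧ k ≤ K + K / t) := by
    intro K hK
    rw [mem_Ico] at hK
    have h1 : k / (2 * t) * (2 * t) ≤ k := Nat.div_mul_le_self _ _
    have h3 : k / (2 * t) ≤ k / 2 := Nat.div_le_div_left (by omega) (by norm_num)
    have h2 : k / (2 * t) ≤ K / t := by
      rw [Nat.le_div_iff_mul_le ht]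
      have : k / (2 * t) * (2 * t) = 2 * (k / (2 * t) * t) := by ring
      omega
    rw [mem_filter, mem_Ioc]
    omega
  have hcard : (k : ℝ) / (4 * t) ≤ ((k / (2 * t) : ℕ) : ℝ) := by
    have h1 : (k : ℝ) / ((2 * t : ℕ) : ℝ) < ((k / (2 * t) : ℕ) : ℝ) + 1 := by
      rw [div_lt_iff₀ (by positivity)]
      have : k < (2 * t) * (k / (2 * t) + 1) := Nat.lt_mul_div_succ k (by omega)
      rw [mul_comm]; exact_mod_cast this
    have h2 : (1 : ℝ) ≤ k / (4 * t) := by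
      rw [le_div_iff₀ (by positivity)]
      rw [one_mul]; exact_mod_cast hk
    have h3 : (k : ℝ) / ((2 * t : ℕ) : ℝ) = 2 * (k / (4 * t)) := by push_cast; field_simp; norm_num
    linarith
  calc (1 : ℝ) = 4 * t * ((k / (4 * t)) * (1 / k)) := by field_simp
    _ ≤ 4 * t * (((k / (2 * t) : ℕ) : ℝ) * (1 / k)) := by gcongr
    _ = 4 * t * ∑ K ∈ Ico (k - k / (2 * t)) k, 1 / (k : ℝ) := by
        rw [sum_const, nsmul_eq_mul, Nat.card_Ico, Nat.sub_sub_self (Nat.div_le_self _ _)]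
    _ ≤ 4 * t * ∑ K ∈ Ico (k - k / (2 * t)) k, 1 / (K : ℝ) := by
        gcongr with K hK
        · have := (mem_filter.mp (hsub hK)).1
          exact_mod_cast (mem_Ioc.mp this).1
        · exact (mem_Ico.mp hK).2.le
    _ ≤ _ := by
        gcongr

lemma sum_le_of_block_le {t M₁ M₂ N : ℕ} (ht : 0 < t) (hM₁ : 4 * t ≤ M₁) (hM₂ : M₂ ≤ N) {g : ℕ → ℝ} (hg : ∀ k, 0 ≤ g k)
    {D : ℝ} (hD : 0 ≤ D) (h : ∀ K, M₁ ≤ 2 * K → K < M₂ → ∑ k ∈ Ioc K (K + K / t), g k ≤ D) :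
    ∑ k ∈ Ioc M₁ M₂, g k ≤ 4 * t * D * (1 + Real.log N) := by
  have h1 : ∀ k ∈ Ioc M₁ M₂, g k ≤
      4 * t * ∑ K ∈ Ioc 0 N, if (M₁ ≤ 2 * K ∧ K < M₂) ∧ k ∈ Ioc K (K + K / t) then 1 / (K : ℝ) * g k else 0 := by
    intro k hk
    rw [mem_Ioc] at hk
    have := mul_le_mul_of_nonneg_right (one_le_sum_block ht (by omega : 4 * t ≤ k)) (hg k)
    rw [one_mul] at this
    refine this.trans ?_
    rw [mul_assoc, sum_mul, ← sum_filter]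
    refine mul_le_mul_of_nonneg_left (sum_le_sum_of_subset_of_nonneg ?_ ?_) (by positivity)
    · intro K hK
      rw [mem_filter, mem_Ioc] at hK ⊢
      have := Nat.div_le_self K t
      rw [mem_Ioc]
      refine ⟨by omega, ⟨by omega, by omega⟩, hK.2.1, hK.2.2⟩
    · intro K _ _
      exact mul_nonneg (by positivity) (hg k)
  calc _ ≤ _ := sum_le_sum h1
    _ = 4 * t * ∑ K ∈ Ioc 0 N, ∑ k ∈ Ioc M₁ M₂,
        if (M₁ ≤ 2 * K ∧ K < M₂) ∧ k ∈ Ioc K (K + K / t) then 1 / (K : ℝ) * g k else 0 := by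
        rw [← mul_sum, sum_comm]
    _ ≤ 4 * t * ∑ K ∈ Ioc 0 N, 1 / (K : ℝ) * D := by
        gcongr with K hK
        by_cases hK2 : M₁ ≤ 2 * K ∧ K < M₂
        · rw [← sum_filter, ← mul_sum]
          gcongr
          refine (sum_le_sum_of_subset_of_nonneg ?_ fun k _ _ => hg k).trans (h K hK2.1 hK2.2)
          intro k hk
          exact (mem_filter.mp hk).2.2
        · simp only [hK2, false_and, if_false, sum_const_zero]
          positivity
    _ = 4 * t * D * ∑ K ∈ Ioc 0 N, 1 / (K : ℝ) := by rw [← sum_mul]; ring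
    _ ≤ _ := by gcongr; exact sum_Ioc_inv_le N

lemma sum_vonMangoldt_div_Ioc_le {x y : ℕ} (hx : 0 < x) (hxy : x ≤ y) :
    ∑ k ∈ Ioc x y, ArithmeticFunction.vonMangoldt k / k ≤ Real.log y - Real.log x + 7 := by
  have h1 := sum_vonMangoldt_div_le (hx.trans_le hxy)
  have h2 := le_sum_vonMangoldt_div hx
  rw [← Finset.sum_Ioc_consecutive _ (Nat.zero_le x) hxy] at h1
  linarith

/-- The bilinear part of Selberg's formula is negligible on the minor arcs. -/
lemma exists_sum_typeII_le {ε : ℝ} (hε : 0 < ε) : ∃ Q₀ : ℕ, ∃ B₀ : ℝ, ∃ N₀ : ℕ, ∀ N ≥ N₀,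
    ∀ q a : ℕ, ∀ β : ℝ, 0 < q → a.Coprime q → q * Real.log N ^ 4 ≤ N → |β| * (q * N) ≤ Real.log N ^ 4 →
    (Q₀ ≤ q ∨ B₀ ≤ |β| * N) →
    ∑ k ∈ Ioc 0 N, ArithmeticFunction.vonMangoldt k * ‖S (N / k) (k * (a / q + β))‖ ≤ ε * N * Real.log N := by
  obtain ⟨C, hC, hblock⟩ := exists_sum_block_le
  set κ : ℝ := min (ε / 48) (1 / 8) with hκ
  have hκp : 0 < κ := by positivity
  have hκ1 : κ ≤ ε / 48 := min_le_left _ _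
  have hκ2 : κ ≤ 1 / 8 := min_le_right _ _
  set t : ℕ := ⌈16 * C / ε⌉₊ with ht
  have htr : 16 * C / ε ≤ t := Nat.le_ceil _
  have htp : (0 : ℝ) < t := lt_of_lt_of_le (by positivity) htr
  have ht0 : 0 < t := by exact_mod_cast htp
  obtain ⟨Q₀, B₀, N₁, hN₁⟩ := hblock κ hκp t ht0
  have e1 := eventually_log_pow_le_rpow (4 * t + 4) 0 hκp
  have e2 := tendsto_log_natCast.eventually (Filter.eventually_ge_atTop (max 1 (480 / ε)))
  obtain ⟨N₂, hN₂⟩ := Filter.eventually_atTop.mp (e1.and e2)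
  refine ⟨Q₀, B₀, max N₁ (max N₂ 1), fun N hN q a β hq ha hqN hβ hor => ?_⟩
  have hb := hN₁ N ((le_max_left _ _).trans hN) q a β hq ha hqN hβ hor
  obtain ⟨h1, h2⟩ := hN₂ N (((le_max_left _ _).trans (le_max_right _ _)).trans hN)
  have hN1 : 1 ≤ N := ((le_max_right _ _).trans (le_max_right _ _)).trans hN
  have hNp : (0 : ℝ) < N := by exact_mod_cast hN1
  set L := Real.log N with hL
  have hL1 : 1 ≤ L := (le_max_left _ _).trans h2
  have hL2 : 480 / ε ≤ L := (le_max_right _ _).trans h2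
  rw [pow_zero, mul_one] at h1
  set T : ℝ := (N : ℝ) ^ κ with hT
  have hTp : 0 < T := by linarith
  have hlogT : Real.log T = κ * L := by rw [hT, Real.log_rpow hNp]
  have hT2 : 3 * T ≤ N / T := by
    rw [le_div_iff₀ hTp]
    have : T ^ 8 ≤ N := by
      rw [hT, ← Real.rpow_natCast, ← Real.rpow_mul hNp.le]
      calc (N : ℝ) ^ (κ * (8 : ℕ)) ≤ (N : ℝ) ^ (1 : ℝ) :=
            Real.rpow_le_rpow_of_exponent_le (by exact_mod_cast hN1) (by push_cast; linarith)
        _ = N := Real.rpow_one _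
    have : T ^ 3 ≤ T ^ 8 := pow_le_pow_right₀ (by linarith) (by norm_num)
    nlinarith [sq_nonneg T]
  set M₁ := ⌈2 * T⌉₊ with hM₁
  set M₂ := ⌊(N : ℝ) / T⌋₊ with hM₂
  have hM₁l : 2 * T ≤ M₁ := Nat.le_ceil _
  have hM₁u : (M₁ : ℝ) < 2 * T + 1 := Nat.ceil_lt_add_one (by positivity)
  have hM₂u : (M₂ : ℝ) ≤ N / T := Nat.floor_le (by positivity)
  have hM₂l : (N : ℝ) / T < M₂ + 1 := Nat.lt_floor_add_one _
  have hM : M₁ ≤ M₂ := by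
    apply Nat.le_floor; linarith
  have hM₁0 : 0 < M₁ := Nat.ceil_pos.mpr (by positivity)
  have hM₁r : (0 : ℝ) < M₁ := by exact_mod_cast hM₁0
  have hM₂N : M₂ ≤ N := by
    have : (M₂ : ℝ) ≤ N := hM₂u.trans (div_le_self hNp.le (by linarith))
    exact_mod_cast this
  have hM₂r : (0 : ℝ) < M₂ := by exact_mod_cast hM₁0.trans_le hM
  set g : ℕ → ℝ := fun k => ArithmeticFunction.vonMangoldt k * ‖S (N / k) (k * (a / q + β))‖ with hg
  have hg0 : ∀ k, 0 ≤ g k := fun k => mul_nonneg ArithmeticFunction.vonMangoldt_nonneg (norm_nonneg _)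
  have hg1 : ∀ k, g k ≤ 6 * N * (ArithmeticFunction.vonMangoldt k / k) := by
    intro k
    calc g k ≤ ArithmeticFunction.vonMangoldt k * (6 * (N / k)) := by
          refine mul_le_mul_of_nonneg_left ((norm_S_le _ _).trans ?_) ArithmeticFunction.vonMangoldt_nonneg
          gcongr
          exact Nat.cast_div_le
      _ = _ := by ring
  have hmid : ∑ k ∈ Ioc M₁ M₂, g k ≤ 4 * t * (C / t ^ 2 * N) * (1 + L) := by
    refine sum_le_of_block_le ht0 ?_ hM₂N hg0 (by positivity) ?_
    · have : ((4 * t : ℕ) : ℝ) ≤ M₁ := by push_cast; linarith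
      exact_mod_cast this
    · intro K hK1 hK2
      apply hb
      · have : (M₁ : ℝ) ≤ 2 * K := by exact_mod_cast hK1
        linarith
      · rw [← le_div_iff₀ hTp]
        have : (K : ℝ) ≤ M₂ := by exact_mod_cast hK2.le
        linarith
  have hlow : ∑ k ∈ Ioc 0 M₁, g k ≤ 6 * N * (κ * L + 8) := by
    refine (sum_le_sum fun k _ => hg1 k).trans ?_
    rw [← mul_sum]
    gcongr
    refine (sum_vonMangoldt_div_le hM₁0).trans ?_
    have : Real.log M₁ ≤ Real.log (3 * T) := Real.log_le_log hM₁r (by linarith)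
    rw [Real.log_mul (by norm_num) hTp.ne', hlogT] at this
    have : Real.log 3 ≤ 3 - 1 := Real.log_le_sub_one_of_pos (by norm_num)
    linarith
  have hhigh : ∑ k ∈ Ioc M₂ N, g k ≤ 6 * N * (κ * L + 8) := by
    refine (sum_le_sum fun k _ => hg1 k).trans ?_
    rw [← mul_sum]
    gcongr
    refine (sum_vonMangoldt_div_Ioc_le (hM₁0.trans_le hM) hM₂N).trans ?_
    have : Real.log (N / T) ≤ Real.log (2 * M₂) := Real.log_le_log (by positivity) (by
      have : (1 : ℝ) ≤ M₂ := by exact_mod_cast hM₁0.trans_le hM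
      linarith)
    rw [Real.log_mul (by norm_num) hM₂r.ne', Real.log_div hNp.ne' hTp.ne', hlogT] at this
    have : Real.log 2 ≤ 2 - 1 := Real.log_le_sub_one_of_pos (by norm_num)
    linarith
  rw [← Finset.sum_Ioc_consecutive _ (Nat.zero_le M₁) (hM.trans hM₂N),
    ← Finset.sum_Ioc_consecutive _ hM hM₂N]
  have i1 : 12 * (κ * L) ≤ ε / 4 * L := by nlinarith
  have i2 : 96 ≤ ε / 5 * L := by
    rw [div_le_iff₀ hε] at hL2; linarith
  have i3 : 4 * t * (C / t ^ 2 * N) * (1 + L) ≤ ε / 2 * L * N := by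
    have j1 : 4 * t * (C / t ^ 2 * N) * (1 + L) = 4 * C / t * (1 + L) * N := by field_simp
    have j2 : 4 * C / t ≤ ε / 4 := by
      rw [div_le_iff₀ hε] at htr
      rw [div_le_iff₀ htp]; linarith
    rw [j1]
    calc _ ≤ ε / 4 * (1 + L) * N := by gcongr
      _ ≤ ε / 4 * (L + L) * N := by gcongr
      _ = _ := by ring
  have i4 : (12 * (κ * L) + 96) * N ≤ (ε / 4 * L + ε / 5 * L) * N := by gcongr
  have i5 : 0 < ε * L * N := by positivity
  nlinarith

lemma exists_norm_typeIMul_le_of_lt (Q : ℕ) : ∃ C : ℝ, 0 < C ∧ ∀ ε : ℝ, 0 < ε → ∃ N₀ : ℕ, ∀ N ≥ N₀,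
    ∀ q < Q, 0 < q → ∀ β : ℝ, 0 < |β| → |β| * (q * N) ≤ Real.log N ^ 4 →
    ‖typeIMul q N β‖ ≤ C * Real.log N / |β| + ε * N * Real.log N := by
  induction Q with
  | zero => exact ⟨1, one_pos, fun ε _ => ⟨0, fun N _ q hq => absurd hq (Nat.not_lt_zero q)⟩⟩
  | succ Q ih =>
    obtain ⟨C₁, hC₁, h1⟩ := ih
    rcases Nat.eq_zero_or_pos Q with h0 | h0
    · refine ⟨1, one_pos, fun ε _ => ⟨0, fun N _ q hq hq0 => ?_⟩⟩
      omega
    obtain ⟨C₂, hC₂, h2⟩ := exists_norm_typeIMul_le h0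
    refine ⟨C₁ + C₂, by positivity, fun ε hε => ?_⟩
    obtain ⟨N₁, hN₁⟩ := h1 ε hε
    obtain ⟨N₂, hN₂⟩ := h2 ε hε
    refine ⟨max N₁ N₂, fun N hN q hq hq0 β hβ hβ2 => ?_⟩
    have hL : 0 ≤ Real.log N := Real.log_natCast_nonneg N
    rcases (Nat.lt_succ_iff.mp hq).lt_or_eq with hlt | heq
    · refine (hN₁ N ((le_max_left _ _).trans hN) q hlt hq0 β hβ hβ2).trans ?_
      gcongr
      linarith
    · subst heq
      refine (hN₂ N ((le_max_right _ _).trans hN) β hβ hβ2).trans ?_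
      gcongr
      linarith

lemma exists_norm_S_mul_log_sub_le {ε : ℝ} (hε : 0 < ε) : ∃ Q₀ : ℕ, ∃ B₀ : ℝ, ∃ N₀ : ℕ, ∀ N ≥ N₀,
    ∀ q a : ℕ, ∀ β : ℝ, 0 < q → a.Coprime q → q * Real.log N ^ 4 ≤ N → |β| * (q * N) ≤ Real.log N ^ 4 →
    (Q₀ ≤ q ∨ B₀ ≤ |β| * N) →
    ‖S N (a / q + β) * Real.log N - typeIMul q N β‖ ≤ ε * N * Real.log N := by
  obtain ⟨Q₀, B₀, N₁, h1⟩ := exists_sum_typeII_le (show 0 < ε / 3 by positivity)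
  obtain ⟨N₂, h2⟩ := exists_norm_typeI_sub_le (show 0 < ε / 3 by positivity)
  obtain ⟨N₃, h3⟩ := Filter.eventually_atTop.mp
    (tendsto_log_natCast.eventually (Filter.eventually_ge_atTop (18 / ε)))
  refine ⟨Q₀, B₀, max N₁ (max N₂ N₃), fun N hN q a β hq ha hqN hβ hor => ?_⟩
  have a1 := h1 N ((le_max_left _ _).trans hN) q a β hq ha hqN hβ hor
  have a2 := h2 N (((le_max_left _ _).trans (le_max_right _ _)).trans hN) q a β hq ha hqN hβ
  have a3 := h3 N (((le_max_right _ _).trans (le_max_right _ _)).trans hN)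
  have a4 := norm_selberg_le N (a / q + β)
  have a5 : ‖∑ k ∈ Ioc 0 N, (ArithmeticFunction.vonMangoldt k : ℂ) * S (N / k) (k * (a / q + β))‖ ≤
      ε / 3 * N * Real.log N := by
    refine (norm_sum_le _ _).trans (le_trans (le_of_eq (sum_congr rfl fun k _ => ?_)) a1)
    rw [norm_mul, Complex.norm_real, Real.norm_of_nonneg ArithmeticFunction.vonMangoldt_nonneg]
  have a6 : 6 * (N : ℝ) ≤ ε / 3 * N * Real.log N := by
    rw [div_le_iff₀ hε] at a3
    nlinarith [show (0 : ℝ) ≤ N from Nat.cast_nonneg N]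
  set X := S N (a / q + β) * Real.log N
  set Y := ∑ k ∈ Ioc 0 N, (ArithmeticFunction.vonMangoldt k : ℂ) * S (N / k) (k * (a / q + β))
  set Z := typeI N (a / q + β)
  have e : X - typeIMul q N β = (X + Y - Z) - Y + (Z - typeIMul q N β) := by ring
  rw [e]
  have b1 := norm_add_le ((X + Y - Z) - Y) (Z - typeIMul q N β)
  have b2 := norm_sub_le (X + Y - Z) Y
  linarith

lemma exists_norm_S_le_of_large_denominator {ε : ℝ} (hε : 0 < ε) : ∃ Q₀ : ℕ, ∃ N₀ : ℕ, ∀ N ≥ N₀,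
    ∀ q a : ℕ, ∀ β : ℝ, 0 < q → a.Coprime q → q * Real.log N ^ 4 ≤ N → |β| * (q * N) ≤ Real.log N ^ 4 →
    Q₀ ≤ q → ‖S N (a / q + β)‖ ≤ ε * N := by
  obtain ⟨Q₀, B₀, N₁, h1⟩ := exists_norm_S_mul_log_sub_le (show 0 < ε / 4 by positivity)
  obtain ⟨C, hC, h2⟩ := exists_card_large_spectrum
  have hδ : 0 < ε / 2 := by positivity
  obtain ⟨N₂, hN₂⟩ := h2 (ε / 2) hδ
  obtain ⟨Q₁, hQ₁⟩ := exists_lt_totient ⌈C / (ε / 2) ^ 3⌉₊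
  obtain ⟨N₃, h3⟩ := Filter.eventually_atTop.mp
    (tendsto_log_natCast.eventually (Filter.eventually_ge_atTop 1))
  refine ⟨max Q₀ Q₁, max N₁ (max N₂ N₃), fun N hN q a β hq ha hqN hβ hQ => ?_⟩
  have hL1 := h3 N (((le_max_right _ _).trans (le_max_right _ _)).trans hN)
  have hclose := fun b (hb : b.Coprime q) => h1 N ((le_max_left _ _).trans hN) q b β hq hb hqN hβ
    (Or.inl ((le_max_left _ _).trans hQ))
  set L := Real.log N with hL
  have hLp : 0 < L := by linarith
  by_contra hlt
  push Not at hlt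
  have hqN' : q ≤ N := by
    have : (q : ℝ) ≤ N := by
      refine le_trans ?_ hqN
      exact le_mul_of_one_le_right (Nat.cast_nonneg q) (one_le_pow₀ hL1)
    exact_mod_cast this
  have hnorm : ∀ b : ℕ, ‖S N (b / q + β) * (L : ℂ)‖ = ‖S N (b / q + β)‖ * L := by
    intro b
    rw [norm_mul, Complex.norm_real, Real.norm_of_nonneg hLp.le]
  have hbig : ∀ b : ℕ, b.Coprime q → ε / 2 * N ≤ ‖S N (b / q + β)‖ := by
    intro b hb
    have c1 := hclose a ha
    have c2 := hclose b hb
    have c3 := norm_sub_norm_le (S N (a / q + β) * (L : ℂ)) (S N (b / q + β) * (L : ℂ))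
    have c4 : ‖S N (a / q + β) * (L : ℂ) - S N (b / q + β) * (L : ℂ)‖ ≤ ε / 4 * N * L + ε / 4 * N * L := by
      have := norm_sub_le (S N (a / q + β) * (L : ℂ) - typeIMul q N β) (S N (b / q + β) * (L : ℂ) - typeIMul q N β)
      rw [sub_sub_sub_cancel_right] at this
      linarith
    rw [hnorm, hnorm] at c3
    have c5 : ε * N * L ≤ ‖S N (a / q + β)‖ * L := by gcongr
    have c6 : ε / 2 * N * L ≤ ‖S N (b / q + β)‖ * L := by linarith
    exact le_of_mul_le_mul_right c6 hLp
  have hcard := hN₂ N (((le_max_left _ _).trans (le_max_right _ _)).trans hN)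
    ((range q).filter fun b => q.Coprime b) (fun b : ℕ => (b : ℝ) / q + β) ?_ ?_
  · have h4 := hQ₁ q ((le_max_right _ _).trans hQ)
    have h5 : C / (ε / 2) ^ 3 < q.totient := (Nat.le_ceil _).trans_lt (by exact_mod_cast h4)
    rw [div_lt_iff₀ (by positivity)] at h5
    rw [Nat.totient] at h5
    linarith
  · intro j hj k hk hjk
    have hj' := mem_range.mp (mem_filter.mp hj).1
    have hk' := mem_range.mp (mem_filter.mp hk).1
    have hnd : ¬ (q : ℤ) ∣ (j : ℤ) - k := by
      intro hd
      have := Int.eq_zero_of_abs_lt_dvd hd (by rw [abs_lt]; omega)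
      omega
    have := one_div_le_nn_int_div hq hnd
    have e : (j : ℝ) / q + β - (k / q + β) = ((j : ℤ) - k : ℤ) / q := by push_cast; ring
    rw [e]
    refine le_trans ?_ this
    have hqp : (0 : ℝ) < q := by exact_mod_cast hq
    have : (q : ℝ) ≤ N := by exact_mod_cast hqN'
    gcongr
    linarith
  · intro j hj
    exact hbig j (Nat.coprime_comm.mp (mem_filter.mp hj).2)

/-- Minor arc bound for the exponential sum over primes. -/
lemma exists_norm_S_le_minor {ε : ℝ} (hε : 0 < ε) : ∃ Q₀ : ℕ, ∃ B₀ : ℝ, ∃ N₀ : ℕ, ∀ N ≥ N₀,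
    ∀ q a : ℕ, ∀ β : ℝ, 0 < q → a.Coprime q → q * Real.log N ^ 4 ≤ N → |β| * (q * N) ≤ Real.log N ^ 4 →
    (Q₀ ≤ q ∨ B₀ ≤ |β| * N) → ‖S N (a / q + β)‖ ≤ ε * N := by
  obtain ⟨Q₀, N₁, h1⟩ := exists_norm_S_le_of_large_denominator hε
  obtain ⟨C, hC, h2⟩ := exists_norm_typeIMul_le_of_lt Q₀
  obtain ⟨N₂, hN₂⟩ := h2 (ε / 4) (by positivity)
  obtain ⟨Q₁, B₁, N₃, h3⟩ := exists_norm_S_mul_log_sub_le (show 0 < ε / 4 by positivity)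
  obtain ⟨N₄, h4⟩ := Filter.eventually_atTop.mp
    (tendsto_log_natCast.eventually (Filter.eventually_ge_atTop 1))
  refine ⟨Q₀, max B₁ (2 * C / ε), max (max N₁ N₂) (max N₃ (max N₄ 1)),
    fun N hN q a β hq ha hqN hβ hor => ?_⟩
  simp only [ge_iff_le, max_le_iff] at hN
  obtain ⟨⟨n1, n2⟩, n3, n4, n5⟩ := hN
  rcases le_or_gt Q₀ q with hQ | hQ
  · exact h1 N n1 q a β hq ha hqN hβ hQ
  have hB := hor.resolve_left (not_le.mpr hQ)
  have hB1 := (le_max_left _ _).trans hB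
  have hB2 := (le_max_right _ _).trans hB
  have hL1 := h4 N n4
  have hNp : (0 : ℝ) < N := by exact_mod_cast n5
  have hLp : 0 < Real.log N := by linarith
  have hβp : 0 < |β| := by
    rcases (abs_nonneg β).eq_or_lt with h0 | h0
    · rw [← h0, zero_mul] at hB2
      have : 0 < 2 * C / ε := by positivity
      linarith
    · exact h0
  have b1 := hN₂ N n2 q hQ hq β hβp hβ
  have b2 := h3 N n3 q a β hq ha hqN hβ (Or.inr hB1)
  have b3 : C * Real.log N / |β| ≤ ε / 2 * N * Real.log N := by
    rw [div_le_iff₀ hβp]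
    rw [div_le_iff₀ hε] at hB2
    nlinarith
  have b4 := norm_sub_norm_le (S N (a / q + β) * (Real.log N : ℂ)) (typeIMul q N β)
  have b5 : ‖S N (a / q + β) * (Real.log N : ℂ)‖ = ‖S N (a / q + β)‖ * Real.log N := by
    rw [norm_mul, Complex.norm_real, Real.norm_of_nonneg hLp.le]
  rw [b5] at b4
  exact le_of_mul_le_mul_right (by linarith) hLp

end Goldbach

namespace Goldbach

open Finset MeasureTheory

/-- Half of the Fejér kernel. -/
noncomputable def fejer (v : ℝ) : ℝ := (1 - Real.cos v) / v ^ 2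

lemma fejer_nonneg (v : ℝ) : 0 ≤ fejer v :=
  div_nonneg (by linarith [Real.cos_le_one v]) (sq_nonneg v)

lemma measurable_fejer : Measurable fejer := by
  unfold fejer; fun_prop

lemma fejer_le (v : ℝ) : fejer v ≤ 3 * (1 + v ^ 2)⁻¹ := by
  unfold fejer
  rcases eq_or_ne v 0 with h | h
  · subst h; norm_num
  have hv : 0 < v ^ 2 := by positivity
  rw [← div_eq_mul_inv, div_le_div_iff₀ hv (by positivity)]
  have h1 := Real.one_sub_sq_div_two_le_cos (x := v)
  have h2 := Real.neg_one_le_cos v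
  nlinarith

lemma integrable_fejer : Integrable fejer :=
  (integrable_inv_one_add_sq.const_mul 3).mono' measurable_fejer.aestronglyMeasurable
    (Filter.Eventually.of_forall fun v => by
      rw [Real.norm_of_nonneg (fejer_nonneg v)]; exact fejer_le v)

lemma integral_fejer_pos : 0 < ∫ v, fejer v := by
  rw [integral_pos_iff_support_of_nonneg fejer_nonneg integrable_fejer]
  refine lt_of_lt_of_le ?_ (measure_mono (show Set.Ioo (0 : ℝ) 1 ⊆ Function.support fejer from ?_))
  · rw [Real.volume_Ioo]; norm_num
  · intro v hv
    rw [Function.mem_support]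
    have : Real.cos v < 1 := by
      rw [← Real.cos_zero]
      exact Real.cos_lt_cos_of_nonneg_of_le_pi_div_two le_rfl (by linarith [Real.pi_gt_three, hv.2]) hv.1
    have hv0 : 0 < v ^ 2 := by have := hv.1; positivity
    exact (div_pos (by linarith) hv0).ne'

lemma re_integral_fejer {v : ℝ} (hv : v ≠ 0) :
    (∫ t in (0 : ℝ)..1, (1 - t : ℂ) * Complex.exp (Complex.I * (t * v))).re = fejer v := by
  have hvc : (v : ℂ) ≠ 0 := by exact_mod_cast hv
  set c : ℂ := Complex.I * v with hc
  have hc0 : c ≠ 0 := mul_ne_zero Complex.I_ne_zero hvc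
  have hderiv : ∀ t : ℝ, HasDerivAt (fun t : ℝ => (1 - t : ℂ) * Complex.exp (c * t) / c + Complex.exp (c * t) / c ^ 2)
      ((1 - t : ℂ) * Complex.exp (Complex.I * (t * v))) t := by
    intro t
    have h0 : HasDerivAt (fun t : ℝ => (t : ℂ)) 1 t := Complex.ofRealCLM.hasDerivAt
    have h1 : HasDerivAt (fun t : ℝ => Complex.exp (c * t)) (Complex.exp (c * t) * (c * 1)) t :=
      (h0.const_mul c).cexp
    have h2 := (((h0.const_sub 1).mul h1).div_const c).add (h1.div_const (c ^ 2))
    refine h2.congr_deriv ?_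
    rw [show Complex.I * ((t : ℂ) * v) = c * t by rw [hc]; ring]
    field_simp
    ring
  rw [intervalIntegral.integral_eq_sub_of_hasDerivAt (fun t _ => hderiv t)
    (Continuous.intervalIntegrable (by fun_prop) _ _)]
  have e : c ^ 2 = -((v ^ 2 : ℝ) : ℂ) := by
    rw [hc, mul_pow, Complex.I_sq]; push_cast; ring
  have e2 : Complex.exp c = Real.cos v + Real.sin v * Complex.I := by
    rw [hc, mul_comm, Complex.exp_mul_I]; push_cast; rfl
  have e3 : (1 : ℂ) / c = -(v⁻¹ : ℝ) * Complex.I := by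
    rw [hc, div_eq_iff hc0]
    push_cast
    have : -(v : ℂ)⁻¹ * Complex.I * (Complex.I * v) = -(v : ℂ)⁻¹ * v * (Complex.I * Complex.I) := by ring
    rw [this, Complex.I_mul_I]
    field_simp
  simp only [Complex.ofReal_one, sub_self, zero_mul, zero_div, zero_add, mul_one, Complex.ofReal_zero, sub_zero,
    mul_zero, Complex.exp_zero, e2, e, e3]
  rw [div_neg, div_neg, fejer]
  simp only [Complex.sub_re, Complex.add_re, Complex.neg_re, Complex.div_ofReal_re, Complex.mul_re, Complex.ofReal_re,
    Complex.ofReal_im, Complex.I_re, Complex.I_im, Complex.one_re, Complex.neg_im]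
  ring

lemma re_integral_transform_eq {b : ℝ → ℝ} (hb : Measurable b) {c : ℝ} (hbc : ∀ u, |b u| ≤ c) {H : ℂ → ℂ}
    (hH : ∀ z : ℂ, 0 < z.re → H z = ∫ u in Set.Ioi (0 : ℝ), (b u : ℂ) * Complex.exp (-(z * u)))
    {ε l : ℝ} (hε : 0 < ε) (hl : 0 < l) (y : ℝ) :
    (∫ t in (0 : ℝ)..1, (1 - t : ℂ) * Complex.exp (Complex.I * (l * t * y)) * H (ε + Complex.I * (l * t))).re =
      ∫ u in Set.Ioi (0 : ℝ), b u * Real.exp (-(ε * u)) * fejer (l * (y - u)) := by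
  set k : ℝ → ℝ → ℂ := fun t u =>
    ((1 - t : ℂ) * Complex.exp (Complex.I * (t * (l * (y - u) : ℝ)))) * ((b u * Real.exp (-(ε * u)) : ℝ) : ℂ) with hk
  have h1 : ∀ t : ℝ, (1 - t : ℂ) * Complex.exp (Complex.I * (l * t * y)) * H (ε + Complex.I * (l * t)) =
      ∫ u in Set.Ioi (0 : ℝ), k t u := by
    intro t
    rw [hH _ (by simpa using hε), ← integral_const_mul]
    refine integral_congr_ae (Filter.Eventually.of_forall fun u => ?_)
    simp only [hk]
    push_cast
    have : Complex.exp (Complex.I * (l * t * y)) * Complex.exp (-((ε + Complex.I * (l * t)) * u)) =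
        Complex.exp (Complex.I * (t * (l * (y - u)))) * Complex.exp (-(ε * u)) := by
      rw [← Complex.exp_add, ← Complex.exp_add]; congr 1; ring
    linear_combination (1 - t : ℂ) * b u * this
  have h_integ : Integrable (Function.uncurry k)
      ((volume.restrict (Set.Ioc (0 : ℝ) 1)).prod (volume.restrict (Set.Ioi (0 : ℝ)))) := by
    have hg : Integrable (fun u : ℝ => c * Real.exp (-(ε * u))) (volume.restrict (Set.Ioi (0 : ℝ))) := by
      have := (integrableOn_exp_mul_Ioi (a := -ε) (by linarith) 0).const_mul c
      simpa [neg_mul] using this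
    have hone : Integrable (fun _ : ℝ => (1 : ℝ)) (volume.restrict (Set.Ioc (0 : ℝ) 1)) := integrable_const _
    refine (hone.mul_prod hg).mono' ?_ ?_
    · apply Measurable.aestronglyMeasurable
      simp only [hk, Function.uncurry_def]
      fun_prop
    · rw [Measure.prod_restrict]
      refine (ae_restrict_iff' (measurableSet_Ioc.prod measurableSet_Ioi)).mpr (Filter.Eventually.of_forall ?_)
      rintro ⟨t, u⟩ ⟨ht, hu⟩
      simp only [Function.uncurry_def, hk, one_mul]
      rw [norm_mul, norm_mul, mul_comm Complex.I, ← Complex.ofReal_mul, Complex.norm_exp_ofReal_mul_I, mul_one,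
        Complex.norm_real, Real.norm_eq_abs, abs_mul, Real.abs_exp]
      have : ‖(1 - t : ℂ)‖ ≤ 1 := by
        rw [show (1 - t : ℂ) = ((1 - t : ℝ) : ℂ) by push_cast; ring, Complex.norm_real, Real.norm_eq_abs, abs_le]
        simp only [Set.mem_Ioc] at ht
        constructor <;> linarith
      calc _ ≤ 1 * (c * Real.exp (-(ε * u))) := by gcongr; exact hbc u
        _ = _ := one_mul _
  simp_rw [h1]
  rw [intervalIntegral.integral_of_le zero_le_one, integral_integral_swap h_integ]
  have h_integ₂ : Integrable (fun u => ∫ t in Set.Ioc (0 : ℝ) 1, k t u) (volume.restrict (Set.Ioi (0 : ℝ))) :=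
    h_integ.integral_prod_right
  rw [← RCLike.re_eq_complex_re, ← integral_re h_integ₂]
  refine integral_congr_ae ?_
  have hne : ∀ᵐ u ∂(volume.restrict (Set.Ioi (0 : ℝ))), u ≠ y :=
    ae_restrict_of_ae (Measure.ae_ne volume y)
  filter_upwards [hne] with u hu
  simp only [hk]
  rw [integral_mul_const, ← intervalIntegral.integral_of_le zero_le_one, RCLike.re_eq_complex_re,
    Complex.re_mul_ofReal, re_integral_fejer (mul_ne_zero hl.ne' (sub_ne_zero.mpr hu.symm)), mul_comm]

lemma re_integral_boundary_eq {b : ℝ → ℝ} (hb : Measurable b) {c : ℝ} (hbc : ∀ u, |b u| ≤ c) {H : ℂ → ℂ}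
    (hHc : ContinuousOn H {z | 0 ≤ z.re})
    (hH : ∀ z : ℂ, 0 < z.re → H z = ∫ u in Set.Ioi (0 : ℝ), (b u : ℂ) * Complex.exp (-(z * u)))
    {l : ℝ} (hl : 0 < l) (y : ℝ) :
    (∫ t in (0 : ℝ)..1, (1 - t : ℂ) * Complex.exp (Complex.I * (l * t * y)) * H (Complex.I * (l * t))).re =
      ∫ u in Set.Ioi (0 : ℝ), b u * fejer (l * (y - u)) := by
  have hmaps : ∀ ε : ℝ, 0 ≤ ε → ∀ t : ℝ, ((ε : ℂ) + Complex.I * (l * t)) ∈ {z : ℂ | 0 ≤ z.re} := by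
    intro ε hε t
    simpa using hε
  have hcont : ∀ ε : ℝ, 0 ≤ ε → Continuous fun t : ℝ => H (ε + Complex.I * (l * t)) := fun ε hε =>
    hHc.comp_continuous (by fun_prop) (hmaps ε hε)
  obtain ⟨M, hM⟩ := (isCompact_Icc (a := (0 : ℝ)) (b := 1)).prod (isCompact_Icc (a := (0 : ℝ)) (b := 1))
    |>.exists_bound_of_continuousOn (f := fun p : ℝ × ℝ => H ((p.1 : ℂ) + Complex.I * (l * p.2)))
      (hHc.comp (by fun_prop) (fun p hp => hmaps p.1 hp.1.1 p.2))
  have hε1 : ∀ᶠ ε : ℝ in nhdsWithin 0 (Set.Ioi 0), 0 < ε ∧ ε ≤ 1 := by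
    filter_upwards [Ioc_mem_nhdsGT (show (0 : ℝ) < 1 from one_pos)] with ε h
    exact h
  have hl1 : Filter.Tendsto (fun ε : ℝ => (∫ t in (0 : ℝ)..1,
      (1 - t : ℂ) * Complex.exp (Complex.I * (l * t * y)) * H (ε + Complex.I * (l * t))).re)
      (nhdsWithin 0 (Set.Ioi 0)) (nhds (∫ t in (0 : ℝ)..1,
      (1 - t : ℂ) * Complex.exp (Complex.I * (l * t * y)) * H (Complex.I * (l * t))).re) := by
    refine (Complex.continuous_re.tendsto _).comp ?_
    refine intervalIntegral.tendsto_integral_filter_of_dominated_convergence (fun _ => M) ?_ ?_ ?_ ?_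
    · filter_upwards [hε1] with ε hε
      apply Continuous.aestronglyMeasurable
      exact (by fun_prop : Continuous fun t : ℝ => (1 - t : ℂ) * Complex.exp (Complex.I * (l * t * y))).mul
        (hcont ε hε.1.le)
    · filter_upwards [hε1] with ε hε
      refine Filter.Eventually.of_forall fun t ht => ?_
      rw [Set.uIoc_of_le zero_le_one] at ht
      have h1 := hM (ε, t) ⟨⟨hε.1.le, hε.2⟩, ⟨ht.1.le, ht.2⟩⟩
      have h2 : ‖(1 - t : ℂ)‖ ≤ 1 := by
        rw [show (1 - t : ℂ) = ((1 - t : ℝ) : ℂ) by push_cast; ring, Complex.norm_real, Real.norm_eq_abs, abs_le]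
        simp only [Set.mem_Ioc] at ht
        constructor <;> linarith
      rw [norm_mul, norm_mul, show Complex.I * (l * t * y : ℂ) = ((l * t * y : ℝ) : ℂ) * Complex.I by push_cast; ring,
        Complex.norm_exp_ofReal_mul_I, mul_one]
      calc _ ≤ 1 * M := by gcongr
        _ = M := one_mul _
    · exact intervalIntegrable_const
    · refine Filter.Eventually.of_forall fun t _ => ?_
      refine Filter.Tendsto.const_mul _ ?_
      have : ContinuousWithinAt H {z | 0 ≤ z.re} (Complex.I * (l * t)) := hHc _ (by simp)
      refine this.tendsto.comp (tendsto_nhdsWithin_iff.mpr ⟨?_, ?_⟩)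
      · have h : Continuous fun ε : ℝ => (ε : ℂ) + Complex.I * (l * t) := by fun_prop
        have := h.tendsto 0
        simp only [Complex.ofReal_zero, zero_add] at this
        exact this.mono_left nhdsWithin_le_nhds
      · filter_upwards [hε1] with ε hε
        exact hmaps ε hε.1.le t
  have hl2 : Filter.Tendsto (fun ε : ℝ => ∫ u in Set.Ioi (0 : ℝ), b u * Real.exp (-(ε * u)) * fejer (l * (y - u)))
      (nhdsWithin 0 (Set.Ioi 0)) (nhds (∫ u in Set.Ioi (0 : ℝ), b u * fejer (l * (y - u)))) := by
    have hm : Measurable fun u : ℝ => fejer (l * (y - u)) := measurable_fejer.comp (by fun_prop)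
    refine tendsto_integral_filter_of_dominated_convergence (fun u => c * fejer (l * (y - u))) ?_ ?_ ?_ ?_
    · refine Filter.Eventually.of_forall fun ε => ?_
      apply Measurable.aestronglyMeasurable
      fun_prop
    · filter_upwards [hε1] with ε hε
      refine (ae_restrict_iff' measurableSet_Ioi).mpr (Filter.Eventually.of_forall fun u hu => ?_)
      rw [Real.norm_eq_abs, abs_mul, abs_mul, Real.abs_exp, abs_of_nonneg (fejer_nonneg _)]
      have h1 : Real.exp (-(ε * u)) ≤ 1 := Real.exp_le_one_iff.mpr (by
        have := mul_pos hε.1 hu; linarith)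
      have h0 := fejer_nonneg (l * (y - u))
      calc _ ≤ c * 1 * fejer (l * (y - u)) := by
            gcongr
            · exact (abs_nonneg _).trans (hbc u)
            · exact hbc u
        _ = _ := by ring
    · refine (Integrable.const_mul ?_ c).integrableOn
      exact (integrable_fejer.comp_mul_left' hl.ne').comp_sub_left y
    · refine Filter.Eventually.of_forall fun u => ?_
      have h : Continuous fun ε : ℝ => b u * Real.exp (-(ε * u)) * fejer (l * (y - u)) := by fun_prop
      have := h.tendsto 0
      simp only [zero_mul, neg_zero, Real.exp_zero, mul_one] at this
      exact this.mono_left nhdsWithin_le_nhds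
  refine tendsto_nhds_unique hl1 (hl2.congr' ?_)
  filter_upwards [hε1] with ε hε
  exact (re_integral_transform_eq hb hbc hH hε.1 hl y).symm

lemma tendsto_integral_fejer_zero {b : ℝ → ℝ} (hb : Measurable b) {c : ℝ} (hbc : ∀ u, |b u| ≤ c) {H : ℂ → ℂ}
    (hHc : ContinuousOn H {z | 0 ≤ z.re})
    (hH : ∀ z : ℂ, 0 < z.re → H z = ∫ u in Set.Ioi (0 : ℝ), (b u : ℂ) * Complex.exp (-(z * u)))
    {l : ℝ} (hl : 0 < l) :
    Filter.Tendsto (fun y => ∫ u in Set.Ioi (0 : ℝ), b u * fejer (l * (y - u))) Filter.atTop (nhds 0) := by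
  have h1 := Real.tendsto_integral_exp_smul_cocompact
    (Set.indicator (Set.Ioc (0 : ℝ) 1) fun t : ℝ => (1 - t : ℂ) * H (Complex.I * (l * t)))
  have h2 : Filter.Tendsto (fun y : ℝ => -(l / (2 * Real.pi)) * y) Filter.atTop (Filter.cocompact ℝ) := by
    refine Filter.Tendsto.mono_right ?_ atBot_le_cocompact
    exact Filter.tendsto_id.const_mul_atTop_of_neg (by
      have := Real.pi_pos
      have : 0 < l / (2 * Real.pi) := by positivity
      linarith)
  have h3 := (Complex.continuous_re.tendsto _).comp (h1.comp h2)
  rw [Complex.zero_re] at h3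
  refine h3.congr fun y => ?_
  rw [← re_integral_boundary_eq hb hbc hHc hH hl y]
  simp only [Function.comp_apply]
  congr 1
  rw [intervalIntegral.integral_of_le zero_le_one, ← integral_indicator measurableSet_Ioc]
  refine integral_congr_ae (Filter.Eventually.of_forall fun t => ?_)
  simp only [Set.indicator_apply]
  split_ifs
  · rw [Circle.smul_def, Real.fourierChar_apply, smul_eq_mul]
    have hpi : (Real.pi : ℂ) ≠ 0 := by exact_mod_cast Real.pi_ne_zero
    have : ((2 * Real.pi * -(t * (-(l / (2 * Real.pi)) * y)) : ℝ) : ℂ) * Complex.I = Complex.I * (l * t * y) := by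
      push_cast
      field_simp
    rw [this]; ring
  · rw [smul_zero]

lemma tendsto_integral_conv_fejer {B : ℝ → ℝ} (hB : Measurable B) {c A : ℝ} (hB0 : ∀ u, 0 ≤ B u) (hBc : ∀ u, B u ≤ c)
    (hBz : ∀ u ≤ 0, B u = 0) {H : ℂ → ℂ} (hHc : ContinuousOn H {z | 0 ≤ z.re})
    (hH : ∀ z : ℂ, 0 < z.re → H z = ∫ u in Set.Ioi (0 : ℝ), ((B u - A : ℝ) : ℂ) * Complex.exp (-(z * u)))
    {l : ℝ} (hl : 0 < l) :
    Filter.Tendsto (fun y => ∫ v, B (y - v / l) * fejer v) Filter.atTop (nhds (A * ∫ v, fejer v)) := by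
  have hbc : ∀ u, |B u - A| ≤ c + |A| := by
    intro u
    have h1 := abs_sub (B u) A
    rw [abs_of_nonneg (hB0 u)] at h1
    linarith [hBc u]
  have h1 := tendsto_integral_fejer_zero (hB.sub_const A) hbc hHc hH hl
  have h2 : Filter.Tendsto (fun y : ℝ => ∫ v, (if 0 < y - v / l then A else 0) * fejer v) Filter.atTop
      (nhds (∫ v, A * fejer v)) := by
    refine tendsto_integral_filter_of_dominated_convergence (fun v => |A| * fejer v) ?_ ?_
      (integrable_fejer.const_mul _) ?_
    · refine Filter.Eventually.of_forall fun y => ?_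
      apply Measurable.aestronglyMeasurable
      refine Measurable.mul ?_ measurable_fejer
      exact Measurable.ite (measurableSet_lt measurable_const (by fun_prop)) measurable_const measurable_const
    · refine Filter.Eventually.of_forall fun y => Filter.Eventually.of_forall fun v => ?_
      rw [Real.norm_eq_abs, abs_mul, abs_of_nonneg (fejer_nonneg v)]
      refine mul_le_mul_of_nonneg_right ?_ (fejer_nonneg v)
      split_ifs
      · exact le_rfl
      · simp
    · refine Filter.Eventually.of_forall fun v => ?_
      refine tendsto_const_nhds.congr' ?_
      filter_upwards [Filter.eventually_gt_atTop (v / l)] with y hy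
      rw [if_pos (by linarith)]
  rw [integral_const_mul] at h2
  have h3 := (h1.const_mul l).add h2
  rw [mul_zero, zero_add] at h3
  refine h3.congr fun y => ?_
  set φ : ℝ → ℝ := fun v => (if 0 < y - v / l then B (y - v / l) - A else 0) * fejer v with hφ
  have e1 : ∫ u in Set.Ioi (0 : ℝ), (B u - A) * fejer (l * (y - u)) = ∫ u, φ (l * (y - u)) := by
    rw [← integral_indicator measurableSet_Ioi]
    refine integral_congr_ae (Filter.Eventually.of_forall fun u => ?_)
    have : y - l * (y - u) / l = u := by field_simp; ring
    simp only [hφ, this, Set.indicator_apply, Set.mem_Ioi]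
    split_ifs <;> simp
  have e2 : ∫ u, φ (l * (y - u)) = l⁻¹ * ∫ v, φ v := by
    rw [integral_sub_left_eq_self (fun u => φ (l * u)) volume y, Measure.integral_comp_mul_left,
      abs_of_pos (inv_pos.mpr hl), smul_eq_mul]
  have hmeas : Measurable fun v : ℝ => if 0 < y - v / l then (1 : ℝ) else 0 :=
    Measurable.ite (measurableSet_lt measurable_const (by fun_prop)) measurable_const measurable_const
  have hi : ∀ (g : ℝ → ℝ), Measurable g → ∀ M, (∀ u, |g u| ≤ M) → Integrable fun v => g v * fejer v := by
    intro g hg M hgM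
    refine (integrable_fejer.const_mul M).mono' (hg.mul measurable_fejer).aestronglyMeasurable
      (Filter.Eventually.of_forall fun v => ?_)
    rw [Real.norm_eq_abs, abs_mul, abs_of_nonneg (fejer_nonneg v)]
    exact mul_le_mul_of_nonneg_right (hgM v) (fejer_nonneg v)
  rw [e1, e2, ← mul_assoc, mul_inv_cancel₀ hl.ne', one_mul, ← integral_add]
  · refine integral_congr_ae (Filter.Eventually.of_forall fun v => ?_)
    simp only [hφ]
    split_ifs with h
    · ring
    · rw [hBz _ (not_lt.mp h)]; ring
  · refine hi _ ?_ (c + |A|) ?_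
    · exact Measurable.ite (measurableSet_lt measurable_const (by fun_prop)) (by fun_prop) measurable_const
    · intro u
      split_ifs
      · exact hbc _
      · rw [abs_zero]; exact (abs_nonneg _).trans (hbc 0)
  · refine hi _ ?_ |A| ?_
    · exact Measurable.ite (measurableSet_lt measurable_const (by fun_prop)) measurable_const measurable_const
    · intro u
      split_ifs
      · exact le_rfl
      · simp

lemma tauberian_bounds {B : ℝ → ℝ} (hB : Measurable B) {c : ℝ} (hB0 : ∀ u, 0 ≤ B u) (hBc : ∀ u, B u ≤ c)
    (hmono : ∀ y h, 0 ≤ h → B y * Real.exp (-h) ≤ B (y + h)) {R δ : ℝ} (hR : 0 < R) (hδ : 0 < δ) (y : ℝ) :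
    B y * Real.exp (-(2 * δ)) * (∫ v in -R..R, fejer v) ≤ ∫ v, B (y + δ - v / (R / δ)) * fejer v ∧
    ∫ v, B (y - δ - v / (R / δ)) * fejer v ≤
      B y * Real.exp (2 * δ) * (∫ v, fejer v) + c * ((∫ v, fejer v) - ∫ v in -R..R, fejer v) := by
  have hi : ∀ (g : ℝ → ℝ), Measurable g → (∀ u, 0 ≤ g u) → (∀ u, g u ≤ c) → Integrable fun v => g v * fejer v := by
    intro g hg hg0 hgM
    refine (integrable_fejer.const_mul c).mono' (hg.mul measurable_fejer).aestronglyMeasurable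
      (Filter.Eventually.of_forall fun v => ?_)
    rw [Real.norm_eq_abs, abs_mul, abs_of_nonneg (fejer_nonneg v), abs_of_nonneg (hg0 v)]
    exact mul_le_mul_of_nonneg_right (hgM v) (fejer_nonneg v)
  have hv : ∀ v ∈ Set.Ioc (-R) R, -δ ≤ v / (R / δ) ∧ v / (R / δ) ≤ δ := by
    intro v hv
    have : 0 < R / δ := by positivity
    rw [le_div_iff₀ this, div_le_iff₀ this]
    have : δ * (R / δ) = R := by field_simp
    rw [neg_mul, this]
    exact ⟨hv.1.le, hv.2⟩
  have hle : -R ≤ R := by linarith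
  constructor
  · have h_integ := hi (fun v => B (y + δ - v / (R / δ))) (by fun_prop) (fun _ => hB0 _) (fun _ => hBc _)
    rw [intervalIntegral.integral_of_le hle, ← integral_const_mul]
    refine le_trans (setIntegral_mono_on (integrable_fejer.const_mul _).integrableOn h_integ.integrableOn
      measurableSet_Ioc fun v hvm => ?_) (setIntegral_le_integral h_integ
        (Filter.Eventually.of_forall fun v => mul_nonneg (hB0 _) (fejer_nonneg v)))
    refine mul_le_mul_of_nonneg_right ?_ (fejer_nonneg v)
    obtain ⟨h1, h2⟩ := hv v hvm
    have h3 := hmono y (δ - v / (R / δ)) (by linarith)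
    rw [show y + (δ - v / (R / δ)) = y + δ - v / (R / δ) by ring] at h3
    refine le_trans (mul_le_mul_of_nonneg_left (Real.exp_le_exp.mpr ?_) (hB0 y)) h3
    linarith
  · have h_integ := hi (fun v => B (y - δ - v / (R / δ))) (by fun_prop) (fun _ => hB0 _) (fun _ => hBc _)
    have hc0 : 0 ≤ c := (hB0 0).trans (hBc 0)
    have hind : Integrable ((Set.Ioc (-R) R).indicator fejer) := integrable_fejer.indicator measurableSet_Ioc
    have hpt : ∀ v, B (y - δ - v / (R / δ)) * fejer v ≤
        B y * Real.exp (2 * δ) * fejer v + c * (fejer v - (Set.Ioc (-R) R).indicator fejer v) := by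
      intro v
      have hf := fejer_nonneg v
      by_cases hvm : v ∈ Set.Ioc (-R) R
      · rw [Set.indicator_of_mem hvm, sub_self, mul_zero, add_zero]
        refine mul_le_mul_of_nonneg_right ?_ hf
        obtain ⟨h1, h2⟩ := hv v hvm
        have h3 := hmono (y - δ - v / (R / δ)) (δ + v / (R / δ)) (by linarith)
        rw [show y - δ - v / (R / δ) + (δ + v / (R / δ)) = y by ring, Real.exp_neg,
          ← div_eq_mul_inv, div_le_iff₀ (Real.exp_pos _)] at h3
        refine h3.trans (mul_le_mul_of_nonneg_left (Real.exp_le_exp.mpr ?_) (hB0 y))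
        linarith
      · rw [Set.indicator_of_notMem hvm, sub_zero]
        have h1 := mul_le_mul_of_nonneg_right (hBc (y - δ - v / (R / δ))) hf
        have h2 : 0 ≤ B y * Real.exp (2 * δ) * fejer v :=
          mul_nonneg (mul_nonneg (hB0 y) (Real.exp_pos _).le) hf
        linarith
    have i1 : Integrable fun v => B y * Real.exp (2 * δ) * fejer v := integrable_fejer.const_mul _
    have i2 : Integrable fun v => c * (fejer v - (Set.Ioc (-R) R).indicator fejer v) :=
      (integrable_fejer.sub hind).const_mul c
    refine (integral_mono h_integ (g := fun v => B y * Real.exp (2 * δ) * fejer v +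
      c * (fejer v - (Set.Ioc (-R) R).indicator fejer v)) (i1.add i2) hpt).trans (le_of_eq ?_)
    rw [integral_add i1 i2, integral_const_mul,
      integral_const_mul, integral_sub integrable_fejer hind, integral_indicator measurableSet_Ioc,
      intervalIntegral.integral_of_le hle]

/-- A Tauberian theorem of Wiener–Ikehara type. -/
lemma tendsto_of_laplace_continuousOn {B : ℝ → ℝ} (hB : Measurable B) {c A : ℝ} (hB0 : ∀ u, 0 ≤ B u) (hBc : ∀ u, B u ≤ c)
    (hBz : ∀ u ≤ 0, B u = 0) (hmono : ∀ y h, 0 ≤ h → B y * Real.exp (-h) ≤ B (y + h))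
    {H : ℂ → ℂ} (hHc : ContinuousOn H {z | 0 ≤ z.re})
    (hH : ∀ z : ℂ, 0 < z.re → H z = ∫ u in Set.Ioi (0 : ℝ), ((B u - A : ℝ) : ℂ) * Complex.exp (-(z * u))) :
    Filter.Tendsto B Filter.atTop (nhds A) := by
  set I := ∫ v, fejer v with hI
  have hIp : 0 < I := integral_fejer_pos
  have hc0 : 0 ≤ c := (hB0 0).trans (hBc 0)
  have key : ∀ θ : ℝ, 0 < θ → θ < 1 → ∀ᶠ y in Filter.atTop,
      B y ≤ (A + θ) * Real.exp (2 * θ) / (1 - θ) ∧ (A - θ - c * θ) * Real.exp (-(2 * θ)) ≤ B y := by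
    intro θ hθ hθ1
    have hlim : Filter.Tendsto (fun R : ℝ => ∫ v in -R..R, fejer v) Filter.atTop (nhds I) :=
      intervalIntegral_tendsto_integral integrable_fejer Filter.tendsto_neg_atTop_atBot Filter.tendsto_id
    obtain ⟨R, hR1, hR⟩ := ((hlim.eventually (lt_mem_nhds (show (1 - θ) * I < I by nlinarith))).and
      (Filter.eventually_gt_atTop 0)).exists
    have hJ := tendsto_integral_conv_fejer hB hB0 hBc hBz hHc hH (show 0 < R / θ by positivity)
    have hJ1 := hJ.comp (Filter.tendsto_atTop_add_const_right _ θ Filter.tendsto_id)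
    have hJ2 := hJ.comp (Filter.tendsto_atTop_add_const_right _ (-θ) Filter.tendsto_id)
    have hθI : 0 < θ * I := by positivity
    filter_upwards [hJ1.eventually (gt_mem_nhds (show A * I < A * I + θ * I by linarith)),
      hJ2.eventually (lt_mem_nhds (show A * I - θ * I < A * I by linarith))] with y hy1 hy2
    obtain ⟨b1, b2⟩ := tauberian_bounds hB hB0 hBc hmono hR hθ y
    simp only [Function.comp_apply, id_eq] at hy1 hy2
    rw [← sub_eq_add_neg] at hy2
    have hexp : Real.exp (-(2 * θ)) * Real.exp (2 * θ) = 1 := by rw [← Real.exp_add]; simp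
    have hep := Real.exp_pos (2 * θ)
    have hen := Real.exp_pos (-(2 * θ))
    constructor
    · rw [le_div_iff₀ (by linarith)]
      have d1 : B y * Real.exp (-(2 * θ)) * ((1 - θ) * I) ≤ (A + θ) * I := by
        have : B y * Real.exp (-(2 * θ)) * ((1 - θ) * I) ≤ B y * Real.exp (-(2 * θ)) * ∫ v in -R..R, fejer v :=
          mul_le_mul_of_nonneg_left hR1.le (mul_nonneg (hB0 y) hen.le)
        linarith
      have d2 : B y * Real.exp (-(2 * θ)) * (1 - θ) ≤ A + θ := by
        refine le_of_mul_le_mul_right ?_ hIp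
        linarith
      calc B y * (1 - θ) = B y * Real.exp (-(2 * θ)) * (1 - θ) * Real.exp (2 * θ) := by
            linear_combination -(B y * (1 - θ)) * hexp
        _ ≤ _ := by gcongr
    · have d1 : (A - θ - c * θ) * I ≤ B y * Real.exp (2 * θ) * I := by
        have : c * (I - ∫ v in -R..R, fejer v) ≤ c * (θ * I) := by
          gcongr; linarith
        linarith
      have d2 := le_of_mul_le_mul_right d1 hIp
      calc _ ≤ B y * Real.exp (2 * θ) * Real.exp (-(2 * θ)) := by gcongr
        _ = B y := by linear_combination B y * hexp
  have hgt : ∀ᶠ θ : ℝ in nhdsWithin 0 (Set.Ioi 0), 0 < θ ∧ θ < 1 := Ioo_mem_nhdsGT one_pos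
  refine tendsto_order.mpr ⟨fun a ha => ?_, fun a ha => ?_⟩
  · have hl : Filter.Tendsto (fun θ : ℝ => (A - θ - c * θ) * Real.exp (-(2 * θ))) (nhdsWithin 0 (Set.Ioi 0)) (nhds A) := by
      have h : Continuous fun θ : ℝ => (A - θ - c * θ) * Real.exp (-(2 * θ)) := by fun_prop
      have := h.tendsto 0
      simp only [sub_zero, mul_zero, neg_zero, Real.exp_zero, mul_one] at this
      exact this.mono_left nhdsWithin_le_nhds
    obtain ⟨θ, h1, h2, h3⟩ := ((hl.eventually (lt_mem_nhds ha)).and hgt).exists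
    filter_upwards [key θ h2 h3] with y hy
    exact h1.trans_le hy.2
  · have hl : Filter.Tendsto (fun θ : ℝ => (A + θ) * Real.exp (2 * θ) / (1 - θ)) (nhdsWithin 0 (Set.Ioi 0)) (nhds A) := by
      have h : ContinuousAt (fun θ : ℝ => (A + θ) * Real.exp (2 * θ) / (1 - θ)) 0 := by
        refine ContinuousAt.div (by fun_prop) (by fun_prop) (by norm_num)
      have := h.tendsto
      simp only [add_zero, mul_zero, Real.exp_zero, mul_one, sub_zero, div_one] at this
      exact this.mono_left nhdsWithin_le_nhds
    obtain ⟨θ, h1, h2, h3⟩ := ((hl.eventually (gt_mem_nhds ha)).and hgt).exists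
    filter_upwards [key θ h2 h3] with y hy
    exact hy.1.trans_lt h1

open ArithmeticFunction.vonMangoldt in
lemma sum_residueClass_le {q : ℕ} (a : ZMod q) (n : ℕ) : ∑ k ∈ Icc 1 n, residueClass a k ≤ 6 * n := by
  calc ∑ k ∈ Icc 1 n, residueClass a k ≤ ∑ k ∈ Icc 1 n, ArithmeticFunction.vonMangoldt k :=
        Finset.sum_le_sum fun k _ => residueClass_le a k
    _ ≤ ∑ k ∈ range (n + 1), ArithmeticFunction.vonMangoldt k := by
        refine Finset.sum_le_sum_of_subset_of_nonneg (fun k hk => ?_)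
          fun _ _ _ => ArithmeticFunction.vonMangoldt_nonneg
        rw [Finset.mem_Icc] at hk
        exact Finset.mem_range.mpr (by omega)
    _ ≤ 6 * n := sum_vonMangoldt_le n

lemma integral_Ioi_one_eq (g : ℝ → ℂ) :
    ∫ t in Set.Ioi (1 : ℝ), g t = ∫ u in Set.Ioi (0 : ℝ), (Real.exp u : ℂ) * g (Real.exp u) := by
  have him : Real.exp '' Set.Ioi 0 = Set.Ioi 1 := by
    ext t
    constructor
    · rintro ⟨u, hu, rfl⟩
      exact Real.one_lt_exp_iff.mpr hu
    · intro ht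
      have h1 : (1 : ℝ) < t := ht
      exact ⟨Real.log t, Real.log_pos h1, Real.exp_log (by linarith)⟩
  rw [← him, integral_image_eq_integral_abs_deriv_smul measurableSet_Ioi
    (fun u _ => (Real.hasDerivAt_exp u).hasDerivWithinAt) Real.exp_injective.injOn]
  refine setIntegral_congr_fun measurableSet_Ioi fun u _ => ?_
  simp [abs_of_pos (Real.exp_pos u)]

open ArithmeticFunction.vonMangoldt in
/-- The prime number theorem in arithmetic progressions. -/
lemma tendsto_sum_residueClass_div {q : ℕ} [NeZero q] {a : ZMod q} (ha : IsUnit a) :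
    Filter.Tendsto (fun n : ℕ => (∑ k ∈ Icc 1 n, residueClass a k) / n) Filter.atTop
      (nhds ((q.totient : ℝ)⁻¹)) := by
  set f : ℕ → ℝ := residueClass a with hf
  have hf0 : ∀ n, 0 ≤ f n := residueClass_nonneg a
  set C : ℕ → ℝ := fun n => ∑ k ∈ Icc 1 n, f k with hC
  have hC0 : ∀ n, 0 ≤ C n := fun n => Finset.sum_nonneg fun k _ => hf0 k
  have hCm : Monotone C := fun m n h => Finset.sum_le_sum_of_subset_of_nonneg
    (Finset.Icc_subset_Icc_right h) fun k _ _ => hf0 k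
  have hf1 : f 1 = 0 := le_antisymm ((residueClass_le a 1).trans (by simp)) (hf0 1)
  set A : ℝ := (q.totient : ℝ)⁻¹ with hA
  set B : ℝ → ℝ := fun u => Real.exp (-u) * C ⌊Real.exp u⌋₊ with hB
  have hBm : Measurable B := by
    have h1 : Measurable fun u : ℝ => C ⌊Real.exp u⌋₊ :=
      (measurable_from_top (f := C)).comp (Nat.measurable_floor.comp Real.measurable_exp)
    exact (by fun_prop : Measurable fun u : ℝ => Real.exp (-u)).mul h1
  have hB0 : ∀ u, 0 ≤ B u := fun u => mul_nonneg (Real.exp_pos _).le (hC0 _)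
  have hB6 : ∀ u, B u ≤ 6 := by
    intro u
    have h1 : C ⌊Real.exp u⌋₊ ≤ 6 * Real.exp u := (sum_residueClass_le a _).trans
      (mul_le_mul_of_nonneg_left (Nat.floor_le (Real.exp_pos u).le) (by norm_num))
    calc B u ≤ Real.exp (-u) * (6 * Real.exp u) := mul_le_mul_of_nonneg_left h1 (Real.exp_pos _).le
      _ = 6 * (Real.exp (-u) * Real.exp u) := by ring
      _ = 6 := by rw [← Real.exp_add]; simp
  have hBz : ∀ u ≤ 0, B u = 0 := by
    intro u hu
    have h1 : ⌊Real.exp u⌋₊ ≤ 1 := by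
      refine Nat.floor_le_of_le ?_
      simpa using Real.exp_le_one_iff.mpr hu
    have h2 : C 1 = 0 := by simp [hC, hf1]
    have h3 : C ⌊Real.exp u⌋₊ = 0 := le_antisymm (h2 ▸ hCm h1) (hC0 _)
    simp only [hB, h3, mul_zero]
  have hmono : ∀ y h, 0 ≤ h → B y * Real.exp (-h) ≤ B (y + h) := by
    intro y h hh
    simp only [hB]
    rw [neg_add, Real.exp_add, mul_right_comm]
    refine mul_le_mul_of_nonneg_left (hCm (Nat.floor_mono (Real.exp_le_exp.mpr (by linarith)))) ?_
    positivity
  have hre : ∀ z : ℂ, 0 ≤ z.re → z + 1 ≠ 0 := by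
    intro z hz h0
    have := congrArg Complex.re h0
    simp at this
    linarith
  have hHc : ContinuousOn (fun z : ℂ => (LFunctionResidueClassAux a (z + 1) - A) / (z + 1)) {z | 0 ≤ z.re} := by
    refine ContinuousOn.div (ContinuousOn.sub ?_ continuousOn_const) (by fun_prop) hre
    refine (continuousOn_LFunctionResidueClassAux a).comp (by fun_prop) ?_
    intro z hz
    have : (0 : ℝ) ≤ z.re := hz
    simpa using this
  have hlim := tendsto_of_laplace_continuousOn hBm (A := A) hB0 hB6 hBz hmono hHc ?_
  · have hl : Filter.Tendsto (fun n : ℕ => Real.log n) Filter.atTop Filter.atTop := tendsto_log_natCast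
    refine (hlim.comp hl).congr' ?_
    filter_upwards [Filter.eventually_gt_atTop 0] with n hn
    have hn' : (0 : ℝ) < n := by exact_mod_cast hn
    simp only [Function.comp_apply, hB]
    rw [Real.exp_neg, Real.exp_log hn', Nat.floor_natCast, div_eq_inv_mul]
  · intro z hz
    have hs : 1 < (z + 1).re := by simpa using hz
    have h1 := LSeries_eq_mul_integral_of_nonneg f zero_le_one hs ?_ hf0
    · have h2 := eqOn_LFunctionResidueClassAux ha (show z + 1 ∈ {s : ℂ | 1 < s.re} from hs)
      have hne := hre z hz.le
      have hz0 : z ≠ 0 := fun h => by simp [h] at hz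
      have hi1 : IntegrableOn (fun u : ℝ => Complex.exp (-(z * u))) (Set.Ioi 0) := by
        have := integrableOn_exp_mul_complex_Ioi (a := -z) (by simpa using hz) 0
        refine this.congr_fun (fun u _ => ?_) measurableSet_Ioi
        simp
      have hi2 : IntegrableOn (fun u : ℝ => (B u : ℂ) * Complex.exp (-(z * u))) (Set.Ioi 0) := by
        refine hi1.bdd_mul (c := 6) (Complex.measurable_ofReal.comp hBm).aestronglyMeasurable
          (Filter.Eventually.of_forall fun u => ?_)
        rw [Complex.norm_real, Real.norm_eq_abs, abs_of_nonneg (hB0 u)]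
        exact hB6 u
      have h3 : ∫ u in Set.Ioi (0 : ℝ), Complex.exp (-(z * u)) = 1 / z := by
        have := integral_exp_mul_complex_Ioi (a := -z) (by simpa using hz) 0
        simp only [Complex.ofReal_zero, mul_zero, Complex.exp_zero, neg_div_neg_eq, neg_mul] at this
        exact this
      have h4 : ∫ u in Set.Ioi (0 : ℝ), (B u : ℂ) * Complex.exp (-(z * u)) = LSeries (fun n => (f n : ℂ)) (z + 1) / (z + 1) := by
        rw [h1, mul_div_cancel_left₀ _ hne, integral_Ioi_one_eq]
        refine setIntegral_congr_fun measurableSet_Ioi fun u _ => ?_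
        have e1 : ((Real.exp u : ℝ) : ℂ) ^ (-(z + 1 + 1)) = Complex.exp (-(z * u)) * Complex.exp (-u) * Complex.exp (-u) := by
          rw [Complex.cpow_def_of_ne_zero (by exact_mod_cast (Real.exp_pos u).ne'), ← Complex.ofReal_log (Real.exp_pos u).le,
            Real.log_exp, ← Complex.exp_add, ← Complex.exp_add]
          ring_nf
        have e2 : (Real.exp u : ℂ) * Complex.exp (-u) = 1 := by
          rw [Complex.ofReal_exp, ← Complex.exp_add]; simp
        simp only [hB, hC]
        rw [e1]
        push_cast at e2 ⊢
        linear_combination (-(∑ k ∈ Icc 1 ⌊Real.exp u⌋₊, (f k : ℂ)) * Complex.exp (-(z * u)) * Complex.exp (-u)) * e2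
      have h5 : ∀ u : ℝ, ((B u - A : ℝ) : ℂ) * Complex.exp (-(z * u)) =
          (B u : ℂ) * Complex.exp (-(z * u)) - A * Complex.exp (-(z * u)) := by
        intro u; push_cast; ring
      simp only [h5]
      rw [integral_sub hi2 (hi1.const_mul _), h4, integral_const_mul, h3]
      simp only [add_sub_cancel_right] at h2
      rw [h2, hA]
      change (LSeries (fun n => (f n : ℂ)) (z + 1) - _ - _) / _ = _
      push_cast
      field_simp
      ring
    · refine Asymptotics.IsBigO.of_bound 6 (Filter.Eventually.of_forall fun n => ?_)
      rw [Real.norm_eq_abs, Real.norm_eq_abs, abs_of_nonneg (hC0 n), Real.rpow_one, Nat.abs_cast]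
      exact sum_residueClass_le a n

end Goldbach

namespace Goldbach

open Finset

/-- The normalised indicator function of the integers coprime to `P`. -/
noncomputable def md (P n : ℕ) : ℝ := if n.Coprime P then (P : ℝ) / P.totient else 0

lemma md_nonneg (P n : ℕ) : 0 ≤ md P n := by unfold md; split_ifs <;> positivity

lemma tendsto_card_residue_div {P : ℕ} [NeZero P] (r : ZMod P) :
    Filter.Tendsto (fun n : ℕ => (((Icc 1 n).filter fun k : ℕ => (k : ZMod P) = r).card : ℝ) / n) Filter.atTop
      (nhds ((P : ℝ)⁻¹)) := by
  have hP : 0 < P := Nat.pos_of_neZero P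
  have hP' : (0 : ℝ) < P := by exact_mod_cast hP
  have hbd : ∀ n : ℕ, |(((Icc 1 n).filter fun k : ℕ => (k : ZMod P) = r).card : ℝ) - n / P| ≤ 2 := by
    intro n
    have h1 : ((Icc 1 n).filter fun k : ℕ => (k : ZMod P) = r) = (Ioc 0 n).filter fun k => k ≡ r.val [MOD P] := by
      ext k
      rw [Finset.mem_filter, Finset.mem_filter, Finset.mem_Icc, Finset.mem_Ioc, ← ZMod.natCast_eq_natCast_iff,
        ZMod.natCast_zmod_val]
      simp [Nat.succ_le_iff]
    have h2 := Nat.Ioc_filter_modEq_card 0 n hP r.val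
    rw [← h1] at h2
    have h3 : ((((Icc 1 n).filter fun k : ℕ => (k : ZMod P) = r).card : ℤ) : ℝ) = _ := congrArg _ h2
    rw [Int.cast_natCast] at h3
    rw [h3]
    set u : ℚ := ((n : ℕ) - (r.val : ℕ) : ℚ) / P
    set v : ℚ := ((0 : ℕ) - (r.val : ℕ) : ℚ) / P
    have huv : (u : ℝ) - v = n / P := by
      simp only [u, v]; push_cast; field_simp; ring
    have f1 : ((⌊u⌋ : ℤ) : ℝ) ≤ u := by exact_mod_cast Int.floor_le u
    have f2 : (u : ℝ) < ⌊u⌋ + 1 := by exact_mod_cast Int.lt_floor_add_one u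
    have f3 : ((⌊v⌋ : ℤ) : ℝ) ≤ v := by exact_mod_cast Int.floor_le v
    have f4 : (v : ℝ) < ⌊v⌋ + 1 := by exact_mod_cast Int.lt_floor_add_one v
    rcases le_total (⌊u⌋ - ⌊v⌋) 0 with h | h
    · rw [max_eq_right h]
      have : ((⌊u⌋ : ℤ) : ℝ) - ⌊v⌋ ≤ 0 := by exact_mod_cast h
      have hn : (0 : ℝ) ≤ n / P := by positivity
      rw [abs_le]; push_cast; constructor <;> linarith
    · rw [max_eq_left h, abs_le]; push_cast
      constructor <;> linarith
  have h0 : Filter.Tendsto (fun n : ℕ => (2 : ℝ) / n) Filter.atTop (nhds 0) := tendsto_const_div_atTop_nhds_zero_nat 2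
  rw [tendsto_iff_dist_tendsto_zero]
  refine squeeze_zero' (Filter.Eventually.of_forall fun _ => dist_nonneg) ?_ h0
  filter_upwards [Filter.eventually_gt_atTop 0] with n hn
  have hn' : (0 : ℝ) < n := by exact_mod_cast hn
  rw [Real.dist_eq, show (P : ℝ)⁻¹ = (n / P) / n by field_simp, ← sub_div, abs_div, abs_of_pos hn']
  gcongr
  exact hbd n

open ArithmeticFunction.vonMangoldt in
lemma tendsto_sum_residueClass_nonunit {P : ℕ} [NeZero P] {r : ZMod P} (hr : ¬IsUnit r) :
    Filter.Tendsto (fun n : ℕ => (∑ k ∈ Icc 1 n, residueClass r k) / n) Filter.atTop (nhds 0) := by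
  classical
  have h1 := tendsto_sum_residueClass_div (q := 1) (a := 1) isUnit_one
  have h2 : Filter.Tendsto (fun n : ℕ => ∑ a ∈ univ.filter (fun a : ZMod P => IsUnit a),
      (∑ k ∈ Icc 1 n, residueClass a k) / n) Filter.atTop
      (nhds (∑ a ∈ univ.filter (fun a : ZMod P => IsUnit a), ((P.totient : ℝ)⁻¹))) :=
    tendsto_finsetSum _ fun a ha => tendsto_sum_residueClass_div (Finset.mem_filter.mp ha).2
  have hcard : (univ.filter (fun a : ZMod P => IsUnit a)).card = P.totient := by
    rw [← ZMod.card_units_eq_totient P, ← Finset.card_univ]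
    symm
    refine Finset.card_bij (fun u _ => (u : ZMod P)) (fun u _ => by simp) (fun u _ v _ h => Units.ext h) ?_
    intro b hb
    obtain ⟨u, rfl⟩ := (Finset.mem_filter.mp hb).2
    exact ⟨u, Finset.mem_univ _, rfl⟩
  have hφ : (P.totient : ℝ) ≠ 0 := by
    have := Nat.totient_pos.mpr (Nat.pos_of_neZero P); positivity
  rw [Finset.sum_const, hcard, nsmul_eq_mul, mul_inv_cancel₀ hφ] at h2
  have h3 := h1.sub h2
  simp only [Nat.totient_one, Nat.cast_one, inv_one, sub_self] at h3
  refine squeeze_zero (fun n => ?_) (fun n => ?_) h3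
  · exact div_nonneg (Finset.sum_nonneg fun k _ => residueClass_nonneg r k) (Nat.cast_nonneg n)
  · rw [le_sub_iff_add_le, ← Finset.sum_div, ← add_div]
    refine div_le_div_of_nonneg_right ?_ (Nat.cast_nonneg n)
    rw [Finset.sum_comm, ← Finset.sum_add_distrib]
    refine Finset.sum_le_sum fun k _ => ?_
    have e1 : residueClass (1 : ZMod 1) k = ArithmeticFunction.vonMangoldt k := by
      rw [residueClass, Set.indicator_of_mem]
      exact Subsingleton.elim _ _
    rw [e1]
    have hmem : ∀ a : ZMod P, residueClass a k = if a = (k : ZMod P) then ArithmeticFunction.vonMangoldt k else 0 := by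
      intro a
      rw [residueClass, Set.indicator_apply]
      exact if_congr (by rw [Set.mem_ofPred_eq]; exact eq_comm) rfl rfl
    have hnot : r ∉ univ.filter (fun a : ZMod P => IsUnit a) := by simpa using hr
    rw [← Finset.sum_insert (f := fun a => residueClass a k) hnot]
    simp only [hmem]
    rw [Finset.sum_ite_eq']
    split_ifs
    · exact le_rfl
    · exact ArithmeticFunction.vonMangoldt_nonneg

open ArithmeticFunction.vonMangoldt in
lemma tendsto_sum_sub_md_residue {P : ℕ} [NeZero P] (r : ZMod P) :
    Filter.Tendsto (fun n : ℕ => (∑ k ∈ Icc 1 n, if (k : ZMod P) = r then ArithmeticFunction.vonMangoldt k - md P k else 0) / n)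
      Filter.atTop (nhds 0) := by
  have hΛ : ∀ k : ℕ, residueClass r k = if (k : ZMod P) = r then ArithmeticFunction.vonMangoldt k else 0 := by
    intro k
    rw [residueClass, Set.indicator_apply]
    rfl
  by_cases hr : IsUnit r
  · have h1 := (tendsto_sum_residueClass_div hr).sub ((tendsto_card_residue_div r).const_mul ((P : ℝ) / P.totient))
    have hP : (P : ℝ) ≠ 0 := by exact_mod_cast NeZero.ne P
    rw [show (P : ℝ) / P.totient * (P : ℝ)⁻¹ = (P.totient : ℝ)⁻¹ by field_simp, sub_self] at h1
    refine h1.congr fun n => ?_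
    rw [← mul_div_assoc, ← sub_div, Finset.card_filter, Nat.cast_sum, Finset.mul_sum, ← Finset.sum_sub_distrib]
    congr 1
    refine Finset.sum_congr rfl fun k _ => ?_
    rw [hΛ]
    split_ifs with h
    · have : k.Coprime P := by rw [← ZMod.isUnit_iff_coprime, h]; exact hr
      rw [md, if_pos this]; simp
    · simp
  · refine (tendsto_sum_residueClass_nonunit hr).congr fun n => ?_
    congr 1
    refine Finset.sum_congr rfl fun k _ => ?_
    rw [hΛ]
    split_ifs with h
    · have : ¬k.Coprime P := by rw [← ZMod.isUnit_iff_coprime, h]; exact hr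
      rw [md, if_neg this, sub_zero]
    · rfl

lemma exists_norm_sum_sub_md_le (P : ℕ) [NeZero P] {δ : ℝ} (hδ : 0 < δ) : ∃ n₀ : ℕ, ∀ n ≥ n₀, ∀ a : ℤ,
    ‖∑ k ∈ Icc 1 n, ((ArithmeticFunction.vonMangoldt k - md P k : ℝ) : ℂ) * ee (k * (a / P))‖ ≤ δ * n := by
  have hP : (P : ℝ) ≠ 0 := by exact_mod_cast NeZero.ne P
  have h1 : Filter.Tendsto (fun n : ℕ => ∑ r : ZMod P,
      |(∑ k ∈ Icc 1 n, if (k : ZMod P) = r then ArithmeticFunction.vonMangoldt k - md P k else 0) / n|)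
      Filter.atTop (nhds (∑ r : ZMod P, |(0 : ℝ)|)) :=
    tendsto_finsetSum _ fun r _ => (tendsto_sum_sub_md_residue r).abs
  simp only [abs_zero, Finset.sum_const_zero] at h1
  obtain ⟨n₀, hn₀⟩ := Filter.eventually_atTop.mp ((h1.eventually (gt_mem_nhds hδ)).and (Filter.eventually_gt_atTop 0))
  refine ⟨n₀, fun n hn a => ?_⟩
  obtain ⟨h2, h3⟩ := hn₀ n hn
  have hn' : (0 : ℝ) < n := by exact_mod_cast h3
  have hper : ∀ k : ℕ, ee (k * (a / P)) = ee (((k : ZMod P).val : ℕ) * (a / P)) := by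
    intro k
    rw [ZMod.val_natCast]
    obtain ⟨t, h4⟩ : ∃ t : ℕ, (k : ℝ) = (k % P : ℕ) + P * t :=
      ⟨k / P, by exact_mod_cast (Nat.mod_add_div k P).symm⟩
    have h5 : (k : ℝ) * (a / P) = (k % P : ℕ) * (a / P) + ((a * t : ℤ) : ℝ) := by
      rw [h4]; push_cast; field_simp
    rw [h5, ee_add_int]
  have h6 : ∑ k ∈ Icc 1 n, ((ArithmeticFunction.vonMangoldt k - md P k : ℝ) : ℂ) * ee (k * (a / P)) =
      ∑ r : ZMod P, ((∑ k ∈ Icc 1 n, if (k : ZMod P) = r then ArithmeticFunction.vonMangoldt k - md P k else 0 : ℝ) : ℂ) *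
        ee ((r.val : ℕ) * (a / P)) := by
    simp only [Complex.ofReal_sum, Finset.sum_mul]
    rw [Finset.sum_comm]
    refine Finset.sum_congr rfl fun k _ => ?_
    rw [Finset.sum_eq_single (k : ZMod P), if_pos rfl, hper]
    · intro r _ hr
      rw [if_neg (Ne.symm hr)]; simp
    · simp
  rw [h6]
  refine (norm_sum_le _ _).trans ?_
  have h7 : ∀ r : ZMod P, ‖((∑ k ∈ Icc 1 n, if (k : ZMod P) = r then ArithmeticFunction.vonMangoldt k - md P k else 0 : ℝ) : ℂ) *
      ee ((r.val : ℕ) * (a / P))‖ =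
      |(∑ k ∈ Icc 1 n, if (k : ZMod P) = r then ArithmeticFunction.vonMangoldt k - md P k else 0) / n| * n := by
    intro r
    rw [norm_mul, norm_ee, mul_one, Complex.norm_real, Real.norm_eq_abs, abs_div, abs_of_pos hn', div_mul_cancel₀ _ hn'.ne']
  simp only [h7]
  rw [← Finset.sum_mul]
  refine mul_le_mul_of_nonneg_right ?_ hn'.le
  exact h2.le

/-- The exponential sum attached to `md P`. -/
noncomputable def GM (P N : ℕ) (α : ℝ) : ℂ := ∑ n ∈ range (N + 1), (md P n : ℂ) * ee (n * α)

lemma md_le (P n : ℕ) : md P n ≤ (P : ℝ) / P.totient := by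
  unfold md; split_ifs
  · exact le_rfl
  · positivity

lemma md_add_self (P n : ℕ) : md P (n + P) = md P n := by simp [md]

lemma md_zero {P : ℕ} (hP : 2 ≤ P) : md P 0 = 0 := by
  rw [md, if_neg]
  rw [Nat.coprime_zero_left]; omega

lemma norm_GM_mul_nn_le (P N : ℕ) (α : ℝ) : ‖GM P N α‖ * (4 * nn (P * α)) ≤ 2 * P * ((P : ℝ) / P.totient) := by
  set w : ℕ → ℂ := fun n => (md P n : ℂ) * ee (n * α) with hw
  have hwn : ∀ n, ‖w n‖ ≤ (P : ℝ) / P.totient := by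
    intro n
    rw [hw, norm_mul, norm_ee, mul_one, Complex.norm_real, Real.norm_eq_abs, abs_of_nonneg (md_nonneg P n)]
    exact md_le P n
  have h1 : GM P N α * (ee (P * α) - 1) = ∑ n ∈ range P, w (N + 1 + n) - ∑ n ∈ range P, w n := by
    have e1 : GM P N α * ee (P * α) = ∑ n ∈ range (N + 1), w (P + n) := by
      rw [GM, Finset.sum_mul]
      refine Finset.sum_congr rfl fun n _ => ?_
      simp only [hw]
      rw [add_comm P n, md_add_self, Nat.cast_add, add_mul, ee_add, mul_assoc]
    have e2 := Finset.sum_range_add w P (N + 1)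
    have e3 := Finset.sum_range_add w (N + 1) P
    rw [add_comm P (N + 1)] at e2
    rw [mul_sub, mul_one, e1, GM]
    linear_combination e3 - e2
  have h2 : ‖GM P N α * (ee (P * α) - 1)‖ ≤ 2 * P * ((P : ℝ) / P.totient) := by
    rw [h1]
    refine (norm_sub_le _ _).trans ?_
    have k1 := norm_sum_le_of_le (range P) (fun n _ => hwn (N + 1 + n))
    have k2 := norm_sum_le_of_le (range P) (fun n _ => hwn n)
    rw [Finset.sum_const, card_range, nsmul_eq_mul] at k1 k2
    linarith
  rw [norm_mul] at h2
  exact (mul_le_mul_of_nonneg_left (four_mul_nn_le _) (norm_nonneg _)).trans h2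

lemma exists_norm_S_sub_GM_le_near {P : ℕ} (hP : 2 ≤ P) {B ε : ℝ} (hB : 0 ≤ B) (hε : 0 < ε) : ∃ N₀ : ℕ, ∀ N ≥ N₀, ∀ a : ℤ,
    ∀ β : ℝ, |β| * N ≤ B → ‖S N (a / P + β) - GM P N (a / P + β)‖ ≤ ε * N := by
  have : NeZero P := ⟨by omega⟩
  have hpi := Real.pi_pos
  set δ : ℝ := ε / (2 * (1 + 4 * Real.pi * B)) with hδ
  have hδ0 : 0 < δ := by positivity
  obtain ⟨n₀, hn₀⟩ := exists_norm_sum_sub_md_le P hδ0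
  set K : ℝ := ∑ i ∈ range (n₀ + 1), |ArithmeticFunction.vonMangoldt i - md P i| with hK
  obtain ⟨N₁, hN₁⟩ := exists_nat_ge (K / δ)
  refine ⟨N₁ + 1, fun N hN a β hβ => ?_⟩
  have hN0 : (1 : ℝ) ≤ N := by exact_mod_cast (by omega : 1 ≤ N)
  have hKN : K ≤ δ * N := by
    have : (N₁ : ℝ) ≤ N := by exact_mod_cast (by omega : N₁ ≤ N)
    rw [div_le_iff₀ hδ0] at hN₁
    nlinarith
  set z : ℕ → ℂ := fun n => ((ArithmeticFunction.vonMangoldt n - md P n : ℝ) : ℂ) * ee (n * (a / P)) with hz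
  have hz0 : z 0 = 0 := by simp [hz, md_zero hP]
  have hnz : ∀ n, ‖z n‖ = |ArithmeticFunction.vonMangoldt n - md P n| := by
    intro n
    rw [hz, norm_mul, norm_ee, mul_one, Complex.norm_real, Real.norm_eq_abs]
  have hpart : ∀ k ≤ N + 1, ‖∑ i ∈ range k, z i‖ ≤ δ * N := by
    intro k hk
    rcases le_or_gt k (n₀ + 1) with h | h
    · refine (norm_sum_le _ _).trans (le_trans ?_ hKN)
      simp only [hnz]
      exact Finset.sum_le_sum_of_subset_of_nonneg (Finset.range_subset_range.mpr h) fun _ _ _ => abs_nonneg _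
    · obtain ⟨m, rfl⟩ : ∃ m, k = m + 1 := ⟨k - 1, by omega⟩
      have e1 : ∑ i ∈ range (m + 1), z i = ∑ i ∈ Icc 1 m, z i := by
        rw [Finset.range_eq_Ico, Finset.sum_eq_sum_Ico_succ_bot (by omega), hz0, zero_add]
        rfl
      rw [e1]
      refine (hn₀ m (by omega) a).trans ?_
      have : (m : ℝ) ≤ N := by exact_mod_cast (by omega : m ≤ N)
      gcongr
  have habel : ∀ g : ℕ → ℝ, (∀ n, |g n| ≤ 1) → (∀ n, |g (n + 1) - g n| ≤ 2 * Real.pi * |β|) →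
      ‖∑ i ∈ range (N + 1), (g i : ℂ) * z i‖ ≤ δ * N * (1 + 4 * Real.pi * B) := by
    intro g hg1 hg2
    refine (norm_sum_mul_le_abel g z (N + 1) hpart).trans ?_
    refine mul_le_mul_of_nonneg_left ?_ (by positivity)
    have h1 := Finset.sum_le_sum (s := range (N + 1)) fun n _ => hg2 n
    rw [Finset.sum_const, card_range, nsmul_eq_mul] at h1
    push_cast at h1
    have h2 : ((N : ℝ) + 1) * (2 * Real.pi * |β|) ≤ 4 * Real.pi * B := by
      have : ((N : ℝ) + 1) * |β| ≤ 2 * B := by nlinarith [abs_nonneg β]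
      nlinarith
    linarith [hg1 (N + 1)]
  have hstep : ∀ n : ℕ, ‖ee ((n + 1 : ℕ) * β) - ee (n * β)‖ ≤ 2 * Real.pi * |β| := by
    intro n
    refine (norm_ee_sub_ee_le _ _).trans (le_of_eq ?_)
    push_cast
    ring_nf
  have hre := habel (fun n => (ee (n * β)).re)
    (fun n => (Complex.abs_re_le_norm _).trans (norm_ee _).le)
    (fun n => by rw [← Complex.sub_re]; exact (Complex.abs_re_le_norm _).trans (hstep n))
  have him := habel (fun n => (ee (n * β)).im)
    (fun n => (Complex.abs_im_le_norm _).trans (norm_ee _).le)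
    (fun n => by rw [← Complex.sub_im]; exact (Complex.abs_im_le_norm _).trans (hstep n))
  have hdec : S N (a / P + β) - GM P N (a / P + β) =
      ∑ i ∈ range (N + 1), ((ee (i * β)).re : ℂ) * z i + Complex.I * ∑ i ∈ range (N + 1), ((ee (i * β)).im : ℂ) * z i := by
    rw [S, GM, ← Finset.sum_sub_distrib, Finset.mul_sum, ← Finset.sum_add_distrib]
    refine Finset.sum_congr rfl fun n _ => ?_
    have h1 := Complex.re_add_im (ee (n * β))
    simp only [hz]
    rw [mul_add, ee_add]
    push_cast
    linear_combination (-((ArithmeticFunction.vonMangoldt n : ℂ) - md P n) * ee (n * (a / P))) * h1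
  rw [hdec]
  refine (norm_add_le _ _).trans ?_
  rw [norm_mul, Complex.norm_I, one_mul]
  have hfin : 2 * (δ * N * (1 + 4 * Real.pi * B)) = ε * N := by
    rw [hδ]; field_simp
  linarith

lemma ee_nat_mul_add_int (n : ℕ) (x : ℝ) (m : ℤ) : ee (n * (x + m)) = ee (n * x) := by
  rw [mul_add, show (n : ℝ) * m = ((n * m : ℤ) : ℝ) by push_cast; ring, ee_add_int]

/-- Uniformly in the frequency, the primes have the same exponential sums as the integers coprime to a suitable
fixed modulus. -/
lemma exists_norm_S_sub_GM_le {ε : ℝ} (hε : 0 < ε) : ∃ P : ℕ, 2 ≤ P ∧ 2 ∣ P ∧ ∃ N₀ : ℕ, ∀ N ≥ N₀, ∀ α : ℝ,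
    ‖S N α - GM P N α‖ ≤ ε * N := by
  obtain ⟨Q₀, B₀, N₁, hminor⟩ := exists_norm_S_le_minor (show 0 < ε / 2 by positivity)
  set P := (Q₀ + 2).factorial with hPdef
  have h2P : 2 ∣ P := Nat.dvd_factorial (by norm_num) (by omega)
  have hP0 : 0 < P := Nat.factorial_pos _
  have hP2 : 2 ≤ P := Nat.le_of_dvd hP0 h2P
  have hPr : (0 : ℝ) < P := by exact_mod_cast hP0
  set D : ℝ := (P : ℝ) / P.totient with hD
  have hD0 : 0 < D := div_pos hPr (by exact_mod_cast Nat.totient_pos.mpr hP0)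
  set B : ℝ := max B₀ (D / ε) with hB
  have hB0 : 0 < B := lt_of_lt_of_le (by positivity) (le_max_right _ _)
  obtain ⟨N₂, hnear⟩ := exists_norm_S_sub_GM_le_near hP2 hB0.le hε
  obtain ⟨N₃, hlog⟩ := Filter.eventually_atTop.mp (eventually_log_pow_le 1 4)
  refine ⟨P, hP2, h2P, N₁ + N₂ + N₃ + 3, fun N hN α => ?_⟩
  wlog hα : 1 ≤ α generalizing α
  · obtain ⟨m, hm⟩ := exists_nat_ge (1 - α)
    have h1 := this (α + (m : ℤ)) (by push_cast; linarith)
    simp only [S, GM, ee_nat_mul_add_int] at h1 ⊢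
    exact h1
  have hN3 : (3 : ℝ) ≤ N := by exact_mod_cast (by omega : 3 ≤ N)
  have hN0 : (0 : ℝ) < N := by linarith
  obtain ⟨m, hm⟩ := exists_int_nn (P * α)
  rcases le_or_gt (nn (P * α) * N) (P * B) with hcase | hcase
  · have h1 : |α - m / P| * N ≤ B := by
      have : α - m / P = (P * α - m) / P := by field_simp
      rw [this, abs_div, ← hm, abs_of_pos hPr, div_mul_eq_mul_div, div_le_iff₀ hPr]
      linarith
    have h2 := hnear N (by omega) m (α - m / P) h1
    rwa [add_sub_cancel] at h2
  · have hGM : ‖GM P N α‖ ≤ ε / 2 * N := by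
      have h1 := norm_GM_mul_nn_le P N α
      rw [← hD] at h1
      have hn : 0 < nn (P * α) := by
        by_contra hneg
        have : nn (P * α) = 0 := le_antisymm (not_lt.mp hneg) (nn_nonneg _)
        rw [this, zero_mul] at hcase
        have : 0 < P * B := by positivity
        linarith
      have hDB : D ≤ B * ε := by
        rw [← div_le_iff₀ hε]; exact le_max_right _ _
      refine le_of_mul_le_mul_right (h1.trans ?_) (show 0 < 4 * nn (P * α) by positivity)
      calc 2 * P * D ≤ 2 * P * (B * ε) := by gcongr
        _ = 2 * ε * (P * B) := by ring
        _ ≤ 2 * ε * (nn (P * α) * N) := by gcongr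
        _ = _ := by ring
    have hS : ‖S N α‖ ≤ ε / 2 * N := by
      have hL := hlog N (by omega)
      rw [one_mul] at hL
      set L4 := Real.log N ^ 4 with hL4
      have hL4p : 0 < L4 := pow_pos (Real.log_pos (by linarith)) 4
      set T := ⌊(N : ℝ) / L4⌋₊ with hT
      have hT1 : 0 < T := Nat.floor_pos.mpr (by rw [le_div_iff₀ hL4p]; linarith)
      obtain ⟨r, hr1, hr2⟩ := Real.exists_rat_abs_sub_le_and_den_le α hT1
      have hden : 0 < r.den := r.den_pos
      have hden' : (0 : ℝ) < r.den := by exact_mod_cast hden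
      have hrnn : 0 ≤ r := by
        have h1 : (1 : ℝ) / ((T + 1) * r.den) ≤ 1 := by
          rw [div_le_one (by positivity)]
          have : (1 : ℝ) ≤ r.den := by exact_mod_cast hden
          have : (0 : ℝ) ≤ T := Nat.cast_nonneg _
          nlinarith
        have h2 := (abs_le.mp (hr1.trans h1)).2
        have : (0 : ℝ) ≤ r := by linarith
        exact_mod_cast this
      have hnum : ((r.num.toNat : ℕ) : ℝ) = r.num := by
        have : (r.num.toNat : ℤ) = r.num := Int.toNat_of_nonneg (Rat.num_nonneg.mpr hrnn)
        exact_mod_cast this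
      have hrq : (r : ℝ) = (r.num.toNat : ℕ) / r.den := by rw [hnum]; exact Rat.cast_def r
      have hcop : r.num.toNat.Coprime r.den := by
        have h1 := r.reduced
        rwa [show r.num.natAbs = r.num.toNat by have := Rat.num_nonneg.mpr hrnn; omega] at h1
      have hTN : (T : ℝ) * L4 ≤ N := by
        rw [← le_div_iff₀ hL4p]; exact Nat.floor_le (by positivity)
      have hTN' : (N : ℝ) ≤ L4 * (T + 1) := by
        rw [← div_le_iff₀' hL4p]; exact (Nat.lt_floor_add_one _).le
      have key := hminor N (by omega) r.den r.num.toNat (α - r) hden hcop ?_ ?_ ?_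
      · rwa [← hrq, add_sub_cancel] at key
      · have : (r.den : ℝ) ≤ T := by exact_mod_cast hr2
        exact (mul_le_mul_of_nonneg_right this hL4p.le).trans hTN
      · calc |α - r| * (r.den * N) ≤ 1 / ((T + 1) * r.den) * (r.den * N) := by gcongr
          _ = N / (T + 1) := by field_simp
          _ ≤ L4 := by rw [div_le_iff₀ (by positivity)]; exact hTN'
      · by_cases hq : Q₀ ≤ r.den
        · exact Or.inl hq
        · right
          have hdvd : r.den ∣ P := Nat.dvd_factorial hden (by omega)
          obtain ⟨t, ht⟩ := hdvd
          have h1 : nn (P * α) ≤ P * |α - r| := by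
            have h2 := nn_le_abs_sub (P * α) (t * r.num)
            refine h2.trans (le_of_eq ?_)
            have h3 : (P : ℝ) * r = ((t * r.num : ℤ) : ℝ) := by
              rw [hrq, hnum, ht]; push_cast; field_simp
            rw [← h3, ← mul_sub, abs_mul, abs_of_pos hPr]
          have h2 : P * B ≤ P * (|α - r| * N) := by
            calc P * B ≤ nn (P * α) * N := hcase.le
              _ ≤ P * |α - r| * N := by gcongr
              _ = _ := by ring
          exact (le_max_left B₀ _).trans (le_of_mul_le_mul_left h2 hPr)
    refine (norm_sub_le _ _).trans ?_
    linarith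

lemma md_prod_primeFactors (P : ℕ) (hP : P ≠ 0) (n : ℕ) : md (∏ p ∈ P.primeFactors, p) n = md P n := by
  set R := ∏ p ∈ P.primeFactors, p with hR
  have hR0 : R ≠ 0 := Finset.prod_ne_zero_iff.mpr fun p hp => (Nat.prime_of_mem_primeFactors hp).ne_zero
  have hpf : R.primeFactors = P.primeFactors := Nat.primeFactors_prod_primeFactors P
  have hφ : ∀ m : ℕ, m ≠ 0 → (m : ℝ) / m.totient = (∏ p ∈ m.primeFactors, (1 - (p : ℝ)⁻¹))⁻¹ := by
    intro m hm
    have h1 : (m.totient : ℝ) = m * ∏ p ∈ m.primeFactors, (1 - (p : ℝ)⁻¹) := by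
      have := congrArg (fun x : ℚ => (x : ℝ)) (Nat.totient_eq_mul_prod_factors m)
      push_cast at this
      exact this
    have hm' : (m : ℝ) ≠ 0 := by exact_mod_cast hm
    rw [h1, ← div_div, div_self hm', one_div]
  have hdvd : ∀ p : ℕ, p.Prime → (p ∣ R ↔ p ∣ P) := by
    intro p hp
    have h1 : p ∈ R.primeFactors ↔ p ∈ P.primeFactors := by rw [hpf]
    rw [Nat.mem_primeFactors, Nat.mem_primeFactors] at h1
    tauto
  have hcop : n.Coprime R ↔ n.Coprime P := by
    constructor
    · intro h
      refine Nat.Coprime.symm (Nat.coprime_of_dvd fun p hp h1 h2 => ?_)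
      exact Nat.not_coprime_of_dvd_of_dvd hp.one_lt h2 ((hdvd p hp).mpr h1) h
    · intro h
      refine Nat.Coprime.symm (Nat.coprime_of_dvd fun p hp h1 h2 => ?_)
      exact Nat.not_coprime_of_dvd_of_dvd hp.one_lt h2 ((hdvd p hp).mp h1) h
  unfold md
  rw [hφ R hR0, hφ P hP, hpf]
  exact if_congr hcop rfl rfl

/-- The number of representations of `n` as a sum of two units modulo `m`. -/
noncomputable def rho (m n : ℕ) : ℕ := Nat.card {x : ZMod m // IsUnit x ∧ IsUnit ((n : ZMod m) - x)}

lemma rho_mul {a b : ℕ} (h : a.Coprime b) (n : ℕ) : rho (a * b) n = rho a n * rho b n := by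
  unfold rho
  rw [← Nat.card_prod]
  refine Nat.card_congr (((ZMod.chineseRemainder h).toEquiv.subtypeEquiv (q := fun c : ZMod a × ZMod b =>
    (IsUnit c.1 ∧ IsUnit ((n : ZMod a) - c.1)) ∧ (IsUnit c.2 ∧ IsUnit ((n : ZMod b) - c.2))) fun x => ?_).trans
    (Equiv.subtypeProdEquivProd (p := fun x : ZMod a => IsUnit x ∧ IsUnit ((n : ZMod a) - x))
      (q := fun x : ZMod b => IsUnit x ∧ IsUnit ((n : ZMod b) - x))))
  rw [← MulEquiv.isUnit_map (ZMod.chineseRemainder h), ← MulEquiv.isUnit_map (ZMod.chineseRemainder h) (x := (n : ZMod (a * b)) - x),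
    map_sub, map_natCast, Prod.isUnit_iff, Prod.isUnit_iff]
  change _ ↔ (IsUnit (ZMod.chineseRemainder h x).1 ∧ IsUnit ((n : ZMod a) - (ZMod.chineseRemainder h x).1)) ∧ 
    (IsUnit (ZMod.chineseRemainder h x).2 ∧ IsUnit ((n : ZMod b) - (ZMod.chineseRemainder h x).2))
  simp only [Prod.fst_sub, Prod.snd_sub, Prod.fst_natCast, Prod.snd_natCast]
  tauto

lemma sub_two_le_rho {p : ℕ} (hp : p.Prime) (n : ℕ) : (p : ℝ) - 2 ≤ rho p n := by
  classical
  have : Fact p.Prime := ⟨hp⟩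
  have h1 : rho p n = (univ \ {0, (n : ZMod p)} : Finset (ZMod p)).card := by
    rw [rho, Nat.card_eq_fintype_card, Fintype.card_subtype]
    congr 1
    ext x
    simp only [isUnit_iff_ne_zero, Finset.mem_filter, Finset.mem_univ, true_and, Finset.mem_sdiff, Finset.mem_insert,
      Finset.mem_singleton, not_or, sub_ne_zero]
    tauto
  have h2 := Finset.le_card_sdiff ({0, (n : ZMod p)} : Finset (ZMod p)) univ
  rw [Finset.card_univ, ZMod.card] at h2
  have h3 : ({0, (n : ZMod p)} : Finset (ZMod p)).card ≤ 2 := Finset.card_le_two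
  have h4 : p ≤ rho p n + 2 := by omega
  have h5 : (p : ℝ) ≤ rho p n + 2 := by exact_mod_cast h4
  linarith

/-- The local density of representations as a sum of two units modulo `m`. -/
noncomputable def sing (m n : ℕ) : ℝ := ((m : ℝ) / m.totient) ^ 2 * rho m n / m

lemma sing_nonneg (m n : ℕ) : 0 ≤ sing m n := by unfold sing; positivity

lemma sing_mul {a b : ℕ} (h : a.Coprime b) (n : ℕ) : sing (a * b) n = sing a n * sing b n := by
  unfold sing
  rw [rho_mul h, Nat.totient_mul h]
  push_cast
  ring

lemma sing_one (n : ℕ) : sing 1 n = 1 := by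
  have : rho 1 n = 1 := by
    rw [rho, Nat.card_eq_one_iff_unique]
    refine ⟨⟨fun a b => Subtype.ext (Subsingleton.elim _ _)⟩, ⟨⟨0, ?_, ?_⟩⟩⟩ <;> exact isUnit_of_subsingleton _
  simp [sing, this]

lemma le_sing_prime {p : ℕ} (hp : p.Prime) (n : ℕ) : 1 - 1 / ((p : ℝ) - 1) ^ 2 ≤ sing p n := by
  have h2 : (2 : ℝ) ≤ p := by exact_mod_cast hp.two_le
  have h1 : (0 : ℝ) < (p : ℝ) - 1 := by linarith
  have ht : (p.totient : ℝ) = (p : ℝ) - 1 := by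
    rw [Nat.totient_prime hp, Nat.cast_sub hp.one_le, Nat.cast_one]
  rw [sing, ht]
  calc 1 - 1 / ((p : ℝ) - 1) ^ 2 = ((p : ℝ) / (p - 1)) ^ 2 * (p - 2) / p := by field_simp; ring
    _ ≤ _ := by
      have := sub_two_le_rho hp n
      gcongr

lemma sing_two {n : ℕ} (hn : Even n) : sing 2 n = 2 := by
  have h0 : (n : ZMod 2) = 0 := (ZMod.natCast_eq_zero_iff n 2).mpr hn.two_dvd
  have : rho 2 n = 1 := by
    rw [rho, Nat.card_eq_one_iff_unique, h0]
    refine ⟨⟨fun a b => Subtype.ext ?_⟩, ⟨⟨1, isUnit_one, by decide⟩⟩⟩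
    have h : ∀ x : ZMod 2, IsUnit x → x = 1 := by decide
    rw [h _ a.2.1, h _ b.2.1]
  rw [sing, this]
  norm_num

lemma le_sing_prod (n M : ℕ) : ∀ s : Finset ℕ, (∀ p ∈ s, p.Prime ∧ 3 ≤ p ∧ p ≤ M + 2) →
    ((M : ℝ) + 2) / (2 * (M + 1)) ≤ sing (∏ p ∈ s, p) n := by
  induction M with
  | zero =>
    intro s hs
    have : s = ∅ := Finset.eq_empty_of_forall_notMem fun p hp => by have := hs p hp; omega
    subst this
    rw [Finset.prod_empty, sing_one]
    norm_num
  | succ M ih =>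
    intro s hs
    have hM : (0 : ℝ) ≤ M := Nat.cast_nonneg M
    by_cases h : M + 3 ∈ s
    · have hp := (hs _ h).1
      have h1 := ih (s.erase (M + 3)) fun p hp => by
        have h2 := hs p (Finset.mem_of_mem_erase hp)
        have h3 := Finset.ne_of_mem_erase hp
        exact ⟨h2.1, h2.2.1, by omega⟩
      have h2 : (M + 3).Coprime (∏ p ∈ s.erase (M + 3), p) := by
        refine Nat.Coprime.prod_right fun p hp' => ?_
        exact (Nat.coprime_primes hp (hs p (Finset.mem_of_mem_erase hp')).1).mpr (Finset.ne_of_mem_erase hp').symm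
      rw [← Finset.mul_prod_erase s _ h, sing_mul h2]
      have h3 := le_sing_prime hp n
      push_cast at h3 ⊢
      calc ((M : ℝ) + 1 + 2) / (2 * (M + 1 + 1)) = (1 - 1 / ((M : ℝ) + 3 - 1) ^ 2) * (((M : ℝ) + 2) / (2 * (M + 1))) := by
            have : (M : ℝ) + 3 - 1 ≠ 0 := by linarith
            have : (M : ℝ) + 1 + 1 ≠ 0 := by linarith
            field_simp; ring
        _ ≤ _ := by
            refine mul_le_mul h3 h1 (by positivity) (sing_nonneg _ _)
    · refine le_trans ?_ (ih s fun p hp => ?_)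
      · push_cast
        rw [div_le_div_iff₀ (by positivity) (by positivity)]
        nlinarith
      · have h2 := hs p hp
        have h3 : p ≠ M + 3 := fun h' => h (h' ▸ hp)
        exact ⟨h2.1, h2.2.1, by omega⟩

lemma half_le_sing {P n : ℕ} (hP : Squarefree P) (h2 : 2 ∣ P) (hn : Even n) : 1 / 2 ≤ sing P n := by
  have hmem : 2 ∈ P.primeFactors := Nat.mem_primeFactors.mpr ⟨Nat.prime_two, h2, hP.ne_zero⟩
  have hs : ∀ p ∈ P.primeFactors.erase 2, p.Prime ∧ 3 ≤ p ∧ p ≤ P + 2 := by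
    intro p hp
    have h3 := Finset.mem_of_mem_erase hp
    have h4 := Finset.ne_of_mem_erase hp
    have h5 := Nat.prime_of_mem_primeFactors h3
    have h6 := h5.two_le
    have h7 := Nat.le_of_mem_primeFactors h3
    exact ⟨h5, by omega, by omega⟩
  have h3 : (2 : ℕ).Coprime (∏ p ∈ P.primeFactors.erase 2, p) := by
    refine Nat.Coprime.prod_right fun p hp => ?_
    exact (Nat.coprime_primes Nat.prime_two (hs p hp).1).mpr (Finset.ne_of_mem_erase hp).symm
  have h4 := le_sing_prod n P _ hs
  rw [← Nat.prod_primeFactors_of_squarefree hP, ← Finset.mul_prod_erase _ _ hmem, sing_mul h3, sing_two hn]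
  have h5 : (1 : ℝ) / 2 ≤ ((P : ℝ) + 2) / (2 * (P + 1)) := by
    rw [div_le_div_iff₀ (by norm_num) (by positivity)]
    linarith
  linarith

lemma sum_range_mul_of_periodic {P : ℕ} {h : ℕ → ℝ} (hper : ∀ k, h (k + P) = h k) (m : ℕ) :
    ∑ k ∈ range (P * m), h k = m * ∑ k ∈ range P, h k := by
  have hper' : ∀ m k, h (P * m + k) = h k := by
    intro m
    induction m with
    | zero => intro k; simp
    | succ m ih => intro k; rw [mul_add, mul_one, add_right_comm, hper, ih]
  induction m with
  | zero => simp
  | succ m ih =>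
    rw [mul_add, mul_one, Finset.sum_range_add, ih]
    simp only [hper']
    push_cast
    ring

lemma le_sum_md_mul_md {P n : ℕ} (hP : Squarefree P) (h2 : 2 ∣ P) (hn : Even n) :
    ((n : ℝ) - P) / 2 ≤ ∑ ij ∈ antidiagonal n, md P ij.1 * md P ij.2 := by
  classical
  have hP0 : 0 < P := Nat.pos_of_ne_zero hP.ne_zero
  have : NeZero P := ⟨hP.ne_zero⟩
  have hPr : (0 : ℝ) < P := by exact_mod_cast hP0
  set D : ℝ := (P : ℝ) / P.totient with hD
  set h : ℕ → ℝ := fun k => if IsUnit (k : ZMod P) ∧ IsUnit ((n : ZMod P) - k) then D ^ 2 else 0 with hh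
  have hh0 : ∀ k, 0 ≤ h k := fun k => by simp only [hh]; split_ifs <;> positivity
  have hper : ∀ k, h (k + P) = h k := by intro k; simp [hh]
  have hsum : ∑ k ∈ range P, h k = sing P n * P := by
    simp only [hh]
    rw [← Finset.sum_filter, Finset.sum_const, nsmul_eq_mul, sing, rho, Nat.card_eq_fintype_card, Fintype.card_subtype,
      div_mul_cancel₀ _ hPr.ne', mul_comm]
    congr 2
    refine Finset.card_bij (fun k _ => (k : ZMod P)) ?_ ?_ ?_
    · intro k hk
      simpa using (Finset.mem_filter.mp hk).2
    · intro a ha b hb hab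
      have ha' := Finset.mem_range.mp (Finset.mem_filter.mp ha).1
      have hb' := Finset.mem_range.mp (Finset.mem_filter.mp hb).1
      rw [ZMod.natCast_eq_natCast_iff] at hab
      exact Nat.ModEq.eq_of_lt_of_lt hab ha' hb'
    · intro x hx
      refine ⟨x.val, Finset.mem_filter.mpr ⟨Finset.mem_range.mpr (ZMod.val_lt x), ?_⟩, ZMod.natCast_zmod_val x⟩
      rw [ZMod.natCast_zmod_val]
      exact (Finset.mem_filter.mp hx).2
  have hterm : ∀ k ∈ range (n + 1), md P k * md P (n - k) = h k := by
    intro k hk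
    have hkn : k ≤ n := by have := Finset.mem_range.mp hk; omega
    simp only [hh, md]
    rw [← Nat.cast_sub hkn]
    simp only [ZMod.isUnit_iff_coprime, ← hD]
    split_ifs <;> first | ring1 | tauto
  rw [Finset.Nat.sum_antidiagonal_eq_sum_range_succ (fun i j => md P i * md P j), Finset.sum_congr rfl hterm]
  have hq : P * (n / P) ≤ n := Nat.mul_div_le n P
  have h1 : ∑ k ∈ range (P * (n / P)), h k ≤ ∑ k ∈ range (n + 1), h k :=
    Finset.sum_le_sum_of_subset_of_nonneg (Finset.range_subset_range.mpr (by omega)) fun k _ _ => hh0 k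
  rw [sum_range_mul_of_periodic hper, hsum] at h1
  refine le_trans ?_ h1
  have h3 := half_le_sing hP h2 hn
  have h4 : (n : ℝ) - P ≤ (n / P : ℕ) * P := by
    have : n < P * (n / P) + P := Nat.lt_mul_div_succ n hP0 |>.trans_eq (by ring)
    have : (n : ℝ) < P * (n / P : ℕ) + P := by exact_mod_cast this
    linarith
  have h5 : (0 : ℝ) ≤ (n / P : ℕ) * P := by positivity
  nlinarith

lemma sum_pow_four_le_of_card_le {ι : Type} (s : Finset ι) (a : ι → ℝ) {C : ℝ}
    (ha : ∀ j ∈ s, 0 ≤ a j) (hC : ∀ t, 0 < t → ((s.filter fun j => t ≤ a j).card : ℝ) * t ^ 3 ≤ C) {η : ℝ} (hη : 0 < η) :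
    ∑ j ∈ s.filter (fun j => a j ≤ η), a j ^ 4 ≤ 16 * C * η := by
  have hC0 : 0 ≤ C := le_trans (by positivity) (hC 1 one_pos)
  have key : ∀ i : ℕ, ∀ η : ℝ, 0 < η → ∑ j ∈ s.filter (fun j => a j ≤ η), a j ^ 4 ≤
      16 * C * η + s.card * (η * (1 / 2) ^ i) ^ 4 := by
    intro i
    induction i with
    | zero =>
      intro η hη
      have h1 : ∑ j ∈ s.filter (fun j => a j ≤ η), a j ^ 4 ≤ ∑ j ∈ s.filter (fun j => a j ≤ η), η ^ 4 := by
        refine Finset.sum_le_sum fun j hj => ?_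
        obtain ⟨h2, h3⟩ := Finset.mem_filter.mp hj
        exact pow_le_pow_left₀ (ha j h2) h3 4
      rw [Finset.sum_const, nsmul_eq_mul] at h1
      have h2 : ((s.filter (fun j => a j ≤ η)).card : ℝ) ≤ s.card := by exact_mod_cast Finset.card_filter_le _ _
      rw [pow_zero, mul_one]
      have h3 : ((s.filter (fun j => a j ≤ η)).card : ℝ) * η ^ 4 ≤ s.card * η ^ 4 := by gcongr
      have : 0 ≤ 16 * C * η := by positivity
      linarith
    | succ i ih =>
      intro η hη
      have h1 := ih (η / 2) (by positivity)
      have h2 : ∑ j ∈ s.filter (fun j => a j ≤ η), a j ^ 4 ≤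
          ∑ j ∈ s.filter (fun j => a j ≤ η / 2), a j ^ 4 + ∑ j ∈ (s.filter fun j => η / 2 ≤ a j), η ^ 4 := by
        have h0 : ∀ j ∈ s, 0 ≤ a j ^ 4 := fun j hj => pow_nonneg (ha j hj) 4
        rw [Finset.sum_filter, Finset.sum_filter, Finset.sum_filter, ← Finset.sum_add_distrib]
        refine Finset.sum_le_sum fun j hj => ?_
        have h3 : a j ≤ η → a j ^ 4 ≤ η ^ 4 := fun h => pow_le_pow_left₀ (ha j hj) h 4
        have h4 := h0 j hj
        have h5 : 0 ≤ η ^ 4 := by positivity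
        split_ifs with c1 c2 c3 c3 c2 c3 c3 <;> first | linarith [h3 c1] | linarith
      rw [Finset.sum_const, nsmul_eq_mul] at h2
      have h3 := hC (η / 2) (by positivity)
      have h4 : ((s.filter fun j => η / 2 ≤ a j).card : ℝ) * η ^ 4 ≤ 8 * C * η := by
        calc ((s.filter fun j => η / 2 ≤ a j).card : ℝ) * η ^ 4 =
              8 * (((s.filter fun j => η / 2 ≤ a j).card : ℝ) * (η / 2) ^ 3) * η := by ring
          _ ≤ 8 * C * η := by gcongr
      have h5 : (η / 2 * (1 / 2) ^ i) ^ 4 = (η * (1 / 2) ^ (i + 1)) ^ 4 := by rw [pow_succ]; ring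
      rw [h5] at h1
      linarith
  have hlim : Filter.Tendsto (fun i : ℕ => 16 * C * η + s.card * (η * (1 / 2) ^ i) ^ 4) Filter.atTop
      (nhds (16 * C * η + s.card * (η * 0) ^ 4)) :=
    ((((tendsto_pow_atTop_nhds_zero_of_lt_one (by norm_num) (by norm_num)).const_mul η).pow 4).const_mul _).const_add _
  have := ge_of_tendsto' hlim fun i => key i η hη
  simpa using this

/-- The transference estimate: functions with restriction bounds that are uniformly close are close in `L⁴`. -/
lemma exists_sum_norm_sq_sub_sq_le {K ν : ℝ} (hK : 0 < K) (hν : 0 < ν) : ∃ ε : ℝ, 0 < ε ∧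
    ∀ {ι : Type} (s : Finset ι) (F G : ι → ℂ),
    (∀ A ⊆ s, ∑ j ∈ A, ‖F j‖ ^ 2 ≤ K * (A.card : ℝ) ^ (1 / 3 : ℝ)) →
    (∀ A ⊆ s, ∑ j ∈ A, ‖G j‖ ^ 2 ≤ K * (A.card : ℝ) ^ (1 / 3 : ℝ)) →
    (∀ j ∈ s, ‖F j - G j‖ ≤ ε) → ∑ j ∈ s, ‖F j ^ 2 - G j ^ 2‖ ^ 2 ≤ ν := by
  classical
  set C : ℝ := √(K ^ 3) with hCdef
  have hC0 : 0 < C := Real.sqrt_pos.mpr (by positivity)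
  set η : ℝ := ν / (128 * C) with hη
  have hη0 : 0 < η := by positivity
  set X : ℝ := (2 * C / η ^ 3) ^ (1 / 3 : ℝ) with hX
  have hX0 : 0 < X := by positivity
  refine ⟨√(ν / (8 * K * X)), Real.sqrt_pos.mpr (by positivity), ?_⟩
  intro ι s F G hF hG hFG
  have hε2 : √(ν / (8 * K * X)) ^ 2 = ν / (8 * K * X) := Real.sq_sqrt (by positivity)
  set ε := √(ν / (8 * K * X)) with hε
  have hcard : ∀ H : ι → ℂ, (∀ A ⊆ s, ∑ j ∈ A, ‖H j‖ ^ 2 ≤ K * (A.card : ℝ) ^ (1 / 3 : ℝ)) → ∀ t, 0 < t →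
      ((s.filter fun j => t ≤ ‖H j‖).card : ℝ) * t ^ 3 ≤ C := by
    intro H hH t ht
    refine card_mul_cube_le (by positivity) ?_
    refine le_trans ?_ (hH (s.filter fun j => t ≤ ‖H j‖) (Finset.filter_subset _ _))
    rw [← nsmul_eq_mul]
    refine Finset.card_nsmul_le_sum _ _ _ fun j hj => ?_
    exact pow_le_pow_left₀ ht.le (Finset.mem_filter.mp hj).2 2
  have hcF := hcard F hF
  have hcG := hcard G hG
  have h4F := sum_pow_four_le_of_card_le s (fun j => ‖F j‖) (fun _ _ => norm_nonneg _) hcF hη0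
  have h4G := sum_pow_four_le_of_card_le s (fun j => ‖G j‖) (fun _ _ => norm_nonneg _) hcG hη0
  set T := s.filter (fun j => η ≤ ‖F j‖ ∨ η ≤ ‖G j‖) with hT
  have hTcard : ((T.card : ℝ)) ^ (1 / 3 : ℝ) ≤ X := by
    refine Real.rpow_le_rpow (by positivity) ?_ (by norm_num)
    rw [le_div_iff₀ (by positivity)]
    have h1 : T.card ≤ (s.filter fun j => η ≤ ‖F j‖).card + (s.filter fun j => η ≤ ‖G j‖).card := by
      rw [hT, Finset.filter_or]
      exact Finset.card_union_le _ _
    have h2 : (T.card : ℝ) ≤ (s.filter fun j => η ≤ ‖F j‖).card + (s.filter fun j => η ≤ ‖G j‖).card := by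
      exact_mod_cast h1
    have h3 := mul_le_mul_of_nonneg_right h2 (show 0 ≤ η ^ 3 by positivity)
    linarith [hcF η hη0, hcG η hη0]
  have hbig : ∑ j ∈ T, ‖F j ^ 2 - G j ^ 2‖ ^ 2 ≤ ν / 2 := by
    have hpt : ∀ j ∈ T, ‖F j ^ 2 - G j ^ 2‖ ^ 2 ≤ 2 * ε ^ 2 * (‖F j‖ ^ 2 + ‖G j‖ ^ 2) := by
      intro j hj
      have h1 := hFG j (Finset.mem_filter.mp hj).1
      have h2 := norm_add_le (F j) (G j)
      rw [show F j ^ 2 - G j ^ 2 = (F j - G j) * (F j + G j) by ring, norm_mul, mul_pow]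
      calc ‖F j - G j‖ ^ 2 * ‖F j + G j‖ ^ 2 ≤ ε ^ 2 * (‖F j‖ + ‖G j‖) ^ 2 := by gcongr
        _ ≤ ε ^ 2 * (2 * (‖F j‖ ^ 2 + ‖G j‖ ^ 2)) := by
            gcongr
            nlinarith [sq_nonneg (‖F j‖ - ‖G j‖)]
        _ = _ := by ring
    have hTs : T ⊆ s := Finset.filter_subset _ _
    refine (Finset.sum_le_sum hpt).trans ?_
    rw [← Finset.mul_sum, Finset.sum_add_distrib]
    have h1 := (hF T hTs).trans (mul_le_mul_of_nonneg_left hTcard hK.le)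
    have h2 := (hG T hTs).trans (mul_le_mul_of_nonneg_left hTcard hK.le)
    calc 2 * ε ^ 2 * (∑ j ∈ T, ‖F j‖ ^ 2 + ∑ j ∈ T, ‖G j‖ ^ 2) ≤ 2 * ε ^ 2 * (K * X + K * X) := by gcongr
      _ = ν / 2 := by rw [hε2]; field_simp; ring
  have hsmall : ∑ j ∈ s \ T, ‖F j ^ 2 - G j ^ 2‖ ^ 2 ≤ ν / 2 := by
    have hpt : ∀ j ∈ s \ T, ‖F j ^ 2 - G j ^ 2‖ ^ 2 ≤ 2 * (‖F j‖ ^ 4 + ‖G j‖ ^ 4) := by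
      intro j _
      have h1 := norm_sub_le (F j ^ 2) (G j ^ 2)
      rw [norm_pow, norm_pow] at h1
      calc ‖F j ^ 2 - G j ^ 2‖ ^ 2 ≤ (‖F j‖ ^ 2 + ‖G j‖ ^ 2) ^ 2 := by gcongr
        _ ≤ _ := by nlinarith [sq_nonneg (‖F j‖ ^ 2 - ‖G j‖ ^ 2)]
    refine (Finset.sum_le_sum hpt).trans ?_
    rw [← Finset.mul_sum, Finset.sum_add_distrib]
    have hsub : ∀ H : ι → ℂ, (∀ j ∈ s \ T, ‖H j‖ ≤ η) →
        ∑ j ∈ s \ T, ‖H j‖ ^ 4 ≤ ∑ j ∈ s.filter (fun j => ‖H j‖ ≤ η), ‖H j‖ ^ 4 := by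
      intro H hH
      refine Finset.sum_le_sum_of_subset_of_nonneg (fun j hj => ?_) fun _ _ _ => by positivity
      exact Finset.mem_filter.mpr ⟨(Finset.mem_sdiff.mp hj).1, hH j hj⟩
    have hnot : ∀ j ∈ s \ T, ‖F j‖ ≤ η ∧ ‖G j‖ ≤ η := by
      intro j hj
      obtain ⟨h1, h2⟩ := Finset.mem_sdiff.mp hj
      have h3 : ¬(η ≤ ‖F j‖ ∨ η ≤ ‖G j‖) := fun h => h2 (Finset.mem_filter.mpr ⟨h1, h⟩)
      push Not at h3
      exact ⟨h3.1.le, h3.2.le⟩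
    have h1 := (hsub F fun j hj => (hnot j hj).1).trans h4F
    have h2 := (hsub G fun j hj => (hnot j hj).2).trans h4G
    have h3 : 16 * C * η = ν / 8 := by rw [hη]; field_simp; ring
    rw [h3] at h1 h2
    linarith
  rw [← Finset.sum_sdiff (Finset.filter_subset _ _ : T ⊆ s)]
  linarith

lemma sum_ee_int_div {L : ℕ} (hL : 0 < L) (m : ℤ) :
    ∑ j ∈ range L, ee (j * (m / L)) = if (L : ℤ) ∣ m then (L : ℂ) else 0 := by
  have hL' : (L : ℝ) ≠ 0 := by positivity
  simp only [ee_nat_mul]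
  split_ifs with h
  · obtain ⟨t, rfl⟩ := h
    have : ((L * t : ℤ) : ℝ) / L = (t : ℤ) := by push_cast; field_simp
    rw [this, ee_int]
    simp
  · have h1 : ee ((m : ℝ) / L) ^ L = 1 := by
      rw [← ee_nat_mul, show (L : ℝ) * (m / L) = (m : ℤ) by field_simp, ee_int]
    have h2 : ee ((m : ℝ) / L) ≠ 1 := by
      intro h3
      have h4 := four_mul_nn_le ((m : ℝ) / L)
      rw [h3, sub_self, norm_zero] at h4
      have h5 := one_div_le_nn_int_div hL h
      have h6 : (0 : ℝ) < 1 / L := by positivity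
      linarith
    have h3 := geom_sum_mul (ee ((m : ℝ) / L)) L
    rw [h1, sub_self] at h3
    exact (mul_eq_zero.mp h3).resolve_right (sub_ne_zero.mpr h2)

lemma parseval_discrete {L : ℕ} (hL : 0 < L) (w : ℕ → ℂ) :
    ∑ j ∈ range L, ‖∑ n ∈ range L, w n * ee (n * (j / L))‖ ^ 2 = L * ∑ n ∈ range L, ‖w n‖ ^ 2 := by
  have hL' : (L : ℝ) ≠ 0 := by positivity
  have key : ∑ j ∈ range L, (∑ n ∈ range L, w n * ee (n * (j / L))) *
      (starRingEnd ℂ) (∑ n ∈ range L, w n * ee (n * (j / L))) =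
      L * ∑ n ∈ range L, w n * (starRingEnd ℂ) (w n) := by
    have e1 : ∀ j : ℕ, (∑ n ∈ range L, w n * ee (n * (j / L))) *
        (starRingEnd ℂ) (∑ n ∈ range L, w n * ee (n * (j / L))) =
        ∑ n ∈ range L, ∑ m ∈ range L, w n * (starRingEnd ℂ) (w m) * ee (j * (((n - m : ℤ) : ℝ) / L)) := by
      intro j
      rw [map_sum, Finset.sum_mul_sum]
      refine Finset.sum_congr rfl fun n _ => Finset.sum_congr rfl fun m _ => ?_
      rw [map_mul, ← ee_neg, show (j : ℝ) * (((n - m : ℤ) : ℝ) / L) = n * (j / L) + -(m * (j / L)) by push_cast; ring, ee_add]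
      ring
    simp only [e1]
    rw [Finset.sum_comm, Finset.mul_sum]
    refine Finset.sum_congr rfl fun n hn => ?_
    rw [Finset.sum_comm, Finset.sum_eq_single n]
    · rw [← Finset.mul_sum, sum_ee_int_div hL, if_pos (by simp)]
      ring
    · intro m hm hmn
      rw [← Finset.mul_sum, sum_ee_int_div hL, if_neg, mul_zero]
      intro hdvd
      have h1 := Finset.mem_range.mp hn
      have h2 := Finset.mem_range.mp hm
      have h3 := Int.eq_zero_of_abs_lt_dvd hdvd (by rw [abs_lt]; constructor <;> omega)
      omega
    · exact fun h => absurd hn h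
  simp only [Complex.mul_conj] at key
  have := congrArg Complex.re key
  simp only [← Complex.ofReal_sum, Complex.normSq_eq_norm_sq] at this
  rw [← Complex.ofReal_natCast, ← Complex.ofReal_mul, Complex.ofReal_re, Complex.ofReal_re] at this
  exact this

lemma one_div_le_nn_sub {L j k : ℕ} (hj : j < L) (hk : k < L) (h : j ≠ k) :
    1 / (L : ℝ) ≤ nn ((j : ℝ) / L - (k : ℝ) / L) := by
  have h1 : ¬ (L : ℤ) ∣ ((j : ℤ) - k) := by
    intro hd
    have := Int.eq_zero_of_abs_lt_dvd hd (by rw [abs_lt]; constructor <;> omega)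
    omega
  have h2 := one_div_le_nn_int_div (by omega) h1
  rw [← sub_div]
  push_cast at h2
  exact h2

lemma sum_range_ite_le {N L : ℕ} (h : N + 1 ≤ L) (u : ℕ → ℂ) (α : ℝ) :
    ∑ n ∈ range L, (if n ≤ N then u n else 0) * ee (n * α) = ∑ n ∈ range (N + 1), u n * ee (n * α) := by
  rw [← Finset.sum_subset (Finset.range_mono h)]
  · refine Finset.sum_congr rfl fun n hn => ?_
    rw [if_pos (by rw [mem_range] at hn; omega)]
  · intro n _ hn
    rw [if_neg (by rw [mem_range] at hn; omega), zero_mul]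

lemma exists_sum_fp_sq_le : ∃ C : ℝ, 0 < C ∧ ∀ N : ℕ, 16 ≤ N → ∀ A ⊆ range (2 * N + 1),
    ∑ j ∈ A, ‖∑ n ∈ range (N + 1), fp (2 * N + 1) n * ee (n * ((j : ℝ) / (2 * N + 1 : ℕ)))‖ ^ 2 ≤
      C * ((2 * N + 1 : ℕ) : ℝ) ^ 2 * (A.card : ℝ) ^ (1 / 3 : ℝ) := by
  obtain ⟨C, hC, h⟩ := exists_spectrum_primes
  refine ⟨C, hC, fun N hN A hA => ?_⟩
  have := h A (fun j => (j : ℝ) / (2 * N + 1 : ℕ)) (2 * N + 1)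
    (fun n => if n ≤ N then fp (2 * N + 1) n else 0) (by omega) ?_ ?_ ?_
  · simpa only [sum_range_ite_le (show N + 1 ≤ 2 * N + 1 by omega)] using this
  · intro n _ hu
    by_cases hn : n ≤ N
    · simp only [hn, if_true] at hu
      exact fp_ne_zero hu
    · simp [hn] at hu
  · intro n _
    by_cases hn : n ≤ N
    · simp only [hn, if_true]
      exact norm_fp_le _ _
    · simp only [hn, if_false, norm_zero]
      exact Real.log_natCast_nonneg n
  · intro j hj k hk hjk
    exact one_div_le_nn_sub (mem_range.1 (hA hj)) (mem_range.1 (hA hk)) hjk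

lemma sum_md_sq_le {P N : ℕ} (hP : 2 ≤ P) (hN : P ^ 2 ≤ N) :
    ∑ n ∈ range (N + 1), md P n ^ 2 ≤ 2 * ((P : ℝ) / P.totient) * N := by
  have hφ : (1 : ℝ) ≤ P.totient := by exact_mod_cast Nat.totient_pos.2 (by omega)
  have hP0 : (0 : ℝ) < P := by exact_mod_cast (by omega : 0 < P)
  have hcard := (abs_le.1 (abs_card_coprime_sub_le (q := P) (by omega) N)).2
  have e : ∑ n ∈ range (N + 1), md P n ^ 2 =
      ((P : ℝ) / P.totient) ^ 2 * (#{x ∈ Ioc 0 N | P.Coprime x} : ℝ) := by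
    rw [Finset.sum_range_succ', md_zero hP]
    have : ∀ n, md P n ^ 2 = if P.Coprime n then ((P : ℝ) / P.totient) ^ 2 else 0 := by
      intro n
      simp only [md, Nat.coprime_comm (n := n)]
      split_ifs <;> simp
    simp only [this]
    rw [mul_comm, ← nsmul_eq_mul, ← Finset.sum_const, Finset.sum_filter]
    have : Ioc 0 N = (range N).image (· + 1) := by
      ext x; simp only [mem_Ioc, mem_image, mem_range]
      constructor
      · rintro ⟨h1, h2⟩; exact ⟨x - 1, by omega, by omega⟩
      · rintro ⟨y, h1, rfl⟩; omega
    rw [this, Finset.sum_image (by intro a _ b _ h; simpa using h)]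
    simp
  rw [e]
  set φ : ℝ := (P.totient : ℝ) with hφd
  have hN' : (P : ℝ) ^ 2 ≤ N := by exact_mod_cast hN
  have h1 : (#{x ∈ Ioc 0 N | P.Coprime x} : ℝ) ≤ φ / P * N + P := by linarith
  calc ((P : ℝ) / φ) ^ 2 * (#{x ∈ Ioc 0 N | P.Coprime x} : ℝ) ≤ (P / φ) ^ 2 * (φ / P * N + P) := by gcongr
    _ = P / φ * N + P / φ * (P ^ 2 / φ) := by field_simp
    _ ≤ P / φ * N + P / φ * N := by
      gcongr
      exact (div_le_self (by positivity) hφ).trans hN'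
    _ = 2 * (P / φ) * N := by ring

lemma exists_sum_GM_sq_le : ∃ C : ℝ, 0 < C ∧ ∀ P N : ℕ, Squarefree P → 2 ≤ P → 2 * P ^ 4 ≤ N →
    ∀ A ⊆ range (2 * N + 1), ∑ j ∈ A, ‖GM P N ((j : ℝ) / (2 * N + 1 : ℕ))‖ ^ 2 ≤
      C * ((2 * N + 1 : ℕ) : ℝ) ^ 2 * (A.card : ℝ) ^ (1 / 3 : ℝ) := by
  obtain ⟨C, hC, h⟩ := exists_spectrum_bound
  refine ⟨C, hC, fun P N hsq hP hN A hA => ?_⟩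
  have := h A (fun j => (j : ℝ) / (2 * N + 1 : ℕ)) (2 * N + 1) P (fun p => p ∣ P)
    (fun n => if n ≤ N then (md P n : ℂ) else 0) 0 (by omega) (by omega) ?_ ?_
  · simp only [sum_range_ite_le (show N + 1 ≤ 2 * N + 1 by omega)] at this
    have hφ : (0 : ℝ) < P.totient := by exact_mod_cast Nat.totient_pos.2 (by omega)
    have hP0 : (0 : ℝ) < P := by exact_mod_cast (by omega : 0 < P)
    have hD : (0 : ℝ) < (P : ℝ) / P.totient := by positivity
    have hG := le_GG_dvd hsq le_rfl
    have e : ∑ n ∈ range (2 * N + 1), ‖(if n ≤ N then (md P n : ℂ) else 0)‖ ^ 2 =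
        ∑ n ∈ range (N + 1), md P n ^ 2 := by
      rw [← Finset.sum_subset (Finset.range_mono (show N + 1 ≤ 2 * N + 1 by omega))]
      · refine Finset.sum_congr rfl fun n hn => ?_
        rw [if_pos (by rw [mem_range] at hn; omega), Complex.norm_real, Real.norm_eq_abs, sq_abs]
      · intro n _ hn
        rw [if_neg (by rw [mem_range] at hn; omega)]; simp
    rw [e] at this
    have h2 := sum_md_sq_le (P := P) (N := N) hP
      (by nlinarith [Nat.pow_le_pow_right (show 0 < P by omega) (show 2 ≤ 4 by norm_num)])
    set X : ℝ := (A.card : ℝ) ^ (1 / 3 : ℝ) with hX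
    have hX0 : 0 ≤ X := by positivity
    set L : ℝ := ((2 * N + 1 : ℕ) : ℝ) with hL
    have hLN : 2 * (N : ℝ) ≤ L := by rw [hL]; push_cast; linarith
    have hL0 : 0 ≤ L := by positivity
    refine le_of_mul_le_mul_right ?_ hD
    calc (∑ j ∈ A, ‖GM P N ((j : ℝ) / L)‖ ^ 2) * ((P : ℝ) / P.totient)
        ≤ (∑ j ∈ A, ‖GM P N ((j : ℝ) / L)‖ ^ 2) * GG (fun p => p ∣ P) P := by gcongr
      _ ≤ C * L * X * ∑ n ∈ range (N + 1), md P n ^ 2 := this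
      _ ≤ C * L * X * (2 * ((P : ℝ) / P.totient) * N) := by gcongr
      _ = C * L * X * ((P : ℝ) / P.totient) * (2 * N) := by ring
      _ ≤ C * L * X * ((P : ℝ) / P.totient) * L := by gcongr
      _ = C * L ^ 2 * X * ((P : ℝ) / P.totient) := by ring
  · intro n _ hu p hp hpP _ hdvd
    by_cases hn : n ≤ N
    · simp only [hn, if_true, md] at hu
      by_cases hc : n.Coprime P
      · exact Nat.not_coprime_of_dvd_of_dvd hp.one_lt (by simpa using hdvd) hpP hc
      · simp [hc] at hu
    · simp [hn] at hu
  · intro j hj k hk hjk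
    exact one_div_le_nn_sub (mem_range.1 (hA hj)) (mem_range.1 (hA hk)) hjk

open Polynomial in
/-- The difference of squares of two exponential polynomials, expanded by convolution. -/
lemma exists_sq_sub_sq_eq (N : ℕ) (u v : ℕ → ℂ) : ∃ c : ℕ → ℂ,
    (∀ n ≤ N, c n = ∑ ij ∈ antidiagonal n, u ij.1 * u ij.2 - ∑ ij ∈ antidiagonal n, v ij.1 * v ij.2) ∧
    ∀ α : ℝ, (∑ n ∈ range (N + 1), u n * ee (n * α)) ^ 2 - (∑ n ∈ range (N + 1), v n * ee (n * α)) ^ 2 =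
      ∑ n ∈ range (2 * N + 1), c n * ee (n * α) := by
  let p : (ℕ → ℂ) → ℂ[X] := fun w => ∑ i ∈ range (N + 1), C (w i) * X ^ i
  have hdeg : ∀ w, (p w).natDegree ≤ N := fun w =>
    natDegree_sum_le_of_forall_le _ _ fun i hi =>
      (natDegree_C_mul_X_pow_le _ _).trans (by rw [mem_range] at hi; omega)
  have hco : ∀ w, ∀ n ≤ N, (p w).coeff n = w n := by
    intro w n hn
    simp only [p, finsetSum_coeff, coeff_C_mul_X_pow]
    rw [Finset.sum_ite_eq, if_pos (mem_range.2 (by omega))]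
  have hev : ∀ w (α : ℝ), ∑ n ∈ range (N + 1), w n * ee (n * α) = (p w).eval (ee α) := by
    intro w α
    simp only [p, eval_finsetSum, eval_mul, eval_C, eval_pow, eval_X, ee_nat_mul]
  have hsq : ∀ w, ∀ n ≤ N, (p w ^ 2).coeff n = ∑ ij ∈ antidiagonal n, w ij.1 * w ij.2 := by
    intro w n hn
    rw [sq, coeff_mul]
    refine Finset.sum_congr rfl fun ij hij => ?_
    rw [HasAntidiagonal.mem_antidiagonal] at hij
    rw [hco w _ (by omega), hco w _ (by omega)]
  refine ⟨fun n => (p u ^ 2 - p v ^ 2).coeff n, fun n hn => ?_, fun α => ?_⟩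
  · simp only [coeff_sub, hsq _ n hn]
  · rw [hev, hev, ← eval_pow, ← eval_pow, ← eval_sub, eval_eq_sum_range' (n := 2 * N + 1)]
    · simp only [ee_nat_mul]
    · have h1 := natDegree_sub_le (p u ^ 2) (p v ^ 2)
      have h2 : (p u ^ 2).natDegree ≤ 2 * N := natDegree_pow_le_of_le 2 (hdeg u)
      have h3 : (p v ^ 2).natDegree ≤ 2 * N := natDegree_pow_le_of_le 2 (hdeg v)
      have := max_le h2 h3
      omega

lemma exists_norm_S_sub_GM_le_squarefree {ε : ℝ} (hε : 0 < ε) : ∃ P : ℕ, Squarefree P ∧ 2 ≤ P ∧ 2 ∣ P ∧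
    ∃ N₀ : ℕ, ∀ N ≥ N₀, ∀ α : ℝ, ‖S N α - GM P N α‖ ≤ ε * N := by
  obtain ⟨P, hP, h2, N₀, h⟩ := exists_norm_S_sub_GM_le hε
  have hsq : Squarefree (∏ p ∈ P.primeFactors, p) := by
    refine Finset.squarefree_prod_of_pairwise_isCoprime ?_ fun p hp => (Nat.prime_of_mem_primeFactors hp).squarefree
    intro p hp q hq hpq
    exact Nat.coprime_iff_isRelPrime.1 ((Nat.coprime_primes (Nat.prime_of_mem_primeFactors hp)
      (Nat.prime_of_mem_primeFactors hq)).2 hpq)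
  have h2' : 2 ∣ ∏ p ∈ P.primeFactors, p :=
    Finset.dvd_prod_of_mem (fun p => p) (Nat.mem_primeFactors.2 ⟨Nat.prime_two, h2, by omega⟩)
  refine ⟨_, hsq, Nat.le_of_dvd (Nat.pos_of_ne_zero hsq.ne_zero) h2', h2', N₀, fun N hN α => ?_⟩
  have : GM (∏ p ∈ P.primeFactors, p) N α = GM P N α := by
    simp only [GM, md_prod_primeFactors P (by omega)]
  rw [this]
  exact h N hN α

/-- On average over `n`, the weighted number of Goldbach representations is close to its model. -/
lemma exists_sum_norm_conv_sub_sq_le {ν : ℝ} (hν : 0 < ν) : ∃ P : ℕ, Squarefree P ∧ 2 ∣ P ∧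
    ∃ N₀ : ℕ, ∀ N ≥ N₀, ∃ c : ℕ → ℂ,
      (∀ n ≤ N, c n = ∑ ij ∈ antidiagonal n, fp (2 * N + 1) ij.1 * fp (2 * N + 1) ij.2 -
        ∑ ij ∈ antidiagonal n, (md P ij.1 : ℂ) * (md P ij.2 : ℂ)) ∧
      ∑ n ∈ range (2 * N + 1), ‖c n‖ ^ 2 ≤ ν * ((2 * N + 1 : ℕ) : ℝ) ^ 3 := by
  obtain ⟨CF, hCF, hF⟩ := exists_sum_fp_sq_le
  obtain ⟨CG, hCG, hG⟩ := exists_sum_GM_sq_le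
  obtain ⟨C₁, hC₁, hfp⟩ := exists_norm_sub_fp_le
  obtain ⟨ε, hε, hmain⟩ := exists_sum_norm_sq_sub_sq_le (K := CF + CG) (by positivity) hν
  obtain ⟨P, hsq, hP2, h2, N₀, hS⟩ := exists_norm_S_sub_GM_le_squarefree hε
  refine ⟨P, hsq, h2, max (max N₀ 16) (max (2 * P ^ 4) ⌈(2 * C₁ / ε) ^ 2⌉₊), fun N hN => ?_⟩
  simp only [ge_iff_le, max_le_iff] at hN
  obtain ⟨⟨hN0, hN16⟩, hNP, hNC⟩ := hN
  obtain ⟨c, hc, hce⟩ := exists_sq_sub_sq_eq N (fp (2 * N + 1)) (fun n => (md P n : ℂ))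
  refine ⟨c, hc, ?_⟩
  have hL2 : ((2 * N + 1 : ℕ) : ℝ) = 2 * N + 1 := by push_cast; ring
  set F : ℕ → ℂ := fun j => ∑ n ∈ range (N + 1), fp (2 * N + 1) n * ee (n * ((j : ℝ) / (2 * N + 1 : ℕ))) with hFd
  set G : ℕ → ℂ := fun j => GM P N ((j : ℝ) / (2 * N + 1 : ℕ)) with hGd
  have hpars := parseval_discrete (show 0 < 2 * N + 1 by omega) c
  have hFG : ∀ j, F j ^ 2 - G j ^ 2 = ∑ n ∈ range (2 * N + 1), c n * ee (n * ((j : ℝ) / (2 * N + 1 : ℕ))) :=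
    fun j => hce _
  simp only [← hFG] at hpars
  set L : ℝ := ((2 * N + 1 : ℕ) : ℝ) with hL
  have hL0 : 0 < L := by rw [hL2]; positivity
  have hnorm : ‖(L : ℂ)‖ = L := by rw [Complex.norm_real, Real.norm_eq_abs, abs_of_pos hL0]
  have hclose : ∀ j, ‖F j - G j‖ ≤ ε * L := by
    intro j
    have a1 := hfp (2 * N + 1) N ((j : ℝ) / (2 * N + 1 : ℕ)) (by omega)
    have a2 := hS N hN0 ((j : ℝ) / (2 * N + 1 : ℕ))
    have a3 : C₁ * √L ≤ ε * L / 2 := by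
      have b1 : (2 * C₁ / ε) ^ 2 ≤ L := by
        have := Nat.ceil_le.1 hNC
        rw [hL2]; linarith [(Nat.cast_nonneg N : (0 : ℝ) ≤ N)]
      have b2 : 2 * C₁ / ε ≤ √L := Real.le_sqrt_of_sq_le b1
      rw [div_le_iff₀ hε] at b2
      have b3 := Real.mul_self_sqrt hL0.le
      nlinarith [Real.sqrt_nonneg L]
    have a4 : ‖F j - G j‖ ≤ ‖S N ((j : ℝ) / (2 * N + 1 : ℕ)) - F j‖ + ‖S N ((j : ℝ) / (2 * N + 1 : ℕ)) - G j‖ := by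
      rw [norm_sub_rev _ (F j)]
      exact norm_sub_le_norm_sub_add_norm_sub _ _ _
    have a5 : ε * N ≤ ε * L / 2 := by rw [hL2]; nlinarith
    calc ‖F j - G j‖ ≤ _ := a4
      _ ≤ C₁ * √L + ε * N := add_le_add a1 a2
      _ ≤ ε * L := by linarith
  have hscale : ∀ (H : ℕ → ℂ) (B : ℝ) (A : Finset ℕ), B ≤ CF + CG →
      ∑ j ∈ A, ‖H j‖ ^ 2 ≤ B * L ^ 2 * (A.card : ℝ) ^ (1 / 3 : ℝ) →
      ∑ j ∈ A, ‖H j / L‖ ^ 2 ≤ (CF + CG) * (A.card : ℝ) ^ (1 / 3 : ℝ) := by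
    intro H B A hB h
    simp only [norm_div, hnorm, div_pow]
    rw [← Finset.sum_div, div_le_iff₀ (by positivity)]
    calc _ ≤ B * L ^ 2 * (A.card : ℝ) ^ (1 / 3 : ℝ) := h
      _ ≤ (CF + CG) * L ^ 2 * (A.card : ℝ) ^ (1 / 3 : ℝ) := by gcongr
      _ = _ := by ring
  have key := hmain (range (2 * N + 1)) (fun j => F j / L) (fun j => G j / L)
    (fun A hA => hscale F CF A (by linarith) (hF N hN16 A hA))
    (fun A hA => hscale G CG A (by linarith) (hG P N hsq hP2 hNP A hA))
    (fun j _ => by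
      rw [← sub_div, norm_div, hnorm, div_le_iff₀ hL0]
      exact hclose j)
  have e : ∀ j, ‖(F j / L) ^ 2 - (G j / L) ^ 2‖ ^ 2 = ‖F j ^ 2 - G j ^ 2‖ ^ 2 / L ^ 4 := by
    intro j
    rw [div_pow, div_pow, ← sub_div, norm_div, norm_pow, hnorm, div_pow]
    ring
  simp only [e] at key
  rw [← Finset.sum_div, div_le_iff₀ (by positivity), hpars] at key
  refine le_of_mul_le_mul_left ?_ hL0
  linarith

lemma le_norm_conv_sub {P M n : ℕ} (hP : Squarefree P) (h2 : 2 ∣ P) (hn : Even n)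
    (hne : ¬ ∃ p q : ℕ, p.Prime ∧ q.Prime ∧ n = p + q) :
    ((n : ℝ) - P) / 2 ≤ ‖∑ ij ∈ antidiagonal n, fp M ij.1 * fp M ij.2 -
      ∑ ij ∈ antidiagonal n, (md P ij.1 : ℂ) * (md P ij.2 : ℂ)‖ := by
  have h0 : ∑ ij ∈ antidiagonal n, fp M ij.1 * fp M ij.2 = 0 := by
    refine Finset.sum_eq_zero fun ij hij => ?_
    by_contra h
    exact hne ⟨ij.1, ij.2, (fp_ne_zero (left_ne_zero_of_mul h)).1, (fp_ne_zero (right_ne_zero_of_mul h)).1,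
      (HasAntidiagonal.mem_antidiagonal.1 hij).symm⟩
  rw [h0, zero_sub, norm_neg]
  have : ∑ ij ∈ antidiagonal n, (md P ij.1 : ℂ) * (md P ij.2 : ℂ) =
      ((∑ ij ∈ antidiagonal n, md P ij.1 * md P ij.2 : ℝ) : ℂ) := by push_cast; rfl
  rw [this, Complex.norm_real]
  exact (le_sum_md_mul_md hP h2 hn).trans (le_abs_self _)

lemma exists_card_exceptional_le {δ : ℝ} (hδ : 0 < δ) : ∃ N₀ : ℕ, ∀ N ≥ N₀, ∀ E : Finset ℕ,
    (∀ n ∈ E, 1 ≤ n ∧ n ≤ N ∧ Even n ∧ ¬ ∃ p q : ℕ, p.Prime ∧ q.Prime ∧ n = p + q) →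
      (E.card : ℝ) ≤ δ * N := by
  obtain ⟨P, hsq, h2, N₀, h⟩ := exists_sum_norm_conv_sub_sq_le (ν := δ ^ 3 / 864 / 16) (by positivity)
  refine ⟨max (max N₀ 1) ⌈8 * P / δ⌉₊, fun N hN E hE => ?_⟩
  simp only [ge_iff_le, max_le_iff] at hN
  obtain ⟨⟨hN0, hN1⟩, hNP⟩ := hN
  obtain ⟨c, hc, hcs⟩ := h N hN0
  have hN1' : (1 : ℝ) ≤ N := by exact_mod_cast hN1
  have hNP' : 8 * (P : ℝ) ≤ δ * N := by
    have := Nat.ceil_le.1 hNP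
    rw [div_le_iff₀ hδ] at this
    linarith
  set X : ℕ := ⌊δ / 4 * N⌋₊ with hX
  have hXle : (X : ℝ) ≤ δ / 4 * N := Nat.floor_le (by positivity)
  have hsmall : ((E.filter (· ≤ X)).card : ℝ) ≤ δ / 4 * N := by
    have : (E.filter (· ≤ X)).card ≤ X := by
      calc _ ≤ (Icc 1 X).card := card_le_card fun n hn => by
            rw [mem_filter] at hn
            exact mem_Icc.2 ⟨(hE n hn.1).1, hn.2⟩
        _ = X := by simp
    exact le_trans (by exact_mod_cast this) hXle
  have hlarge : ((E.filter (¬ · ≤ X)).card : ℝ) ≤ δ / 2 * N := by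
    have hpt : ∀ n ∈ E.filter (¬ · ≤ X), (δ * N / 16) ^ 2 ≤ ‖c n‖ ^ 2 := by
      intro n hn
      rw [mem_filter, not_le] at hn
      obtain ⟨_, hnN, hev, hne⟩ := hE n hn.1
      have a1 := le_norm_conv_sub (M := 2 * N + 1) hsq h2 hev hne
      rw [← hc n hnN] at a1
      have a2 : δ / 4 * N < n := (Nat.floor_lt (by positivity)).1 hn.2
      have a3 : δ * N / 16 ≤ ‖c n‖ := by linarith
      gcongr
    have hsub : E.filter (¬ · ≤ X) ⊆ range (2 * N + 1) := fun n hn => by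
      rw [mem_filter] at hn
      have := (hE n hn.1).2.1
      rw [mem_range]; omega
    have b1 : ((E.filter (¬ · ≤ X)).card : ℝ) * (δ * N / 16) ^ 2 ≤ δ ^ 3 / 864 / 16 * (3 * N) ^ 3 := by
      calc _ ≤ ∑ n ∈ E.filter (¬ · ≤ X), ‖c n‖ ^ 2 := by
            rw [← nsmul_eq_mul]; exact Finset.card_nsmul_le_sum _ _ _ hpt
        _ ≤ ∑ n ∈ range (2 * N + 1), ‖c n‖ ^ 2 :=
            Finset.sum_le_sum_of_subset_of_nonneg hsub fun _ _ _ => by positivity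
        _ ≤ _ := hcs
        _ ≤ _ := by
          gcongr
          push_cast
          linarith
    refine le_of_mul_le_mul_right (b1.trans (le_of_eq ?_)) (show 0 < (δ * (N : ℝ) / 16) ^ 2 by positivity)
    ring
  have hcard : E.card = (E.filter (· ≤ X)).card + (E.filter (¬ · ≤ X)).card :=
    (Finset.card_filter_add_card_filter_not _).symm
  rw [hcard]
  push_cast
  have : 0 ≤ δ * N := by positivity
  linarith

end Goldbach

open scoped Classical

theorem stmt_12 :
    Filter.Tendsto (fun x : ℕ =>
      (((Finset.Icc 1 x).filter (fun k => Even k ∧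
        ¬ ∃ p q : ℕ, p.Prime ∧ q.Prime ∧ k = p + q)).card : ℝ) / x)
      Filter.atTop (nhds 0) := by
  rw [Metric.tendsto_atTop]
  intro δ hδ
  obtain ⟨N₀, h⟩ := Goldbach.exists_card_exceptional_le (half_pos hδ)
  refine ⟨max N₀ 1, fun N hN => ?_⟩
  have hN1 : (0 : ℝ) < N := by exact_mod_cast lt_of_lt_of_le one_pos ((le_max_right _ _).trans hN)
  rw [Real.dist_eq, sub_zero, abs_of_nonneg (by positivity), div_lt_iff₀ hN1]
  refine lt_of_le_of_lt (h N ((le_max_left _ _).trans hN) _ fun n hn => ?_)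
    (by nlinarith : δ / 2 * N < δ * N)
  rw [Finset.mem_filter, Finset.mem_Icc] at hn
  exact ⟨hn.1.1, hn.1.2, hn.2⟩
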